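/- For every dimension d ≥ 5 and every ρ ∈ (0,1], there exists λ₀(d) > 0 such that for every λ ∈ (0,λ₀] there exists δ = δ(d,ρ,λ) > 0 with: lim_{r→∞} limsup_{n→∞} sup_{x : |x| ≥ r} n^{d/2} |C_n(x)/c_n − φ_{nδ}(x)| = 0. -/

import Mathlib

open MeasureTheory Filter Finset
open scoped Classical

noncomputable section

abbrev Ed (d : ℕ) := EuclideanSpace ℝ (Fin d)

/-- The centered Gaussian density `φ_t` on `ℝ^d` with covariance `t · Id`. -/
def gauss (d : ℕ) (t : ℝ) (x : Ed d) : ℝ :=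
  (2 * Real.pi * t) ^ (-(d : ℝ) / 2) * Real.exp (-‖x‖ ^ 2 / (2 * t))

/-- Convolution of two functions on `ℝ^d`. -/
def convl (d : ℕ) (f g : Ed d → ℝ) (x : Ed d) : ℝ := ∫ y, f y * g (x - y)

/-- `γ^{(k)}(m) = ∫ |y|^{2k} Γ_m(y) dy`. -/
def gammaMom {d : ℕ} (Γ : ℕ → Ed d → ℝ) (k m : ℕ) : ℝ := ∫ y, ‖y‖ ^ (2 * k) * Γ m y

/-- A rotationally invariant (radial) function on `ℝ^d`. -/
def Radial {d : ℕ} (f : Ed d → ℝ) : Prop := ∀ x y : Ed d, ‖x‖ = ‖y‖ → f x = f y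

/-- A function vanishing at infinity. -/
def VanishAtInfty {d : ℕ} (f : Ed d → ℝ) : Prop := Tendsto f (cocompact (Ed d)) (nhds 0)

/-- Condition B1–B4 on the dominating sequence `Γ`. -/
structure CondB (d : ℕ) (Γ : ℕ → Ed d → ℝ) (χ : ℕ → ℕ → ℝ) (K1 K2 K3 : ℝ) : Prop where
  pos : ∀ m, 1 ≤ m → ∀ x, 0 < Γ m x
  cont : ∀ m, 1 ≤ m → Continuous (Γ m)
  radial : ∀ m, 1 ≤ m → Radial (Γ m)
  vanish : ∀ m, 1 ≤ m → VanishAtInfty (Γ m)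
  integrable : ∀ m, 1 ≤ m → ∀ k, k ≤ 2 → Integrable fun y => ‖y‖ ^ (2 * k) * Γ m y
  chi_pos : ∀ n s, 1 ≤ s → s ≤ n → 0 < χ n s
  chi_symm : ∀ n s, 1 ≤ s → s ≤ n → χ n s = χ n (n - s)
  chi_sum : ∀ n : ℕ, (∑ s ∈ Finset.Ico 1 n, (↑(min s (n - s)) : ℝ) * χ n s) ≤ K1
  conv_le : ∀ m n, 1 ≤ m → 1 ≤ n → ∀ x, convl d (Γ m) (Γ n) x ≤ χ (m + n) m * Γ (m + n) x
  doubling : ∀ t s : ℕ, 1 ≤ t → t ≤ s → s ≤ 2 * t → ∀ x, Γ s x ≤ K2 * Γ (2 * t) x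
  smoothing : ∀ (m : ℕ) (t : ℝ), 1 ≤ m → (m : ℝ) ≤ t → ∀ k, k ≤ 2 → ∀ x,
    (∫ y, gauss d t (x - y) * (‖y‖ ^ (2 * k) * Γ m y)) ≤
      K3 * gammaMom Γ k m * gauss d (t + (m : ℝ)) x
  sum0 : Summable fun n : ℕ => (n : ℝ) * gammaMom Γ 0 n
  sum1 : Summable fun n : ℕ => gammaMom Γ 1 n
  sum2 : Summable fun n : ℕ => gammaMom Γ 2 n / (n : ℝ)

/-- `b_k = ∫ B_k`. -/
def bInt {d : ℕ} (B : ℕ → Ed d → ℝ) (k : ℕ) : ℝ := ∫ y, B k y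

/-- The scalar `b̄_m` with `∫ x xᵀ B_m(x) dx = b̄_m I_d`. -/
def bbar {d : ℕ} (B : ℕ → Ed d → ℝ) (m : ℕ) : ℝ := (∫ y, ‖y‖ ^ 2 * B m y) / d

/-- Regularity of the sequence `B`, dominated by `Γ`. -/
structure BSeq (d : ℕ) (B Γ : ℕ → Ed d → ℝ) : Prop where
  cont : ∀ m, 1 ≤ m → Continuous (B m)
  radial : ∀ m, 1 ≤ m → Radial (B m)
  vanish : ∀ m, 1 ≤ m → VanishAtInfty (B m)
  integrable : ∀ m, 1 ≤ m → Integrable (B m)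
  integrable2 : ∀ m, 1 ≤ m → Integrable fun y => ‖y‖ ^ 2 * B m y
  dom : ∀ m, 1 ≤ m → ∀ x, |B m x| ≤ Γ m x

/-- The recursion for the norming sequence `c`. -/
def cSeq {d : ℕ} (B : ℕ → Ed d → ℝ) (lam : ℝ) (c : ℕ → ℝ) : Prop :=
  c 0 = 1 ∧ ∀ n, 1 ≤ n →
    c n = c (n - 1) + lam * ∑ k ∈ Finset.Icc 1 n, c k * bInt B k * c (n - k)

/-- The basic convolution recursion for `C` (with `C_0 = δ_0`). -/
def CSeq (d : ℕ) (B : ℕ → Ed d → ℝ) (lam : ℝ) (c : ℕ → ℝ) (C : ℕ → Ed d → ℝ) : Prop :=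
  (∀ x, C 1 x = gauss d 1 x + lam * (c 1 * B 1 x)) ∧
  ∀ n, 2 ≤ n → ∀ x, C n x = convl d (C (n - 1)) (gauss d 1) x +
    lam * ((∑ k ∈ Finset.Icc 1 (n - 1), c k * convl d (B k) (C (n - k)) x) + c n * B n x)

/-- The drift parameter `δ`. -/
def deltaParam {d : ℕ} (B : ℕ → Ed d → ℝ) (lam μ : ℝ) (a : ℕ → ℝ) : ℝ :=
  (μ⁻¹ + lam * ∑' m : ℕ, a (m + 1) * bbar B (m + 1)) /
    (μ⁻¹ + lam * ∑' m : ℕ, ((m : ℝ) + 1) * a (m + 1) * bInt B (m + 1))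

def zeta1 {d : ℕ} (Γ : ℕ → Ed d → ℝ) (n : ℕ) : ℝ :=
  1 + ∑ i ∈ Finset.range 3, ∑ m ∈ Finset.Icc 1 n, (m : ℝ) ^ (2 - i) * gammaMom Γ i m

def zeta2 {d : ℕ} (Γ : ℕ → Ed d → ℝ) (n : ℕ) : ℝ :=
  ∑' m : ℕ, (gammaMom Γ 1 (n + m) + (↑(n + m) : ℝ) * gammaMom Γ 0 (n + m))

def zetaBar {d : ℕ} (Γ : ℕ → Ed d → ℝ) (n : ℕ) : ℝ :=
  (∑ j ∈ Finset.Icc 1 n, zeta1 Γ j) / (n : ℝ) ^ 2 + (∑ j ∈ Finset.Icc 1 n, zeta2 Γ j) / (n : ℝ)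

/-- `ψ_n = φ_{nδ(1+ε)}`. -/
def psiFun (d : ℕ) (δv ε : ℝ) (n : ℕ) : Ed d → ℝ := gauss d ((n : ℝ) * δv * (1 + ε))

/-- `f_n = Σ_{s=1}^{[n/2]} s (ψ_s * Γ_{n-s}) + ζ̄(n) ψ_n`. -/
def fFun (d : ℕ) (Γ : ℕ → Ed d → ℝ) (δv ε : ℝ) (n : ℕ) (x : Ed d) : ℝ :=
  (∑ s ∈ Finset.Icc 1 (n / 2), (s : ℝ) * convl d (psiFun d δv ε s) (Γ (n - s)) x) +
    zetaBar Γ n * psiFun d δv ε n x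

/-- `κ(n) = Σ_{s=1}^{[n/2]} ψ_s * Γ_{n-s} + (ζ̄(n)/n) ψ_n`. -/
def kapFun (d : ℕ) (Γ : ℕ → Ed d → ℝ) (δv ε : ℝ) (n : ℕ) (x : Ed d) : ℝ :=
  (∑ s ∈ Finset.Icc 1 (n / 2), convl d (psiFun d δv ε s) (Γ (n - s)) x) +
    zetaBar Γ n / n * psiFun d δv ε n x

/-- `Δ(k,j)`, with the convention `φ_0 = δ_0` (the `m = k` term is `B_m` itself). -/
def DeltaFun (d : ℕ) (B : ℕ → Ed d → ℝ) (lam μ δv : ℝ) (a : ℕ → ℝ) (k j : ℕ) (x : Ed d) : ℝ :=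
  a j * gauss d ((k : ℝ) * δv) x - μ⁻¹ * a (j - 1) * gauss d (((k : ℝ) - 1) * δv + 1) x -
    lam * ∑ m ∈ Finset.Icc 1 j, a m * a (j - m) *
      (if m = k then B m x else convl d (B m) (gauss d (((k : ℝ) - (m : ℝ)) * δv)) x)

/-! Weakly self-avoiding walk. -/

/-- `I_ρ`, the indicator of the ball of radius `ρ`. -/
def indBall (d : ℕ) (ρ : ℝ) (x : Ed d) : ℝ := if ‖x‖ ≤ ρ then 1 else 0

/-- `K_{λ,ρ}[a,b]`. -/
def Ksaw (d : ℕ) (lam ρ : ℝ) (a b : ℕ) (y : ℕ → Ed d) : ℝ :=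
  ∏ p ∈ (Finset.Icc a b ×ˢ Finset.Icc a b).filter fun p => p.1 < p.2,
    (1 - lam * indBall d ρ (y p.2 - y p.1))

/-- `Φ[a,b]`. -/
def PhiProd (d : ℕ) (a b : ℕ) (y : ℕ → Ed d) : ℝ :=
  ∏ i ∈ Finset.Icc (a + 1) b, gauss d 1 (y i - y (i - 1))

/-- Extend a finite vector `z : Fin L → ℝ^d` to indices `1,…,L` in `ℕ`. -/
def extPath (d L : ℕ) (z : Fin L → Ed d) (i : ℕ) : Ed d :=
  if h : 1 ≤ i ∧ i ≤ L then z ⟨i - 1, by omega⟩ else 0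

/-- The path `0, x_1, …, x_{n-1}, x`. -/
def sawPath (d n : ℕ) (x : Ed d) (z : ℕ → Ed d) (j : ℕ) : Ed d :=
  if j = 0 then 0 else if j = n then x else z j

/-- The connectivity function `C_n^{SAW}`. -/
def Csaw (d : ℕ) (lam ρ : ℝ) (n : ℕ) (x : Ed d) : ℝ :=
  ∫ z : Fin (n - 1) → Ed d,
    Ksaw d lam ρ 0 n (sawPath d n x (extPath d (n - 1) z)) *
      PhiProd d 0 n (sawPath d n x (extPath d (n - 1) z))

/-- `c_n^{SAW} = ∫ C_n^{SAW}`. -/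
def csawInt (d : ℕ) (lam ρ : ℝ) (n : ℕ) : ℝ := ∫ x, Csaw d lam ρ n x

/-- Connected graphs on `[a,b]` (in the sense of the lace expansion). -/
def IsConnGraph (a b : ℕ) (G : Finset (ℕ × ℕ)) : Prop :=
  (∀ p ∈ G, a ≤ p.1 ∧ p.1 < p.2 ∧ p.2 ≤ b) ∧
    (∃ p ∈ G, p.1 = a ∨ p.2 = a) ∧ (∃ p ∈ G, p.1 = b ∨ p.2 = b) ∧
    ∀ c, a < c → c < b → ∃ p ∈ G, p.1 < c ∧ c < p.2

/-- `J[a,b]`, the sum over connected graphs. -/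
def Jsaw (d : ℕ) (lam ρ : ℝ) (a b : ℕ) (y : ℕ → Ed d) : ℝ :=
  ∑ G ∈ ((Finset.Icc a b ×ˢ Finset.Icc a b).powerset).filter (IsConnGraph a b),
    ∏ p ∈ G, -(lam * indBall d ρ (y p.2 - y p.1))

/-- The lace functions `Π_n`. -/
def Pisaw (d : ℕ) (lam ρ : ℝ) (n : ℕ) (x : Ed d) : ℝ :=
  ∫ z : Fin (n - 1) → Ed d,
    Jsaw d lam ρ 0 n (sawPath d n x (extPath d (n - 1) z)) *
      PhiProd d 0 n (sawPath d n x (extPath d (n - 1) z))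

/-- The error rates `r_n`. -/
def rseq (d n : ℕ) : ℝ :=
  if d = 5 then (n : ℝ) ^ (-(1 : ℝ) / 2)
  else if d = 6 then Real.log n / n
  else (n : ℝ)⁻¹

/-- `Γ_n = K n^{-d/2} Σ_{k=1}^n k^{1-d/2} φ_{2k/5}`. -/
def GammaSAW (d : ℕ) (K : ℝ) (n : ℕ) (x : Ed d) : ℝ :=
  K * (n : ℝ) ^ (-(d : ℝ) / 2) *
    ∑ k ∈ Finset.Icc 1 n, (k : ℝ) ^ (1 - (d : ℝ) / 2) * gauss d (2 * k / 5) x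

/-- `χ_n(s) = LK (n/(s(n-s)))^{d/2}`. -/
def chiSAW (d : ℕ) (LK : ℝ) (n s : ℕ) : ℝ :=
  LK * ((n : ℝ) / ((s : ℝ) * (↑(n - s) : ℝ))) ^ ((d : ℝ) / 2)

/-! Laces. -/

/-- `β(j)`: index of the bond of the basic `N`-lace containing the vertex `j`. -/
def betaIdx (N j : ℕ) : ℕ :=
  if j = 0 then 1 else if j = 2 * N - 1 then N else if j % 2 = 0 then j / 2 else (j + 3) / 2

/-- `Φ^{(ν)}_{N,m,t}(x₁,…,x_{N-1})` (with `x 0 = 0` as convention on the argument). -/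
def PhiLace (d N : ℕ) (ν : ℝ) (m : Fin (2 * N - 1) → ℕ) (t : Fin (2 * N - 1) → ℝ)
    (x : ℕ → Ed d) : ℝ :=
  ∏ i : Fin (2 * N - 1),
    gauss d (ν * m i + t i) (x (betaIdx N ((i : ℕ) + 1) - 1) - x (betaIdx N (i : ℕ) - 1))

/-- `L^{(N)}_r[0,n]`: interdistance vectors summing to `n`, bounded below by `r`. -/
def laceFinset (len n : ℕ) (r : Fin len → ℕ) : Finset (Fin len → ℕ) :=
  (Fintype.piFinset fun _ => Finset.range (n + 1)).filter fun m =>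
    (∑ i, m i) = n ∧ ∀ i, r i ≤ m i

/-- Extend a vector `Fin len → ℕ` to indices `1,…,len`. -/
def extVec (len : ℕ) (m : Fin len → ℕ) (i : ℕ) : ℕ :=
  if h : 1 ≤ i ∧ i ≤ len then m ⟨i - 1, by omega⟩ else 0

/-- The vertices of a lace diagram, collapsing steps with `m_i = 0` (`G_0 = δ_0`). -/
def laceVertex (d N : ℕ) (m : ℕ → ℕ) (x : Ed d) (z : ℕ → Ed d) : ℕ → Ed d
  | 0 => 0
  | i + 1 =>
    if i + 1 = 2 * N - 1 then x
    else if m (i + 1) = 0 then laceVertex d N m x z i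
    else z (i + 1)

/-- Lower endpoint `i̲` of the `i`-th bond of the basic `N`-lace. -/
def bLow (i : ℕ) : ℕ := if i = 1 then 0 else 2 * i - 3

/-- Upper endpoint `ī` of the `i`-th bond of the basic `N`-lace. -/
def bHigh (N i : ℕ) : ℕ := if i = N then 2 * N - 1 else 2 * i

/-- `Ξ_ℓ(G,ρ)(x)`; coordinates with `m_i = 0` are collapsed (the `δ_0` convention),
and the corresponding unused integration variables are normalized away by a
standard Gaussian factor. -/
def XiLace (d N : ℕ) (G : ℕ → Ed d → ℝ) (ρ : ℝ) (m : Fin (2 * N - 1) → ℕ) (x : Ed d) : ℝ :=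
  ∫ z : Fin (2 * N - 2) → Ed d,
    (∏ i ∈ Finset.Icc 1 (2 * N - 1),
      if extVec (2 * N - 1) m i = 0 then gauss d 1 (extPath d (2 * N - 2) z i)
      else
        G (extVec (2 * N - 1) m i)
          (laceVertex d N (extVec (2 * N - 1) m) x (extPath d (2 * N - 2) z) i -
            laceVertex d N (extVec (2 * N - 1) m) x (extPath d (2 * N - 2) z) (i - 1))) *
    ∏ i ∈ Finset.Icc 1 N,
      indBall d ρ
        (laceVertex d N (extVec (2 * N - 1) m) x (extPath d (2 * N - 2) z) (bHigh N i) -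
          laceVertex d N (extVec (2 * N - 1) m) x (extPath d (2 * N - 2) z) (bLow i))

/-- The natural restriction vector `r⁰` for `N`-laces (`0`-indexed). -/
def r0vec (N : ℕ) (j : Fin (2 * N - 1)) : ℕ :=
  if (j : ℕ) % 2 = 1 ∨ (j : ℕ) = 0 ∨ (j : ℕ) = 2 * N - 2 then 1 else 0

/-- `ξ_n^{(N)}(G,ρ) = Σ_{ℓ ∈ L^{(N)}[0,n]} Ξ_ℓ(G,ρ)`. -/
def xiLace (d N : ℕ) (G : ℕ → Ed d → ℝ) (ρ : ℝ) (n : ℕ) (x : Ed d) : ℝ :=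
  ∑ m ∈ laceFinset (2 * N - 1) n (r0vec N), XiLace d N G ρ m x

/-- `Γ_n = n^{-a} φ_{n/2}`. -/
def GammaPoly (d : ℕ) (a : ℝ) (n : ℕ) (x : Ed d) : ℝ := (n : ℝ) ^ (-a) * gauss d ((n : ℝ) / 2) x

open scoped ENNReal RealInnerProductSpace

namespace SAW

section Algebra

variable (e u : ℕ → ℕ → ℝ≥0∞)

/-- The interaction over all pairs `a ≤ i < j ≤ b`. -/
def Kp (a b : ℕ) : ℝ≥0∞ := ∏ j ∈ Ioc a b, ∏ i ∈ Ico a j, e i j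

/-- The interaction between `[q,p)` and `(p,n]`. -/
def crs (q p n : ℕ) : ℝ≥0∞ := ∏ t ∈ Ioc p n, ∏ s ∈ Ico q p, e s t

/-- The interaction of `(p,n]` with itself, with `p` and with `[q,p)`. -/
def Tp (q p n : ℕ) : ℝ≥0∞ := crs e q p n * Kp e p n

/-- The weight of the event that `t` is the first time after `p` to interact with `[q,p)`. -/
def Vp (q p t : ℕ) : ℝ≥0∞ :=
  crs e q p (t - 1) * ∑ s ∈ Ico q p, (∏ s' ∈ Ico q s, e s' t) * u s t

/-- Positive (`true`) and negative (`false`) parts of the lace interaction. -/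
def jfun (σ : Bool) (q p m : ℕ) : ℝ≥0∞ :=
  if m ≤ p then (if m = p ∧ σ = true then 1 else 0)
  else ∑ t : (Ioc p m : Finset ℕ), Vp e u q p t * Kp e p t * jfun (!σ) p t m
termination_by m - p
decreasing_by
  have := mem_Ioc.1 t.2
  omega

theorem jfun_self (σ : Bool) (q p : ℕ) : jfun e u σ q p p = if σ = true then 1 else 0 := by
  rw [jfun]; simp

theorem jfun_of_lt (σ : Bool) {q p m : ℕ} (h : p < m) :
    jfun e u σ q p m = ∑ t ∈ Ioc p m, Vp e u q p t * Kp e p t * jfun e u (!σ) p t m := by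
  rw [jfun, if_neg (by omega)]
  exact sum_coe_sort (Ioc p m) fun t => Vp e u q p t * Kp e p t * jfun e u (!σ) p t m

/-- The total weight of the lace interaction. -/
def jhat (q p m : ℕ) : ℝ≥0∞ := jfun e u true q p m + jfun e u false q p m

theorem jhat_self (q p : ℕ) : jhat e u q p p = 1 := by simp [jhat, jfun_self]

theorem jhat_of_lt {q p m : ℕ} (h : p < m) :
    jhat e u q p m = ∑ t ∈ Ioc p m, Vp e u q p t * Kp e p t * jhat e u p t m := by
  simp only [jhat, jfun_of_lt e u _ h, ← sum_add_distrib, Bool.not_true, Bool.not_false]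
  exact sum_congr rfl fun t _ => by ring

@[simp] theorem Kp_self (a : ℕ) : Kp e a a = 1 := by simp [Kp]

theorem Kp_eq_mul_Tp {p t n : ℕ} (h : p ≤ t) (h' : t ≤ n) :
    Kp e p n = Kp e p t * Tp e p t n := by
  have h1 : Ioc p n = Ioc p t ∪ Ioc t n := by ext; simp; omega
  have h2 : Disjoint (Ioc p t) (Ioc t n) := by
    rw [Finset.disjoint_left]; intro x; simp; omega
  rw [Kp, h1, prod_union h2, Tp, crs, Kp, Kp, ← prod_mul_distrib]
  congr 1
  refine prod_congr rfl fun j hj => ?_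
  simp at hj
  have h3 : Ico p j = Ico p t ∪ Ico t j := by ext; simp; omega
  rw [h3, prod_union]
  rw [Finset.disjoint_left]; intro x; simp; omega

variable {e u}

theorem first_decomp (heu : ∀ i j, e i j + u i j = 1) (q p t : ℕ) :
    ∏ s ∈ Ico q p, e s t + ∑ s ∈ Ico q p, (∏ s' ∈ Ico q s, e s' t) * u s t = 1 := by
  rcases Nat.lt_or_ge q p with h | h
  · induction p, h using Nat.le_induction with
    | base => simp [heu]
    | succ p hp ih =>
      rw [prod_Ico_succ_top (by omega), sum_Ico_succ_top (by omega)]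
      calc _ = (∏ s ∈ Ico q p, e s t) * (e p t + u p t) +
            ∑ s ∈ Ico q p, (∏ s' ∈ Ico q s, e s' t) * u s t := by ring
        _ = 1 := by rw [heu, mul_one, ih]
  · simp [h]

theorem crs_add_Vp (heu : ∀ i j, e i j + u i j = 1) {q p t : ℕ} (h : p < t) :
    crs e q p t + Vp e u q p t = crs e q p (t - 1) := by
  have h1 : Ioc p t = insert t (Ioc p (t - 1)) := by ext; simp; omega
  rw [Vp, crs, h1, prod_insert (by simp; omega)]
  change _ * crs e q p (t - 1) + _ = _
  calc _ = crs e q p (t - 1) * (∏ s ∈ Ico q p, e s t +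
        ∑ s ∈ Ico q p, (∏ s' ∈ Ico q s, e s' t) * u s t) := by ring
    _ = _ := by rw [first_decomp heu, mul_one]

theorem crs_add_sum_Vp (heu : ∀ i j, e i j + u i j = 1) {q p n : ℕ} (h : p ≤ n) :
    crs e q p n + ∑ t ∈ Ioc p n, Vp e u q p t = 1 := by
  induction n, h using Nat.le_induction with
  | base => simp [crs]
  | succ n hn ih =>
    have h1 : Ioc p (n + 1) = insert (n + 1) (Ioc p n) := by ext; simp; omega
    rw [h1, sum_insert (by simp), ← add_assoc, crs_add_Vp heu (by omega)]
    simpa using ih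

theorem e_le_one (heu : ∀ i j, e i j + u i j = 1) (i j : ℕ) : e i j ≤ 1 :=
  (heu i j) ▸ le_self_add

theorem crs_le_one (heu : ∀ i j, e i j + u i j = 1) (q p n : ℕ) : crs e q p n ≤ 1 :=
  Finset.prod_le_one' fun _ _ => Finset.prod_le_one' fun _ _ => e_le_one heu _ _

theorem Kp_le_one (heu : ∀ i j, e i j + u i j = 1) (p n : ℕ) : Kp e p n ≤ 1 :=
  Finset.prod_le_one' fun _ _ => Finset.prod_le_one' fun _ _ => e_le_one heu _ _

theorem Tp_le_Kp (heu : ∀ i j, e i j + u i j = 1) (q p n : ℕ) : Tp e q p n ≤ Kp e p n :=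
  mul_le_of_le_one_left' (crs_le_one heu _ _ _)

theorem Kp_le_mul (heu : ∀ i j, e i j + u i j = 1) {p t n : ℕ} (h : p ≤ t) (h' : t ≤ n) :
    Kp e p n ≤ Kp e p t * Kp e t n := by
  rw [Kp_eq_mul_Tp e h h']
  exact mul_le_mul_right (Tp_le_Kp heu _ _ _) _

theorem Vp_le (heu : ∀ i j, e i j + u i j = 1) (q p t : ℕ) :
    Vp e u q p t ≤ ∑ s ∈ Ico q p, u s t := by
  refine (mul_le_of_le_one_left' (crs_le_one heu _ _ _)).trans ?_
  exact sum_le_sum fun s _ => mul_le_of_le_one_left'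
    (Finset.prod_le_one' fun _ _ => e_le_one heu _ _)

theorem Kp_eq_Tp_add (heu : ∀ i j, e i j + u i j = 1) {q p n : ℕ} (h : p ≤ n) :
    Kp e p n = Tp e q p n + ∑ t ∈ Ioc p n, Vp e u q p t * Kp e p t * Tp e p t n := by
  calc Kp e p n = (crs e q p n + ∑ t ∈ Ioc p n, Vp e u q p t) * Kp e p n := by
        rw [crs_add_sum_Vp heu h, one_mul]
    _ = _ := by
        rw [add_mul, sum_mul, Tp]
        congr 1
        refine sum_congr rfl fun t ht => ?_
        simp at ht
        rw [mul_assoc, ← Kp_eq_mul_Tp e (by omega) (by omega)]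

theorem sum_Ioc_exchange {p M : ℕ} (f : ℕ → ℕ → ℝ≥0∞) :
    ∑ m ∈ Ioc p M, ∑ t ∈ Ioc p m, f t m = ∑ t ∈ Ioc p M, ∑ m ∈ Icc t M, f t m := by
  refine sum_comm' fun x y => ?_
  simp; omega

theorem sum_jfun (σ : Bool) {q p M : ℕ} (h : p ≤ M) (g : ℕ → ℝ≥0∞) :
    ∑ m ∈ Icc p M, jfun e u σ q p m * g m = (if σ = true then g p else 0) +
      ∑ t ∈ Ioc p M, Vp e u q p t * Kp e p t * ∑ m ∈ Icc t M, jfun e u (!σ) p t m * g m := by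
  have h1 : Icc p M = insert p (Ioc p M) := by ext; simp; omega
  rw [h1, sum_insert (by simp), jfun_self]
  congr 1
  · cases σ <;> simp
  · simp only [mul_sum]
    rw [← sum_Ioc_exchange]
    refine sum_congr rfl fun m hm => ?_
    simp at hm
    rw [jfun_of_lt e u σ hm.1, sum_mul]
    exact sum_congr rfl fun t _ => by ring

/-- The lace expansion of a path interaction. -/
theorem Tp_add_lace (heu : ∀ i j, e i j + u i j = 1) (q p n : ℕ) (h : p ≤ n) :
    Tp e q p n + ∑ m ∈ Icc p n, jfun e u false q p m * Kp e m n =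
      ∑ m ∈ Icc p n, jfun e u true q p m * Kp e m n := by
  rw [sum_jfun _ h, sum_jfun _ h]
  simp only [if_true, Bool.not_true, Bool.not_false, Bool.false_eq_true, if_false, zero_add]
  conv_rhs => rw [Kp_eq_Tp_add heu (q := q) h]
  rw [add_assoc, ← sum_add_distrib]
  congr 1
  refine sum_congr rfl fun t ht => ?_
  have ht' := mem_Ioc.1 ht
  rw [← Tp_add_lace heu p t n ht'.2]
  ring
termination_by n - p
decreasing_by omega

theorem Kp_add_lace (heu : ∀ i j, e i j + u i j = 1) {n : ℕ} (h : 1 ≤ n) :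
    Kp e 0 n + ∑ m ∈ Icc 1 n, Kp e 0 1 * jfun e u false 0 1 m * Kp e m n =
      ∑ m ∈ Icc 1 n, Kp e 0 1 * jfun e u true 0 1 m * Kp e m n := by
  rw [Kp_eq_mul_Tp e (Nat.zero_le 1) h]
  simp only [mul_assoc, ← mul_sum, ← mul_add]
  rw [Tp_add_lace heu 0 1 n h]

theorem jhat_le (heu : ∀ i j, e i j + u i j = 1) {q p m : ℕ} (h : p < m) :
    jhat e u q p m ≤ ∑ s ∈ Ico q p, ∑ t ∈ Ioc p m, u s t * Kp e p t * jhat e u p t m := by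
  rw [jhat_of_lt e u h, sum_comm]
  refine sum_le_sum fun t _ => ?_
  rw [← sum_mul, ← sum_mul]
  gcongr
  exact Vp_le heu _ _ _

variable (e u) in
/-- The contribution of the laces that jump out of `[0,M]`. -/
def exitSum (M n q p : ℕ) : ℝ≥0∞ :=
  ∑ t ∈ Ioc M n, Vp e u q p t * Kp e p t * Tp e p t n +
    ∑ t : (Ioc p M : Finset ℕ), Vp e u q p t * Kp e p t * exitSum M n p t
termination_by M - p
decreasing_by
  have := mem_Ioc.1 t.2
  omega

variable (e u) in
theorem exitSum_eq (M n q p : ℕ) : exitSum e u M n q p =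
    ∑ t ∈ Ioc M n, Vp e u q p t * Kp e p t * Tp e p t n +
    ∑ t ∈ Ioc p M, Vp e u q p t * Kp e p t * exitSum e u M n p t := by
  rw [exitSum]
  congr 1
  exact sum_coe_sort (Ioc p M) fun t => Vp e u q p t * Kp e p t * exitSum e u M n p t

theorem truncated_lace (heu : ∀ i j, e i j + u i j = 1) (M n q p : ℕ) (h : p ≤ M) (hM : M ≤ n) :
    Tp e q p n + ∑ m ∈ Icc p M, jfun e u false q p m * Kp e m n ≤
      ∑ m ∈ Icc p M, jfun e u true q p m * Kp e m n + exitSum e u M n q p ∧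
    ∑ m ∈ Icc p M, jfun e u true q p m * Kp e m n ≤
      Tp e q p n + ∑ m ∈ Icc p M, jfun e u false q p m * Kp e m n + exitSum e u M n q p := by
  rw [sum_jfun _ h, sum_jfun _ h]
  simp only [if_true, Bool.not_true, Bool.not_false, Bool.false_eq_true, if_false, zero_add]
  have hU : Ioc p n = Ioc p M ∪ Ioc M n := by ext; simp; omega
  have hD : Disjoint (Ioc p M) (Ioc M n) := by
    rw [Finset.disjoint_left]; intro x; simp; omega
  rw [exitSum_eq, Kp_eq_Tp_add heu (q := q) (h.trans hM), hU, sum_union hD]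
  set X := ∑ t ∈ Ioc M n, Vp e u q p t * Kp e p t * Tp e p t n
  have ih : ∀ t ∈ Ioc p M, _ := fun t ht =>
    truncated_lace heu M n p t (by simp at ht; omega) hM
  constructor
  · calc _ ≤ Tp e q p n + ∑ t ∈ Ioc p M, Vp e u q p t * Kp e p t *
          (Tp e p t n + ∑ m ∈ Icc t M, jfun e u false p t m * Kp e m n + exitSum e u M n p t) := by
          gcongr with t ht
          exact (ih t ht).2
      _ = Tp e q p n + (∑ t ∈ Ioc p M, Vp e u q p t * Kp e p t * Tp e p t n +
        ∑ t ∈ Ioc p M, Vp e u q p t * Kp e p t * ∑ m ∈ Icc t M, jfun e u false p t m * Kp e m n +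
        ∑ t ∈ Ioc p M, Vp e u q p t * Kp e p t * exitSum e u M n p t) := by
          simp only [mul_add, sum_add_distrib]
      _ ≤ _ := by
          rw [show ∀ a b c d f g : ℝ≥0∞, a + (b + c) + d + (f + g) = a + (b + d + g) + (c + f) by
            intros; ring]
          exact le_self_add
  · calc _ = Tp e q p n + X + ∑ t ∈ Ioc p M, Vp e u q p t * Kp e p t *
          (Tp e p t n + ∑ m ∈ Icc t M, jfun e u false p t m * Kp e m n) := by
          simp only [mul_add, sum_add_distrib]
          ring
      _ ≤ Tp e q p n + X + ∑ t ∈ Ioc p M, Vp e u q p t * Kp e p t *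
          (∑ m ∈ Icc t M, jfun e u true p t m * Kp e m n + exitSum e u M n p t) := by
          refine add_le_add_right (sum_le_sum fun t ht => ?_) _
          exact mul_le_mul_right (ih t ht).1 _
      _ = _ := by
          simp only [mul_add, sum_add_distrib]
          ring
termination_by M - p
decreasing_by
  simp at ht; omega

theorem Vp_mul_Kp_le_one (heu : ∀ i j, e i j + u i j = 1) (q p t : ℕ) :
    Vp e u q p t * Kp e p t ≤ 1 := by
  refine mul_le_one' (mul_le_one' (crs_le_one heu _ _ _) ?_) (Kp_le_one heu _ _)
  exact first_decomp heu q p t ▸ le_add_self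

theorem sum_two_pow (p M : ℕ) (h : p ≤ M) :
    1 + ∑ t ∈ Ioc p M, (2 : ℝ≥0∞) ^ (M - t) = 2 ^ (M - p) := by
  induction M, h using Nat.le_induction with
  | base => simp
  | succ M hM ih =>
    have h1 : Ioc p (M + 1) = insert (M + 1) (Ioc p M) := by ext; simp; omega
    have h2 : ∑ t ∈ Ioc p M, (2 : ℝ≥0∞) ^ (M + 1 - t) = 2 * ∑ t ∈ Ioc p M, (2 : ℝ≥0∞) ^ (M - t) := by
      rw [mul_sum]
      refine sum_congr rfl fun t ht => ?_
      simp at ht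
      rw [show M + 1 - t = (M - t) + 1 by omega, pow_succ, mul_comm]
    rw [h1, sum_insert (by simp), h2, show M + 1 - p = (M - p) + 1 by omega, pow_succ, ← ih]
    simp
    ring

/-- A bound for the contribution of the laces that jump out of `[0,M]`, according to whether
they land before or after `h`. -/
theorem exitSum_le (heu : ∀ i j, e i j + u i j = 1) (M h n q p : ℕ) (hp : p ≤ M) (hh : M ≤ h)
    (hn : h ≤ n) : exitSum e u M n q p ≤ ∑ t ∈ Ioc M h, jhat e u q p t * Kp e t n +
      2 ^ (M - p) * ∑ p' ∈ range (M + 1), ∑ s ∈ range p', ∑ t ∈ Ioc h n,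
        u s t * Kp e p' t * Kp e t n := by
  set Y : ℕ → ℝ≥0∞ := fun p' => ∑ s ∈ range p', ∑ t ∈ Ioc h n, u s t * Kp e p' t * Kp e t n
  change _ ≤ _ + 2 ^ (M - p) * ∑ p' ∈ range (M + 1), Y p'
  set Z := ∑ p' ∈ range (M + 1), Y p'
  have hU : Ioc M n = Ioc M h ∪ Ioc h n := by ext; simp; omega
  have hD : Disjoint (Ioc M h) (Ioc h n) := by
    rw [Finset.disjoint_left]; intro x; simp; omega
  have hX : ∑ t ∈ Ioc h n, Vp e u q p t * Kp e p t * Tp e p t n ≤ Z := by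
    calc _ ≤ Y p := by
          simp only [Y]
          rw [sum_comm]
          refine sum_le_sum fun t _ => ?_
          rw [← sum_mul, ← sum_mul]
          gcongr
          · refine (Vp_le heu _ _ _).trans (sum_le_sum_of_subset ?_)
            intro x; simp
          · exact Tp_le_Kp heu _ _ _
      _ ≤ Z := single_le_sum (f := Y) (fun _ _ => zero_le) (by simp; omega)
  have ih : ∀ t ∈ Ioc p M, _ := fun t ht =>
    exitSum_le heu M h n p t (by simp at ht; omega) hh hn
  rw [exitSum_eq, hU, sum_union hD]
  calc _ ≤ ∑ t ∈ Ioc M h, Vp e u q p t * Kp e p t * Kp e t n + Z +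
        ∑ t ∈ Ioc p M, Vp e u q p t * Kp e p t * (∑ t' ∈ Ioc M h, jhat e u p t t' * Kp e t' n +
          2 ^ (M - t) * Z) := by
        refine add_le_add (add_le_add ?_ hX) (sum_le_sum fun t ht => ?_)
        · gcongr
          exact Tp_le_Kp heu _ _ _
        · exact mul_le_mul_right (ih t ht) _
    _ = (∑ t ∈ Ioc M h, Vp e u q p t * Kp e p t * Kp e t n +
          ∑ t ∈ Ioc p M, Vp e u q p t * Kp e p t * ∑ t' ∈ Ioc M h, jhat e u p t t' * Kp e t' n) +
        (Z + ∑ t ∈ Ioc p M, Vp e u q p t * Kp e p t * (2 ^ (M - t) * Z)) := by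
        simp only [mul_add, sum_add_distrib]
        ring
    _ ≤ _ := by
        refine add_le_add ?_ ?_
        · simp only [mul_sum]
          rw [sum_comm, ← sum_add_distrib]
          refine sum_le_sum fun t ht => ?_
          have ht' := mem_Ioc.1 ht
          rw [jhat_of_lt e u (show p < t by omega), sum_mul]
          have hs : insert t (Ioc p M) ⊆ Ioc p t := by
            intro x; simp; omega
          refine le_trans ?_ (sum_le_sum_of_subset hs)
          rw [sum_insert (by simp; omega), jhat_self]
          simp [mul_assoc]
        · calc _ ≤ Z + ∑ t ∈ Ioc p M, 2 ^ (M - t) * Z := by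
                refine add_le_add_right (sum_le_sum fun t _ => ?_) _
                exact mul_le_of_le_one_left' (Vp_mul_Kp_le_one heu _ _ _)
            _ = (1 + ∑ t ∈ Ioc p M, 2 ^ (M - t)) * Z := by rw [add_mul, one_mul, sum_mul]
            _ ≤ _ := by rw [sum_two_pow p M hp]
termination_by M - p
decreasing_by
  simp at ht; omega

theorem Kp_congr {e e' : ℕ → ℕ → ℝ≥0∞} {a b : ℕ}
    (h : ∀ i j, a ≤ i → i < j → j ≤ b → e i j = e' i j) : Kp e a b = Kp e' a b := by
  refine prod_congr rfl fun j hj => prod_congr rfl fun i hi => ?_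
  simp at hi hj
  exact h i j hi.1 hi.2 hj.2

theorem Vp_congr {e e' u u' : ℕ → ℕ → ℝ≥0∞} {q p t m : ℕ} (hpt : p < t) (htm : t ≤ m)
    (h : ∀ i j, i < j → j ≤ m → e i j = e' i j)
    (h' : ∀ i j, i < j → j ≤ m → u i j = u' i j) : Vp e u q p t = Vp e' u' q p t := by
  unfold Vp crs
  congr 1
  · refine prod_congr rfl fun j hj => prod_congr rfl fun i hi => ?_
    simp at hi hj
    exact h i j (by omega) (by omega)
  · refine sum_congr rfl fun s hs => ?_
    simp at hs
    rw [h' s t (by omega) htm]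
    congr 1
    refine prod_congr rfl fun i hi => ?_
    simp at hi
    exact h i t (by omega) htm

theorem jfun_congr {e e' u u' : ℕ → ℕ → ℝ≥0∞} (σ : Bool) (q p m : ℕ)
    (h : ∀ i j, i < j → j ≤ m → e i j = e' i j)
    (h' : ∀ i j, i < j → j ≤ m → u i j = u' i j) : jfun e u σ q p m = jfun e' u' σ q p m := by
  rcases Nat.lt_or_ge p m with hp | hp
  · rw [jfun_of_lt _ _ _ hp, jfun_of_lt _ _ _ hp]
    refine sum_congr rfl fun t ht => ?_
    have ht' := mem_Ioc.1 ht
    rw [Vp_congr ht'.1 ht'.2 h h', jfun_congr (!σ) p t m h h',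
      Kp_congr fun i j _ hij hj => h i j hij (hj.trans ht'.2)]
  · rw [jfun, jfun, if_pos hp, if_pos hp]
termination_by m - p
decreasing_by omega

theorem measurable_Kp {Ω : Type*} [MeasurableSpace Ω] {e : Ω → ℕ → ℕ → ℝ≥0∞}
    (he : ∀ i j, Measurable fun ω => e ω i j) (a b : ℕ) : Measurable fun ω => Kp (e ω) a b := by
  unfold Kp
  fun_prop

theorem measurable_jfun {Ω : Type*} [MeasurableSpace Ω] {e u : Ω → ℕ → ℕ → ℝ≥0∞}
    (he : ∀ i j, Measurable fun ω => e ω i j) (hu : ∀ i j, Measurable fun ω => u ω i j)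
    (σ : Bool) (q p m : ℕ) : Measurable fun ω => jfun (e ω) (u ω) σ q p m := by
  rcases Nat.lt_or_ge p m with hp | hp
  · simp only [jfun_of_lt _ _ _ hp]
    refine Finset.measurable_sum _ fun t ht => ?_
    have ht' := mem_Ioc.1 ht
    refine (Measurable.mul ?_ (measurable_Kp he _ _)).mul (measurable_jfun he hu (!σ) p t m)
    unfold Vp crs
    fun_prop
  · have : ∀ ω, jfun (e ω) (u ω) σ q p m = if m = p ∧ σ = true then 1 else 0 := fun ω => by
      rw [jfun, if_pos hp]
    simp only [this]
    exact measurable_const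
termination_by m - p
decreasing_by omega

end Algebra

section Marginal

variable {V : Type*} [MeasureSpace V] [SigmaFinite (volume : Measure V)]

/-- The marginal with respect to the Lebesgue measure in the coordinates in `s`. -/
abbrev marg (s : Finset ℕ) (f : (ℕ → V) → ℝ≥0∞) : (ℕ → V) → ℝ≥0∞ :=
  lmarginal (fun _ => (volume : Measure V)) s f

theorem marg_mono {s : Finset ℕ} {f g : (ℕ → V) → ℝ≥0∞} (h : ∀ y, f y ≤ g y) (y : ℕ → V) :
    marg s f y ≤ marg s g y :=
  lmarginal_mono (μ := fun _ => (volume : Measure V)) (s := s) (f := f) (g := g) h y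

theorem measurable_marg {s : Finset ℕ} {f : (ℕ → V) → ℝ≥0∞} (hf : Measurable f) :
    Measurable (marg s f) := hf.lmarginal _

theorem marg_insert {s : Finset ℕ} {f : (ℕ → V) → ℝ≥0∞} (hf : Measurable f) {i : ℕ}
    (hi : i ∉ s) (y : ℕ → V) :
    marg (insert i s) f y = ∫⁻ z, marg s f (Function.update y i z) :=
  lmarginal_insert f hf hi y

theorem marg_union {s t : Finset ℕ} {f : (ℕ → V) → ℝ≥0∞} (hf : Measurable f)
    (h : Disjoint s t) (y : ℕ → V) : marg (s ∪ t) f y = marg s (marg t f) y :=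
  congrFun (lmarginal_union _ f hf h) y

theorem marg_congr {s : Finset ℕ} {f : (ℕ → V) → ℝ≥0∞} {x y : ℕ → V} {S : Set ℕ}
    (hf : DependsOn f S) (h : ∀ i ∈ S, i ∉ s → x i = y i) : marg s f x = marg s f y := by
  refine lintegral_congr fun z => hf fun i hi => ?_
  simp only [Function.updateFinset]
  split_ifs with hs
  · rfl
  · exact h i hi hs

theorem marg_mul_left {s : Finset ℕ} {f g : (ℕ → V) → ℝ≥0∞} {S : Set ℕ}
    (hg : DependsOn g S) (hS : ∀ i ∈ S, i ∉ s) (hf : Measurable f) (y : ℕ → V) :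
    marg s (fun y => g y * f y) y = g y * marg s f y := by
  have : ∀ z : (i : s) → V, g (Function.updateFinset y s z) = g y := fun z => hg fun i hi => by
    simp [Function.updateFinset, hS i hi]
  simp only [marg, lmarginal, this]
  exact lintegral_const_mul _ (hf.comp measurable_updateFinset)

theorem marg_sum {ι : Type*} {s : Finset ℕ} (T : Finset ι) {f : ι → (ℕ → V) → ℝ≥0∞}
    (hf : ∀ i, Measurable (f i)) (y : ℕ → V) :
    marg s (fun y => ∑ i ∈ T, f i y) y = ∑ i ∈ T, marg s (f i) y :=
  lintegral_finsetSum _ fun i _ => (hf i).comp measurable_updateFinset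

theorem marg_add {s : Finset ℕ} {f g : (ℕ → V) → ℝ≥0∞} (hf : Measurable f) (y : ℕ → V) :
    marg s f y + marg s g y = marg s (fun y => f y + g y) y :=
  (lintegral_add_left (hf.comp measurable_updateFinset) _).symm

theorem marg_comp (L : V ≃ᵐ V) (hL : MeasurePreserving L) (s : Finset ℕ)
    {f : (ℕ → V) → ℝ≥0∞} (hf : Measurable f) (y : ℕ → V) :
    marg s f (fun i => L (y i)) = marg s (fun y => f fun i => L (y i)) y := by
  have hf' : Measurable fun y : ℕ → V => f fun i => L (y i) :=
    hf.comp (measurable_pi_lambda _ fun i => L.measurable.comp (measurable_pi_apply i))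
  induction s using Finset.induction generalizing y with
  | empty => simp [marg]
  | insert i s hi ih =>
    rw [marg_insert hf hi, marg_insert hf' hi, ← hL.lintegral_comp_emb L.measurableEmbedding]
    refine lintegral_congr fun z => ?_
    rw [← ih]
    congr 1
    funext j
    by_cases h : j = i
    · subst h; simp
    · simp [h]

theorem marg_shift (a : ℕ) (s : Finset ℕ) {f : (ℕ → V) → ℝ≥0∞} (hf : Measurable f) (y : ℕ → V) :
    marg (s.image (· + a)) (fun y => f fun i => y (i + a)) y = marg s f fun i => y (i + a) :=
  lmarginal_image (X := fun _ : ℕ => V) (μ := fun _ => (volume : Measure V)) (e := (· + a))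
    (add_left_injective a) s hf y

/-- Integration over a path that is pinned at an intermediate time. -/
theorem marg_concat {a m n : ℕ} (ham : a < m) (hmn : m < n) {f g : (ℕ → V) → ℝ≥0∞}
    (hf : Measurable f) (hg : Measurable g) (hfm : DependsOn f (Set.Iic m))
    (hgm : DependsOn g (Set.Ici m)) (y : ℕ → V) :
    marg (Ioo a n) (fun y => f y * g y) y =
      ∫⁻ z, marg (Ioo a m) f (Function.update y m z) * marg (Ioo m n) g (Function.update y m z) := by
  have h1 : Ioo a n = insert m (Ioo a m ∪ Ioo m n) := by ext; simp; omega
  have hd : Disjoint (Ioo a m) (Ioo m n) := by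
    rw [Finset.disjoint_left]; intro x; simp; omega
  have hfg : Measurable fun y => f y * g y := hf.mul hg
  rw [h1, marg_insert hfg (by simp)]
  refine lintegral_congr fun z => ?_
  rw [marg_union hfg hd]
  have h2 : marg (Ioo m n) (fun y => f y * g y) = fun y => marg (Ioo m n) g y * f y := by
    funext y
    rw [marg_mul_left hfm (by simp; omega) hg, mul_comm]
  rw [h2, marg_mul_left (S := Set.Ici m) _ (by simp; omega) hf, mul_comm]
  intro y y' h
  exact marg_congr hgm fun i hi _ => h i hi

end Marginal

section Paths

variable {V : Type*} [AddGroup V]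

/-- The pair weights along a path. -/
def pw (E : V → ℝ≥0∞) (y : ℕ → V) (i j : ℕ) : ℝ≥0∞ := E (y j - y i)

/-- The product of step weights. -/
def Phi (D : V → ℝ≥0∞) (a b : ℕ) (y : ℕ → V) : ℝ≥0∞ := ∏ i ∈ Ioc a b, D (y i - y (i - 1))

/-- The weight of a line. -/
def Wline (D E : V → ℝ≥0∞) (a b : ℕ) (y : ℕ → V) : ℝ≥0∞ := Kp (pw E y) a b * Phi D a b y

/-- The path pinned to `x` at all positive times. -/
def pt (x : V) (i : ℕ) : V := if i = 0 then 0 else x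

@[simp] theorem pt_zero (x : V) : pt x 0 = 0 := rfl

theorem pt_pos (x : V) {i : ℕ} (h : 0 < i) : pt x i = x := by simp [pt, h.ne']

variable {D E U : V → ℝ≥0∞}

theorem dependsOn_Phi (a b : ℕ) : DependsOn (Phi D a b) (Set.Icc a b) := by
  intro x y h
  refine prod_congr rfl fun i hi => ?_
  simp at hi
  rw [h i ⟨by omega, by omega⟩, h (i - 1) ⟨by omega, by omega⟩]

theorem dependsOn_Kp (a b : ℕ) : DependsOn (fun y : ℕ → V => Kp (pw E y) a b) (Set.Icc a b) := by
  intro x y h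
  refine Kp_congr fun i j h1 h2 h3 => ?_
  simp only [pw]
  rw [h i ⟨by omega, by omega⟩, h j ⟨by omega, by omega⟩]

theorem dependsOn_Wline (a b : ℕ) : DependsOn (Wline D E a b) (Set.Icc a b) := by
  intro x y h
  simp only [Wline]
  rw [dependsOn_Phi a b h]
  congr 1
  exact dependsOn_Kp a b h

theorem dependsOn_jfun (σ : Bool) (q p m : ℕ) :
    DependsOn (fun y : ℕ → V => jfun (pw E y) (pw U y) σ q p m) (Set.Iic m) := by
  intro x y h
  refine jfun_congr σ q p m (fun i j h1 h2 => ?_) fun i j h1 h2 => ?_ <;>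
  · simp only [pw]
    rw [h i (by simp; omega), h j (by simp; omega)]

theorem Phi_mul {a b c : ℕ} (h : a ≤ b) (h' : b ≤ c) (y : ℕ → V) :
    Phi D a c y = Phi D a b y * Phi D b c y := by
  have h1 : Ioc a c = Ioc a b ∪ Ioc b c := by ext; simp; omega
  rw [Phi, h1, prod_union, Phi, Phi]
  rw [Finset.disjoint_left]; intro x; simp; omega

theorem pw_add (heu : ∀ x, E x + U x = 1) (y : ℕ → V) (i j : ℕ) : pw E y i j + pw U y i j = 1 :=
  heu _

theorem Wline_le_mul (heu : ∀ x, E x + U x = 1) {a b c : ℕ} (h : a ≤ b) (h' : b ≤ c)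
    (y : ℕ → V) : Wline D E a c y ≤ Wline D E a b y * Wline D E b c y := by
  rw [Wline, Wline, Wline, Phi_mul h h' y]
  calc _ ≤ Kp (pw E y) a b * Kp (pw E y) b c * (Phi D a b y * Phi D b c y) := by
        gcongr
        exact Kp_le_mul (pw_add heu y) h h'
    _ = _ := by ring

theorem Wline_shift (a n : ℕ) (y : ℕ → V) :
    Wline D E a (n + a) y = Wline D E 0 n fun i => y (i + a) := by
  simp only [Wline, Kp, Phi]
  have him : Ioc a (n + a) = (Ioc 0 n).image (· + a) := by
    ext x; simp only [mem_Ioc, mem_image]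
    exact ⟨fun h => ⟨x - a, by omega, by omega⟩, fun ⟨z, h, h'⟩ => by omega⟩
  have hinj : ∀ s : Set ℕ, Set.InjOn (· + a) s := fun s => (add_left_injective a).injOn
  rw [him, prod_image (hinj _), prod_image (hinj _)]
  congr 1
  · refine prod_congr rfl fun j hj => ?_
    have : Ico a (j + a) = (Ico 0 j).image (· + a) := by
      ext x; simp only [mem_Ico, mem_image]
      exact ⟨fun h => ⟨x - a, by omega, by omega⟩, fun ⟨z, h, h'⟩ => by omega⟩
    rw [this, prod_image (hinj _)]
    rfl
  · refine prod_congr rfl fun j hj => ?_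
    simp at hj
    rw [show j + a - 1 = j - 1 + a by omega]

variable [MeasureSpace V] [MeasurableAdd₂ V] [MeasurableSub₂ V]
  [SigmaFinite (volume : Measure V)] [(volume : Measure V).IsAddRightInvariant]

theorem measurable_pw (hE : Measurable E) (i j : ℕ) : Measurable fun y : ℕ → V => pw E y i j := by
  unfold pw; fun_prop

theorem measurable_Phi (hD : Measurable D) (a b : ℕ) : Measurable (Phi D a b) := by
  unfold Phi; fun_prop

theorem measurable_Wline (hD : Measurable D) (hE : Measurable E) (a b : ℕ) :
    Measurable (Wline D E a b) :=
  (measurable_Kp (measurable_pw hE) a b).mul (measurable_Phi hD a b)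

variable (D E) in
/-- The two-point function of an `n`-step path. -/
def Cn (n : ℕ) (x : V) : ℝ≥0∞ := marg (Ioo 0 n) (Wline D E 0 n) (pt x)

theorem measurable_pt : Measurable (pt : V → ℕ → V) := by
  refine measurable_pi_lambda _ fun i => ?_
  by_cases h : i = 0
  · simp only [pt, h, if_true]; exact measurable_const
  · simp only [pt, h, if_false]; exact measurable_id

theorem measurable_Cn (hD : Measurable D) (hE : Measurable E) (n : ℕ) : Measurable (Cn D E n) :=
  (measurable_marg (measurable_Wline hD hE 0 n)).comp measurable_pt

theorem marg_translate {f : (ℕ → V) → ℝ≥0∞} (hf : Measurable f)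
    (hfi : ∀ (y : ℕ → V) (c : V), f (fun i => y i + c) = f y) (s : Finset ℕ) (y : ℕ → V) (c : V) :
    marg s f (fun i => y i + c) = marg s f y := by
  have := marg_comp (MeasurableEquiv.addRight c) (measurePreserving_add_right volume c) s hf y
  simp only [MeasurableEquiv.coe_addRight, hfi] at this
  exact this

theorem pw_translate (y : ℕ → V) (c : V) : pw E (fun i => y i + c) = pw E y := by
  funext i j; simp [pw]

theorem Phi_translate (a b : ℕ) (y : ℕ → V) (c : V) :
    Phi D a b (fun i => y i + c) = Phi D a b y := by
  simp [Phi]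

/-- The integral of a translation invariant weight on `[0,m]` over the intermediate points. -/
theorem marg_pinned {f : (ℕ → V) → ℝ≥0∞} (hf : Measurable f) {m : ℕ}
    (hfi : ∀ (y : ℕ → V) (c : V), f (fun i => y i + c) = f y) (hfm : DependsOn f (Set.Iic m))
    (hm : 0 < m) (y : ℕ → V) :
    marg (Ioo 0 m) f y = marg (Ioo 0 m) f (pt (y m - y 0)) := by
  rw [← marg_translate hf hfi (Ioo 0 m) y (-(y 0))]
  refine marg_congr hfm fun i hi hi' => ?_
  simp at hi hi'
  rcases Nat.eq_zero_or_pos i with h | h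
  · subst h; simp
  · have : i = m := by have := hi' h; omega
    subst this
    simp [pt_pos _ h, sub_eq_add_neg]

theorem marg_Wline (hD : Measurable D) (hE : Measurable E) {a b : ℕ} (h : a < b) (y : ℕ → V) :
    marg (Ioo a b) (Wline D E a b) y = Cn D E (b - a) (y b - y a) := by
  obtain ⟨n, rfl⟩ : ∃ n, b = n + a := ⟨b - a, by omega⟩
  have him : Ioo a (n + a) = (Ioo 0 n).image (· + a) := by
    ext x; simp only [mem_Ioo, mem_image]
    exact ⟨fun h => ⟨x - a, by omega, by omega⟩, fun ⟨z, h, h'⟩ => by omega⟩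
  rw [him, show Wline D E a (n + a) = _ from funext fun y => Wline_shift a n y,
    marg_shift a _ (measurable_Wline hD hE 0 n),
    marg_pinned (measurable_Wline hD hE 0 n) _ _ (by omega)]
  · simp [Cn]
  · intro y c
    simp only [Wline, pw_translate, Phi_translate]
  · exact fun x y h => dependsOn_Wline 0 n fun i hi => h i hi.2

/-- Integration over a line together with its endpoint. -/
theorem marg_Ioc_Wline (hD : Measurable D) (hE : Measurable E) {p t : ℕ} (h : p < t)
    {f : (ℕ → V) → ℝ≥0∞} (hf : Measurable f) {S : Set ℕ} (hfS : DependsOn f S)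
    (hS : ∀ i ∈ S, i ∉ Ioo p t) (y : ℕ → V) :
    marg (Ioc p t) (fun y => f y * Wline D E p t y) y =
      ∫⁻ z, f (Function.update y t z) * Cn D E (t - p) (z - y p) := by
  have h1 : Ioc p t = insert t (Ioo p t) := by ext; simp; omega
  have hfg : Measurable fun y => f y * Wline D E p t y := hf.mul (measurable_Wline hD hE p t)
  rw [h1, marg_insert hfg (by simp)]
  refine lintegral_congr fun z => ?_
  rw [marg_mul_left hfS hS (measurable_Wline hD hE p t), marg_Wline hD hE h]
  simp [h.ne]

variable (D E U) in
/-- Positive and negative part of the lace functions. -/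
def Pn (σ : Bool) (m : ℕ) (x : V) : ℝ≥0∞ :=
  marg (Ioo 0 m)
    (fun y => Kp (pw E y) 0 1 * jfun (pw E y) (pw U y) σ 0 1 m * Phi D 0 m y) (pt x)

theorem measurable_Pn_integrand (hD : Measurable D) (hE : Measurable E) (hU : Measurable U)
    (σ : Bool) (m : ℕ) : Measurable fun y : ℕ → V =>
      Kp (pw E y) 0 1 * jfun (pw E y) (pw U y) σ 0 1 m * Phi D 0 m y :=
  ((measurable_Kp (measurable_pw hE) 0 1).mul
    (measurable_jfun (measurable_pw hE) (measurable_pw hU)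
      σ 0 1 m)).mul (measurable_Phi hD 0 m)

theorem measurable_Pn (hD : Measurable D) (hE : Measurable E) (hU : Measurable U)
    (σ : Bool) (m : ℕ) : Measurable (Pn D E U σ m) :=
  (measurable_marg (measurable_Pn_integrand hD hE hU σ m)).comp measurable_pt

theorem dependsOn_Pn_integrand (σ : Bool) {m : ℕ} (hm : 1 ≤ m) : DependsOn (fun y : ℕ → V =>
      Kp (pw E y) 0 1 * jfun (pw E y) (pw U y) σ 0 1 m * Phi D 0 m y) (Set.Iic m) := by
  intro x y h
  simp only
  rw [dependsOn_Phi (D := D) 0 m fun i hi => h i hi.2]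
  congr 2
  · exact dependsOn_Kp 0 1 fun i hi => h i (hi.2.trans hm)
  · exact dependsOn_jfun σ 0 1 m h

/-- Convolution of nonnegative functions. -/
def lconv (f g : V → ℝ≥0∞) (x : V) : ℝ≥0∞ := ∫⁻ z, f z * g (x - z)

/-- Convolution with a two-point function, where the zero-step function is the unit mass at 0. -/
def lconvC (D E : V → ℝ≥0∞) (f : V → ℝ≥0∞) (k : ℕ) (x : V) : ℝ≥0∞ :=
  if k = 0 then f x else lconv f (Cn D E k) x

theorem marg_concat_Cn (hD : Measurable D) (hE : Measurable E) {m n : ℕ} (hm : 0 < m) (hn : m < n)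
    {f : (ℕ → V) → ℝ≥0∞} (hf : Measurable f) (hfm : DependsOn f (Set.Iic m)) (x : V) :
    marg (Ioo 0 n) (fun y => f y * Wline D E m n y) (pt x) =
      lconv (fun z => marg (Ioo 0 m) f (pt z)) (Cn D E (n - m)) x := by
  rw [marg_concat hm hn hf (measurable_Wline hD hE m n) hfm
    fun x y h => dependsOn_Wline m n fun i hi => h i hi.1]
  refine lintegral_congr fun z => ?_
  rw [marg_Wline hD hE hn]
  congr 1
  · refine marg_congr hfm fun i hi hi' => ?_
    simp at hi hi'
    rcases Nat.eq_zero_or_pos i with h | h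
    · subst h; simp [hm.ne]
    · have : i = m := by have := hi' h; omega
      subst this
      simp [pt_pos _ h]
  · simp [hn.ne', pt_pos _ (hm.trans hn)]

variable (D E U) in
/-- The integrand of the lace functions concatenated with a walk up to time `n`. -/
def laceInt (n : ℕ) (σ : Bool) (m : ℕ) (y : ℕ → V) : ℝ≥0∞ :=
  Kp (pw E y) 0 1 * jfun (pw E y) (pw U y) σ 0 1 m * Kp (pw E y) m n * Phi D 0 n y

theorem measurable_laceInt (hD : Measurable D) (hE : Measurable E) (hU : Measurable U) (n : ℕ)
    (σ : Bool) (m : ℕ) : Measurable (laceInt D E U n σ m) :=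
  (((measurable_Kp (measurable_pw hE) 0 1).mul
    (measurable_jfun (measurable_pw hE) (measurable_pw hU) σ 0 1 m)).mul
      (measurable_Kp (measurable_pw hE) m n)).mul (measurable_Phi hD 0 n)

theorem lconvC_Pn (hD : Measurable D) (hE : Measurable E) (hU : Measurable U) (σ : Bool) {m n : ℕ}
    (hm : 1 ≤ m) (hmn : m ≤ n) (x : V) : lconvC D E (Pn D E U σ m) (n - m) x =
      marg (Ioo 0 n) (laceInt D E U n σ m) (pt x) := by
  rcases hmn.eq_or_lt with h | h
  · subst h
    rw [Nat.sub_self, lconvC, if_pos rfl, Pn]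
    refine congrArg (fun f => marg _ f (pt x)) (funext fun y => ?_)
    rw [laceInt, Kp_self, mul_one]
  · rw [lconvC, if_neg (by omega)]
    have := marg_concat_Cn hD hE (by omega) h (measurable_Pn_integrand hD hE hU σ m)
      (dependsOn_Pn_integrand σ hm) x
    rw [show Pn D E U σ m = _ from rfl]
    unfold Pn
    rw [← this]
    congr 1
    funext y
    rw [laceInt, Phi_mul (Nat.zero_le m) hmn, Wline]
    ring

/-- The lace expansion. -/
theorem lace_expansion (hD : Measurable D) (hE : Measurable E) (hU : Measurable U)
    (heu : ∀ x, E x + U x = 1) {n : ℕ} (hn : 1 ≤ n) (x : V) :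
    Cn D E n x + ∑ m ∈ Icc 1 n, lconvC D E (Pn D E U false m) (n - m) x =
      ∑ m ∈ Icc 1 n, lconvC D E (Pn D E U true m) (n - m) x := by
  have key : ∀ σ : Bool, ∀ m ∈ Icc 1 n, lconvC D E (Pn D E U σ m) (n - m) x = _ := fun σ m hm =>
    lconvC_Pn hD hE hU σ (mem_Icc.1 hm).1 (mem_Icc.1 hm).2 x
  rw [sum_congr rfl (key true), sum_congr rfl (key false),
    ← marg_sum _ (measurable_laceInt hD hE hU n true),
    ← marg_sum _ (measurable_laceInt hD hE hU n false), Cn, marg_add (measurable_Wline hD hE 0 n)]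
  congr 1
  funext y
  simp only [laceInt]
  rw [Wline, ← sum_mul, ← sum_mul, ← add_mul, Kp_add_lace (pw_add heu y) hn]

theorem Cn_add_le (hD : Measurable D) (hE : Measurable E) (heu : ∀ x, E x + U x = 1) {a b : ℕ}
    (ha : 0 < a) (hb : 0 < b) (x : V) : Cn D E (a + b) x ≤ lconv (Cn D E a) (Cn D E b) x := by
  have := marg_concat_Cn hD hE ha (show a < a + b by omega) (measurable_Wline hD hE 0 a)
    (fun x y h => dependsOn_Wline 0 a fun i hi => h i hi.2) x
  rw [Nat.add_sub_cancel_left] at this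
  unfold Cn at *
  rw [← this]
  exact marg_mono (fun y => Wline_le_mul heu (Nat.zero_le a) (by omega) y) _

theorem Cn_one (x : V) : Cn D E 1 x = E x * D x := by
  rw [Cn, show Ioo 0 1 = (∅ : Finset ℕ) by rfl, marg, lmarginal_empty]
  simp [Wline, Kp, Phi, pw, pt]

theorem marg_comp_pt {f : (ℕ → V) → ℝ≥0∞} (hf : Measurable f) (L : V ≃ᵐ V)
    (hL : MeasurePreserving L) (hL0 : L 0 = 0) (hfL : ∀ y : ℕ → V, f (fun i => L (y i)) = f y)
    (s : Finset ℕ) (x : V) : marg s f (pt (L x)) = marg s f (pt x) := by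
  have h1 := marg_comp L hL s hf (pt x)
  simp only [hfL] at h1
  have h2 : (fun i => L (pt x i)) = pt (L x) := by
    funext i
    by_cases h : i = 0 <;> simp [pt, h, hL0]
  rw [← h2]
  exact h1

end Paths

section Diagrams

variable {d : ℕ} {D E U : Ed d → ℝ≥0∞} {θ : ℕ → Ed d → ℝ≥0∞}

/-- Weighted two-point functions. -/
def ut (θ : ℕ → Ed d → ℝ≥0∞) (D E : Ed d → ℝ≥0∞) (n : ℕ) (x : Ed d) : ℝ≥0∞ := θ n x * Cn D E n x

/-- Correlation with the weight `U`. -/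
def ustar (U f : Ed d → ℝ≥0∞) (ζ : Ed d) : ℝ≥0∞ := ∫⁻ v, U (v - ζ) * f v

/-- A loop made from a line `w e` and a diagram `b r`. -/
def hloop (w b : ℕ → Ed d → ℝ≥0∞) (e r : ℕ) (v : Ed d) : ℝ≥0∞ := w e v * b r (-v)

/-- The lines of a lace diagram up to its first closing bond. -/
def dline (w b : ℕ → Ed d → ℝ≥0∞) (r : ℕ) (v : Ed d) : ℝ≥0∞ :=
  w r v + ∑ l ∈ Ioo 0 r, (hloop w b l (r - l) v +
    ∑ a ∈ Ioo 0 l, lconv (w a) (hloop w b (l - a) (r - l)) v)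

/-- Lace diagrams with at most `k` bonds. -/
def bdiag (U : Ed d → ℝ≥0∞) (w : ℕ → Ed d → ℝ≥0∞) : ℕ → ℕ → Ed d → ℝ≥0∞
  | 0 => fun _ _ => 0
  | k + 1 => fun r => ustar U (dline w (bdiag U w k) r)

theorem measurable_lconv {f g : Ed d → ℝ≥0∞} (hf : Measurable f) (hg : Measurable g) :
    Measurable (lconv f g) := by
  unfold lconv
  exact Measurable.lintegral_prod_right' (f := fun p : Ed d × Ed d => f p.2 * g (p.1 - p.2))
    (by fun_prop)

theorem measurable_ustar {f : Ed d → ℝ≥0∞} (hU : Measurable U) (hf : Measurable f) :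
    Measurable (ustar U f) := by
  unfold ustar
  exact Measurable.lintegral_prod_right' (f := fun p : Ed d × Ed d => U (p.2 - p.1) * f p.2)
    (by fun_prop)

theorem measurable_ut (hD : Measurable D) (hE : Measurable E) (hθ : ∀ n, Measurable (θ n)) (n : ℕ) :
    Measurable (ut θ D E n) := (hθ n).mul (measurable_Cn hD hE n)

theorem measurable_hloop {w b : ℕ → Ed d → ℝ≥0∞} (hw : ∀ n, Measurable (w n))
    (hb : ∀ n, Measurable (b n)) (e r : ℕ) : Measurable (hloop w b e r) :=
  (hw e).mul ((hb r).comp measurable_neg)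

theorem measurable_dline {w b : ℕ → Ed d → ℝ≥0∞} (hw : ∀ n, Measurable (w n))
    (hb : ∀ n, Measurable (b n)) (r : ℕ) : Measurable (dline w b r) := by
  have h1 := measurable_hloop hw hb
  have h2 := fun a e r => measurable_lconv (hw a) (h1 e r)
  refine (hw r).add (Finset.measurable_sum _ fun l _ => (h1 _ _).add
    (Finset.measurable_sum _ fun a _ => h2 _ _ _))

theorem measurable_bdiag (hU : Measurable U) {w : ℕ → Ed d → ℝ≥0∞} (hw : ∀ n, Measurable (w n)) :
    ∀ k r, Measurable (bdiag U w k r)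
  | 0, _ => measurable_const
  | k + 1, r => measurable_ustar hU (measurable_dline hw (measurable_bdiag hU hw k) r)

theorem lintegral_mul_ustar {f g : Ed d → ℝ≥0∞} (hU : Measurable U) (hf : Measurable f)
    (hg : Measurable g) (ζ : Ed d) :
    ∫⁻ y, g y * ustar U f (ζ - y) = ustar U (lconv g f) ζ := by
  unfold ustar lconv
  calc ∫⁻ y, g y * ∫⁻ v, U (v - (ζ - y)) * f v
      = ∫⁻ y, g y * ∫⁻ v, U (v - ζ) * f (v - y) := by
        refine lintegral_congr fun y => ?_
        rw [← lintegral_sub_right_eq_self _ y]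
        congr 1
        refine lintegral_congr fun v => ?_
        congr 2; abel
    _ = ∫⁻ y, ∫⁻ v, g y * (U (v - ζ) * f (v - y)) := by
        refine lintegral_congr fun y => ?_
        rw [lintegral_const_mul]
        fun_prop
    _ = ∫⁻ v, ∫⁻ y, g y * (U (v - ζ) * f (v - y)) := by
        refine lintegral_lintegral_swap (Measurable.aemeasurable ?_)
        simp only [Function.uncurry_def]
        fun_prop
    _ = _ := by
        refine lintegral_congr fun v => ?_
        rw [← lintegral_const_mul _ (by fun_prop)]
        refine lintegral_congr fun y => ?_
        ring

theorem ustar_add {f g : Ed d → ℝ≥0∞} (hU : Measurable U) (hf : Measurable f) (ζ : Ed d) :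
    ustar U (fun v => f v + g v) ζ = ustar U f ζ + ustar U g ζ := by
  unfold ustar
  rw [← lintegral_add_left (by fun_prop)]
  simp only [mul_add]

theorem ustar_sum {ι : Type*} (s : Finset ι) {f : ι → Ed d → ℝ≥0∞} (hU : Measurable U)
    (hf : ∀ i, Measurable (f i)) (ζ : Ed d) :
    ustar U (fun v => ∑ i ∈ s, f i v) ζ = ∑ i ∈ s, ustar U (f i) ζ := by
  unfold ustar
  simp only [mul_sum]
  exact lintegral_finsetSum _ fun i _ => by have := hf i; fun_prop

/-- Integration over a weighted line together with its endpoint. -/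
theorem marg_line (hD : Measurable D) (hE : Measurable E) (hθ : ∀ n, Measurable (θ n)) {p t : ℕ}
    (h : p < t) {f : (ℕ → Ed d) → ℝ≥0∞} (hf : Measurable f) {S : Set ℕ} (hfS : DependsOn f S)
    (hS : ∀ i ∈ S, i ∉ Ioo p t) (y : ℕ → Ed d) :
    marg (Ioc p t) (fun y => f y * (θ (t - p) (y t - y p) * Wline D E p t y)) y =
      ∫⁻ v, f (Function.update y t (v + y p)) * ut θ D E (t - p) v := by
  simp only [← mul_assoc]
  have hm : Measurable fun y : ℕ → Ed d => f y * θ (t - p) (y t - y p) := by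
    have := hθ (t - p); fun_prop
  rw [marg_Ioc_Wline hD hE h hm (S := S ∪ {t, p}) ?_ ?_ y]
  · rw [← lintegral_add_right_eq_self _ (y p)]
    refine lintegral_congr fun v => ?_
    simp [h.ne, ut, mul_assoc]
  · intro x y hxy
    simp only
    rw [hfS fun i hi => hxy i (Or.inl hi), hxy t (by simp), hxy p (by simp)]
  · rintro i (hi | hi)
    · exact hS i hi
    · rcases hi with rfl | rfl <;> simp

/-- The integrand of a lace diagram attached to `s` and starting at `p`. -/
def dint (D E U : Ed d → ℝ≥0∞) (θ : ℕ → Ed d → ℝ≥0∞) (s p m : ℕ) (y : ℕ → Ed d) : ℝ≥0∞ :=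
  (∑ t ∈ Ioc p m, pw U y s t * Kp (pw E y) p t * jhat (pw E y) (pw U y) p t m) *
    (Phi D p m y * θ (m - p) (y m - y p))

theorem measurable_jhat (hE : Measurable E) (hU : Measurable U) (q p m : ℕ) :
    Measurable fun y : ℕ → Ed d => jhat (pw E y) (pw U y) q p m :=
  (measurable_jfun (measurable_pw hE) (measurable_pw hU) _ _ _ _).add
    (measurable_jfun (measurable_pw hE) (measurable_pw hU) _ _ _ _)

theorem measurable_dint (hD : Measurable D) (hE : Measurable E) (hU : Measurable U)
    (hθ : ∀ n, Measurable (θ n)) (s p m : ℕ) : Measurable (dint D E U θ s p m) := by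
  refine Measurable.mul (Finset.measurable_sum _ fun t _ => ?_) ((measurable_Phi hD p m).mul ?_)
  · exact ((measurable_pw hU s t).mul (measurable_Kp (measurable_pw hE) p t)).mul
      (measurable_jhat hE hU p t m)
  · have := hθ (m - p); fun_prop

theorem dint_le (heu : ∀ x, E x + U x = 1)
    (hsub : ∀ m l x y, 0 < m → 0 < l → θ (m + l) (x + y) ≤ θ m x * θ l y)
    {s p m : ℕ} (hpm : p < m) (y : ℕ → Ed d) :
    dint D E U θ s p m y ≤ pw U y s m * (θ (m - p) (y m - y p) * Wline D E p m y) +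
      ∑ t ∈ Ioo p m, (pw U y s t * (θ (t - p) (y t - y p) * Wline D E p t y) * dint D E U θ p t m y +
        ∑ s' ∈ Ioo p t, pw U y s t * (θ (s' - p) (y s' - y p) * Wline D E p s' y) *
          (θ (t - s') (y t - y s') * Wline D E s' t y) * dint D E U θ s' t m y) := by
  have h1 : Ioc p m = insert m (Ioo p m) := by ext; simp; omega
  have hsub' : ∀ {a b c : ℕ}, a < b → b < c →
      θ (c - a) (y c - y a) ≤ θ (b - a) (y b - y a) * θ (c - b) (y c - y b) := by
    intro a b c hab hbc
    have := hsub (b - a) (c - b) (y b - y a) (y c - y b) (by omega) (by omega)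
    rwa [show b - a + (c - b) = c - a by omega,
      show y b - y a + (y c - y b) = y c - y a by abel] at this
  have hE' := pw_add heu y
  rw [dint, sum_mul, h1, sum_insert (by simp), jhat_self]
  refine add_le_add (le_of_eq ?_) (sum_le_sum fun t ht => ?_)
  · rw [Wline]; ring
  simp at ht
  have h2 : Ico p t = insert p (Ioo p t) := by ext; simp; omega
  calc _ ≤ pw U y s t * Kp (pw E y) p t * (∑ s' ∈ Ico p t, ∑ t' ∈ Ioc t m,
          pw U y s' t' * Kp (pw E y) t t' * jhat (pw E y) (pw U y) t t' m) *
          (Phi D p t y * Phi D t m y * (θ (t - p) (y t - y p) * θ (m - t) (y m - y t))) := by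
        rw [Phi_mul ht.1.le ht.2.le]
        gcongr
        · exact jhat_le hE' ht.2
        · exact hsub' ht.1 ht.2
    _ = ∑ s' ∈ Ico p t, pw U y s t * (θ (t - p) (y t - y p) * Wline D E p t y) *
          dint D E U θ s' t m y := by
        rw [mul_sum, sum_mul]
        refine sum_congr rfl fun s' _ => ?_
        rw [dint, Wline]
        ring
    _ ≤ _ := by
        rw [h2, sum_insert (by simp)]
        refine add_le_add le_rfl (sum_le_sum fun s' hs' => ?_)
        simp at hs'
        calc _ ≤ pw U y s t * ((θ (s' - p) (y s' - y p) * θ (t - s') (y t - y s')) *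
              (Wline D E p s' y * Wline D E s' t y)) * dint D E U θ s' t m y := by
              have h3 := hsub' hs'.1 hs'.2
              have h4 := Wline_le_mul (D := D) heu hs'.1.le hs'.2.le y
              gcongr
          _ = _ := by ring

theorem dependsOn_pw (s t : ℕ) : DependsOn (fun y : ℕ → Ed d => pw U y s t) {s, t} := by
  intro x y h
  simp only [pw]
  rw [h s (by simp), h t (by simp)]

/-- Lace diagrams dominate the integrated lace interactions. -/
theorem marg_dint_le (hD : Measurable D) (hE : Measurable E) (hU : Measurable U)
    (hθ : ∀ n, Measurable (θ n)) (heu : ∀ x, E x + U x = 1)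
    (hsub : ∀ m l x y, 0 < m → 0 < l → θ (m + l) (x + y) ≤ θ m x * θ l y)
    (k : ℕ) : ∀ {s p m : ℕ}, s < p → p < m → m < p + k → ∀ y : ℕ → Ed d,
    marg (Ioc p m) (dint D E U θ s p m) y ≤ bdiag U (ut θ D E) k (m - p) (y s - y p) := by
  induction k with
  | zero => intro s p m _ _ h; omega
  | succ k ih =>
    intro s p m hsp hpm hmk y
    have hw := measurable_ut hD hE hθ
    have hb := measurable_bdiag hU hw k
    have hl := measurable_hloop hw hb
    set w := ut θ D E
    set b := bdiag U w k
    have hWl : ∀ p t : ℕ, Measurable fun y : ℕ → Ed d =>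
        θ (t - p) (y t - y p) * Wline D E p t y := fun p t => by
      have h1 := hθ (t - p)
      have h2 := measurable_Wline hD hE p t
      fun_prop
    have hpw := fun s t => measurable_pw (V := Ed d) hU s t
    have hdi := measurable_dint hD hE hU hθ
    -- the last line
    have hlast : marg (Ioc p m) (fun y => pw U y s m *
        (θ (m - p) (y m - y p) * Wline D E p m y)) y = ustar U (w (m - p)) (y s - y p) := by
      rw [marg_line hD hE hθ hpm (hpw s m) (dependsOn_pw s m) (by simp; omega)]
      refine lintegral_congr fun v => ?_
      have : s ≠ m := by omega
      simp only [pw, Function.update_self, Function.update_of_ne this]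
      congr 2; abel
    -- integration over a first line, with a general factor depending on its two endpoints
    have hone : ∀ (g : Ed d → Ed d → ℝ≥0∞), Measurable (Function.uncurry g) → ∀ (p t : ℕ), p < t →
        ∀ y : ℕ → Ed d, s < p → marg (Ioc p t) (fun y => g (y t - y p) (y t - y s) *
        (θ (t - p) (y t - y p) * Wline D E p t y)) y =
          ∫⁻ v, g v (v - (y s - y p)) * w (t - p) v := by
      intro g hg p t hpt y hsp
      rw [marg_line hD hE hθ hpt (S := {s, p, t}) (by fun_prop) ?_ (by simp; omega)]
      · refine lintegral_congr fun v => ?_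
        have h1 : s ≠ t := by omega
        simp only [Function.update_self, Function.update_of_ne h1, Function.update_of_ne hpt.ne]
        congr 2 <;> abel
      · intro x y h
        simp only
        rw [h s (by simp), h t (by simp), h p (by simp)]
    have hsplit : ∀ t, p < t → t < m → ∀ {f g : (ℕ → Ed d) → ℝ≥0∞} {S : Set ℕ}, DependsOn f S →
        (∀ i ∈ S, i ∉ Ioc t m) → Measurable f → Measurable g → ∀ B : (ℕ → Ed d) → ℝ≥0∞,
        (∀ y, marg (Ioc t m) g y ≤ B y) →
        marg (Ioc p m) (fun y => f y * g y) y ≤ marg (Ioc p t) (fun y => f y * B y) y := by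
      intro t hpt htm f g S hfS hS hf hg B hB
      have hu : Ioc p m = Ioc p t ∪ Ioc t m := by ext; simp; omega
      have hd : Disjoint (Ioc p t) (Ioc t m) := by
        rw [Finset.disjoint_left]; intro x; simp; omega
      have hfg : Measurable fun y => f y * g y := hf.mul hg
      rw [hu, marg_union hfg hd]
      refine marg_mono (fun y => ?_) y
      rw [marg_mul_left hfS hS hg]
      gcongr
      exact hB y
    -- a loop at the beginning
    have hzero : ∀ t ∈ Ioo p m, marg (Ioc p m) (fun y => pw U y s t * (θ (t - p) (y t - y p) *
        Wline D E p t y) * dint D E U θ p t m y) y ≤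
        ustar U (hloop w b (t - p) (m - t)) (y s - y p) := by
      intro t ht
      simp at ht
      refine (hsplit t ht.1 ht.2 (f := fun y => pw U y s t * (θ (t - p) (y t - y p) *
        Wline D E p t y)) (S := Set.Iic t) ?_ (by simp; omega) ((hpw s t).mul (hWl p t))
        (hdi p t m) (fun y => b (m - t) (y p - y t)) (ih ht.1 ht.2 (by omega))).trans (le_of_eq ?_)
      · intro x y h
        simp only [pw]
        rw [h s (by simp; omega), h t (by simp), h p (by simp; omega),
          dependsOn_Wline p t fun i hi => h i hi.2]
      have hb' := hb (m - t)
      have := hone (fun v v' => U v' * b (m - t) (-v)) (by fun_prop) p t ht.1 y hsp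
      simp only [neg_sub] at this
      rw [show (fun y : ℕ → Ed d => pw U y s t * (θ (t - p) (y t - y p) * Wline D E p t y) *
          b (m - t) (y p - y t)) = fun y => U (y t - y s) * b (m - t) (y p - y t) *
          (θ (t - p) (y t - y p) * Wline D E p t y) from funext fun y => by rw [pw]; ring, this]
      refine lintegral_congr fun v => ?_
      rw [hloop]
      ring
    have hpos : ∀ t ∈ Ioo p m, ∀ s' ∈ Ioo p t, marg (Ioc p m) (fun y => pw U y s t *
        (θ (s' - p) (y s' - y p) * Wline D E p s' y) *
          (θ (t - s') (y t - y s') * Wline D E s' t y) * dint D E U θ s' t m y) y ≤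
        ustar U (lconv (w (s' - p)) (hloop w b (t - s') (m - t))) (y s - y p) := by
      intro t ht s' hs'
      simp at ht hs'
      refine (hsplit t ht.1 ht.2 (f := fun y => pw U y s t *
        (θ (s' - p) (y s' - y p) * Wline D E p s' y) *
          (θ (t - s') (y t - y s') * Wline D E s' t y)) (S := Set.Iic t) ?_ (by simp; omega)
        (((hpw s t).mul (hWl p s')).mul (hWl s' t))
        (hdi s' t m) (fun y => b (m - t) (y s' - y t)) (ih hs'.2 ht.2 (by omega))).trans
        (le_of_eq ?_)
      · intro x y h
        simp only [pw]
        rw [h s (by simp; omega), h t (by simp), h p (by simp; omega), h s' (by simp; omega),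
          dependsOn_Wline s' t fun i hi => h i hi.2,
          dependsOn_Wline p s' fun i hi => h i (hi.2.trans (Set.mem_Iic.2 hs'.2.le))]
      have hb' := hb (m - t)
      have hu : Ioc p t = Ioc p s' ∪ Ioc s' t := by ext; simp; omega
      have hd : Disjoint (Ioc p s') (Ioc s' t) := by
        rw [Finset.disjoint_left]; intro x; simp; omega
      have hW1 := hWl p s'
      have hW2 := hWl s' t
      have hp1 := hpw s t
      rw [hu, marg_union (by fun_prop) hd]
      have h2 : marg (Ioc s' t) (fun y => pw U y s t * (θ (s' - p) (y s' - y p) * Wline D E p s' y) *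
          (θ (t - s') (y t - y s') * Wline D E s' t y) * b (m - t) (y s' - y t)) =
          fun y => ustar U (hloop w b (t - s') (m - t)) (y s - y s') *
            (θ (s' - p) (y s' - y p) * Wline D E p s' y) := by
        funext y
        have h3 := hone (fun v v' => U v' * b (m - t) (-v)) (by fun_prop) s' t hs'.2 y (by omega)
        simp only [neg_sub] at h3
        rw [show (fun y : ℕ → Ed d => pw U y s t * (θ (s' - p) (y s' - y p) * Wline D E p s' y) *
          (θ (t - s') (y t - y s') * Wline D E s' t y) * b (m - t) (y s' - y t)) = fun y =>
          (θ (s' - p) (y s' - y p) * Wline D E p s' y) * (U (y t - y s) * b (m - t) (y s' - y t) *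
          (θ (t - s') (y t - y s') * Wline D E s' t y)) from funext fun y => by rw [pw]; ring,
          marg_mul_left (S := Set.Iic s') ?_ (by simp; omega) (by fun_prop), h3, mul_comm]
        · congr 1
          refine lintegral_congr fun v => ?_
          rw [hloop]
          ring
        · intro x y h
          simp only
          rw [h s' (by simp), h p (by simp; omega), dependsOn_Wline p s' fun i hi => h i hi.2]
      have hus := measurable_ustar hU (hl (t - s') (m - t))
      rw [h2, ← lintegral_mul_ustar hU (hl _ _) (hw _)]
      have h4 := hone (fun v v' => ustar U (hloop w b (t - s') (m - t)) (-v')) (by fun_prop)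
        p s' hs'.1 y hsp
      simp only [neg_sub] at h4
      rw [h4]
      exact lintegral_congr fun v => mul_comm _ _
    refine (marg_mono (dint_le heu hsub hpm) y).trans ?_
    have hm1 : ∀ t, Measurable fun y : ℕ → Ed d => pw U y s t * (θ (t - p) (y t - y p) *
        Wline D E p t y) * dint D E U θ p t m y := fun t =>
      ((hpw s t).mul (hWl p t)).mul (hdi p t m)
    have hm2 : ∀ t s', Measurable fun y : ℕ → Ed d => pw U y s t *
        (θ (s' - p) (y s' - y p) * Wline D E p s' y) *
          (θ (t - s') (y t - y s') * Wline D E s' t y) * dint D E U θ s' t m y := fun t s' =>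
      (((hpw s t).mul (hWl p s')).mul (hWl s' t)).mul (hdi s' t m)
    rw [← marg_add (f := fun y => pw U y s m * _) ((hpw s m).mul (hWl p m)), hlast, marg_sum]
    swap
    · exact fun t => (hm1 t).add (Finset.measurable_sum _ fun s' _ => hm2 t s')
    simp only [bdiag]
    unfold dline
    have hlc := fun a e r => measurable_lconv (hw a) (hl e r)
    have hsumm : ∀ l, Measurable fun v => ∑ a ∈ Ioo 0 l, lconv (w a) (hloop w b (l - a) (m - p - l)) v :=
      fun l => Finset.measurable_sum _ fun a _ => hlc _ _ _
    rw [ustar_add hU (hw _), ustar_sum _ (f := fun l v => hloop w b l (m - p - l) v +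
      ∑ a ∈ Ioo 0 l, lconv (w a) (hloop w b (l - a) (m - p - l)) v) hU
      fun l => (hl _ _).add (hsumm l)]
    gcongr
    have him : Ioo p m = (Ioo 0 (m - p)).image (· + p) := by
      ext x; simp only [mem_Ioo, mem_image]
      exact ⟨fun h => ⟨x - p, by omega, by omega⟩, fun ⟨z, h, h'⟩ => by omega⟩
    have hinj : ∀ s : Set ℕ, Set.InjOn (· + p) s := fun s => (add_left_injective p).injOn
    rw [him, sum_image (hinj _)]
    refine sum_le_sum fun l hlm => ?_
    simp at hlm
    have him' : Ioo p (l + p) = (Ioo 0 l).image (· + p) := by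
      ext x; simp only [mem_Ioo, mem_image]
      exact ⟨fun h => ⟨x - p, by omega, by omega⟩, fun ⟨z, h, h'⟩ => by omega⟩
    rw [← marg_add (hm1 _), marg_sum _ (hm2 _), ustar_add hU (hl _ _), ustar_sum _ hU fun a => hlc _ _ _]
    have hlm' : l + p ∈ Ioo p m := by simp; omega
    refine add_le_add ?_ ?_
    · have := hzero (l + p) hlm'
      refine this.trans (le_of_eq ?_)
      rw [show l + p - p = l by omega, show m - (l + p) = m - p - l by omega]
    · rw [him', sum_image (hinj _)]
      refine sum_le_sum fun a ha => ?_
      simp at ha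
      have := hpos (l + p) hlm' (a + p) (by simp; omega)
      refine this.trans (le_of_eq ?_)
      rw [show a + p - p = a by omega, show m - (l + p) = m - p - l by omega,
        show l + p - (a + p) = l - a by omega]

end Diagrams

section DiagramBounds

variable {d : ℕ} {D E U : Ed d → ℝ≥0∞} {θ : ℕ → Ed d → ℝ≥0∞}

/-- The weighted mass of the lace functions is dominated by diagrams. -/
theorem lintegral_Pn_le (hD : Measurable D) (hE : Measurable E) (hU : Measurable U)
    (hθ : ∀ n, Measurable (θ n)) (heu : ∀ x, E x + U x = 1)
    (hsub : ∀ m l x y, 0 < m → 0 < l → θ (m + l) (x + y) ≤ θ m x * θ l y)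
    {m : ℕ} (hm : 2 ≤ m) :
    ∫⁻ x, θ m x * (Pn D E U true m x + Pn D E U false m x) ≤
      ∫⁻ v, ut θ D E 1 v * bdiag U (ut θ D E) m (m - 1) (-v) := by
  have hP := measurable_Pn_integrand hD hE hU
  have hθm : Measurable fun y : ℕ → Ed d => θ m (y m - y 0) := by have := hθ m; fun_prop
  set F : (ℕ → Ed d) → ℝ≥0∞ := fun y => θ m (y m - y 0) *
    (Kp (pw E y) 0 1 * jfun (pw E y) (pw U y) true 0 1 m * Phi D 0 m y +
      Kp (pw E y) 0 1 * jfun (pw E y) (pw U y) false 0 1 m * Phi D 0 m y) with hF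
  have hFm : Measurable F := hθm.mul ((hP true m).add (hP false m))
  have hFd : DependsOn F (Set.Iic m) := by
    intro x y h
    have h1 := dependsOn_Pn_integrand (D := D) (E := E) (U := U) true (m := m) (by omega) h
    have h2 := dependsOn_Pn_integrand (D := D) (E := E) (U := U) false (m := m) (by omega) h
    simp only at h1 h2
    simp only [hF]
    rw [h1, h2, h m (by simp), h 0 (by simp)]
  have h1 : ∀ x, θ m x * (Pn D E U true m x + Pn D E U false m x) = marg (Ioo 0 m) F (pt x) := by
    intro x
    have hg : DependsOn (fun y : ℕ → Ed d => θ m (y m - y 0)) {0, m} := by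
      intro x y h
      simp only
      rw [h 0 (by simp), h m (by simp)]
    have hPP : Measurable fun y : ℕ → Ed d =>
        Kp (pw E y) 0 1 * jfun (pw E y) (pw U y) true 0 1 m * Phi D 0 m y +
        Kp (pw E y) 0 1 * jfun (pw E y) (pw U y) false 0 1 m * Phi D 0 m y :=
      (hP true m).add (hP false m)
    rw [hF, marg_mul_left (s := Ioo 0 m) hg (by simp) hPP, pt_zero, pt_pos _ (by omega),
      sub_zero]
    congr 1
    exact (lintegral_add_left ((hP true m).comp measurable_updateFinset) _).symm
  have h2 : ∫⁻ x, marg (Ioo 0 m) F (pt x) = marg (Ioc 0 m) F 0 := by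
    have : Ioc 0 m = insert m (Ioo 0 m) := by ext; simp; omega
    rw [this, marg_insert hFm (by simp)]
    refine lintegral_congr fun z => marg_congr hFd fun i hi hi' => ?_
    simp at hi hi'
    rcases Nat.eq_zero_or_pos i with rfl | hi0
    · rw [pt_zero, Function.update_of_ne (by omega)]; rfl
    · obtain rfl : i = m := by have := hi' hi0; omega
      rw [pt_pos _ hi0, Function.update_self]
  have hWl : Measurable fun y : ℕ → Ed d => θ (1 - 0) (y 1 - y 0) * Wline D E 0 1 y := by
    have h1 := hθ (1 - 0)
    have h2 := measurable_Wline hD hE 0 1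
    fun_prop
  have hdi := measurable_dint hD hE hU hθ 0 1 m
  have h3 : ∀ y, F y ≤ (θ (1 - 0) (y 1 - y 0) * Wline D E 0 1 y) * dint D E U θ 0 1 m y := by
    intro y
    have hj := jhat_le (pw_add heu y) (q := 0) (p := 1) (m := m) (by omega)
    have hs := hsub 1 (m - 1) (y 1 - y 0) (y m - y 1) (by omega) (by omega)
    rw [show 1 + (m - 1) = m by omega, show y 1 - y 0 + (y m - y 1) = y m - y 0 by abel] at hs
    have h01 : Ico 0 1 = ({0} : Finset ℕ) := by decide
    rw [h01, sum_singleton] at hj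
    calc F y = θ m (y m - y 0) * (Kp (pw E y) 0 1 * jhat (pw E y) (pw U y) 0 1 m *
          (Phi D 0 1 y * Phi D 1 m y)) := by
          rw [hF, ← Phi_mul (by omega) (by omega), jhat]; ring
      _ ≤ _ := mul_le_mul' hs (mul_le_mul' (mul_le_mul' le_rfl hj) le_rfl)
      _ = _ := by rw [dint, Wline]; ring
  calc _ = marg (Ioc 0 m) F 0 := by rw [← h2]; exact lintegral_congr h1
    _ ≤ marg (Ioc 0 m) (fun y => (θ (1 - 0) (y 1 - y 0) * Wline D E 0 1 y) *
          dint D E U θ 0 1 m y) 0 := marg_mono h3 0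
    _ = marg (Ioc 0 1) (marg (Ioc 1 m) (fun y => (θ (1 - 0) (y 1 - y 0) * Wline D E 0 1 y) *
          dint D E U θ 0 1 m y)) 0 := by
        have hu : Ioc 0 m = Ioc 0 1 ∪ Ioc 1 m := by ext; simp; omega
        have hd : Disjoint (Ioc 0 1) (Ioc 1 m) := by
          rw [Finset.disjoint_left]; intro x; simp; omega
        have hm' : Measurable fun y : ℕ → Ed d => θ (1 - 0) (y 1 - y 0) * Wline D E 0 1 y *
          dint D E U θ 0 1 m y := hWl.mul hdi
        rw [hu, marg_union hm' hd]
    _ ≤ marg (Ioc 0 1) (fun y => bdiag U (ut θ D E) m (m - 1) (y 0 - y 1) *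
          (θ (1 - 0) (y 1 - y 0) * Wline D E 0 1 y)) 0 := by
        refine marg_mono (fun y => ?_) 0
        rw [marg_mul_left (S := Set.Iic 1) ?_ (by simp; omega) hdi, mul_comm]
        · exact mul_le_mul' (marg_dint_le hD hE hU hθ heu hsub m (by omega) (by omega)
            (by omega) y) le_rfl
        · intro x y h
          simp only
          rw [h 1 (by simp), h 0 (by simp), dependsOn_Wline 0 1 fun i hi => h i hi.2]
    _ = _ := by
        have hb := measurable_bdiag hU (measurable_ut hD hE hθ) m (m - 1)
        rw [marg_line hD hE hθ one_pos (f := fun y => bdiag U (ut θ D E) m (m - 1) (y 0 - y 1))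
          (S := {0, 1}) (by fun_prop) ?_ (by simp)]
        · refine lintegral_congr fun v => ?_
          rw [mul_comm]
          simp
        · intro x y h
          simp only
          rw [h 1 (by simp), h 0 (by simp)]

theorem lintegral_lconv {f g : Ed d → ℝ≥0∞} (hf : Measurable f) (hg : Measurable g) :
    ∫⁻ x, lconv f g x = (∫⁻ x, f x) * ∫⁻ x, g x := by
  unfold lconv
  rw [lintegral_lintegral_swap (by
    refine Measurable.aemeasurable ?_
    simp only [Function.uncurry_def]; fun_prop)]
  rw [← lintegral_mul_const _ hf]
  refine lintegral_congr fun z => ?_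
  rw [lintegral_const_mul _ (by fun_prop), lintegral_sub_right_eq_self]

theorem lconv_le_of_left {f g : Ed d → ℝ≥0∞} (hg : Measurable g) {c : ℝ≥0∞}
    (h : ∀ x, f x ≤ c) (x : Ed d) : lconv f g x ≤ c * ∫⁻ x, g x := by
  unfold lconv
  calc _ ≤ ∫⁻ z, c * g (x - z) := lintegral_mono fun z => mul_le_mul' (h z) le_rfl
    _ = _ := by
      rw [lintegral_const_mul _ (by fun_prop), lintegral_sub_left_eq_self]

theorem lconv_le_of_right {f g : Ed d → ℝ≥0∞} (hf : Measurable f) {c : ℝ≥0∞}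
    (h : ∀ x, g x ≤ c) (x : Ed d) : lconv f g x ≤ (∫⁻ x, f x) * c := by
  unfold lconv
  calc _ ≤ ∫⁻ z, f z * c := lintegral_mono fun z => mul_le_mul' le_rfl (h _)
    _ = _ := lintegral_mul_const _ hf

theorem lintegral_ustar {f : Ed d → ℝ≥0∞} (hU : Measurable U) (hf : Measurable f) :
    ∫⁻ x, ustar U f x = (∫⁻ x, U x) * ∫⁻ x, f x := by
  unfold ustar
  rw [lintegral_lintegral_swap (by
    refine Measurable.aemeasurable ?_
    simp only [Function.uncurry_def]; fun_prop)]
  rw [← lintegral_const_mul _ hf]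
  refine lintegral_congr fun z => ?_
  rw [lintegral_mul_const _ (by fun_prop), lintegral_sub_left_eq_self]

theorem ustar_le {f : Ed d → ℝ≥0∞} (hU : Measurable U) {c : ℝ≥0∞}
    (h : ∀ x, f x ≤ c) (x : Ed d) : ustar U f x ≤ (∫⁻ x, U x) * c := by
  unfold ustar
  calc _ ≤ ∫⁻ z, U (z - x) * c := lintegral_mono fun z => mul_le_mul' le_rfl (h _)
    _ = _ := by rw [lintegral_mul_const _ (by fun_prop), lintegral_sub_right_eq_self]

theorem sum_comp_le_tsum {ι : Type*} (s : Finset ι) (f : ι → ℕ) (hf : Set.InjOn f s)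
    (g : ℕ → ℝ≥0∞) : ∑ i ∈ s, g (f i) ≤ ∑' n, g n := by
  rw [← sum_image (f := g) hf]
  exact ENNReal.sum_le_tsum _

section Norms

variable {w b : ℕ → Ed d → ℝ≥0∞} {q g : ℕ → ℝ≥0∞} {Q A β : ℝ≥0∞} {R : ℕ}

theorem lintegral_hloop_le (hw : ∀ n, Measurable (w n)) (hb : ∀ n, Measurable (b n))
    (hqg : ∀ a c, 0 < a → a ≤ c → q c ≤ g a * g c)
    {e r : ℕ} (he : 0 < e) (hr : 0 < r) (hwe : ∫⁻ x, w e x ≤ A) (hwe' : ∀ x, w e x ≤ A * q e)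
    (hbr : ∫⁻ x, b r x ≤ β) (hbr' : ∀ x, b r x ≤ β * q r) :
    ∫⁻ x, hloop w b e r x ≤ A * β * (g e * g r) := by
  unfold hloop
  rcases le_total e r with h | h
  · calc _ ≤ ∫⁻ x, w e x * (β * q r) := lintegral_mono fun z => mul_le_mul' le_rfl (hbr' _)
      _ = (∫⁻ x, w e x) * (β * q r) := lintegral_mul_const _ (hw e)
      _ ≤ A * (β * (g e * g r)) :=
        mul_le_mul' hwe (mul_le_mul' le_rfl (hqg e r he h))
      _ = _ := by ring
  · calc _ ≤ ∫⁻ x, (A * q e) * b r (-x) := lintegral_mono fun z => mul_le_mul' (hwe' _) le_rfl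
      _ = (A * q e) * ∫⁻ x, b r x := by
        have := hb r
        rw [lintegral_const_mul _ (by fun_prop), lintegral_neg_eq_self]
      _ ≤ (A * (g r * g e)) * β :=
        mul_le_mul' (mul_le_mul' le_rfl (hqg r e hr h)) hbr
      _ = _ := by ring

theorem lconv_le_pair {f f' : Ed d → ℝ≥0∞} (hf : Measurable f) (hf' : Measurable f')
    (hqg : ∀ a c, 0 < a → a ≤ c → q c ≤ g a * g c)
    {e r : ℕ} (he : 0 < e) (hr : 0 < r) (hwe : ∫⁻ x, f x ≤ A) (hwe' : ∀ x, f x ≤ A * q e)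
    (hbr : ∫⁻ x, f' x ≤ β) (hbr' : ∀ x, f' x ≤ β * q r) (x : Ed d) :
    lconv f f' x ≤ A * β * (g e * g r) := by
  rcases le_total e r with h | h
  · calc _ ≤ (∫⁻ x, f x) * (β * q r) := lconv_le_of_right hf hbr' x
      _ ≤ A * (β * (g e * g r)) :=
        mul_le_mul' hwe (mul_le_mul' le_rfl (hqg e r he h))
      _ = _ := by ring
  · calc _ ≤ (A * q e) * ∫⁻ x, f' x := lconv_le_of_left hf' hwe' x
      _ ≤ (A * (g r * g e)) * β :=
        mul_le_mul' (mul_le_mul' le_rfl (hqg r e hr h)) hbr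
      _ = _ := by ring

/-- The sup bound for a line followed by a loop. -/
theorem lconv_hloop_le (hw : ∀ n, Measurable (w n)) (hb : ∀ n, Measurable (b n))
    (hqg : ∀ a c, 0 < a → a ≤ c → q c ≤ g a * g c)
    (hq3 : ∀ a r, 0 < a → r ≤ 3 * a → q a ≤ Q * q r)
    {a e r n : ℕ} (ha : 0 < a) (he : 0 < e) (hr : 0 < r) (hn : a + e + r = n)
    (hwa : ∫⁻ x, w a x ≤ A) (hwa' : ∀ x, w a x ≤ A * q a)
    (hwe : ∫⁻ x, w e x ≤ A) (hwe' : ∀ x, w e x ≤ A * q e)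
    (hbr : ∫⁻ x, b r x ≤ β) (hbr' : ∀ x, b r x ≤ β * q r) (x : Ed d) :
    lconv (w a) (hloop w b e r) x ≤
      A * A * β * (Q * q n) * (g e * g r + g a * g e + g a * g r) := by
  have hor : n ≤ 3 * a ∨ n ≤ 3 * r ∨ n ≤ 3 * e := by omega
  rcases hor with h | h | h
  · calc _ ≤ A * q a * ∫⁻ x, hloop w b e r x :=
          lconv_le_of_left (measurable_hloop hw hb e r) hwa' x
      _ ≤ A * (Q * q n) * (A * β * (g e * g r)) := mul_le_mul'
          (mul_le_mul' le_rfl (hq3 a n ha h))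
          (lintegral_hloop_le hw hb hqg he hr hwe hwe' hbr hbr')
      _ = A * A * β * (Q * q n) * (g e * g r) := by ring
      _ ≤ _ := mul_le_mul' le_rfl (by rw [add_assoc]; exact le_self_add)
  · calc _ ≤ lconv (w a) (fun v => w e v * (β * (Q * q n))) x := by
          refine lintegral_mono fun z => mul_le_mul' le_rfl (mul_le_mul' le_rfl ?_)
          exact (hbr' _).trans (mul_le_mul' le_rfl (hq3 r n hr h))
      _ = lconv (w a) (w e) x * (β * (Q * q n)) := by
          unfold lconv
          have h1 := hw a
          have h2 := hw e
          rw [← lintegral_mul_const _ (by fun_prop)]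
          simp only [mul_assoc]
      _ ≤ A * A * (g a * g e) * (β * (Q * q n)) := mul_le_mul'
          (lconv_le_pair (hw a) (hw e) hqg ha he hwa hwa' hwe hwe' x) le_rfl
      _ = A * A * β * (Q * q n) * (g a * g e) := by ring
      _ ≤ _ := mul_le_mul' le_rfl (le_trans le_add_self le_self_add)
  · have hbn : Measurable fun v => b r (-v) := (hb r).comp measurable_neg
    calc _ ≤ lconv (w a) (fun v => A * (Q * q n) * b r (-v)) x := by
          refine lintegral_mono fun z => mul_le_mul' le_rfl (mul_le_mul' ?_ le_rfl)
          exact (hwe' _).trans (mul_le_mul' le_rfl (hq3 e n he h))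
      _ = A * (Q * q n) * lconv (w a) (fun v => b r (-v)) x := by
          unfold lconv
          have h1 := hw a
          rw [← lintegral_const_mul _ (by fun_prop)]
          refine lintegral_congr fun z => by ring
      _ ≤ A * (Q * q n) * (A * β * (g a * g r)) := by
          refine mul_le_mul' le_rfl
            (lconv_le_pair (hw a) hbn hqg ha hr hwa hwa' ?_ (fun x => hbr' _) x)
          rw [lintegral_neg_eq_self]; exact hbr
      _ = A * A * β * (Q * q n) * (g a * g r) := by ring
      _ ≤ _ := mul_le_mul' le_rfl le_add_self

/-- Uniform bounds on lace diagrams. -/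
theorem bdiag_bounds (hU : Measurable U) (hw : ∀ n, Measurable (w n))
    (hqg : ∀ a c, 0 < a → a ≤ c → q c ≤ g a * g c)
    (hq3 : ∀ a r, 0 < a → r ≤ 3 * a → q a ≤ Q * q r)
    (hg1 : ∀ n, 0 < n → q n ≤ g n) (hQ : 1 ≤ Q)
    {G Λ : ℝ≥0∞} (hG : ∑' n, g n = G) (hΛ : ∫⁻ x, U x ≤ Λ)
    (hβ : Λ * (A + (A + A * A) * β * (Q * (2 * G + 3 * (G * G)))) ≤ β)
    (hw1 : ∀ n, 0 < n → n ≤ R → ∫⁻ x, w n x ≤ A)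
    (hw2 : ∀ n, 0 < n → n ≤ R → ∀ x, w n x ≤ A * q n) (k : ℕ) :
    ∀ r, 0 < r → r ≤ R → ∫⁻ x, bdiag U w k r x ≤ β ∧ ∀ x, bdiag U w k r x ≤ β * q r := by
  have hsum : ∀ {ι : Type} (s : Finset ι) (f : ι → ℕ), Set.InjOn f s → ∑ i ∈ s, g (f i) ≤ G :=
    fun s f hf => hG ▸ sum_comp_le_tsum s f hf g
  have hgG : ∀ n, g n ≤ G := fun n => hG ▸ ENNReal.le_tsum n
  have hsum0 : ∀ r, ∑ l ∈ Ioo 0 r, g l ≤ G := fun r => hsum _ (fun l => l) (Set.injOn_id _)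
  have hsumr : ∀ r, ∑ l ∈ Ioo 0 r, g (r - l) ≤ G := fun r => hsum _ _ fun a ha b hb h => by
    simp at ha hb; omega
  have hsuma : ∀ a r, ∑ l ∈ Ioo a r, g (l - a) ≤ G := fun a r => hsum _ _ fun c hc b hb h => by
    simp at hc hb; omega
  have hs1 : ∀ r, ∑ l ∈ Ioo 0 r, g l * g (r - l) ≤ G * G := fun r => by
    calc _ ≤ ∑ l ∈ Ioo 0 r, G * g (r - l) :=
          sum_le_sum fun l _ => mul_le_mul' (hgG l) le_rfl
      _ = G * ∑ l ∈ Ioo 0 r, g (r - l) := by rw [mul_sum]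
      _ ≤ _ := mul_le_mul' le_rfl (hsumr r)
  have hs2 : ∀ r, ∑ l ∈ Ioo 0 r, ∑ a ∈ Ioo 0 l, g (l - a) * g (r - l) ≤ G * G := fun r => by
    calc _ = ∑ l ∈ Ioo 0 r, (∑ a ∈ Ioo 0 l, g (l - a)) * g (r - l) := by
          simp only [sum_mul]
      _ ≤ ∑ l ∈ Ioo 0 r, G * g (r - l) :=
          sum_le_sum fun l _ => mul_le_mul' (hsumr l) le_rfl
      _ = G * ∑ l ∈ Ioo 0 r, g (r - l) := by rw [mul_sum]
      _ ≤ _ := mul_le_mul' le_rfl (hsumr r)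
  have hs3 : ∀ r, ∑ l ∈ Ioo 0 r, ∑ a ∈ Ioo 0 l, g a * g (r - l) ≤ G * G := fun r => by
    calc _ = ∑ l ∈ Ioo 0 r, (∑ a ∈ Ioo 0 l, g a) * g (r - l) := by
          simp only [sum_mul]
      _ ≤ ∑ l ∈ Ioo 0 r, G * g (r - l) :=
          sum_le_sum fun l _ => mul_le_mul' (hsum0 l) le_rfl
      _ = G * ∑ l ∈ Ioo 0 r, g (r - l) := by rw [mul_sum]
      _ ≤ _ := mul_le_mul' le_rfl (hsumr r)
  have hs4 : ∀ r, ∑ l ∈ Ioo 0 r, ∑ a ∈ Ioo 0 l, g a * g (l - a) ≤ G * G := fun r => by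
    calc _ = ∑ a ∈ Ioo 0 r, ∑ l ∈ Ioo a r, g a * g (l - a) :=
          sum_comm' (by simp; omega)
      _ = ∑ a ∈ Ioo 0 r, g a * ∑ l ∈ Ioo a r, g (l - a) := by simp only [mul_sum]
      _ ≤ ∑ a ∈ Ioo 0 r, g a * G :=
          sum_le_sum fun l _ => mul_le_mul' le_rfl (hsuma l r)
      _ = (∑ a ∈ Ioo 0 r, g a) * G := by rw [sum_mul]
      _ ≤ _ := mul_le_mul' (hsum0 r) le_rfl
  induction k with
  | zero => intro r _ _; simp [bdiag]
  | succ k ih =>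
    intro r hr hrR
    have hb := measurable_bdiag hU hw k
    set b := bdiag U w k
    have hl := measurable_hloop hw hb
    have hlc := fun a e r => measurable_lconv (hw a) (hl e r)
    have hdl := measurable_dline hw hb r
    have hl1 : ∀ e r, 0 < e → e ≤ R → 0 < r → r ≤ R →
        ∫⁻ x, hloop w b e r x ≤ A * β * (g e * g r) := fun e r he he' hr hr' =>
      lintegral_hloop_le hw hb hqg he hr (hw1 e he he') (hw2 e he he') (ih r hr hr').1 (ih r hr hr').2
    constructor
    · have h1 : ∫⁻ x, dline w b r x ≤ A + (A + A * A) * β * (Q * (2 * G + 3 * (G * G))) := by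
        unfold dline
        have hms : ∀ l, Measurable fun x => hloop w b l (r - l) x +
            ∑ a ∈ Ioo 0 l, lconv (w a) (hloop w b (l - a) (r - l)) x := fun l =>
          (hl _ _).add (Finset.measurable_sum _ fun a _ => hlc _ _ _)
        rw [lintegral_add_left (hw r), lintegral_finsetSum _ fun l _ => hms l]
        refine add_le_add (hw1 r hr hrR) ?_
        calc _ ≤ ∑ l ∈ Ioo 0 r, (A * β * (g l * g (r - l)) +
              ∑ a ∈ Ioo 0 l, A * (A * β * (g (l - a) * g (r - l)))) := by
              refine sum_le_sum fun l hlr => ?_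
              simp at hlr
              rw [lintegral_add_left (hl _ _), lintegral_finsetSum _ fun a _ => hlc _ _ _]
              refine add_le_add (hl1 _ _ (by omega) (by omega) (by omega) (by omega))
                (sum_le_sum fun a ha => ?_)
              simp at ha
              rw [lintegral_lconv (hw a) (hl _ _)]
              exact mul_le_mul' (hw1 a (by omega) (by omega))
                (hl1 _ _ (by omega) (by omega) (by omega) (by omega))
          _ = A * β * ∑ l ∈ Ioo 0 r, g l * g (r - l) +
              A * A * β * ∑ l ∈ Ioo 0 r, ∑ a ∈ Ioo 0 l, g (l - a) * g (r - l) := by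
              rw [sum_add_distrib]
              simp only [mul_sum, mul_assoc]
          _ ≤ A * β * (G * G) + A * A * β * (G * G) :=
              add_le_add (mul_le_mul' le_rfl (hs1 r)) (mul_le_mul' le_rfl (hs2 r))
          _ = (A + A * A) * β * (1 * (G * G)) := by ring
          _ ≤ _ := by
              refine mul_le_mul' le_rfl (mul_le_mul' hQ ?_)
              calc G * G ≤ 2 * G + (2 * (G * G) + G * G) := le_trans le_add_self le_add_self
                _ = _ := by ring
      calc _ = (∫⁻ x, U x) * ∫⁻ x, dline w b r x := lintegral_ustar hU hdl
        _ ≤ _ := mul_le_mul' hΛ h1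
        _ ≤ β := hβ
    · have h1 : ∀ x, dline w b r x ≤
          (A + (A + A * A) * β * (Q * (2 * G + 3 * (G * G)))) * q r := by
        intro x
        calc _ ≤ A * q r + ∑ l ∈ Ioo 0 r, (A * β * (Q * q r) * (g l + g (r - l)) +
              ∑ a ∈ Ioo 0 l, A * A * β * (Q * q r) *
                (g (l - a) * g (r - l) + g a * g (l - a) + g a * g (r - l))) := by
              refine add_le_add (hw2 r hr hrR x) (sum_le_sum fun l hlr => ?_)
              simp at hlr
              refine add_le_add ?_ (sum_le_sum fun a ha => ?_)
              · calc hloop w b l (r - l) x ≤ A * q l * (β * q (r - l)) :=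
                      mul_le_mul' (hw2 l (by omega) (by omega) x)
                        ((ih (r - l) (by omega) (by omega)).2 _)
                  _ = A * β * (q l * q (r - l)) := by ring
                  _ ≤ A * β * (Q * q r * (g l + g (r - l))) := by
                      refine mul_le_mul' le_rfl ?_
                      have hor : r ≤ 3 * l ∨ r ≤ 3 * (r - l) := by omega
                      rcases hor with h | h
                      · exact mul_le_mul' (hq3 l r (by omega) h)
                          ((hg1 _ (by omega)).trans le_add_self)
                      · rw [mul_comm (q l)]
                        exact mul_le_mul' (hq3 (r - l) r (by omega) h)
                          ((hg1 _ (by omega)).trans le_self_add)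
                  _ = _ := by ring
              · simp at ha
                exact lconv_hloop_le hw hb hqg hq3 (by omega) (by omega) (by omega) (by omega)
                  (hw1 _ (by omega) (by omega)) (hw2 _ (by omega) (by omega))
                  (hw1 _ (by omega) (by omega)) (hw2 _ (by omega) (by omega))
                  (ih _ (by omega) (by omega)).1 (ih _ (by omega) (by omega)).2 x
          _ = A * q r + (A * β * (Q * q r) * (∑ l ∈ Ioo 0 r, g l + ∑ l ∈ Ioo 0 r, g (r - l)) +
              A * A * β * (Q * q r) * (∑ l ∈ Ioo 0 r, ∑ a ∈ Ioo 0 l, g (l - a) * g (r - l) +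
                ∑ l ∈ Ioo 0 r, ∑ a ∈ Ioo 0 l, g a * g (l - a) +
                ∑ l ∈ Ioo 0 r, ∑ a ∈ Ioo 0 l, g a * g (r - l))) := by
              congr 1
              simp only [sum_add_distrib, ← mul_sum, mul_add]
          _ ≤ A * q r + (A * β * (Q * q r) * (G + G) +
              A * A * β * (Q * q r) * (G * G + G * G + G * G)) :=
              add_le_add le_rfl (add_le_add
                (mul_le_mul' le_rfl (add_le_add (hsum0 r) (hsumr r)))
                (mul_le_mul' le_rfl (add_le_add (add_le_add (hs2 r) (hs4 r)) (hs3 r))))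
          _ ≤ A * q r + (A * β * (Q * q r) * (2 * G + 3 * (G * G)) +
              A * A * β * (Q * q r) * (2 * G + 3 * (G * G))) := by
              refine add_le_add le_rfl (add_le_add
                (mul_le_mul' le_rfl ?_) (mul_le_mul' le_rfl ?_))
              · rw [two_mul]; exact le_self_add
              · rw [show G * G + G * G + G * G = 3 * (G * G) by ring]; exact le_add_self
          _ = _ := by ring
      intro x
      calc _ ≤ (∫⁻ x, U x) * ((A + (A + A * A) * β * (Q * (2 * G + 3 * (G * G)))) * q r) :=
            ustar_le hU h1 x
        _ ≤ Λ * ((A + (A + A * A) * β * (Q * (2 * G + 3 * (G * G)))) * q r) :=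
            mul_le_mul' hΛ le_rfl
        _ = _ * q r := by rw [← mul_assoc]
        _ ≤ β * q r := mul_le_mul' hβ le_rfl

end Norms

/-- Mass bound on the lace functions in terms of bounds on the two-point functions. -/
theorem lintegral_Pn_bound (hD : Measurable D) (hE : Measurable E) (hU : Measurable U)
    (hθ : ∀ n, Measurable (θ n)) (heu : ∀ x, E x + U x = 1)
    (hsub : ∀ m l x y, 0 < m → 0 < l → θ (m + l) (x + y) ≤ θ m x * θ l y)
    {q g : ℕ → ℝ≥0∞} {Q A β : ℝ≥0∞} {R : ℕ}
    (hqg : ∀ a c, 0 < a → a ≤ c → q c ≤ g a * g c)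
    (hq3 : ∀ a r, 0 < a → r ≤ 3 * a → q a ≤ Q * q r)
    (hg1 : ∀ n, 0 < n → q n ≤ g n) (hQ : 1 ≤ Q)
    {G Λ : ℝ≥0∞} (hG : ∑' n, g n = G) (hΛ : ∫⁻ x, U x ≤ Λ)
    (hβ : Λ * (A + (A + A * A) * β * (Q * (2 * G + 3 * (G * G)))) ≤ β)
    (hw1 : ∀ n, 0 < n → n ≤ R → ∫⁻ x, ut θ D E n x ≤ A)
    (hw2 : ∀ n, 0 < n → n ≤ R → ∀ x, ut θ D E n x ≤ A * q n) {m : ℕ} (hm : 2 ≤ m)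
    (hmR : m ≤ R + 1) :
    ∫⁻ x, θ m x * (Pn D E U true m x + Pn D E U false m x) ≤ A * β * Q * q m := by
  have hw := measurable_ut hD hE hθ
  have hb := (bdiag_bounds hU hw hqg hq3 hg1 hQ hG hΛ hβ hw1 hw2 m (m - 1) (by omega)
    (by omega)).2
  calc _ ≤ _ := lintegral_Pn_le hD hE hU hθ heu hsub hm
    _ ≤ ∫⁻ v, ut θ D E 1 v * (β * (Q * q m)) := by
        refine lintegral_mono fun v => mul_le_mul' le_rfl ((hb _).trans ?_)
        exact mul_le_mul' le_rfl (hq3 _ _ (by omega) (by omega))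
    _ = (∫⁻ v, ut θ D E 1 v) * (β * (Q * q m)) := lintegral_mul_const _ (hw 1)
    _ ≤ A * (β * (Q * q m)) := mul_le_mul' (hw1 1 (by omega) (by omega)) le_rfl
    _ = _ := by ring

end DiagramBounds

/-! Renewal-type recursions in a commutative ring without unit. -/

section Renewal

variable {R : Type*} [NonUnitalCommRing R]

/-- `u = p + p * u`, `E = (1 - p)(1 + φ)` and `F = (1 - φ_1 X)(1 + u)` at the level of sequences
indexed by positive integers. -/
structure Renewal (p φ u E F : ℕ → R) : Prop where
  hφ : ∀ a b, 0 < a → 0 < b → φ (a + b) = φ a * φ b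
  hu : ∀ n, 0 < n → u n = p n + ∑ m ∈ Ioo 0 n, p m * u (n - m)
  hE : ∀ n, 0 < n → E n = φ n - p n - ∑ m ∈ Ioo 0 n, p m * φ (n - m)
  hF1 : F 1 = u 1 - φ 1
  hF : ∀ n, 0 < n → F (n + 1) = u (n + 1) - φ 1 * u n

variable {p φ u E F : ℕ → R}

theorem Ioo_succ_right' {n : ℕ} (hn : 0 < n) : Ioo 0 (n + 1) = insert n (Ioo 0 n) := by
  ext; simp; omega

theorem Ioo_zero_one : Ioo 0 1 = (∅ : Finset ℕ) := by decide

theorem Icc_succ_right' (M : ℕ) : Icc 1 (M + 1) = insert (M + 1) (Icc 1 M) := by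
  ext; simp; omega

theorem Renewal.E_one (h : Renewal p φ u E F) : E 1 = φ 1 - p 1 := by
  rw [h.hE 1 one_pos]; simp [Ioo_zero_one]

theorem Renewal.E_succ (h : Renewal p φ u E F) {m : ℕ} (hm : 0 < m) :
    E (m + 1) = φ 1 * E m - p (m + 1) := by
  have h2 : ∑ j ∈ Ioo 0 m, p j * φ (m + 1 - j) = φ 1 * ∑ j ∈ Ioo 0 m, p j * φ (m - j) := by
    rw [mul_sum]
    refine sum_congr rfl fun j hj => ?_
    simp at hj
    rw [show m + 1 - j = 1 + (m - j) by omega, h.hφ 1 _ one_pos (by omega), mul_left_comm]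
  rw [h.hE _ (by omega), h.hE m hm, Ioo_succ_right' hm, sum_insert (by simp), h2,
    show m + 1 - m = 1 by omega, h.hφ m 1 hm one_pos, mul_sub, mul_sub, mul_comm (φ m),
    mul_comm (p m)]
  abel

theorem Renewal.truncated (h : Renewal p φ u E F) (M : ℕ) (hM : 0 < M) (n : ℕ) (hn : M + 2 ≤ n) :
    F n + ∑ m ∈ Icc 1 M, E m * F (n - m) =
      u n - ∑ m ∈ Icc 1 M, p m * u (n - m) - φ 1 * E M * u (n - M - 1) := by
  induction M with
  | zero => omega
  | succ M ih =>
    have hFn : ∀ k, 1 < k → F k = u k - φ 1 * u (k - 1) := fun k hk => by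
      obtain ⟨j, rfl⟩ : ∃ j, k = j + 1 := ⟨k - 1, by omega⟩
      exact h.hF j (by omega)
    rcases Nat.eq_zero_or_pos M with rfl | hM0
    · simp only [zero_add, Icc_self, sum_singleton]
      rw [hFn n (by omega), hFn (n - 1) (by omega), h.E_one]
      simp only [mul_sub, sub_mul, mul_assoc, mul_left_comm (p 1) (φ 1)]
      abel
    · have := ih hM0 (by omega)
      rw [Icc_succ_right', sum_insert (by simp), sum_insert (by simp),
        add_comm (E (M + 1) * _), ← add_assoc, this, hFn (n - (M + 1)) (by omega),
        show n - M - 1 = n - (M + 1) by omega, mul_sub]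
      nth_rewrite 1 [h.E_succ hM0]
      rw [sub_mul, mul_left_comm, ← mul_assoc (φ 1) (E (M + 1))]
      abel

theorem Renewal.F_eq (h : Renewal p φ u E F) (n : ℕ) (hn : 0 < n) :
    F n = -E n - ∑ m ∈ Ioo 0 n, E m * F (n - m) := by
  have hu1 : u 1 = p 1 := by rw [h.hu 1 one_pos]; simp [Ioo_zero_one]
  have hF1 : F 1 = -E 1 := by rw [h.hF1, h.E_one, hu1]; abel
  obtain rfl | rfl | hn : n = 1 ∨ n = 2 ∨ 3 ≤ n := by omega
  · rw [hF1]; simp [Ioo_zero_one]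
  · rw [h.hF 1 one_pos, h.hu 2 (by omega), h.E_succ one_pos]
    have : Ioo 0 2 = {1} := by decide
    simp only [this, sum_singleton]
    rw [show 2 - 1 = 1 from rfl, hF1, h.E_one, hu1]
    simp only [mul_sub, sub_mul, mul_neg]
    rw [mul_comm (p 1) (φ 1)]
    abel
  · obtain ⟨k, rfl⟩ : ∃ k, n = k + 2 := ⟨n - 2, by omega⟩
    have hk : 0 < k := by omega
    have ht := h.truncated k hk (k + 2) le_rfl
    have h1 : Ioo 0 (k + 2) = insert (k + 1) (Icc 1 k) := by ext; simp; omega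
    have h2 := h.hu (k + 2) (by omega)
    rw [h1, sum_insert (by simp)] at h2
    rw [h2] at ht
    rw [h1, sum_insert (by simp), eq_sub_iff_add_eq, add_comm (E (k + 1) * _), ← add_assoc, ht,
      show k + 2 - (k + 1) = 1 by omega, show k + 2 - k - 1 = 1 by omega, h.hF1,
      show k + 2 = k + 1 + 1 from rfl, h.E_succ (m := k + 1) (by omega), mul_sub,
      mul_comm (φ 1) (E (k + 1))]
    nth_rewrite 1 [h.E_succ hk]
    rw [sub_mul]
    abel

theorem Renewal.telescope (h : Renewal p φ u E F) (J : ℕ) (hJ : 0 < J) (n : ℕ) (hn : J < n) :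
    u n = φ J * u (n - J) + F n + ∑ j ∈ Ioo 0 J, φ j * F (n - j) := by
  induction J with
  | zero => omega
  | succ J ih =>
    have hFn : ∀ k, 1 < k → F k = u k - φ 1 * u (k - 1) := fun k hk => by
      obtain ⟨j, rfl⟩ : ∃ j, k = j + 1 := ⟨k - 1, by omega⟩
      exact h.hF j (by omega)
    rcases Nat.eq_zero_or_pos J with rfl | hJ0
    · simp [hFn n hn, Ioo_zero_one]
    · have h1 := hFn (n - J) (by omega)
      rw [Ioo_succ_right' hJ0, sum_insert (by simp), h1, h.hφ J 1 hJ0 one_pos, mul_sub,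
        ih hJ0 (by omega), show n - J - 1 = n - (J + 1) by omega, mul_assoc]
      abel

theorem Renewal.u_eq (h : Renewal p φ u E F) (n : ℕ) (hn : 0 < n) :
    u n = φ n + F n + ∑ m ∈ Ioo 0 n, φ (n - m) * F m := by
  have hu1 : u 1 = φ 1 + F 1 := by rw [h.hF1]; abel
  obtain rfl | hn : n = 1 ∨ 2 ≤ n := by omega
  · rw [hu1]; simp [Ioo_zero_one]
  · have h1 := h.telescope (n - 1) (by omega) n (by omega)
    have h2 : ∑ m ∈ Ioo 0 n, φ (n - m) * F m = ∑ m ∈ Ioo 0 n, φ m * F (n - m) := by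
      refine sum_nbij' (fun m => n - m) (fun m => n - m) ?_ ?_ ?_ ?_ ?_ <;>
        intro m hm <;> simp at hm ⊢ <;> try omega
      rw [show n - (n - m) = m by omega]
    rw [h2, show n = n - 1 + 1 by omega, Ioo_succ_right' (by omega), sum_insert (by simp),
      show n - 1 + 1 = n by omega, show n - (n - 1) = 1 by omega, h1,
      show n - (n - 1) = 1 by omega, hu1, mul_add, ← h.hφ _ 1 (by omega) one_pos,
      show n - 1 + 1 = n by omega]
    abel

end Renewal

variable {d : ℕ}

/-! The convolution ring of bounded integrable functions. -/

/-- Bounded, measurable, integrable functions on `ℝ^d`. -/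
def Lsub (d : ℕ) : Submodule ℝ (Ed d → ℝ) where
  carrier := {f | Measurable f ∧ Integrable f ∧ ∃ C, ∀ x, |f x| ≤ C}
  zero_mem' := ⟨measurable_const, integrable_zero _ _ _, 0, by simp⟩
  add_mem' := by
    rintro f g ⟨hf, hf', C, hC⟩ ⟨hg, hg', C', hC'⟩
    exact ⟨hf.add hg, hf'.add hg', C + C', fun x =>
      (abs_add_le _ _).trans (add_le_add (hC x) (hC' x))⟩
  smul_mem' := by
    rintro c f ⟨hf, hf', C, hC⟩
    refine ⟨hf.const_smul c, hf'.smul c, |c| * C, fun x => ?_⟩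
    simp only [Pi.smul_apply, smul_eq_mul, abs_mul]
    exact mul_le_mul_of_nonneg_left (hC x) (abs_nonneg _)

abbrev LF (d : ℕ) := ↥(Lsub d)

instance : CoeFun (LF d) fun _ => Ed d → ℝ := ⟨fun f => f.1⟩

theorem LF.meas (f : LF d) : Measurable f := f.2.1
theorem LF.integ (f : LF d) : Integrable f := f.2.2.1
theorem LF.bdd (f : LF d) : ∃ C, ∀ x, |f x| ≤ C := f.2.2.2

@[ext] theorem LF.ext {f g : LF d} (h : ∀ x, f x = g x) : f = g := Subtype.ext (funext h)

theorem LF.abs_mem (f : LF d) : (fun x => |f x|) ∈ Lsub d := by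
  obtain ⟨C, hC⟩ := f.bdd
  exact ⟨f.meas.norm, f.integ.norm, C, by simpa using hC⟩

/-- The absolute value. -/
def LF.abs (f : LF d) : LF d := ⟨fun x => |f x|, f.abs_mem⟩

theorem LF.integrable_mul_sub (f g : LF d) (x : Ed d) :
    Integrable fun y => f y * g (x - y) := by
  obtain ⟨C, hC⟩ := g.bdd
  exact f.integ.mul_bdd (c := C)
    (g.meas.comp (measurable_const.sub measurable_id)).aestronglyMeasurable
    (Eventually.of_forall fun y => hC _)

theorem LF.abs_conv_le (f g : LF d) {C : ℝ} (hC : ∀ x, |g x| ≤ C) (x : Ed d) :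
    |∫ y, f y * g (x - y)| ≤ (∫ y, |f y|) * C := by
  calc |∫ y, f y * g (x - y)| ≤ ∫ y, |f y * g (x - y)| := abs_integral_le_integral_abs
    _ ≤ ∫ y, |f y| * C := by
        refine integral_mono (f.integrable_mul_sub g x).abs (f.integ.abs.mul_const C) fun y => ?_
        simp only [abs_mul]
        exact mul_le_mul_of_nonneg_left (hC _) (abs_nonneg _)
    _ = _ := integral_mul_const _ _

theorem LF.conv_mem (f g : LF d) : (fun x => ∫ y, f y * g (x - y)) ∈ Lsub d := by
  obtain ⟨C, hC⟩ := g.bdd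
  refine ⟨?_, ?_, _, f.abs_conv_le g hC⟩
  · have : StronglyMeasurable fun p : Ed d × Ed d => f p.2 * g (p.1 - p.2) :=
      ((f.meas.comp measurable_snd).mul
        (g.meas.comp (measurable_fst.sub measurable_snd))).stronglyMeasurable
    exact this.integral_prod_right'.measurable
  · exact f.integ.integrable_convolution (ContinuousLinearMap.mul ℝ ℝ) g.integ

instance : Mul (LF d) := ⟨fun f g => ⟨fun x => ∫ y, f y * g (x - y), f.conv_mem g⟩⟩

theorem LF.mul_apply (f g : LF d) (x : Ed d) : (f * g) x = ∫ y, f y * g (x - y) := rfl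

theorem LF.mul_apply' (f g : LF d) (x : Ed d) : (f * g) x = ∫ y, f (x - y) * g y := by
  rw [LF.mul_apply, ← integral_sub_left_eq_self (fun y => f y * g (x - y)) volume x]
  simp

theorem LF.convolutionExistsAt (f g : LF d) (x : Ed d) :
    ConvolutionExistsAt f g x (ContinuousLinearMap.mul ℝ ℝ) volume :=
  f.integrable_mul_sub g x

theorem LF.mul_assoc' (f g h : LF d) : f * g * h = f * (g * h) := by
  ext x
  refine convolution_assoc (ContinuousLinearMap.mul ℝ ℝ) (ContinuousLinearMap.mul ℝ ℝ)
    (ContinuousLinearMap.mul ℝ ℝ) (ContinuousLinearMap.mul ℝ ℝ)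
    (fun a b c => mul_assoc a b c) (x₀ := x) (ν := volume) (μ := volume)
    f.meas.aestronglyMeasurable g.meas.aestronglyMeasurable h.meas.aestronglyMeasurable
    (Eventually.of_forall fun y => f.convolutionExistsAt g y)
    (Eventually.of_forall fun y => g.abs.convolutionExistsAt h.abs y)
    (f.abs.convolutionExistsAt (g.abs * h.abs) x)

instance : NonUnitalCommRing (LF d) where
  left_distrib f g h := by
    ext x
    change ∫ y, f y * (g (x - y) + h (x - y)) = (∫ y, f y * g (x - y)) + ∫ y, f y * h (x - y)
    rw [← integral_add (f.integrable_mul_sub g x) (f.integrable_mul_sub h x)]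
    simp only [mul_add]
  right_distrib f g h := by
    ext x
    change ∫ y, (f y + g y) * h (x - y) = (∫ y, f y * h (x - y)) + ∫ y, g y * h (x - y)
    rw [← integral_add (f.integrable_mul_sub h x) (g.integrable_mul_sub h x)]
    simp only [add_mul]
  zero_mul f := by
    ext x
    change ∫ y, 0 * f (x - y) = 0
    simp
  mul_zero f := by
    ext x
    change ∫ y, f y * 0 = 0
    simp
  mul_assoc := LF.mul_assoc'
  mul_comm f g := by
    ext x
    rw [LF.mul_apply, LF.mul_apply']
    simp only [mul_comm]

@[simp] theorem LF.add_apply (f g : LF d) (x : Ed d) : (f + g) x = f x + g x := rfl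
@[simp] theorem LF.sub_apply (f g : LF d) (x : Ed d) : (f - g) x = f x - g x := rfl
@[simp] theorem LF.neg_apply (f : LF d) (x : Ed d) : (-f) x = -f x := rfl
@[simp] theorem LF.smul_apply (c : ℝ) (f : LF d) (x : Ed d) : (c • f) x = c * f x := rfl
@[simp] theorem LF.sum_apply {ι : Type*} (s : Finset ι) (f : ι → LF d) (x : Ed d) :
    (∑ i ∈ s, f i) x = ∑ i ∈ s, f i x := by
  have : ((∑ i ∈ s, f i : LF d) : Ed d → ℝ) = ∑ i ∈ s, (f i : Ed d → ℝ) :=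
    map_sum (Lsub d).subtype f s
  rw [this, Finset.sum_apply]

instance : IsScalarTower ℝ (LF d) (LF d) := ⟨fun c f g => by
  ext x
  change ∫ y, c * f y * g (x - y) = c * ∫ y, f y * g (x - y)
  rw [← integral_const_mul]
  simp only [mul_assoc]⟩

instance : SMulCommClass ℝ (LF d) (LF d) := ⟨fun c f g => by
  change c • (f * g) = f * (c • g)
  rw [mul_comm f (c • g), smul_mul_assoc, mul_comm]⟩

theorem LF.integral_mul (f g : LF d) : ∫ x, (f * g) x = (∫ x, f x) * ∫ x, g x :=
  integral_convolution (ContinuousLinearMap.mul ℝ ℝ) f.integ g.integ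

/-! Gaussian facts. -/

theorem gauss_nonneg {t : ℝ} (ht : 0 ≤ t) (x : Ed d) : 0 ≤ gauss d t x := by
  unfold gauss; positivity

theorem continuous_gauss (t : ℝ) : Continuous (gauss d t) := by
  unfold gauss; fun_prop

theorem gauss_le_zero {t : ℝ} (ht : 0 ≤ t) (x : Ed d) :
    gauss d t x ≤ (2 * Real.pi * t) ^ (-(d : ℝ) / 2) := by
  unfold gauss
  refine mul_le_of_le_one_right (by positivity) (Real.exp_le_one_iff.2 ?_)
  rw [neg_div]; simp; positivity

theorem gauss_le {t : ℝ} (ht : 0 < t) (x : Ed d) : gauss d t x ≤ t ^ (-(d : ℝ) / 2) := by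
  refine (gauss_le_zero ht.le x).trans ?_
  refine Real.rpow_le_rpow_of_nonpos ht ?_ (by rw [neg_div]; simp; positivity)
  nlinarith [Real.pi_gt_three]

theorem integral_gauss_aux {t : ℝ} (ht : 0 < t) :
    ∫ x : Ed d, Real.exp (-‖x‖ ^ 2 / (2 * t)) = (2 * Real.pi * t) ^ ((d : ℝ) / 2) := by
  have := GaussianFourier.integral_rexp_neg_mul_sq_norm (V := Ed d) (b := 1 / (2 * t)) (by positivity)
  rw [finrank_euclideanSpace_fin] at this
  rw [show Real.pi / (1 / (2 * t)) = 2 * Real.pi * t by field_simp] at this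
  rw [← this]
  congr 1
  ext x
  ring_nf

theorem integral_gauss {t : ℝ} (ht : 0 < t) : ∫ x : Ed d, gauss d t x = 1 := by
  unfold gauss
  rw [integral_const_mul, integral_gauss_aux ht, ← Real.rpow_add (by positivity)]
  simp [neg_div]

theorem integrable_gauss {t : ℝ} (ht : 0 < t) : Integrable (gauss d t) := by
  by_contra h
  have := integral_gauss (d := d) ht
  rw [integral_undef h] at this
  exact zero_ne_one this

/-- The Gaussian density as an element of the convolution ring (zero for `t ≤ 0`). -/
def G (d : ℕ) (t : ℝ) : LF d :=
  if h : 0 < t then ⟨gauss d t, (continuous_gauss t).measurable, integrable_gauss h,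
    _, fun x => by rw [abs_of_nonneg (gauss_nonneg h.le x)]; exact gauss_le h x⟩ else 0

theorem G_apply {t : ℝ} (ht : 0 < t) (x : Ed d) : G d t x = gauss d t x := by
  simp [G, ht]

theorem G_nonneg (t : ℝ) (x : Ed d) : 0 ≤ G d t x := by
  by_cases h : 0 < t
  · rw [G_apply h]; exact gauss_nonneg h.le x
  · simp [G, h]

theorem gauss_mul_gauss {a b : ℝ} (ha : 0 < a) (hb : 0 < b) (x y : Ed d) :
    gauss d a y * gauss d b (x - y) =
      gauss d (a + b) x * gauss d (a * b / (a + b)) (y - (a / (a + b)) • x) := by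
  have h1 : ‖x - y‖ ^ 2 = ‖x‖ ^ 2 - 2 * inner ℝ x y + ‖y‖ ^ 2 := norm_sub_sq_real x y
  have h2 : ‖y - (a / (a + b)) • x‖ ^ 2 = ‖y‖ ^ 2 - 2 * (a / (a + b)) * inner ℝ x y +
      (a / (a + b)) ^ 2 * ‖x‖ ^ 2 := by
    rw [norm_sub_sq_real, inner_smul_right, norm_smul, mul_pow, real_inner_comm, Real.norm_eq_abs,
      sq_abs]
    ring
  unfold gauss
  rw [mul_mul_mul_comm, mul_mul_mul_comm ((2 * Real.pi * (a + b)) ^ _), ← Real.exp_add, ← Real.exp_add,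
    ← Real.mul_rpow (by positivity) (by positivity),
    ← Real.mul_rpow (by positivity) (by positivity), h1, h2]
  congr 2
  · field_simp
  · field_simp; ring

theorem G_mul_G {a b : ℝ} (ha : 0 < a) (hb : 0 < b) : G d a * G d b = G d (a + b) := by
  ext x
  rw [LF.mul_apply, G_apply (by positivity)]
  simp only [G_apply ha, G_apply hb, gauss_mul_gauss ha hb]
  rw [integral_const_mul, integral_sub_right_eq_self (fun y => gauss d (a * b / (a + b)) y),
    integral_gauss (by positivity), mul_one]

theorem integral_G {t : ℝ} (ht : 0 < t) : ∫ x, G d t x = 1 := by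
  simp only [G_apply ht, integral_gauss ht]

/-! Weighted `L¹` bounds and sup bounds. -/

/-- The submultiplicative weight `8 (1 + |x|⁴ / n²)`. -/
def wt (n : ℕ) (x : Ed d) : ℝ := 8 * (1 + ‖x‖ ^ 4 / (n : ℝ) ^ 2)

theorem wt_ge (n : ℕ) (x : Ed d) : 8 ≤ wt n x := by
  unfold wt; have : 0 ≤ ‖x‖ ^ 4 / (n : ℝ) ^ 2 := by positivity
  linarith

theorem wt_nonneg (n : ℕ) (x : Ed d) : 0 ≤ wt n x := by linarith [wt_ge n x]

theorem measurable_wt (n : ℕ) : Measurable (wt (d := d) n) := by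
  unfold wt; fun_prop

theorem norm_add_pow_four_le (x y : Ed d) : ‖x + y‖ ^ 4 ≤ 8 * (‖x‖ ^ 4 + ‖y‖ ^ 4) := by
  have h1 : ‖x + y‖ ^ 4 ≤ (‖x‖ + ‖y‖) ^ 4 := by gcongr; exact norm_add_le x y
  nlinarith [sq_nonneg (‖x‖ - ‖y‖), sq_nonneg (‖x‖ ^ 2 - ‖y‖ ^ 2), norm_nonneg x, norm_nonneg y,
    mul_nonneg (norm_nonneg x) (norm_nonneg y), sq_nonneg (‖x‖ + ‖y‖),
    mul_nonneg (mul_nonneg (norm_nonneg x) (norm_nonneg y)) (sq_nonneg (‖x‖ - ‖y‖)),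
    sq_nonneg ((‖x‖ - ‖y‖) ^ 2)]

theorem wt_add_le {m l : ℕ} (hm : 0 < m) (hl : 0 < l) (x y : Ed d) :
    wt (m + l) (x + y) ≤ wt m x * wt l y := by
  have h := norm_add_pow_four_le x y
  have hm' : (0 : ℝ) < m := by exact_mod_cast hm
  have hl' : (0 : ℝ) < l := by exact_mod_cast hl
  have h1 : ‖x + y‖ ^ 4 / ((m + l : ℕ) : ℝ) ^ 2 ≤
      8 * (‖x‖ ^ 4 / (m : ℝ) ^ 2 + ‖y‖ ^ 4 / (l : ℝ) ^ 2) := by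
    have hx : ‖x‖ ^ 4 / ((m + l : ℕ) : ℝ) ^ 2 ≤ ‖x‖ ^ 4 / (m : ℝ) ^ 2 := by
      push_cast; gcongr; linarith
    have hy : ‖y‖ ^ 4 / ((m + l : ℕ) : ℝ) ^ 2 ≤ ‖y‖ ^ 4 / (l : ℝ) ^ 2 := by
      push_cast; gcongr; linarith
    calc ‖x + y‖ ^ 4 / ((m + l : ℕ) : ℝ) ^ 2
        ≤ 8 * (‖x‖ ^ 4 + ‖y‖ ^ 4) / ((m + l : ℕ) : ℝ) ^ 2 := by gcongr
      _ = 8 * (‖x‖ ^ 4 / ((m + l : ℕ) : ℝ) ^ 2 + ‖y‖ ^ 4 / ((m + l : ℕ) : ℝ) ^ 2) := by ring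
      _ ≤ _ := by linarith
  have ha : 0 ≤ ‖x‖ ^ 4 / (m : ℝ) ^ 2 := by positivity
  have hb : 0 ≤ ‖y‖ ^ 4 / (l : ℝ) ^ 2 := by positivity
  unfold wt
  nlinarith [mul_nonneg ha hb]

/-- `∫ |f| wt_n ≤ c`. -/
def NB (n : ℕ) (f : Ed d → ℝ) (c : ℝ) : Prop :=
  ∫⁻ x, ENNReal.ofReal (|f x| * wt n x) ≤ ENNReal.ofReal c

theorem NB.mono {n : ℕ} {f : Ed d → ℝ} {c c' : ℝ} (h : NB n f c) (hc : c ≤ c') : NB n f c' :=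
  le_trans h (ENNReal.ofReal_le_ofReal hc)

theorem NB.of_abs_le {n : ℕ} {f g : Ed d → ℝ} {c : ℝ} (h : NB n g c) (hfg : ∀ x, |f x| ≤ |g x|) :
    NB n f c := by
  refine le_trans (lintegral_mono fun x => ENNReal.ofReal_le_ofReal ?_) h
  exact mul_le_mul_of_nonneg_right (hfg x) (wt_nonneg n x)

theorem NB.neg {n : ℕ} {f : LF d} {c : ℝ} (h : NB n f c) : NB n (-f : LF d) c :=
  h.of_abs_le fun x => by simp

theorem NB.add {n : ℕ} {f g : LF d} {c c' : ℝ} (hc : 0 ≤ c) (hc' : 0 ≤ c') (hf : NB n f c)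
    (hg : NB n g c') : NB n (f + g : LF d) (c + c') := by
  unfold NB at *
  rw [ENNReal.ofReal_add hc hc']
  refine le_trans ?_ (add_le_add hf hg)
  rw [← lintegral_add_left]
  · refine lintegral_mono fun x => ?_
    rw [← ENNReal.ofReal_add (mul_nonneg (abs_nonneg _) (wt_nonneg n x))
      (mul_nonneg (abs_nonneg _) (wt_nonneg n x)), ← add_mul]
    refine ENNReal.ofReal_le_ofReal (mul_le_mul_of_nonneg_right ?_ (wt_nonneg n x))
    exact abs_add_le _ _
  · exact (f.meas.abs.mul (measurable_wt n)).ennreal_ofReal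

theorem NB.sub {n : ℕ} {f g : LF d} {c c' : ℝ} (hc : 0 ≤ c) (hc' : 0 ≤ c') (hf : NB n f c)
    (hg : NB n g c') : NB n (f - g : LF d) (c + c') := by
  rw [sub_eq_add_neg]
  exact hf.add hc hc' hg.neg

theorem NB.sum {n : ℕ} {ι : Type*} (s : Finset ι) {f : ι → LF d} {c : ι → ℝ}
    (hc : ∀ i ∈ s, 0 ≤ c i) (h : ∀ i ∈ s, NB n (f i) (c i)) :
    NB n (∑ i ∈ s, f i : LF d) (∑ i ∈ s, c i) := by
  induction s using Finset.induction_on with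
  | empty => simp [NB]
  | insert a s ha ih =>
    rw [sum_insert ha, sum_insert ha]
    refine NB.add (hc a (by simp)) (sum_nonneg fun i hi => hc i (by simp [hi]))
      (h a (by simp)) (ih (fun i hi => hc i (by simp [hi])) fun i hi => h i (by simp [hi]))

theorem NB.smul {n : ℕ} {f : LF d} {c : ℝ} (a : ℝ) (h : NB n f c) :
    NB n (a • f : LF d) (|a| * c) := by
  unfold NB at *
  rw [ENNReal.ofReal_mul (abs_nonneg a)]
  refine le_trans (le_of_eq ?_) (mul_le_mul' le_rfl h)
  rw [← lintegral_const_mul]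
  · refine lintegral_congr fun x => ?_
    rw [← ENNReal.ofReal_mul (abs_nonneg a), LF.smul_apply, abs_mul, mul_assoc]
  · exact (f.meas.abs.mul (measurable_wt n)).ennreal_ofReal

theorem NB.mul {m l : ℕ} (hm : 0 < m) (hl : 0 < l) {f g : LF d} {c c' : ℝ} (hc : 0 ≤ c)
    (hf : NB m f c) (hg : NB l g c') : NB (m + l) (f * g : LF d) (c * c') := by
  unfold NB at *
  rw [ENNReal.ofReal_mul hc]
  refine le_trans ?_ (mul_le_mul' hf hg)
  have h1 : Measurable fun x => ENNReal.ofReal (|f x| * wt m x) :=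
    (f.meas.abs.mul (measurable_wt m)).ennreal_ofReal
  have h2 : Measurable fun x => ENNReal.ofReal (|g x| * wt l x) :=
    (g.meas.abs.mul (measurable_wt l)).ennreal_ofReal
  rw [← lintegral_lconv h1 h2]
  refine lintegral_mono fun x => ?_
  have h3 : |(f * g) x| ≤ ∫ y, |f y| * |g (x - y)| := by
    rw [LF.mul_apply]
    refine abs_integral_le_integral_abs.trans (le_of_eq ?_)
    simp only [abs_mul]
  calc ENNReal.ofReal (|(f * g) x| * wt (m + l) x)
      ≤ ENNReal.ofReal (∫ y, |f y| * |g (x - y)| * wt (m + l) x) := by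
        rw [integral_mul_const]
        exact ENNReal.ofReal_le_ofReal (mul_le_mul_of_nonneg_right h3 (wt_nonneg _ x))
    _ = ∫⁻ y, ENNReal.ofReal (|f y| * |g (x - y)| * wt (m + l) x) := by
        rw [ofReal_integral_eq_lintegral_ofReal]
        · exact (f.abs.integrable_mul_sub g.abs x).mul_const _
        · exact Eventually.of_forall fun y => mul_nonneg (by positivity) (wt_nonneg _ x)
    _ ≤ _ := by
        refine lintegral_mono fun y => ?_
        rw [← ENNReal.ofReal_mul (mul_nonneg (abs_nonneg _) (wt_nonneg _ _))]
        refine ENNReal.ofReal_le_ofReal ?_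
        rw [mul_mul_mul_comm]
        refine mul_le_mul_of_nonneg_left ?_ (by positivity)
        simpa using wt_add_le hm hl y (x - y)

theorem NB.integrable {n : ℕ} {f : LF d} {c : ℝ} (h : NB n f c) :
    Integrable fun x => |f x| * wt n x := by
  refine ⟨(f.meas.abs.mul (measurable_wt n)).aestronglyMeasurable, ?_⟩
  rw [hasFiniteIntegral_iff_ofReal
    (Eventually.of_forall fun x => mul_nonneg (abs_nonneg _) (wt_nonneg _ _))]
  exact lt_of_le_of_lt h ENNReal.ofReal_lt_top

theorem NB.integral_le {n : ℕ} {f : LF d} {c : ℝ} (hc : 0 ≤ c) (h : NB n f c) :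
    ∫ x, |f x| * wt n x ≤ c := by
  rw [← ENNReal.ofReal_le_ofReal_iff hc, ofReal_integral_eq_lintegral_ofReal h.integrable]
  · exact h
  · exact Eventually.of_forall fun x => mul_nonneg (abs_nonneg _) (wt_nonneg _ _)

theorem NB.of_integral_le {n : ℕ} {f : LF d} {c : ℝ} (hi : Integrable fun x => |f x| * wt n x)
    (h : ∫ x, |f x| * wt n x ≤ c) : NB n f c := by
  unfold NB
  rw [← ofReal_integral_eq_lintegral_ofReal hi]
  · exact ENNReal.ofReal_le_ofReal h
  · exact Eventually.of_forall fun x => mul_nonneg (abs_nonneg _) (wt_nonneg _ _)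

theorem NB.integral_abs_le {n : ℕ} {f : LF d} {c : ℝ} (hc : 0 ≤ c) (h : NB n f c) :
    ∫ x, |f x| ≤ c := by
  refine le_trans (integral_mono f.integ.abs h.integrable fun x => ?_) (h.integral_le hc)
  exact le_mul_of_one_le_right (abs_nonneg _) (by linarith [wt_ge n x])

theorem NB.abs_integral_le {n : ℕ} {f : LF d} {c : ℝ} (hc : 0 ≤ c) (h : NB n f c) :
    |∫ x, f x| ≤ c :=
  abs_integral_le_integral_abs.trans (h.integral_abs_le hc)

theorem NB.integrable_pow_four {n : ℕ} (hn : 0 < n) {f : LF d} {c : ℝ} (h : NB n f c) :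
    Integrable fun x => |f x| * ‖x‖ ^ 4 := by
  have hn' : (0 : ℝ) < n := by exact_mod_cast hn
  refine (h.integrable.const_mul ((n : ℝ) ^ 2)).mono'
    (f.meas.abs.mul (measurable_norm.pow_const 4)).aestronglyMeasurable
    (Eventually.of_forall fun x => ?_)
  rw [Real.norm_of_nonneg (by positivity), mul_left_comm]
  refine mul_le_mul_of_nonneg_left ?_ (abs_nonneg _)
  unfold wt
  have : (n : ℝ) ^ 2 * (8 * (1 + ‖x‖ ^ 4 / (n : ℝ) ^ 2)) = 8 * (n : ℝ) ^ 2 + 8 * ‖x‖ ^ 4 := by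
    field_simp
  rw [this]; nlinarith [pow_nonneg (norm_nonneg x) 4]

theorem NB.integral_pow_four_le {n : ℕ} (hn : 0 < n) {f : LF d} {c : ℝ} (hc : 0 ≤ c)
    (h : NB n f c) : ∫ x, |f x| * ‖x‖ ^ 4 ≤ (n : ℝ) ^ 2 * c := by
  have hn' : (0 : ℝ) < n := by exact_mod_cast hn
  refine le_trans (integral_mono (h.integrable_pow_four hn)
    (h.integrable.const_mul ((n : ℝ) ^ 2)) fun x => ?_) ?_
  · simp only
    rw [mul_left_comm]
    refine mul_le_mul_of_nonneg_left ?_ (abs_nonneg _)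
    unfold wt
    have : (n : ℝ) ^ 2 * (8 * (1 + ‖x‖ ^ 4 / (n : ℝ) ^ 2)) = 8 * (n : ℝ) ^ 2 + 8 * ‖x‖ ^ 4 := by
      field_simp
    rw [this]; nlinarith [pow_nonneg (norm_nonneg x) 4]
  · rw [integral_const_mul]
    exact mul_le_mul_of_nonneg_left (h.integral_le hc) (by positivity)

theorem sq_norm_le_wt {n : ℕ} (hn : 0 < n) (x : Ed d) : ‖x‖ ^ 2 ≤ n * wt n x := by
  have hn' : (0 : ℝ) < n := by exact_mod_cast hn
  unfold wt
  have : (n : ℝ) * (8 * (1 + ‖x‖ ^ 4 / (n : ℝ) ^ 2)) = 8 * n + 8 * ((‖x‖ ^ 2) ^ 2 / n) := by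
    field_simp
  rw [this]
  have h2 : 0 ≤ (‖x‖ ^ 2 - n) ^ 2 / n := by positivity
  have h3 : (‖x‖ ^ 2 - n) ^ 2 / n = (‖x‖ ^ 2) ^ 2 / n - 2 * ‖x‖ ^ 2 + n := by field_simp; ring
  have h4 : 0 ≤ (‖x‖ ^ 2) ^ 2 / n := by positivity
  nlinarith

theorem NB.integrable_sq {n : ℕ} (hn : 0 < n) {f : LF d} {c : ℝ} (h : NB n f c) :
    Integrable fun x => |f x| * ‖x‖ ^ 2 := by
  refine (h.integrable.const_mul (n : ℝ)).mono'
    (f.meas.abs.mul (measurable_norm.pow_const 2)).aestronglyMeasurable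
    (Eventually.of_forall fun x => ?_)
  rw [Real.norm_of_nonneg (by positivity), mul_left_comm]
  exact mul_le_mul_of_nonneg_left (sq_norm_le_wt hn x) (abs_nonneg _)

theorem NB.integral_sq_le {n : ℕ} (hn : 0 < n) {f : LF d} {c : ℝ} (hc : 0 ≤ c)
    (h : NB n f c) : ∫ x, |f x| * ‖x‖ ^ 2 ≤ n * c := by
  refine le_trans (integral_mono (h.integrable_sq hn)
    (h.integrable.const_mul (n : ℝ)) fun x => ?_) ?_
  · simp only
    rw [mul_left_comm]
    exact mul_le_mul_of_nonneg_left (sq_norm_le_wt hn x) (abs_nonneg _)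
  · rw [integral_const_mul]
    exact mul_le_mul_of_nonneg_left (h.integral_le hc) (by positivity)

/-- `sup |f| ≤ c`. -/
def SB (f : Ed d → ℝ) (c : ℝ) : Prop := ∀ x, |f x| ≤ c

theorem SB.mono {f : Ed d → ℝ} {c c' : ℝ} (h : SB f c) (hc : c ≤ c') : SB f c' :=
  fun x => (h x).trans hc

theorem SB.nonneg {f : Ed d → ℝ} {c : ℝ} (h : SB f c) : 0 ≤ c := (abs_nonneg _).trans (h 0)

theorem SB.neg {f : LF d} {c : ℝ} (h : SB f c) : SB (-f : LF d) c := fun x => by simpa using h x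

theorem SB.add {f g : LF d} {c c' : ℝ} (hf : SB f c) (hg : SB g c') :
    SB (f + g : LF d) (c + c') := fun x => (abs_add_le _ _).trans (add_le_add (hf x) (hg x))

theorem SB.sub {f g : LF d} {c c' : ℝ} (hf : SB f c) (hg : SB g c') :
    SB (f - g : LF d) (c + c') := by
  rw [sub_eq_add_neg]; exact hf.add hg.neg

theorem SB.sum {ι : Type*} (s : Finset ι) {f : ι → LF d} {c : ι → ℝ}
    (h : ∀ i ∈ s, SB (f i) (c i)) : SB (∑ i ∈ s, f i : LF d) (∑ i ∈ s, c i) := fun x => by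
  rw [LF.sum_apply]
  exact (abs_sum_le_sum_abs _ _).trans (sum_le_sum fun i hi => h i hi x)

theorem SB.smul {f : LF d} {c : ℝ} (a : ℝ) (h : SB f c) : SB (a • f : LF d) (|a| * c) := fun x => by
  rw [LF.smul_apply, abs_mul]; exact mul_le_mul_of_nonneg_left (h x) (abs_nonneg _)

theorem SB.mul_of_integral {f g : LF d} {a c : ℝ} (hf : ∫ x, |f x| ≤ a) (hg : SB g c) :
    SB (f * g : LF d) (a * c) := fun x =>
  (f.abs_conv_le g hg x).trans (mul_le_mul_of_nonneg_right hf hg.nonneg)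

theorem NB.mul_SB {n : ℕ} {f g : LF d} {a c : ℝ} (ha : 0 ≤ a) (hf : NB n f a) (hg : SB g c) :
    SB (f * g : LF d) (a * c) := SB.mul_of_integral (hf.integral_abs_le ha) hg

/-! Gaussian bounds. -/

theorem gauss_scale_const {c T : ℝ} (hc : 0 < c) (hT : 0 < T) :
    (2 * Real.pi * T) ^ (-(d : ℝ) / 2) =
      c ^ ((d : ℝ) / 2) * (2 * Real.pi * (c * T)) ^ (-(d : ℝ) / 2) := by
  have h : 2 * Real.pi * (c * T) = c * (2 * Real.pi * T) := by ring
  rw [h, Real.mul_rpow hc.le (by positivity), ← mul_assoc, ← Real.rpow_add hc]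
  simp [neg_div]

theorem gauss_mul_exp {T : ℝ} (hT : 0 < T) (x : Ed d) :
    gauss d T x * Real.exp (7 / 16 * (‖x‖ ^ 2 / T)) = 8 ^ ((d : ℝ) / 2) * gauss d (8 * T) x := by
  unfold gauss
  rw [mul_assoc, ← Real.exp_add, ← mul_assoc]
  congr 1
  · exact gauss_scale_const (by norm_num) hT
  · congr 1; field_simp; ring

theorem gauss_le_of_le {T T' c : ℝ} (hT : 0 < T) (hTT' : T ≤ T') (hc : T' ≤ c * T) (x : Ed d) :
    gauss d T x ≤ c ^ ((d : ℝ) / 2) * gauss d T' x := by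
  have hT' : 0 < T' := hT.trans_le hTT'
  have hc0 : 0 < c := by
    by_contra h
    have : c * T ≤ 0 := mul_nonpos_of_nonpos_of_nonneg (not_lt.1 h) hT.le
    linarith
  unfold gauss
  rw [← mul_assoc]
  refine mul_le_mul ?_ (Real.exp_le_exp.2 ?_) (by positivity) (by positivity)
  · rw [neg_div, Real.rpow_neg (by positivity), Real.rpow_neg (by positivity), ← div_eq_mul_inv,
      ← Real.inv_rpow (by positivity), ← Real.div_rpow (by positivity) (by positivity)]
    refine Real.rpow_le_rpow (by positivity) ?_ (by positivity)
    rw [inv_eq_one_div, div_le_div_iff₀ (by positivity) (by positivity)]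
    nlinarith [Real.pi_pos]
  · rw [neg_div, neg_div, neg_le_neg_iff]
    gcongr

theorem gauss_mul_pow_four_le {T : ℝ} (hT : 0 < T) (x : Ed d) :
    gauss d T x * ‖x‖ ^ 4 ≤ 32 * 2 ^ ((d : ℝ) / 2) * T ^ 2 * gauss d (2 * T) x := by
  have hz : ∀ z : ℝ, 0 ≤ z → z ^ 2 ≤ 2 * Real.exp z := fun z hz => by
    have := Real.quadratic_le_exp_of_nonneg hz
    nlinarith
  have h := hz (‖x‖ ^ 2 / (4 * T)) (by positivity)
  have h1 : ‖x‖ ^ 4 = 16 * T ^ 2 * (‖x‖ ^ 2 / (4 * T)) ^ 2 := by field_simp; ring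
  have h2 : gauss d T x * Real.exp (‖x‖ ^ 2 / (4 * T)) = 2 ^ ((d : ℝ) / 2) * gauss d (2 * T) x := by
    unfold gauss
    rw [mul_assoc, ← Real.exp_add, ← mul_assoc]
    congr 1
    · exact gauss_scale_const (by norm_num) hT
    · congr 1; field_simp; ring
  calc gauss d T x * ‖x‖ ^ 4 = 16 * T ^ 2 * (gauss d T x * (‖x‖ ^ 2 / (4 * T)) ^ 2) := by
        rw [h1]; ring
    _ ≤ 16 * T ^ 2 * (gauss d T x * (2 * Real.exp (‖x‖ ^ 2 / (4 * T)))) := by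
        have := gauss_nonneg hT.le x; gcongr
    _ = 32 * T ^ 2 * (gauss d T x * Real.exp (‖x‖ ^ 2 / (4 * T))) := by ring
    _ = _ := by rw [h2]; ring

theorem NB_G (n : ℕ) {T : ℝ} (hT : 0 < T) :
    NB n (G d T) (8 + 256 * 2 ^ ((d : ℝ) / 2) * (T ^ 2 / (n : ℝ) ^ 2)) := by
  have hle : ∀ x : Ed d, |G d T x| * wt n x ≤
      8 * gauss d T x + 256 * 2 ^ ((d : ℝ) / 2) * (T ^ 2 / (n : ℝ) ^ 2) * gauss d (2 * T) x := by
    intro x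
    rw [abs_of_nonneg (G_nonneg T x), G_apply hT]
    unfold wt
    calc gauss d T x * (8 * (1 + ‖x‖ ^ 4 / (n : ℝ) ^ 2))
        = 8 * gauss d T x + 8 / (n : ℝ) ^ 2 * (gauss d T x * ‖x‖ ^ 4) := by ring
      _ ≤ 8 * gauss d T x + 8 / (n : ℝ) ^ 2 *
          (32 * 2 ^ ((d : ℝ) / 2) * T ^ 2 * gauss d (2 * T) x) := by
        have := mul_le_mul_of_nonneg_left (gauss_mul_pow_four_le hT x)
          (show 0 ≤ 8 / (n : ℝ) ^ 2 by positivity)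
        linarith
      _ = _ := by ring
  have h1 := integrable_gauss (d := d) hT
  have h2 := integrable_gauss (d := d) (t := 2 * T) (by positivity)
  have hi := (h1.const_mul 8).add
    (h2.const_mul (256 * 2 ^ ((d : ℝ) / 2) * (T ^ 2 / (n : ℝ) ^ 2)))
  have hi' : Integrable fun x : Ed d => |G d T x| * wt n x :=
    hi.mono' ((G d T).meas.abs.mul (measurable_wt n)).aestronglyMeasurable
      (Eventually.of_forall fun x => by
        rw [Real.norm_of_nonneg (mul_nonneg (abs_nonneg _) (wt_nonneg _ _))]; exact hle x)
  refine NB.of_integral_le hi' ((integral_mono hi' hi hle).trans (le_of_eq ?_))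
  simp only [Pi.add_apply]
  rw [integral_add (h1.const_mul _) (h2.const_mul _), integral_const_mul, integral_const_mul,
    integral_gauss hT, integral_gauss (by positivity)]
  ring

theorem SB_G {T : ℝ} (hT : 0 < T) : SB (G d T) (T ^ (-(d : ℝ) / 2)) := fun x => by
  rw [abs_of_nonneg (G_nonneg T x), G_apply hT]; exact gauss_le hT x

/-! Second order Taylor expansion of the heat kernel. -/

theorem abs_exp_sub_one_sub_le (L : ℝ) : |Real.exp L - 1 - L| ≤ L ^ 2 * Real.exp |L| := by
  have h := Complex.norm_exp_sub_sum_le_norm_mul_exp (L : ℂ) 2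
  have h1 : Complex.exp (L : ℂ) - ∑ m ∈ range 2, (L : ℂ) ^ m / (m.factorial : ℂ) =
      ((Real.exp L - 1 - L : ℝ) : ℂ) := by
    simp [sum_range_succ]; ring
  rw [h1, Complex.norm_real, Complex.norm_real] at h
  simpa using h

theorem abs_cosh_sub_le (c : ℝ) : |Real.cosh c - 1 - c ^ 2 / 2| ≤ c ^ 4 * Real.exp |c| := by
  have key : ∀ c : ℝ, |Real.exp c - (1 + c + c ^ 2 / 2 + c ^ 3 / 6)| ≤ c ^ 4 * Real.exp |c| := by
    intro c
    have h := Complex.norm_exp_sub_sum_le_norm_mul_exp (c : ℂ) 4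
    have h1 : Complex.exp (c : ℂ) - ∑ m ∈ range 4, (c : ℂ) ^ m / (m.factorial : ℂ) =
        ((Real.exp c - (1 + c + c ^ 2 / 2 + c ^ 3 / 6) : ℝ) : ℂ) := by
      simp [sum_range_succ, Nat.factorial]
    rw [h1, Complex.norm_real, Complex.norm_real, Real.norm_eq_abs, Real.norm_eq_abs] at h
    have h4 : |c| ^ 4 = c ^ 4 := by rw [show 4 = 2 * 2 by rfl, pow_mul, pow_mul, sq_abs]
    rwa [h4] at h
  have h1 := abs_le.1 (key c)
  have h2 := abs_le.1 (key (-c))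
  have h3 : (-c) ^ 4 * Real.exp |(-c)| = c ^ 4 * Real.exp |c| := by
    rw [abs_neg]; ring
  rw [h3] at h2
  rw [Real.cosh_eq, abs_le]
  constructor <;> nlinarith

theorem cosh_le_exp_abs (c : ℝ) : Real.cosh c ≤ Real.exp |c| := by
  rw [Real.cosh_eq]
  have h1 : Real.exp c ≤ Real.exp |c| := Real.exp_le_exp.2 (le_abs_self c)
  have h2 : Real.exp (-c) ≤ Real.exp |c| := Real.exp_le_exp.2 (neg_le_abs c)
  linarith

set_option maxHeartbeats 1000000 in
theorem taylor_scalar {s : ℝ} (hs : 0 ≤ s) : ∃ K : ℝ, 0 < K ∧ ∀ X σ b a : ℝ, 0 ≤ X →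
    |σ| ≤ 1 / 4 → 0 ≤ b → b ≤ 1 → a ^ 2 ≤ X * b →
    |(1 + σ) ^ (-s) * Real.exp (X * σ / (2 * (1 + σ)) - b / (2 * (1 + σ))) *
      Real.cosh (a / (1 + σ)) - (1 + σ * (X / 2 - s) + (a ^ 2 - b) / 2)| ≤
      K * (σ ^ 2 + b ^ 2) * Real.exp (7 / 16 * X) := by
  refine ⟨(2 * (2 * s + 1) ^ 2 + 4 + 2 * (2 * s + 1) + 1 + (2 * s + 2)) *
    (400 * Real.exp (s + 6)), by positivity, ?_⟩
  intro X σ b a hX hσ hb hb1 ha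
  obtain ⟨hσ1, hσ2⟩ := abs_le.1 hσ
  set r : ℝ := (1 + σ)⁻¹ with hr
  have hpos : 0 < 1 + σ := by linarith
  have hrpos : 0 < r := inv_pos.2 hpos
  have hrmul : (1 + σ) * r = 1 := mul_inv_cancel₀ hpos.ne'
  have hr43 : r ≤ 4 / 3 := by
    rw [hr, inv_eq_one_div, div_le_div_iff₀ hpos (by norm_num)]; linarith
  set Q := σ ^ 2 + b ^ 2 with hQ
  have hQ0 : 0 ≤ Q := by positivity
  set c := a / (1 + σ) with hc
  have hcr : c = a * r := by rw [hc, hr, div_eq_mul_inv]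
  set L := -s * Real.log (1 + σ) + X * σ / (2 * (1 + σ)) - b / (2 * (1 + σ)) with hL
  have hexp : (1 + σ) ^ (-s) * Real.exp (X * σ / (2 * (1 + σ)) - b / (2 * (1 + σ))) =
      Real.exp L := by
    rw [Real.rpow_def_of_pos hpos, ← Real.exp_add, hL]; ring_nf
  have hLr : L = -s * Real.log (1 + σ) + X * (σ * r) / 2 - b * r / 2 := by
    rw [hL, hr]; field_simp
  have hσr : σ * r = σ - σ ^ 2 * r := by
    have : σ * r * (1 + σ) = (σ - σ ^ 2 * r) * (1 + σ) := by
      have : r * (1 + σ) = 1 := by rw [mul_comm]; exact hrmul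
      linear_combination (σ + σ ^ 2) * this
    exact mul_right_cancel₀ hpos.ne' this
  have hr1 : r = 1 - σ * r := by linarith
  have hlog1 : Real.log (1 + σ) ≤ σ := by have := Real.log_le_sub_one_of_pos hpos; linarith
  have hlog2 : σ - σ ^ 2 * r ≤ Real.log (1 + σ) := by
    have := Real.one_sub_inv_le_log_of_pos hpos
    rw [← hr] at this; linarith
  have hσ2r : σ ^ 2 * r ≤ 4 / 3 * σ ^ 2 := by nlinarith [sq_nonneg σ]
  have hσ2r0 : 0 ≤ σ ^ 2 * r := by positivity
  have habsσr : |σ * r| ≤ 4 / 3 * |σ| := by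
    rw [abs_mul, abs_of_pos hrpos]; nlinarith [abs_nonneg σ]
  have hlogabs : |Real.log (1 + σ)| ≤ 4 / 3 * |σ| := by
    rw [abs_le]
    constructor
    · have := (abs_le.1 habsσr).1; linarith
    · have := le_abs_self σ; have := abs_nonneg σ; linarith
  have hσb : b * |σ| ≤ Q / 2 := by
    have : Q = |σ| ^ 2 + b ^ 2 := by rw [sq_abs]
    nlinarith [sq_nonneg (b - |σ|)]
  have hσQ : σ ^ 2 ≤ Q := by rw [hQ]; nlinarith [sq_nonneg b]
  have hbQ : b ^ 2 ≤ Q := by rw [hQ]; nlinarith [sq_nonneg σ]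
  have hb43 : |b * r / 2| ≤ 2 / 3 * b := by
    rw [abs_of_nonneg (by positivity)]
    have := mul_le_mul_of_nonneg_left hr43 hb
    linarith
  have hXσ : |X * (σ * r) / 2| ≤ 2 / 3 * X * |σ| := by
    rw [abs_div, abs_mul, abs_of_nonneg hX, abs_two]
    have := mul_le_mul_of_nonneg_left habsσr hX
    linarith
  have hslog : |-s * Real.log (1 + σ)| ≤ 4 / 3 * s * |σ| := by
    rw [abs_mul, abs_neg, abs_of_nonneg hs]
    have := mul_le_mul_of_nonneg_left hlogabs hs
    linarith
  have hLabs : |L| ≤ 4 / 3 * s * |σ| + 2 / 3 * X * |σ| + 2 / 3 * b := by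
    rw [hLr]
    refine (abs_sub _ _).trans (add_le_add ((abs_add_le _ _).trans (add_le_add hslog hXσ)) hb43)
  have hL1 : |L| ≤ (2 * s + 1) * (|σ| + b) * (1 + X) := by
    refine hLabs.trans ?_
    have h0 := abs_nonneg σ
    have e1 : 0 ≤ s * |σ| := by positivity
    have e2 : 0 ≤ X * |σ| := by positivity
    have e3 : 0 ≤ s * b := by positivity
    have e4 : 0 ≤ X * b := by positivity
    have e5 : 0 ≤ s * |σ| * X := by positivity
    have e6 : 0 ≤ s * b * X := by positivity
    nlinarith
  have hL2 : |L| ≤ s + 1 + X / 6 := by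
    refine hLabs.trans ?_
    have e1 : s * |σ| ≤ s * (1 / 4) := mul_le_mul_of_nonneg_left hσ hs
    have e2 : X * |σ| ≤ X * (1 / 4) := mul_le_mul_of_nonneg_left hσ hX
    nlinarith
  have hLL : L ^ 2 ≤ 2 * (2 * s + 1) ^ 2 * Q * (1 + X) ^ 2 := by
    rw [← sq_abs]
    calc |L| ^ 2 ≤ ((2 * s + 1) * (|σ| + b) * (1 + X)) ^ 2 := by gcongr
      _ = (2 * s + 1) ^ 2 * (1 + X) ^ 2 * (|σ| + b) ^ 2 := by ring
      _ ≤ (2 * s + 1) ^ 2 * (1 + X) ^ 2 * (2 * Q) := by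
        have : Q = |σ| ^ 2 + b ^ 2 := by rw [sq_abs]
        refine mul_le_mul_of_nonneg_left ?_ (by positivity)
        nlinarith [sq_nonneg (b - |σ|)]
      _ = _ := by ring
  have hLL0 : |L - (σ * (X / 2 - s) - b / 2)| ≤ (2 * s + 2) * Q * (1 + X) := by
    have e : L - (σ * (X / 2 - s) - b / 2) =
        -s * (Real.log (1 + σ) - σ) - X * (σ ^ 2 * r) / 2 + b * (σ * r) / 2 := by
      rw [hLr]
      linear_combination (X / 2) * hσr - (b / 2) * hr1
    rw [e]
    have e1 : |-s * (Real.log (1 + σ) - σ)| ≤ s * (4 / 3 * σ ^ 2) := by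
      rw [abs_mul, abs_neg, abs_of_nonneg hs]
      refine mul_le_mul_of_nonneg_left ?_ hs
      rw [abs_le]; constructor <;> linarith
    have e2 : |X * (σ ^ 2 * r) / 2| ≤ X * (2 / 3 * σ ^ 2) := by
      rw [abs_of_nonneg (by positivity)]
      have := mul_le_mul_of_nonneg_left hσ2r hX
      linarith
    have e3 : |b * (σ * r) / 2| ≤ 2 / 3 * (b * |σ|) := by
      rw [abs_div, abs_mul, abs_of_nonneg hb, abs_two]
      have := mul_le_mul_of_nonneg_left habsσr hb
      linarith
    have h := (abs_add_le (-s * (Real.log (1 + σ) - σ) - X * (σ ^ 2 * r) / 2)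
      (b * (σ * r) / 2)).trans (add_le_add ((abs_sub _ _).trans (add_le_add e1 e2)) e3)
    refine h.trans ?_
    have f1 : s * σ ^ 2 ≤ s * Q := by gcongr
    have f2 : X * σ ^ 2 ≤ X * Q := by gcongr
    have f3 : 0 ≤ s * Q * X := by positivity
    have f4 : 0 ≤ s * Q := by positivity
    have f5 : 0 ≤ X * Q := by positivity
    have f6 : (2 * s + 2) * Q * (1 + X) = 2 * (s * Q) + 2 * Q + 2 * (s * Q * X) + 2 * (X * Q) := by
      ring
    rw [f6]; linarith
  have ha0 : 0 ≤ a ^ 2 := sq_nonneg a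
  have hc2 : c ^ 2 ≤ 16 / 9 * (X * b) := by
    rw [hcr, mul_pow]
    have h9 : r ^ 2 ≤ 16 / 9 := by
      have := pow_le_pow_left₀ hrpos.le hr43 2
      norm_num at this ⊢; linarith
    calc a ^ 2 * r ^ 2 ≤ (X * b) * (16 / 9) := by gcongr
      _ = _ := by ring
  have hXb : 0 ≤ X * b := by positivity
  have hc4 : c ^ 4 ≤ 4 * (1 + X) ^ 2 * Q := by
    have : c ^ 4 ≤ (16 / 9 * (X * b)) ^ 2 := by
      rw [show c ^ 4 = (c ^ 2) ^ 2 by ring]; gcongr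
    refine this.trans ?_
    have e1 : X ^ 2 ≤ (1 + X) ^ 2 := by gcongr; linarith
    have e2 : X ^ 2 * b ^ 2 ≤ (1 + X) ^ 2 * Q := by gcongr
    have e3 : 0 ≤ (1 + X) ^ 2 * Q := by positivity
    have e4 : (16 / 9 * (X * b)) ^ 2 = 256 / 81 * (X ^ 2 * b ^ 2) := by ring
    rw [e4]; linarith
  have hcabs : |c| ≤ X / 10 + 5 := by
    refine abs_le_of_sq_le_sq ?_ (by positivity)
    have h5 : X * b ≤ X := mul_le_of_le_one_right hX hb1
    have h6 := sq_nonneg (X / 10 - 5)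
    have h7 : (X / 10 + 5) ^ 2 = (X / 10 - 5) ^ 2 + 2 * X := by ring
    rw [h7]; linarith
  have hca : |c ^ 2 - a ^ 2| ≤ 2 * Q * (1 + X) ^ 2 := by
    have e : c ^ 2 - a ^ 2 = a ^ 2 * (-(σ * r) * (r + 1)) := by
      rw [hcr]
      linear_combination a ^ 2 * (r + 1) * hr1
    rw [e, abs_mul, abs_of_nonneg ha0, abs_mul, abs_neg, abs_of_nonneg (by positivity : 0 ≤ r + 1)]
    calc a ^ 2 * (|σ * r| * (r + 1)) ≤ (X * b) * ((4 / 3 * |σ|) * (4 / 3 + 1)) := by gcongr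
      _ = 28 / 9 * X * (b * |σ|) := by ring
      _ ≤ 28 / 9 * X * (Q / 2) := by gcongr
      _ = 2 * Q * (1 + X) ^ 2 - Q * (2 + 22 / 9 * X + 2 * X ^ 2) := by ring
      _ ≤ _ := sub_le_self _ (by positivity)
  set ee := Real.exp |L| * Real.exp |c| with hee
  have hee1 : 1 ≤ ee := by
    rw [hee]
    exact one_le_mul_of_one_le_of_one_le (Real.one_le_exp (abs_nonneg _))
      (Real.one_le_exp (abs_nonneg _))
  set Z := Q * (1 + X) ^ 2 * ee with hZ
  have hZ1 : Q * (1 + X) ^ 2 ≤ Z := by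
    rw [hZ]; exact le_mul_of_one_le_right (by positivity) hee1
  have t1 : |(Real.exp L - 1 - L) * Real.cosh c| ≤ 2 * (2 * s + 1) ^ 2 * Z := by
    rw [abs_mul, abs_of_pos (Real.cosh_pos c)]
    calc |Real.exp L - 1 - L| * Real.cosh c ≤ (L ^ 2 * Real.exp |L|) * Real.exp |c| := by
          gcongr
          · exact abs_exp_sub_one_sub_le L
          · exact cosh_le_exp_abs c
      _ = L ^ 2 * ee := by rw [hee]; ring
      _ ≤ (2 * (2 * s + 1) ^ 2 * Q * (1 + X) ^ 2) * ee := by gcongr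
      _ = _ := by rw [hZ]; ring
  have t2 : |(1 + L) * (Real.cosh c - 1 - c ^ 2 / 2)| ≤ 4 * Z := by
    rw [abs_mul]
    have : |1 + L| ≤ Real.exp |L| := by
      refine (abs_add_le _ _).trans ?_
      rw [abs_one, add_comm]; exact Real.add_one_le_exp _
    calc |1 + L| * |Real.cosh c - 1 - c ^ 2 / 2| ≤ Real.exp |L| * (c ^ 4 * Real.exp |c|) := by
          gcongr
          exact abs_cosh_sub_le c
      _ = c ^ 4 * ee := by rw [hee]; ring
      _ ≤ (4 * (1 + X) ^ 2 * Q) * ee := by gcongr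
      _ = _ := by rw [hZ]; ring
  have t3 : |L * c ^ 2 / 2| ≤ 2 * (2 * s + 1) * Z := by
    rw [abs_div, abs_mul, abs_of_nonneg (sq_nonneg c), abs_two]
    have e0 : (|σ| + b) * b ≤ 2 * Q := by
      have : (|σ| + b) * b = b * |σ| + b ^ 2 := by ring
      linarith
    calc |L| * c ^ 2 / 2 ≤ ((2 * s + 1) * (|σ| + b) * (1 + X)) * (16 / 9 * (X * b)) / 2 := by gcongr
      _ = 8 / 9 * (2 * s + 1) * (1 + X) * X * ((|σ| + b) * b) := by ring
      _ ≤ 8 / 9 * (2 * s + 1) * (1 + X) * (1 + X) * (2 * Q) := by gcongr; linarith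
      _ = 16 / 9 * (2 * s + 1) * (Q * (1 + X) ^ 2) := by ring
      _ ≤ 2 * (2 * s + 1) * Z := by gcongr; norm_num
  have t4 : |(c ^ 2 - a ^ 2) / 2| ≤ 1 * Z := by
    rw [abs_div, abs_two]; linarith
  have t5 : |L - (σ * (X / 2 - s) - b / 2)| ≤ (2 * s + 2) * Z := by
    refine hLL0.trans ?_
    rw [mul_assoc]
    refine mul_le_mul_of_nonneg_left (le_trans ?_ hZ1) (by positivity)
    refine mul_le_mul_of_nonneg_left ?_ hQ0
    have : (1 + X) ^ 2 = (1 + X) + (X + X ^ 2) := by ring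
    rw [this]; exact le_add_of_nonneg_right (by positivity)
  have hid : Real.exp L * Real.cosh c - (1 + σ * (X / 2 - s) + (a ^ 2 - b) / 2) =
      (Real.exp L - 1 - L) * Real.cosh c + (1 + L) * (Real.cosh c - 1 - c ^ 2 / 2) +
      L * c ^ 2 / 2 + (c ^ 2 - a ^ 2) / 2 + (L - (σ * (X / 2 - s) - b / 2)) := by ring
  have hZb : Z ≤ 400 * Real.exp (s + 6) * Q * Real.exp (7 / 16 * X) := by
    have g1 : ee ≤ Real.exp (s + 6 + 4 / 15 * X) := by
      rw [hee, ← Real.exp_add]; exact Real.exp_le_exp.2 (by linarith)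
    have g2 : (1 + X) ^ 2 ≤ 400 * Real.exp (X / 10) := by
      have : 1 + X ≤ 20 * Real.exp (X / 20) := by
        have := Real.add_one_le_exp (X / 20); linarith
      calc (1 + X) ^ 2 ≤ (20 * Real.exp (X / 20)) ^ 2 := by gcongr
        _ = 400 * Real.exp (X / 10) := by
          rw [mul_pow, ← Real.exp_nat_mul]; norm_num; ring_nf
    calc Z ≤ Q * (400 * Real.exp (X / 10)) * Real.exp (s + 6 + 4 / 15 * X) := by
          rw [hZ]; gcongr
      _ = 400 * Q * Real.exp (X / 10 + (s + 6 + 4 / 15 * X)) := by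
          rw [Real.exp_add (X / 10)]; ring
      _ ≤ 400 * Q * Real.exp (s + 6 + 7 / 16 * X) := by
          gcongr 400 * Q * Real.exp ?_; linarith
      _ = _ := by rw [Real.exp_add (s + 6)]; ring
  rw [hexp, hid]
  refine (abs_add_le _ _).trans ((add_le_add ((abs_add_le _ _).trans (add_le_add
    ((abs_add_le _ _).trans (add_le_add ((abs_add_le _ _).trans (add_le_add t1 t2)) t3)) t4))
    t5).trans ?_)
  rw [← add_mul, ← add_mul, ← add_mul, ← add_mul]
  refine (mul_le_mul_of_nonneg_left hZb (by positivity)).trans (le_of_eq ?_)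
  ring

theorem half_gauss_add {d : ℕ} {T s : ℝ} (hT : 0 < T) (hs : |s| ≤ T / 4) (x y : Ed d) :
    (gauss d (T + s) (x + y) + gauss d (T + s) (x - y)) / 2 =
      gauss d T x * ((1 + s / T) ^ (-((d : ℝ) / 2)) *
        Real.exp (‖x‖ ^ 2 / T * (s / T) / (2 * (1 + s / T)) - ‖y‖ ^ 2 / T / (2 * (1 + s / T))) *
        Real.cosh (⟪x, y⟫ / T / (1 + s / T))) := by
  have h1 := abs_le.1 hs
  have hpos : 0 < 1 + s / T := by
    have : -(1 / 4) ≤ s / T := by rw [le_div_iff₀ hT]; linarith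
    linarith
  have hTs : T + s = T * (1 + s / T) := by field_simp
  have hp : 0 < T + s := by linarith
  have e1 : (2 * Real.pi * (T + s)) ^ (-(d : ℝ) / 2) =
      (2 * Real.pi * T) ^ (-(d : ℝ) / 2) * (1 + s / T) ^ (-((d : ℝ) / 2)) := by
    rw [hTs, ← mul_assoc, Real.mul_rpow (by positivity) hpos.le, neg_div]
  have e2 : ∀ r : ℝ, Real.exp (-(‖x‖ ^ 2 + 2 * r + ‖y‖ ^ 2) / (2 * (T + s))) =
      Real.exp (-‖x‖ ^ 2 / (2 * T)) *
      Real.exp (‖x‖ ^ 2 / T * (s / T) / (2 * (1 + s / T)) - ‖y‖ ^ 2 / T / (2 * (1 + s / T))) *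
      Real.exp (-(r / T / (1 + s / T))) := by
    intro r
    rw [← Real.exp_add, ← Real.exp_add]
    congr 1
    field_simp
    ring
  have e3 : ‖x + y‖ ^ 2 = ‖x‖ ^ 2 + 2 * ⟪x, y⟫ + ‖y‖ ^ 2 := norm_add_sq_real x y
  have e4 : ‖x - y‖ ^ 2 = ‖x‖ ^ 2 + 2 * (-⟪x, y⟫) + ‖y‖ ^ 2 := by
    rw [norm_sub_sq_real]; ring
  unfold gauss
  rw [e3, e4, e2, e2, e1, Real.cosh_eq]
  have e5 : -(-⟪x, y⟫ / T / (1 + s / T)) = ⟪x, y⟫ / T / (1 + s / T) := by ring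
  rw [e5]
  ring

theorem taylor_gauss (d : ℕ) : ∃ K > 0, ∀ (T s : ℝ), 0 < T → |s| ≤ T / 4 → ∀ x y : Ed d,
    |(gauss d (T + s) (x + y) + gauss d (T + s) (x - y)) / 2 -
      gauss d T x * (1 + s / T * (‖x‖ ^ 2 / T / 2 - (d : ℝ) / 2) +
        ((⟪x, y⟫ / T) ^ 2 - ‖y‖ ^ 2 / T) / 2)| ≤
    K * ((s / T) ^ 2 + (‖y‖ ^ 2 / T) ^ 2) * gauss d (8 * T) x +
    K * min 1 ((‖y‖ ^ 2 / T) ^ 2) * (gauss d (8 * T) (x + y) + gauss d (8 * T) (x - y)) := by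
  obtain ⟨K, hK, H⟩ := taylor_scalar (s := (d : ℝ) / 2) (by positivity)
  set K1 : ℝ := 11 ^ ((d : ℝ) / 2) with hK1
  have hK1p : 0 < K1 := by positivity
  set K8 : ℝ := 8 ^ ((d : ℝ) / 2) with hK8
  have hK8p : 0 < K8 := by positivity
  refine ⟨(K + 40 * (2 + d)) * K8 + K1, by positivity, fun T s hT hs x y => ?_⟩
  have hb : 0 ≤ ‖y‖ ^ 2 / T := by positivity
  have hX : 0 ≤ ‖x‖ ^ 2 / T := by positivity
  have hσ : |s / T| ≤ 1 / 4 := by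
    rw [abs_div, abs_of_pos hT, div_le_iff₀ hT]; linarith
  have ha : (⟪x, y⟫ / T) ^ 2 ≤ ‖x‖ ^ 2 / T * (‖y‖ ^ 2 / T) := by
    have h := real_inner_mul_inner_self_le x y
    rw [real_inner_self_eq_norm_sq, real_inner_self_eq_norm_sq] at h
    rw [div_pow, div_mul_div_comm, ← sq, sq ⟪x, y⟫]
    exact div_le_div_of_nonneg_right h (by positivity)
  have hg := gauss_mul_exp hT x
  have gT := gauss_nonneg (d := d) hT.le x
  have g8 := gauss_nonneg (d := d) (by positivity : 0 ≤ 8 * T) x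
  have g8a := gauss_nonneg (d := d) (by positivity : 0 ≤ 8 * T) (x + y)
  have g8b := gauss_nonneg (d := d) (by positivity : 0 ≤ 8 * T) (x - y)
  set X := ‖x‖ ^ 2 / T
  set b := ‖y‖ ^ 2 / T
  set a := ⟪x, y⟫ / T
  set σ := s / T
  by_cases hb1 : b ≤ 1
  · rw [half_gauss_add hT hs x y, ← mul_sub, abs_mul, abs_of_nonneg gT]
    have h0 := H X σ b a hX hσ hb hb1 ha
    calc _ ≤ gauss d T x * (K * (σ ^ 2 + b ^ 2) * Real.exp (7 / 16 * X)) :=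
          mul_le_mul_of_nonneg_left h0 gT
      _ = K * (σ ^ 2 + b ^ 2) * (gauss d T x * Real.exp (7 / 16 * X)) := by ring
      _ = K * K8 * ((σ ^ 2 + b ^ 2) * gauss d (8 * T) x) := by rw [hg]; ring
      _ ≤ ((K + 40 * (2 + d)) * K8 + K1) * ((σ ^ 2 + b ^ 2) * gauss d (8 * T) x) := by
          refine mul_le_mul_of_nonneg_right ?_ (by positivity)
          have : 0 ≤ 40 * (2 + (d : ℝ)) * K8 := by positivity
          linarith
      _ ≤ _ := by
          rw [← mul_assoc]
          refine le_add_of_nonneg_right (mul_nonneg (by positivity) (by positivity))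
  · push Not at hb1
    have hmin : min 1 (b ^ 2) = 1 := min_eq_left (one_le_pow₀ hb1.le)
    have h1 := abs_le.1 hs
    have hTs : 0 < T + s := by linarith
    have ga := gauss_le_of_le (d := d) (T' := 8 * T) (c := 11) hTs (by linarith) (by linarith)
    have gsum : |(gauss d (T + s) (x + y) + gauss d (T + s) (x - y)) / 2| ≤
        K1 * (gauss d (8 * T) (x + y) + gauss d (8 * T) (x - y)) := by
      have e1 := ga (x + y)
      have e2 := ga (x - y)
      have e3 := gauss_nonneg (d := d) hTs.le (x + y)
      have e4 := gauss_nonneg (d := d) hTs.le (x - y)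
      rw [abs_of_nonneg (by positivity), mul_add]
      linarith
    have hexp : 1 + X ≤ 20 * Real.exp (7 / 16 * X) := by
      have := Real.add_one_le_exp (7 / 16 * X); linarith
    have hpoly : |1 + σ * (X / 2 - (d : ℝ) / 2) + (a ^ 2 - b) / 2| ≤
        (2 + d) * 2 * (1 + X) * b ^ 2 := by
      have hbb : b ≤ b ^ 2 := by rw [sq]; exact le_mul_of_one_le_left hb hb1.le
      have hb2 : 1 ≤ b ^ 2 := one_le_pow₀ hb1.le
      have q1 : |σ * (X / 2 - (d : ℝ) / 2)| ≤ 1 * (X + d) := by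
        rw [abs_mul]
        refine mul_le_mul (by linarith) ?_ (abs_nonneg _) (by norm_num)
        have hd0 : (0 : ℝ) ≤ d := by positivity
        rw [abs_le]; constructor <;> linarith
      have q2 : |(a ^ 2 - b) / 2| ≤ (1 + X) * b ^ 2 := by
        have e1 : X * b ≤ X * b ^ 2 := by gcongr
        have e2 : 0 ≤ a ^ 2 := sq_nonneg a
        have e3 : (1 + X) * b ^ 2 = b ^ 2 + X * b ^ 2 := by ring
        have e4 : 0 ≤ X * b := by positivity
        rw [e3, abs_le]; constructor <;> linarith
      have hXd : 1 + 1 * (X + d) ≤ (2 + d) * (1 + X) * b ^ 2 := by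
        have : (2 + d) * (1 + X) * 1 ≤ (2 + d) * (1 + X) * b ^ 2 := by gcongr
        have h0 : 0 ≤ (d : ℝ) * X := by positivity
        have : (2 + (d : ℝ)) * (1 + X) * 1 = 2 + d + 2 * X + d * X := by ring
        linarith
      have hq : (1 + X) * b ^ 2 ≤ (2 + d) * (1 + X) * b ^ 2 := by
        have : 0 ≤ (1 + (d : ℝ)) * ((1 + X) * b ^ 2) := by positivity
        have h2 : (2 + (d : ℝ)) * (1 + X) * b ^ 2 =
          (1 + (d : ℝ)) * ((1 + X) * b ^ 2) + (1 + X) * b ^ 2 := by ring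
        linarith
      calc _ ≤ |1 + σ * (X / 2 - (d : ℝ) / 2)| + |(a ^ 2 - b) / 2| := abs_add_le _ _
        _ ≤ |1| + |σ * (X / 2 - (d : ℝ) / 2)| + |(a ^ 2 - b) / 2| := by
            gcongr; exact abs_add_le _ _
        _ ≤ (2 + d) * (1 + X) * b ^ 2 + (2 + d) * (1 + X) * b ^ 2 := by
            rw [abs_one]; linarith
        _ = _ := by ring
    have gpoly : |gauss d T x * (1 + σ * (X / 2 - (d : ℝ) / 2) + (a ^ 2 - b) / 2)| ≤
        40 * (2 + d) * K8 * (b ^ 2 * gauss d (8 * T) x) := by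
      rw [abs_mul, abs_of_nonneg gT]
      calc _ ≤ gauss d T x * ((2 + d) * 2 * (20 * Real.exp (7 / 16 * X)) * b ^ 2) := by
            refine mul_le_mul_of_nonneg_left (hpoly.trans ?_) gT
            gcongr
        _ = 40 * (2 + d) * b ^ 2 * (gauss d T x * Real.exp (7 / 16 * X)) := by ring
        _ = _ := by rw [hg]; ring
    refine (abs_sub _ _).trans ((add_le_add gsum gpoly).trans ?_)
    rw [hmin, mul_one]
    have z1 : 40 * (2 + d) * K8 * (b ^ 2 * gauss d (8 * T) x) ≤
        ((K + 40 * (2 + d)) * K8 + K1) * ((σ ^ 2 + b ^ 2) * gauss d (8 * T) x) := by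
      refine mul_le_mul ?_ ?_ (by positivity) (by positivity)
      · have : 0 ≤ K * K8 := by positivity
        linarith
      · refine mul_le_mul_of_nonneg_right ?_ g8
        have := sq_nonneg σ
        linarith
    have z2 : K1 * (gauss d (8 * T) (x + y) + gauss d (8 * T) (x - y)) ≤
        ((K + 40 * (2 + d)) * K8 + K1) * (gauss d (8 * T) (x + y) + gauss d (8 * T) (x - y)) := by
      refine mul_le_mul_of_nonneg_right ?_ (by positivity)
      have : 0 ≤ (K + 40 * (2 + (d : ℝ))) * K8 := by positivity
      linarith
    rw [mul_assoc _ (σ ^ 2 + b ^ 2)]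
    linarith

/-- The time derivative of the heat kernel. -/
def dgauss (d : ℕ) (T : ℝ) (x : Ed d) : ℝ :=
  gauss d T x * (1 / T * (‖x‖ ^ 2 / T / 2 - (d : ℝ) / 2))

def KA (d : ℕ) : ℝ := 20 * (1 + d) * 8 ^ ((d : ℝ) / 2)

theorem KA_pos (d : ℕ) : 0 < KA d := by unfold KA; positivity

theorem abs_dgauss_le {T : ℝ} (hT : 0 < T) (x : Ed d) :
    |dgauss d T x| ≤ KA d / T * gauss d (8 * T) x := by
  have hX : 0 ≤ ‖x‖ ^ 2 / T := by positivity
  have hg := gauss_mul_exp hT x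
  have gT := gauss_nonneg (d := d) hT.le x
  unfold dgauss
  set X := ‖x‖ ^ 2 / T
  have hexp : 1 + X ≤ 20 * Real.exp (7 / 16 * X) := by
    have := Real.add_one_le_exp (7 / 16 * X); linarith
  have hd0 : (0 : ℝ) ≤ d := by positivity
  have h1 : |X / 2 - (d : ℝ) / 2| ≤ (1 + d) * (1 + X) := by
    have : 0 ≤ d * X := by positivity
    rw [abs_le]; constructor <;> nlinarith
  rw [abs_mul, abs_of_nonneg gT, abs_mul, abs_of_pos (by positivity : 0 < 1 / T)]
  calc gauss d T x * (1 / T * |X / 2 - (d : ℝ) / 2|)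
      ≤ gauss d T x * (1 / T * ((1 + d) * (20 * Real.exp (7 / 16 * X)))) := by
        gcongr; exact h1.trans (by gcongr)
    _ = 20 * (1 + d) / T * (gauss d T x * Real.exp (7 / 16 * X)) := by ring
    _ = _ := by rw [hg]; unfold KA; ring

theorem measurable_dgauss (T : ℝ) : Measurable (dgauss d T) := by
  unfold dgauss gauss; fun_prop

def AT (d : ℕ) (T : ℝ) : LF d :=
  if h : 0 < T then ⟨dgauss d T, measurable_dgauss T,
    ((integrable_gauss (d := d) (t := 8 * T) (by positivity)).const_mul (KA d / T)).mono'
      (measurable_dgauss T).aestronglyMeasurable (Eventually.of_forall (abs_dgauss_le h)),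
    KA d / T * (8 * T) ^ (-(d : ℝ) / 2), fun x => (abs_dgauss_le h x).trans
      (mul_le_mul_of_nonneg_left (gauss_le (by positivity) x)
        (div_nonneg (KA_pos d).le h.le))⟩ else 0

theorem AT_apply {T : ℝ} (hT : 0 < T) (x : Ed d) : AT d T x = dgauss d T x := by
  simp [AT, hT]

theorem NB_of_gauss_le {n : ℕ} {f : LF d} {c T : ℝ} (hc : 0 ≤ c) (hT : 0 < T)
    (hn : T ≤ 2 * n) (h : ∀ x, |f x| ≤ c * gauss d (8 * T) x) :
    NB n f (c * (8 + 65536 * 2 ^ ((d : ℝ) / 2))) := by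
  have h8 : (0 : ℝ) < 8 * T := by positivity
  have h0 : NB n (c • G d (8 * T) : LF d) _ := (NB_G n h8).smul c
  refine (h0.of_abs_le fun x => ?_).mono ?_
  · rw [LF.smul_apply, G_apply h8, abs_of_nonneg (mul_nonneg hc (gauss_nonneg h8.le x))]
    exact h x
  · rw [abs_of_nonneg hc]
    refine mul_le_mul_of_nonneg_left (add_le_add_right ?_ _) hc
    have hn0 : (0 : ℝ) < n := by linarith
    have : (8 * T) ^ 2 / (n : ℝ) ^ 2 ≤ 256 := by
      rw [div_le_iff₀ (by positivity)]
      have : T ^ 2 ≤ (2 * n) ^ 2 := by gcongr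
      nlinarith
    calc 256 * 2 ^ ((d : ℝ) / 2) * ((8 * T) ^ 2 / (n : ℝ) ^ 2)
        ≤ 256 * 2 ^ ((d : ℝ) / 2) * 256 := by gcongr
      _ = _ := by ring

theorem SB_of_gauss_le {f : LF d} {c T : ℝ} (hc : 0 ≤ c) (hT : 0 < T)
    (h : ∀ x, |f x| ≤ c * gauss d (8 * T) x) : SB f (c * T ^ (-(d : ℝ) / 2)) := fun x => by
  refine (h x).trans (mul_le_mul_of_nonneg_left ?_ hc)
  refine (gauss_le (by positivity) x).trans ?_
  exact Real.rpow_le_rpow_of_nonpos hT (by linarith) (by rw [neg_div]; simp; positivity)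

theorem SB_AT {T : ℝ} (hT : 0 < T) : SB (AT d T) (KA d / T * T ^ (-(d : ℝ) / 2)) :=
  SB_of_gauss_le (div_nonneg (KA_pos d).le hT.le) hT fun x => by
    rw [AT_apply hT]; exact abs_dgauss_le hT x

theorem NB_AT {n : ℕ} {T : ℝ} (hT : 0 < T) (hn : T ≤ 2 * n) :
    NB n (AT d T) (KA d / T * (8 + 65536 * 2 ^ ((d : ℝ) / 2))) :=
  NB_of_gauss_le (div_nonneg (KA_pos d).le hT.le) hT hn fun x => by
    rw [AT_apply hT]; exact abs_dgauss_le hT x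

theorem wt_double (n : ℕ) (x : Ed d) : wt n x ≤ 4 * wt (n + n) x := by
  unfold wt
  push_cast
  have : ‖x‖ ^ 4 / ((n : ℝ) + n) ^ 2 = ‖x‖ ^ 4 / (n : ℝ) ^ 2 / 4 := by
    rw [show ((n : ℝ) + n) ^ 2 = (n : ℝ) ^ 2 * 4 by ring, div_div]
  rw [this]; linarith

theorem NB.of_double {n : ℕ} {f : Ed d → ℝ} {c : ℝ} (h : NB (n + n) f c) : NB n f (4 * c) := by
  unfold NB at *
  calc ∫⁻ x, ENNReal.ofReal (|f x| * wt n x)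
      ≤ ∫⁻ x, ENNReal.ofReal 4 * ENNReal.ofReal (|f x| * wt (n + n) x) := by
        refine lintegral_mono fun x => ?_
        rw [← ENNReal.ofReal_mul (by norm_num)]
        refine ENNReal.ofReal_le_ofReal ?_
        calc |f x| * wt n x ≤ |f x| * (4 * wt (n + n) x) :=
              mul_le_mul_of_nonneg_left (wt_double n x) (abs_nonneg _)
          _ = _ := by ring
    _ = ENNReal.ofReal 4 * ∫⁻ x, ENNReal.ofReal (|f x| * wt (n + n) x) :=
        lintegral_const_mul' _ _ ENNReal.ofReal_ne_top
    _ ≤ _ := by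
        rw [ENNReal.ofReal_mul (by norm_num)]; gcongr

/-- `|f|` damped by `min 1 (|y|^2/T)^2`. -/
def LF.damp (f : LF d) (T : ℝ) : LF d :=
  ⟨fun y => |f y| * min 1 ((‖y‖ ^ 2 / T) ^ 2),
    f.meas.abs.mul (measurable_const.min (by fun_prop)),
    f.abs.integ.mul_bdd (c := 1) (by
      have : Measurable fun y : Ed d => min 1 ((‖y‖ ^ 2 / T) ^ 2) :=
        measurable_const.min (by fun_prop)
      exact this.aestronglyMeasurable) (Eventually.of_forall fun y => by
        rw [Real.norm_eq_abs, abs_of_nonneg (le_min (zero_le_one' ℝ) (sq_nonneg _))]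
        exact min_le_left _ _), by
    obtain ⟨C, hC⟩ := f.bdd
    refine ⟨C, fun x => ?_⟩
    rw [abs_mul, abs_abs, abs_of_nonneg (le_min (zero_le_one' ℝ) (sq_nonneg _))]
    exact (mul_le_of_le_one_right (abs_nonneg _) (min_le_left _ _)).trans (hC x)⟩

theorem LF.damp_apply (f : LF d) (T : ℝ) (y : Ed d) :
    f.damp T y = |f y| * min 1 ((‖y‖ ^ 2 / T) ^ 2) := rfl

/-- Second-order expansion remainder of `f * G (T + s)`. -/
def remT (f : LF d) (T s : ℝ) : LF d :=
  f * G d (T + s) - (∫ y, f y) • G d T -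
    (s * (∫ y, f y) + 1 / d * ∫ y, ‖y‖ ^ 2 * f y) • AT d T

structure Sym (f : LF d) : Prop where
  even : ∀ x, f (-x) = f x
  iso : ∀ x : Ed d, ∫ y, f y * ⟪x, y⟫ ^ 2 = ‖x‖ ^ 2 * (1 / d * ∫ y, ‖y‖ ^ 2 * f y)

theorem integrable_mul_sq {m : ℕ} (hm : 0 < m) {f : LF d} {c : ℝ} (h : NB m f c) :
    Integrable fun y => ‖y‖ ^ 2 * f y := by
  refine (h.integrable_sq hm).mono' ((measurable_norm.pow_const 2).mul f.meas).aestronglyMeasurable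
    (Eventually.of_forall fun y => ?_)
  simp [mul_comm]

theorem integrable_mul_inner_sq {m : ℕ} (hm : 0 < m) {f : LF d} {c : ℝ} (h : NB m f c) (x : Ed d) :
    Integrable fun y => f y * ⟪x, y⟫ ^ 2 := by
  refine ((h.integrable_sq hm).const_mul (‖x‖ ^ 2)).mono'
    (f.meas.mul (by fun_prop)).aestronglyMeasurable (Eventually.of_forall fun y => ?_)
  have h1 := real_inner_mul_inner_self_le x y
  rw [real_inner_self_eq_norm_sq, real_inner_self_eq_norm_sq] at h1
  rw [Real.norm_eq_abs, abs_mul, abs_of_nonneg (sq_nonneg ⟪x, y⟫), sq ⟪x, y⟫]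
  calc |f y| * (⟪x, y⟫ * ⟪x, y⟫) ≤ |f y| * (‖x‖ ^ 2 * ‖y‖ ^ 2) := by gcongr
    _ = _ := by ring

theorem integral_comp_neg_mul (f g : LF d) (hf : ∀ x, f (-x) = f x) (x : Ed d) :
    Integrable (fun y => f y * g (x + y)) ∧ ∫ y, f y * g (x + y) = ∫ y, f y * g (x - y) := by
  have h := (f.integrable_mul_sub g x).comp_neg
  have e : (fun y => f (-y) * g (x - -y)) = fun y => f y * g (x + y) := by
    funext y; rw [hf, sub_neg_eq_add]
  refine ⟨by rwa [e] at h, ?_⟩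
  rw [← integral_neg_eq_self (fun y => f y * g (x - y)), e]

theorem integral_lin4 {a b c e : Ed d → ℝ} (ha : Integrable a) (hb : Integrable b)
    (hc : Integrable c) (he : Integrable e) {k₁ k₂ k₃ k₄ : ℝ} :
    ∫ y, (k₁ * a y + k₂ * b y + (k₃ * c y + k₄ * e y)) =
      k₁ * (∫ y, a y) + k₂ * (∫ y, b y) + (k₃ * (∫ y, c y) + k₄ * ∫ y, e y) := by
  have h1 : Integrable fun y => k₁ * a y + k₂ * b y := (ha.const_mul _).add (hb.const_mul _)
  have h2 : Integrable fun y => k₃ * c y + k₄ * e y := (hc.const_mul _).add (he.const_mul _)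
  rw [integral_add h1 h2, integral_add (ha.const_mul _) (hb.const_mul _),
    integral_add (hc.const_mul _) (he.const_mul _)]
  simp only [integral_const_mul]

theorem integral_lin5 {a b c e f : Ed d → ℝ} (ha : Integrable a) (hb : Integrable b)
    (hc : Integrable c) (he : Integrable e) (hf : Integrable f) {k₁ k₂ k₃ k₄ k₅ : ℝ} :
    ∫ y, (k₁ * a y + k₂ * b y - (k₃ * c y + (k₄ * e y - k₅ * f y))) =
      k₁ * (∫ y, a y) + k₂ * (∫ y, b y) -
        (k₃ * (∫ y, c y) + (k₄ * (∫ y, e y) - k₅ * ∫ y, f y)) := by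
  have h1 : Integrable fun y => k₁ * a y + k₂ * b y := (ha.const_mul _).add (hb.const_mul _)
  have h3 : Integrable fun y => k₄ * e y - k₅ * f y := (he.const_mul _).sub (hf.const_mul _)
  have h2 : Integrable fun y => k₃ * c y + (k₄ * e y - k₅ * f y) := (hc.const_mul _).add h3
  rw [integral_sub h1 h2, integral_add (ha.const_mul _) (hb.const_mul _),
    integral_add (hc.const_mul _) h3, integral_sub (he.const_mul _) (hf.const_mul _)]
  simp only [integral_const_mul]

theorem exists_remT_bound (hd : 0 < d) : ∃ K > 0, ∀ (T s : ℝ), 0 < T → |s| ≤ T / 4 →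
    ∀ (f : LF d) (m : ℕ) (c : ℝ), 0 < m → 0 ≤ c → Sym f → NB m f c → ∀ x,
    |remT f T s x| ≤ K * (c * ((s / T) ^ 2 + (m / T) ^ 2)) * gauss d (8 * T) x +
      K * (f.damp T * G d (8 * T)) x := by
  obtain ⟨K, hK, H⟩ := taylor_gauss d
  refine ⟨2 * K, by positivity, fun T s hT hs f m c hm hc hsym hf x => ?_⟩
  have hTs : 0 < T + s := by have := (abs_le.1 hs).1; linarith
  have h8 : 0 < 8 * T := by positivity
  have hd' : (d : ℝ) ≠ 0 := by positivity
  obtain ⟨i1, e1⟩ := integral_comp_neg_mul f (G d (T + s)) hsym.even x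
  have i2 := f.integrable_mul_sub (G d (T + s)) x
  have i3 := integrable_mul_sq hm hf
  have i4 := integrable_mul_inner_sq hm hf x
  set R : Ed d → ℝ := fun y => (gauss d (T + s) (x + y) + gauss d (T + s) (x - y)) / 2 -
      gauss d T x * (1 + s / T * (‖x‖ ^ 2 / T / 2 - (d : ℝ) / 2) +
        ((⟪x, y⟫ / T) ^ 2 - ‖y‖ ^ 2 / T) / 2) with hR
  have hexp : (fun y => f y * R y) = fun y => (1 / 2) * (f y * G d (T + s) (x + y)) +
      (1 / 2) * (f y * G d (T + s) (x - y)) -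
      (gauss d T x * (1 + s / T * (‖x‖ ^ 2 / T / 2 - (d : ℝ) / 2)) * f y +
      (gauss d T x / (2 * T ^ 2) * (f y * ⟪x, y⟫ ^ 2) - gauss d T x / (2 * T) * (‖y‖ ^ 2 * f y))) := by
    funext y
    rw [hR, G_apply hTs, G_apply hTs]
    field_simp
  have hrem : remT f T s x = ∫ y, f y * R y := by
    rw [hexp, integral_lin5 i1 i2 f.integ i4 i3]
    rw [e1, hsym.iso x]
    unfold remT
    simp only [LF.sub_apply, LF.smul_apply, LF.mul_apply, G_apply hT, AT_apply hT]
    unfold dgauss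
    field_simp
    ring
  obtain ⟨j1, k1⟩ := integral_comp_neg_mul (f.damp T) (G d (8 * T)) (fun y => by
    rw [LF.damp_apply, LF.damp_apply, hsym.even, norm_neg]) x
  have j2 := (f.damp T).integrable_mul_sub (G d (8 * T)) x
  have j3 := hf.integrable_pow_four hm
  have j4 : Integrable fun y => |f y| := f.abs.integ
  have hbd : ∀ y, |f y * R y| ≤ K * (s / T) ^ 2 * gauss d (8 * T) x * |f y| +
      K / T ^ 2 * gauss d (8 * T) x * (|f y| * ‖y‖ ^ 4) +
      (K * (f.damp T y * G d (8 * T) (x + y)) + K * (f.damp T y * G d (8 * T) (x - y))) := by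
    intro y
    rw [abs_mul]
    refine (mul_le_mul_of_nonneg_left (H T s hT hs x y) (abs_nonneg _)).trans (le_of_eq ?_)
    rw [G_apply h8, G_apply h8, LF.damp_apply]
    ring
  rw [hrem]
  refine abs_integral_le_integral_abs.trans ((integral_mono_of_nonneg
    (Eventually.of_forall fun y => abs_nonneg _) (((j4.const_mul _).add (j3.const_mul _)).add
      ((j1.const_mul _).add (j2.const_mul _))) (Eventually.of_forall hbd)).trans ?_)
  have hsplit : (∫ y, (K * (s / T) ^ 2 * gauss d (8 * T) x * |f y| +
      K / T ^ 2 * gauss d (8 * T) x * (|f y| * ‖y‖ ^ 4) +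
      (K * (f.damp T y * G d (8 * T) (x + y)) + K * (f.damp T y * G d (8 * T) (x - y))))) =
      K * (s / T) ^ 2 * gauss d (8 * T) x * (∫ y, |f y|) +
      K / T ^ 2 * gauss d (8 * T) x * (∫ y, |f y| * ‖y‖ ^ 4) +
      (K * (f.damp T * G d (8 * T)) x + K * (f.damp T * G d (8 * T)) x) := by
    rw [integral_lin4 j4 j3 j1 j2]
    rw [k1, LF.mul_apply]
  refine (le_of_eq hsplit).trans ?_
  have g8 := gauss_nonneg (d := d) h8.le x
  have a1 : K * (s / T) ^ 2 * gauss d (8 * T) x * (∫ y, |f y|) ≤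
      K * (s / T) ^ 2 * gauss d (8 * T) x * c := by
    gcongr; exact hf.integral_abs_le hc
  have a2 : K / T ^ 2 * gauss d (8 * T) x * (∫ y, |f y| * ‖y‖ ^ 4) ≤
      K / T ^ 2 * gauss d (8 * T) x * ((m : ℝ) ^ 2 * c) := by
    gcongr; exact hf.integral_pow_four_le hm hc
  have a3 : 0 ≤ K * (c * ((s / T) ^ 2 + (m / T) ^ 2)) * gauss d (8 * T) x := by positivity
  have a4 : K * (s / T) ^ 2 * gauss d (8 * T) x * c +
      K / T ^ 2 * gauss d (8 * T) x * ((m : ℝ) ^ 2 * c) =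
      K * (c * ((s / T) ^ 2 + (m / T) ^ 2)) * gauss d (8 * T) x := by
    rw [div_pow (m : ℝ)]; field_simp
  linarith

theorem NB_damp {n m : ℕ} (hm : 0 < m) {f : LF d} {c T : ℝ} (hc : 0 ≤ c) (hT : 0 < T)
    (hn : T ≤ 2 * n) (hf : NB m f c) : NB n (f.damp T) (40 * (c * (m / T) ^ 2)) := by
  have hn0 : (0 : ℝ) < n := by linarith
  have j3 := hf.integrable_pow_four hm
  have hb : ∀ y, |f.damp T y| * wt n y ≤ 40 / T ^ 2 * (|f y| * ‖y‖ ^ 4) := by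
    intro y
    rw [LF.damp_apply, abs_mul, abs_abs, abs_of_nonneg (le_min (zero_le_one' ℝ) (sq_nonneg _)),
      mul_assoc]
    have hw : min 1 ((‖y‖ ^ 2 / T) ^ 2) * wt n y ≤ 40 / T ^ 2 * ‖y‖ ^ 4 := by
      have h1 : min 1 ((‖y‖ ^ 2 / T) ^ 2) ≤ ‖y‖ ^ 4 / T ^ 2 :=
        (min_le_right _ _).trans (le_of_eq (by rw [div_pow]; ring))
      have h2 : min 1 ((‖y‖ ^ 2 / T) ^ 2) * (‖y‖ ^ 4 / n ^ 2) ≤ ‖y‖ ^ 4 / n ^ 2 :=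
        mul_le_of_le_one_left (by positivity) (min_le_left _ _)
      have h3 : ‖y‖ ^ 4 / (n : ℝ) ^ 2 ≤ 4 * (‖y‖ ^ 4 / T ^ 2) := by
        rw [div_le_iff₀ (by positivity)]
        have : T ^ 2 ≤ (2 * n) ^ 2 := by gcongr
        have h4 : 1 ≤ 4 * (n : ℝ) ^ 2 / T ^ 2 := by
          rw [le_div_iff₀ (by positivity)]; linarith
        calc ‖y‖ ^ 4 = ‖y‖ ^ 4 * 1 := by ring
          _ ≤ ‖y‖ ^ 4 * (4 * (n : ℝ) ^ 2 / T ^ 2) := by gcongr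
          _ = _ := by ring
      unfold wt
      have : 40 / T ^ 2 * ‖y‖ ^ 4 = 40 * (‖y‖ ^ 4 / T ^ 2) := by ring
      rw [this, mul_left_comm, mul_add]
      linarith
    calc |f y| * (min 1 ((‖y‖ ^ 2 / T) ^ 2) * wt n y) ≤ |f y| * (40 / T ^ 2 * ‖y‖ ^ 4) := by gcongr
      _ = _ := by ring
  have hint : Integrable fun y => |f.damp T y| * wt n y :=
    (j3.const_mul (40 / T ^ 2)).mono'
      ((f.damp T).meas.abs.mul (measurable_wt n)).aestronglyMeasurable
      (Eventually.of_forall fun y => by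
        rw [Real.norm_eq_abs, abs_of_nonneg (mul_nonneg (abs_nonneg _) (wt_nonneg _ _))]
        exact hb y)
  refine NB.of_integral_le hint ((integral_mono hint (j3.const_mul _) hb).trans ?_)
  rw [integral_const_mul]
  calc 40 / T ^ 2 * (∫ y, |f y| * ‖y‖ ^ 4) ≤ 40 / T ^ 2 * ((m : ℝ) ^ 2 * c) := by
        gcongr; exact hf.integral_pow_four_le hm hc
    _ = _ := by rw [div_pow]; ring

theorem remT_bounds (hd : 0 < d) : ∃ K > 0, ∀ (T s : ℝ), 0 < T → |s| ≤ T / 4 →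
    ∀ (f : LF d) (m : ℕ) (c : ℝ), 0 < m → 0 ≤ c → Sym f → NB m f c →
    SB (remT f T s) (K * (c * ((s / T) ^ 2 + (m / T) ^ 2)) * T ^ (-(d : ℝ) / 2)) ∧
    ∀ n : ℕ, T ≤ 2 * n → NB n (remT f T s) (K * (c * ((s / T) ^ 2 + (m / T) ^ 2))) := by
  obtain ⟨K, hK, H⟩ := exists_remT_bound hd
  set L : ℝ := 8 + 65536 * 2 ^ ((d : ℝ) / 2) with hL
  have hLp : 0 < L := by positivity
  refine ⟨K * (161 * L), by positivity, fun T s hT hs f m c hm hc hsym hf => ?_⟩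
  have h8 : 0 < 8 * T := by positivity
  have hb := H T s hT hs f m c hm hc hsym hf
  set z := c * ((s / T) ^ 2 + (m / T) ^ 2) with hz
  have hz0 : 0 ≤ z := by positivity
  have hcz : c * (m / T) ^ 2 ≤ z := by
    rw [hz]; gcongr; exact le_add_of_nonneg_left (sq_nonneg _)
  have hL1 : (8 : ℝ) ≤ L := by rw [hL]; exact le_add_of_nonneg_right (by positivity)
  have hGSB : SB (G d (8 * T)) (T ^ (-(d : ℝ) / 2)) := fun x => by
    have := SB_of_gauss_le (f := G d (8 * T)) zero_le_one hT (fun x => by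
      rw [G_apply h8, one_mul, abs_of_nonneg (gauss_nonneg h8.le x)]) x
    simpa using this
  have hmajor : ∀ x, |remT f T s x| ≤
      |((K * z) • G d (8 * T) + K • (f.damp T * G d (8 * T)) : LF d) x| := fun x => by
    refine (hb x).trans (le_trans (le_of_eq ?_) (le_abs_self _))
    rw [LF.add_apply, LF.smul_apply, LF.smul_apply, G_apply h8]
  constructor
  · obtain ⟨N, hN⟩ := exists_nat_gt T
    have hN' : T ≤ 2 * (N : ℝ) := by linarith
    have h1 : SB ((K * z) • G d (8 * T) + K • (f.damp T * G d (8 * T)) : LF d) _ :=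
      (hGSB.smul (K * z)).add
      (((NB_damp hm hc hT hN' hf).mul_SB (by positivity) hGSB).smul K)
    refine SB.mono (fun x => (hmajor x).trans (h1 x)) ?_
    rw [abs_of_nonneg (by positivity), abs_of_nonneg hK.le]
    have hT' : 0 ≤ T ^ (-(d : ℝ) / 2) := by positivity
    calc K * z * T ^ (-(d : ℝ) / 2) + K * (40 * (c * (m / T) ^ 2) * T ^ (-(d : ℝ) / 2))
        ≤ K * z * T ^ (-(d : ℝ) / 2) + K * (40 * z * T ^ (-(d : ℝ) / 2)) := by gcongr
      _ = K * (41 * 1) * z * T ^ (-(d : ℝ) / 2) := by ring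
      _ ≤ K * (161 * L) * z * T ^ (-(d : ℝ) / 2) := by gcongr <;> linarith
  · intro n hn
    have hn0 : 0 < n := by
      have : (0 : ℝ) < n := by linarith
      exact_mod_cast this
    have hG : NB n (G d (8 * T)) (1 * L) := NB_of_gauss_le zero_le_one hT hn fun x => by
      rw [G_apply h8, one_mul, abs_of_nonneg (gauss_nonneg h8.le x)]
    have h1 : NB n ((K * z) • G d (8 * T) + K • (f.damp T * G d (8 * T)) : LF d) _ :=
      (hG.smul (K * z)).add (by positivity) (by positivity)
      ((NB.mul hn0 hn0 (by positivity) (NB_damp hm hc hT hn hf) hG).of_double.smul K)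
    refine (h1.of_abs_le hmajor).mono ?_
    rw [abs_of_nonneg (by positivity), abs_of_nonneg hK.le]
    calc K * z * (1 * L) + K * (4 * (40 * (c * (m / T) ^ 2) * (1 * L)))
        ≤ K * z * (1 * L) + K * (4 * (40 * z * (1 * L))) := by gcongr
      _ = _ := by ring

theorem gauss_time_bounds (d : ℕ) : ∃ K > 0, ∀ (T s : ℝ), 0 < T → |s| ≤ T / 4 →
    SB (G d (T + s) - G d T - s • AT d T : LF d) (K * (s / T) ^ 2 * T ^ (-(d : ℝ) / 2)) ∧
    ∀ n : ℕ, T ≤ 2 * n → NB n (G d (T + s) - G d T - s • AT d T : LF d) (K * (s / T) ^ 2) := by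
  obtain ⟨K, hK, H⟩ := taylor_gauss d
  set L : ℝ := 8 + 65536 * 2 ^ ((d : ℝ) / 2) with hL
  have hL1 : (8 : ℝ) ≤ L := by rw [hL]; exact le_add_of_nonneg_right (by positivity)
  refine ⟨K * L, by positivity, fun T s hT hs => ?_⟩
  have hTs : 0 < T + s := by have := (abs_le.1 hs).1; linarith
  have hb : ∀ x, |(G d (T + s) - G d T - s • AT d T : LF d) x| ≤
      K * (s / T) ^ 2 * gauss d (8 * T) x := fun x => by
    have h := H T s hT hs x 0
    simp only [add_zero, sub_zero, inner_zero_right, norm_zero] at h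
    have e1 : min 1 (((0 : ℝ) ^ 2 / T) ^ 2) = 0 := by simp
    rw [e1] at h
    simp only [LF.sub_apply, LF.smul_apply, G_apply hTs, G_apply hT, AT_apply hT, dgauss]
    convert h using 2
    · field_simp; ring
    · simp
  constructor
  · refine (SB_of_gauss_le (by positivity) hT hb).mono ?_
    have : 0 ≤ T ^ (-(d : ℝ) / 2) := by positivity
    gcongr
    exact le_mul_of_one_le_right hK.le (by linarith)
  · intro n hn
    exact (NB_of_gauss_le (by positivity) hT hn hb).mono (le_of_eq (by ring))

/-! Elementary sums of powers. -/

theorem rpow_neg_five_halves_le {x : ℝ} (hx : 1 ≤ x) :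
    x ^ (-(5 / 2 : ℝ)) ≤ 5 / 3 * (x ^ (-(3 / 2 : ℝ)) - (x + 1) ^ (-(3 / 2 : ℝ))) := by
  have hx0 : 0 < x := by linarith
  have h1 : 1 + 3 / 2 * (1 / x) ≤ (1 + 1 / x) ^ (3 / 2 : ℝ) :=
    one_add_mul_self_le_rpow_one_add (by have : 0 < 1 / x := by positivity
                                         linarith) (by norm_num)
  have h2 : (x + 1) ^ (-(3 / 2 : ℝ)) = x ^ (-(3 / 2 : ℝ)) * ((1 + 1 / x) ^ (3 / 2 : ℝ))⁻¹ := by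
    rw [show x + 1 = x * (1 + 1 / x) by field_simp, Real.mul_rpow hx0.le (by positivity),
      Real.rpow_neg (by positivity : 0 ≤ 1 + 1 / x)]
  have h3 : ((1 + 1 / x) ^ (3 / 2 : ℝ))⁻¹ ≤ (1 + 3 / 2 * (1 / x))⁻¹ :=
    inv_anti₀ (by positivity) h1
  have h4 : x ^ (-(5 / 2 : ℝ)) = x ^ (-(3 / 2 : ℝ)) * x⁻¹ := by
    rw [← Real.rpow_neg_one, ← Real.rpow_add hx0]; norm_num
  have h5 : x⁻¹ ≤ 5 / 3 * (1 - (1 + 3 / 2 * (1 / x))⁻¹) := by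
    have : (1 + 3 / 2 * (1 / x))⁻¹ = x / (x + 3 / 2) := by field_simp
    rw [this, one_sub_div (by positivity), ← one_div, div_le_iff₀ hx0]
    rw [show 5 / 3 * ((x + 3 / 2 - x) / (x + 3 / 2)) * x = (5 / 2 * x) / (x + 3 / 2) by ring,
      le_div_iff₀ (by positivity)]
    linarith
  have hp : 0 ≤ x ^ (-(3 / 2 : ℝ)) := by positivity
  rw [h2, h4]
  calc x ^ (-(3 / 2 : ℝ)) * x⁻¹ ≤ x ^ (-(3 / 2 : ℝ)) * (5 / 3 * (1 - (1 + 3 / 2 * (1 / x))⁻¹)) := by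
        gcongr
    _ ≤ x ^ (-(3 / 2 : ℝ)) * (5 / 3 * (1 - ((1 + 1 / x) ^ (3 / 2 : ℝ))⁻¹)) := by gcongr
    _ = _ := by ring

theorem rpow_neg_three_halves_le {x : ℝ} (hx : 1 ≤ x) :
    x ^ (-(3 / 2 : ℝ)) ≤ 4 * (x ^ (-(1 / 2 : ℝ)) - (x + 1) ^ (-(1 / 2 : ℝ))) := by
  have hx0 : 0 < x := by linarith
  have h1 : (1 + -(1 / (x + 1))) ^ (1 / 2 : ℝ) ≤ 1 + 1 / 2 * -(1 / (x + 1)) :=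
    rpow_one_add_le_one_add_mul_self (by
      have : 1 / (x + 1) ≤ 1 := by rw [div_le_one (by linarith)]; linarith
      linarith) (by norm_num) (by norm_num)
  have h2 : (x + 1) ^ (-(1 / 2 : ℝ)) = x ^ (-(1 / 2 : ℝ)) * (1 + -(1 / (x + 1))) ^ (1 / 2 : ℝ) := by
    rw [show 1 + -(1 / (x + 1)) = x * (x + 1)⁻¹ by field_simp; ring,
      Real.mul_rpow hx0.le (by positivity), ← mul_assoc, ← Real.rpow_add hx0, neg_add_cancel,
      Real.rpow_zero, one_mul, Real.inv_rpow (by positivity), Real.rpow_neg (by positivity)]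
  have h4 : x ^ (-(3 / 2 : ℝ)) = x ^ (-(1 / 2 : ℝ)) * x⁻¹ := by
    rw [← Real.rpow_neg_one, ← Real.rpow_add hx0]; norm_num
  have h5 : x⁻¹ ≤ 4 * (1 - (1 + 1 / 2 * -(1 / (x + 1)))) := by
    rw [show 4 * (1 - (1 + 1 / 2 * -(1 / (x + 1)))) = 2 / (x + 1) by ring, ← one_div,
      div_le_div_iff₀ hx0 (by linarith)]
    linarith
  rw [h2, h4]
  calc x ^ (-(1 / 2 : ℝ)) * x⁻¹ ≤ x ^ (-(1 / 2 : ℝ)) * (4 * (1 - (1 + 1 / 2 * -(1 / (x + 1))))) := by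
        gcongr
    _ ≤ x ^ (-(1 / 2 : ℝ)) * (4 * (1 - (1 + -(1 / (x + 1))) ^ (1 / 2 : ℝ))) := by gcongr
    _ = _ := by ring

theorem sum_Ioc_le_of_tele {f g : ℕ → ℝ} {c : ℝ} (hc : 0 ≤ c) (hg : ∀ n, 0 ≤ g n)
    (h : ∀ m, 0 < m → f m ≤ c * (g m - g (m + 1))) (q N : ℕ) :
    ∑ m ∈ Ioc q N, f m ≤ c * g (q + 1) := by
  by_cases hqN : q ≤ N
  · have : ∑ m ∈ Ioc q N, f m ≤ c * (g (q + 1) - g (N + 1)) := by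
      induction N, hqN using Nat.le_induction with
      | base => simp
      | succ n hn ih =>
        rw [sum_Ioc_succ_top hn]
        have := h (n + 1) (by omega)
        linarith
    have h2 : 0 ≤ c * g (N + 1) := mul_nonneg hc (hg _)
    linarith
  · rw [Finset.Ioc_eq_empty (by omega), sum_empty]; exact mul_nonneg hc (hg _)

theorem sum_Ioc_five_halves (q N : ℕ) {t : ℝ} (ht : 0 ≤ t) :
    ∑ m ∈ Ioc q N, ((m : ℝ) + t) ^ (-(5 / 2 : ℝ)) ≤ 5 / 3 * ((q : ℝ) + 1 + t) ^ (-(3 / 2 : ℝ)) := by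
  have := sum_Ioc_le_of_tele (f := fun m : ℕ => ((m : ℝ) + t) ^ (-(5 / 2 : ℝ)))
    (g := fun m : ℕ => ((m : ℝ) + t) ^ (-(3 / 2 : ℝ))) (c := 5 / 3) (by norm_num)
    (fun n => by positivity) (fun m hm => by
      have h1 : (1 : ℝ) ≤ m := by exact_mod_cast hm
      have := rpow_neg_five_halves_le (x := (m : ℝ) + t) (by linarith)
      simp only [Nat.cast_add, Nat.cast_one]
      rwa [add_right_comm (m : ℝ) 1 t]) q N
  simpa using this

theorem sum_Ioc_three_halves (q N : ℕ) :
    ∑ m ∈ Ioc q N, (m : ℝ) ^ (-(3 / 2 : ℝ)) ≤ 4 * ((q : ℝ) + 1) ^ (-(1 / 2 : ℝ)) := by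
  have := sum_Ioc_le_of_tele (f := fun m : ℕ => (m : ℝ) ^ (-(3 / 2 : ℝ)))
    (g := fun m : ℕ => (m : ℝ) ^ (-(1 / 2 : ℝ))) (c := 4) (by norm_num)
    (fun n => by positivity) (fun m hm => by
      have h1 : (1 : ℝ) ≤ m := by exact_mod_cast hm
      simpa using rpow_neg_three_halves_le h1) q N
  simpa using this

theorem sum_Ioc_half (n : ℕ) :
    ∑ m ∈ Ioc 0 n, (m : ℝ) ^ (-(1 / 2 : ℝ)) ≤ 2 * (n : ℝ) ^ (1 / 2 : ℝ) := by
  induction n with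
  | zero => simp
  | succ n ih =>
    rw [sum_Ioc_succ_top (by omega)]
    have hs : ∀ x : ℝ, x ^ (1 / 2 : ℝ) = √x := fun x => (Real.sqrt_eq_rpow x).symm
    rw [Real.rpow_neg (by positivity), hs]
    rw [hs] at ih
    have h0 : 0 < √((n + 1 : ℕ) : ℝ) := Real.sqrt_pos.2 (by positivity)
    have h1 : √((n + 1 : ℕ) : ℝ) ^ 2 = n + 1 := by
      rw [Real.sq_sqrt (by positivity)]; push_cast; ring
    have h2 : √(n : ℝ) ^ 2 = n := Real.sq_sqrt (by positivity)
    have h3 : (√((n + 1 : ℕ) : ℝ))⁻¹ ≤ 2 * √((n + 1 : ℕ) : ℝ) - 2 * √(n : ℝ) := by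
      rw [inv_le_iff_one_le_mul₀ h0]
      nlinarith [sq_nonneg (√((n + 1 : ℕ) : ℝ) - √(n : ℝ))]
    linarith

theorem abs_tsum_sub_sum_le {f g : ℕ → ℝ} (hg : Summable g) (hfg : ∀ m, |f m| ≤ g m)
    (hf0 : f 0 = 0) (q : ℕ) {B : ℝ} (hB : ∀ N, ∑ m ∈ Ioc q N, g m ≤ B) :
    |(∑' m, f m) - ∑ m ∈ Ioc 0 q, f m| ≤ B := by
  have hf : Summable f := Summable.of_norm_bounded hg hfg
  have ht := (hf.hasSum.tendsto_sum_nat.comp (tendsto_add_atTop_nat 1)).sub_const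
    (∑ m ∈ Ioc 0 q, f m)
  refine le_of_tendsto ht.abs ?_
  filter_upwards [eventually_ge_atTop q] with N hN
  have e : ∑ m ∈ range (N + 1), f m = ∑ m ∈ Ioc 0 N, f m := by
    have : range (N + 1) = insert 0 (Ioc 0 N) := by ext i; simp only [mem_range, mem_insert, mem_Ioc]; omega
    rw [this, sum_insert (by simp), hf0, zero_add]
  have e2 := sum_Ioc_consecutive f (Nat.zero_le q) hN
  simp only [Function.comp]
  rw [e, ← e2, add_sub_cancel_left]
  exact (abs_sum_le_sum_abs _ _).trans ((sum_le_sum fun i _ => hfg i).trans (hB N))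

theorem rpow_quarter {n : ℕ} (hn : 0 < n) {a : ℝ} (ha : 0 ≤ a) {x : ℝ} (hx : (n : ℝ) / 4 ≤ x) :
    x ^ (-a) ≤ 4 ^ a * (n : ℝ) ^ (-a) := by
  have hn' : (0 : ℝ) < n := by exact_mod_cast hn
  refine (Real.rpow_le_rpow_of_nonpos (by positivity) hx (by linarith)).trans (le_of_eq ?_)
  rw [Real.div_rpow hn'.le (by norm_num), Real.rpow_neg (by norm_num : (0:ℝ) ≤ 4), div_inv_eq_mul,
    mul_comm]

theorem quarter_le (n : ℕ) : (n : ℝ) / 4 ≤ ((n / 4 : ℕ) : ℝ) + 1 := by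
  have : n ≤ 4 * (n / 4 + 1) := by omega
  have : (n : ℝ) ≤ 4 * (((n / 4 : ℕ) : ℝ) + 1) := by exact_mod_cast this
  linarith

theorem four_rpow_three_halves : (4 : ℝ) ^ (3 / 2 : ℝ) = 8 := by
  rw [show (4 : ℝ) = 2 ^ (2 : ℝ) by norm_num, ← Real.rpow_mul (by norm_num)]; norm_num

theorem four_rpow_half : (4 : ℝ) ^ (1 / 2 : ℝ) = 2 := by
  rw [show (4 : ℝ) = 2 ^ (2 : ℝ) by norm_num, ← Real.rpow_mul (by norm_num)]; norm_num

theorem tail_five_halves {n : ℕ} (hn : 0 < n) (N : ℕ) :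
    ∑ m ∈ Ioc (n / 4) N, (m : ℝ) ^ (-(5 / 2 : ℝ)) ≤ 14 * (n : ℝ) ^ (-(3 / 2 : ℝ)) := by
  have h := sum_Ioc_five_halves (n / 4) N le_rfl
  simp only [add_zero] at h
  have h2 := rpow_quarter hn (a := 3 / 2) (by norm_num) (quarter_le n)
  rw [four_rpow_three_halves] at h2
  have : 0 ≤ (n : ℝ) ^ (-(3 / 2 : ℝ)) := by positivity
  linarith

theorem tail_three_halves {n : ℕ} (hn : 0 < n) (N : ℕ) :
    ∑ m ∈ Ioc (n / 4) N, (m : ℝ) ^ (-(3 / 2 : ℝ)) ≤ 8 * (n : ℝ) ^ (-(1 / 2 : ℝ)) := by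
  have h := sum_Ioc_three_halves (n / 4) N
  have h2 := rpow_quarter hn (a := 1 / 2) (by norm_num) (quarter_le n)
  rw [four_rpow_half] at h2
  linarith

theorem natcast_rpow_anti {m : ℕ} {a b : ℝ} (hb : b ≠ 0) (ha : a ≠ 0) (hab : a ≤ b) :
    (m : ℝ) ^ a ≤ (m : ℝ) ^ b := by
  rcases Nat.eq_zero_or_pos m with h | h
  · subst h; simp [Real.zero_rpow ha, Real.zero_rpow hb]
  · exact Real.rpow_le_rpow_of_exponent_le (by exact_mod_cast h) hab

/-- Lace coefficients of size `β`, normalized at fugacity `w`. -/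
structure LaceData (d : ℕ) (β w : ℝ) (P : ℕ → LF d) : Prop where
  zero : P 0 = 0
  sym : ∀ m, Sym (P m)
  nb : ∀ m, 0 < m → NB m (P m) (β * (m : ℝ) ^ (-((d : ℝ) / 2)))
  w_ge : 1 / 2 ≤ w
  w_le : w ≤ 2
  mass : w + ∑' m, ∫ x, P m x = 1

def mass (P : ℕ → LF d) (m : ℕ) : ℝ := ∫ x, P m x
def var (P : ℕ → LF d) (m : ℕ) : ℝ := 1 / d * ∫ y, ‖y‖ ^ 2 * P m y

def delta (w : ℝ) (P : ℕ → LF d) : ℝ :=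
  (w + ∑' m, var P m) / (w + ∑' m : ℕ, (m : ℝ) * mass P m)

/-- Sum of `m^(-3/2)`. -/
def zeta32 : ℝ := ∑' m : ℕ, (m : ℝ) ^ (-(3 / 2 : ℝ))

theorem summable_32 : Summable fun m : ℕ => (m : ℝ) ^ (-(3 / 2 : ℝ)) :=
  Real.summable_nat_rpow.2 (by norm_num)

theorem summable_52 : Summable fun m : ℕ => (m : ℝ) ^ (-(5 / 2 : ℝ)) :=
  Real.summable_nat_rpow.2 (by norm_num)

theorem zeta32_nonneg : 0 ≤ zeta32 := tsum_nonneg fun m => by positivity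

theorem half_d_ge (hd : 5 ≤ d) : (5 / 2 : ℝ) ≤ (d : ℝ) / 2 := by
  have : (5 : ℝ) ≤ d := by exact_mod_cast hd
  linarith

theorem pow_s_le_52 (hd : 5 ≤ d) (m : ℕ) :
    (m : ℝ) ^ (-((d : ℝ) / 2)) ≤ (m : ℝ) ^ (-(5 / 2 : ℝ)) := by
  have := half_d_ge hd
  exact natcast_rpow_anti (by norm_num) (by linarith) (by linarith)

theorem natcast_mul_rpow_52 (m : ℕ) :
    (m : ℝ) * (m : ℝ) ^ (-(5 / 2 : ℝ)) = (m : ℝ) ^ (-(3 / 2 : ℝ)) := by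
  rcases Nat.eq_zero_or_pos m with h | h
  · subst h; simp [Real.zero_rpow]
  · have h0 : (0 : ℝ) < m := by exact_mod_cast h
    nth_rewrite 1 [← Real.rpow_one (m : ℝ)]
    rw [← Real.rpow_add h0]; norm_num

theorem natcast_sq_mul_rpow_52 (m : ℕ) :
    (m : ℝ) ^ 2 * (m : ℝ) ^ (-(5 / 2 : ℝ)) = (m : ℝ) ^ (-(1 / 2 : ℝ)) := by
  rcases Nat.eq_zero_or_pos m with h | h
  · subst h; simp [Real.zero_rpow]
  · have h0 : (0 : ℝ) < m := by exact_mod_cast h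
    rw [← Real.rpow_natCast, ← Real.rpow_add h0]; norm_num

namespace LaceData

variable {β w : ℝ} {P : ℕ → LF d}

theorem abs_mass_le (h : LaceData d β w P) (hd : 5 ≤ d) (hβ : 0 ≤ β) (m : ℕ) :
    |SAW.mass P m| ≤ β * (m : ℝ) ^ (-(5 / 2 : ℝ)) := by
  unfold SAW.mass
  rcases Nat.eq_zero_or_pos m with h0 | h0
  · subst h0; simp [h.zero, Real.zero_rpow]
  · refine ((h.nb m h0).abs_integral_le (by positivity)).trans ?_
    exact mul_le_mul_of_nonneg_left (pow_s_le_52 hd m) hβ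

theorem abs_var_le (h : LaceData d β w P) (hd : 5 ≤ d) (hβ : 0 ≤ β) (m : ℕ) :
    |var P m| ≤ β * (m : ℝ) ^ (-(3 / 2 : ℝ)) := by
  unfold var
  rcases Nat.eq_zero_or_pos m with h0 | h0
  · subst h0; simp [h.zero, Real.zero_rpow]
  · have hn := h.nb m h0
    have hd0 : (1 : ℝ) ≤ d := by
      have : 1 ≤ d := by omega
      exact_mod_cast this
    have h1 : |∫ y, ‖y‖ ^ 2 * P m y| ≤ m * (β * (m : ℝ) ^ (-((d : ℝ) / 2))) := by
      refine abs_integral_le_integral_abs.trans (le_trans (le_of_eq ?_)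
        (hn.integral_sq_le h0 (by positivity)))
      congr 1; funext y
      rw [abs_mul, abs_of_nonneg (by positivity), mul_comm]
    rw [abs_mul, abs_of_nonneg (by positivity : (0 : ℝ) ≤ 1 / d)]
    calc 1 / (d : ℝ) * |∫ y, ‖y‖ ^ 2 * P m y| ≤ 1 * |∫ y, ‖y‖ ^ 2 * P m y| := by
          gcongr; rw [div_le_one (by linarith)]; exact hd0
      _ ≤ m * (β * (m : ℝ) ^ (-((d : ℝ) / 2))) := by rw [one_mul]; exact h1
      _ ≤ m * (β * (m : ℝ) ^ (-(5 / 2 : ℝ))) :=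
          mul_le_mul_of_nonneg_left (mul_le_mul_of_nonneg_left (pow_s_le_52 hd m) hβ) (by positivity)
      _ = β * (m * (m : ℝ) ^ (-(5 / 2 : ℝ))) := by ring
      _ = _ := by rw [natcast_mul_rpow_52]

theorem abs_mul_mass_le (h : LaceData d β w P) (hd : 5 ≤ d) (hβ : 0 ≤ β) (m : ℕ) :
    |(m : ℝ) * SAW.mass P m| ≤ β * (m : ℝ) ^ (-(3 / 2 : ℝ)) := by
  rw [abs_mul, abs_of_nonneg (by positivity), ← natcast_mul_rpow_52, mul_left_comm]
  gcongr
  exact h.abs_mass_le hd hβ m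

theorem summable_var (h : LaceData d β w P) (hd : 5 ≤ d) (hβ : 0 ≤ β) :
    Summable (var P) :=
  Summable.of_norm_bounded (summable_32.mul_left β) (h.abs_var_le hd hβ)

theorem summable_mul_mass (h : LaceData d β w P) (hd : 5 ≤ d) (hβ : 0 ≤ β) :
    Summable fun m : ℕ => (m : ℝ) * SAW.mass P m :=
  Summable.of_norm_bounded (summable_32.mul_left β) (h.abs_mul_mass_le hd hβ)

theorem delta_facts (h : LaceData d β w P) (hd : 5 ≤ d) (hβ : 0 ≤ β)
    (hβ0 : β * zeta32 ≤ 1 / 64) :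
    |delta w P - 1| ≤ 8 * zeta32 * β ∧ |delta w P - 1| ≤ 1 / 8 ∧
    w * (1 - delta w P) + ∑' m : ℕ, (var P m - m * delta w P * SAW.mass P m) = 0 := by
  have b1 : |∑' m, var P m| ≤ β * zeta32 := by
    have := tsum_of_norm_bounded (f := var P) (summable_32.mul_left β).hasSum (h.abs_var_le hd hβ)
    rwa [tsum_mul_left] at this
  have b2 : |∑' m : ℕ, (m : ℝ) * SAW.mass P m| ≤ β * zeta32 := by
    have := tsum_of_norm_bounded (f := fun m : ℕ => (m : ℝ) * SAW.mass P m)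
      (summable_32.mul_left β).hasSum (h.abs_mul_mass_le hd hβ)
    rwa [tsum_mul_left] at this
  have hw := h.w_ge
  have hden : 1 / 4 ≤ w + ∑' m : ℕ, (m : ℝ) * SAW.mass P m := by
    have := (abs_le.1 b2).1; linarith
  have hdiff : |delta w P - 1| ≤ 8 * zeta32 * β := by
    unfold delta
    rw [div_sub_one (by linarith), abs_div, abs_of_pos (by linarith : 0 < w +
      ∑' m : ℕ, (m : ℝ) * SAW.mass P m), div_le_iff₀ (by linarith)]
    have e : |w + ∑' m, var P m - (w + ∑' m : ℕ, (m : ℝ) * SAW.mass P m)| ≤ 2 * (β * zeta32) := by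
      rw [add_sub_add_left_eq_sub]
      exact (abs_sub _ _).trans (by linarith)
    have hz : 0 ≤ 8 * zeta32 * β := by
      have := zeta32_nonneg
      positivity
    have := mul_le_mul_of_nonneg_left hden hz
    linarith
  refine ⟨hdiff, hdiff.trans (by linarith), ?_⟩
  have s1 := h.summable_var hd hβ
  have s2 := (h.summable_mul_mass hd hβ).mul_left (delta w P)
  have e : ∀ m : ℕ, var P m - m * delta w P * SAW.mass P m =
      var P m - delta w P * (m * SAW.mass P m) := fun m => by ring
  simp only [e]
  rw [s1.tsum_sub s2, tsum_mul_left]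
  have : delta w P * (w + ∑' m : ℕ, (m : ℝ) * SAW.mass P m) = w + ∑' m, var P m := by
    unfold delta; rw [div_mul_cancel₀ _ (by linarith)]
  linarith

end LaceData

/-- The part of the error term coming from short memory. -/
def mainErr (w : ℝ) (P : ℕ → LF d) (n : ℕ) (T : ℝ) : LF d :=
  G d T - w • G d (T + (1 - delta w P)) -
    ∑ m ∈ Ioc 0 (n / 4), P m * G d (T + -(m * delta w P))

theorem mainErr_eq (w : ℝ) (P : ℕ → LF d) (n : ℕ) (T : ℝ) :
    mainErr w P n T =
      -(w • (G d (T + (1 - delta w P)) - G d T - (1 - delta w P) • AT d T)) -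
      ∑ m ∈ Ioc 0 (n / 4), remT (P m) T (-(m * delta w P)) +
      (1 - w - ∑ m ∈ Ioc 0 (n / 4), mass P m) • G d T -
      (w * (1 - delta w P) +
        ∑ m ∈ Ioc 0 (n / 4), (var P m - m * delta w P * mass P m)) • AT d T := by
  ext x
  simp only [mainErr, remT, LF.sub_apply, LF.add_apply, LF.neg_apply, LF.smul_apply, LF.sum_apply,
    sum_sub_distrib, mass, var]
  simp only [← sum_mul, sum_add_distrib, neg_mul, sum_neg_distrib]
  ring

theorem nat_rpow_facts {n : ℕ} (hn : 0 < n) :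
    1 / (n : ℝ) ^ 2 ≤ (n : ℝ) ^ (-(3 / 2 : ℝ)) ∧
    (n : ℝ) ^ (1 / 2 : ℝ) * (1 / (n : ℝ) ^ 2) = (n : ℝ) ^ (-(3 / 2 : ℝ)) ∧
    (n : ℝ) ^ (-(1 / 2 : ℝ)) * (1 / (n : ℝ)) = (n : ℝ) ^ (-(3 / 2 : ℝ)) := by
  have h1 : (1 : ℝ) ≤ n := by exact_mod_cast hn
  have h0 : (0 : ℝ) < n := by linarith
  have e2 : 1 / (n : ℝ) ^ 2 = (n : ℝ) ^ (-(2 : ℝ)) := by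
    rw [Real.rpow_neg h0.le, one_div]; norm_num
  have e1 : 1 / (n : ℝ) = (n : ℝ) ^ (-(1 : ℝ)) := by
    rw [Real.rpow_neg h0.le, one_div]; norm_num
  refine ⟨?_, ?_, ?_⟩
  · rw [e2]; exact Real.rpow_le_rpow_of_exponent_le h1 (by norm_num)
  · rw [e2, ← Real.rpow_add h0]; norm_num
  · rw [e1, ← Real.rpow_add h0]; norm_num

theorem mainErr_scalars (hd : 5 ≤ d) {β w : ℝ} {P : ℕ → LF d} (h : LaceData d β w P) (hβ : 0 ≤ β)
    (hβ0 : β * zeta32 ≤ 1 / 64) {n : ℕ} (hn : 0 < n) {T : ℝ} (hT : n * delta w P ≤ T) :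
    7 / 8 * n ≤ T ∧
    ((1 - delta w P) / T) ^ 2 ≤ 2 * zeta32 * β * (n : ℝ) ^ (-(3 / 2 : ℝ)) ∧
    (∑ m ∈ Ioc 0 (n / 4), β * (m : ℝ) ^ (-((d : ℝ) / 2)) *
      ((-(m * delta w P) / T) ^ 2 + (m / T) ^ 2)) ≤ 12 * β * (n : ℝ) ^ (-(3 / 2 : ℝ)) ∧
    |1 - w - ∑ m ∈ Ioc 0 (n / 4), mass P m| ≤ 14 * β * (n : ℝ) ^ (-(3 / 2 : ℝ)) ∧
    |w * (1 - delta w P) + ∑ m ∈ Ioc 0 (n / 4), (var P m - m * delta w P * mass P m)| / T ≤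
      48 * β * (n : ℝ) ^ (-(3 / 2 : ℝ)) := by
  obtain ⟨hδ1, hδ2, hδ3⟩ := h.delta_facts hd hβ hβ0
  obtain ⟨f1, f2, f3⟩ := nat_rpow_facts hn
  have hz := zeta32_nonneg
  set δ := delta w P with hδ
  set r := (n : ℝ) ^ (-(3 / 2 : ℝ)) with hr
  have hr0 : 0 ≤ r := by positivity
  have hδl : 7 / 8 ≤ δ := by have := (abs_le.1 hδ2).1; linarith
  have hδu : δ ≤ 9 / 8 := by have := (abs_le.1 hδ2).2; linarith
  have hn0 : (0 : ℝ) < n := by exact_mod_cast hn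
  have hTn : 7 / 8 * n ≤ T := by
    have : 7 / 8 * (n : ℝ) ≤ δ * n := by gcongr
    linarith
  have hT0 : 0 < T := by linarith
  have hT2 : 1 / T ^ 2 ≤ 2 * (1 / (n : ℝ) ^ 2) := by
    rw [← div_eq_mul_one_div, div_le_div_iff₀ (by positivity) (by positivity)]
    have : (7 / 8 * n) ^ 2 ≤ T ^ 2 := by gcongr
    nlinarith [sq_nonneg (n : ℝ)]
  have hT1 : 1 / T ≤ 2 * (1 / (n : ℝ)) := by
    rw [← div_eq_mul_one_div, div_le_div_iff₀ (by positivity) (by positivity)]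
    linarith
  refine ⟨hTn, ?_, ?_, ?_, ?_⟩
  · have e1 : (1 - δ) ^ 2 ≤ zeta32 * β := by
      have h1 : |1 - δ| = |δ - 1| := abs_sub_comm _ _
      rw [← sq_abs, h1, sq]
      calc |δ - 1| * |δ - 1| ≤ (8 * zeta32 * β) * (1 / 8) := by gcongr
        _ = _ := by ring
    calc ((1 - δ) / T) ^ 2 = (1 - δ) ^ 2 * (1 / T ^ 2) := by rw [div_pow]; ring
      _ ≤ (zeta32 * β) * (2 * r) := by
        refine mul_le_mul e1 (hT2.trans (by linarith)) (by positivity) (by positivity)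
      _ = _ := by ring
  · calc _ ≤ ∑ m ∈ Ioc 0 (n / 4), (3 * β * (1 / T ^ 2)) * (m : ℝ) ^ (-(1 / 2 : ℝ)) := by
          refine sum_le_sum fun m _ => ?_
          have e : (-(m * δ) / T) ^ 2 + (m / T) ^ 2 = (δ ^ 2 + 1) * ((1 / T ^ 2) * (m : ℝ) ^ 2) := by
            rw [div_pow, div_pow]; ring
          have e2 : δ ^ 2 + 1 ≤ 3 := by nlinarith
          have e3 : 0 ≤ (1 / T ^ 2) * (m : ℝ) ^ 2 := by positivity
          rw [e]
          calc β * (m : ℝ) ^ (-((d : ℝ) / 2)) * ((δ ^ 2 + 1) * ((1 / T ^ 2) * (m : ℝ) ^ 2))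
              ≤ β * (m : ℝ) ^ (-(5 / 2 : ℝ)) * (3 * ((1 / T ^ 2) * (m : ℝ) ^ 2)) := by
                refine mul_le_mul (mul_le_mul_of_nonneg_left (pow_s_le_52 hd m) hβ) ?_
                  (by positivity) (by positivity)
                exact mul_le_mul_of_nonneg_right e2 e3
            _ = (3 * β * (1 / T ^ 2)) * ((m : ℝ) ^ 2 * (m : ℝ) ^ (-(5 / 2 : ℝ))) := by ring
            _ = _ := by rw [natcast_sq_mul_rpow_52]
      _ = (3 * β * (1 / T ^ 2)) * ∑ m ∈ Ioc 0 (n / 4), (m : ℝ) ^ (-(1 / 2 : ℝ)) := by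
          rw [mul_sum]
      _ ≤ (3 * β * (2 * (1 / (n : ℝ) ^ 2))) * (2 * (n : ℝ) ^ (1 / 2 : ℝ)) := by
          refine mul_le_mul (by gcongr) ((sum_Ioc_half _).trans ?_) (by positivity) (by positivity)
          have : ((n / 4 : ℕ) : ℝ) ≤ n := by exact_mod_cast Nat.div_le_self n 4
          gcongr
      _ = 12 * β * ((n : ℝ) ^ (1 / 2 : ℝ) * (1 / (n : ℝ) ^ 2)) := by ring
      _ = _ := by rw [f2]
  · have hm := h.mass
    have := abs_tsum_sub_sum_le (f := mass P) (summable_52.mul_left β) (h.abs_mass_le hd hβ)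
      (by simp [mass, h.zero]) (n / 4) (B := 14 * β * r) (fun N => by
        rw [← mul_sum]
        calc β * _ ≤ β * (14 * r) := by gcongr; exact tail_five_halves hn N
          _ = _ := by ring)
    have e : 1 - w - ∑ m ∈ Ioc 0 (n / 4), mass P m =
        (∑' m, mass P m) - ∑ m ∈ Ioc 0 (n / 4), mass P m := by
      unfold mass; linarith
    rw [e]; exact this
  · have hb : ∀ m : ℕ, |var P m - m * δ * mass P m| ≤ 3 * β * (m : ℝ) ^ (-(3 / 2 : ℝ)) := by
      intro m
      have e1 := h.abs_var_le hd hβ m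
      have e2 := h.abs_mul_mass_le hd hβ m
      have e3 : |(m : ℝ) * δ * mass P m| ≤ 2 * (β * (m : ℝ) ^ (-(3 / 2 : ℝ))) := by
        rw [show (m : ℝ) * δ * mass P m = δ * (m * mass P m) by ring, abs_mul]
        refine mul_le_mul ?_ e2 (abs_nonneg _) (by norm_num)
        rw [abs_of_nonneg (by linarith)]; linarith
      refine (abs_sub _ _).trans ?_
      linarith
    have := abs_tsum_sub_sum_le (f := fun m : ℕ => var P m - m * δ * mass P m)
      (summable_32.mul_left (3 * β)) hb
      (by simp [mass, var, h.zero]) (n / 4) (B := 24 * β * (n : ℝ) ^ (-(1 / 2 : ℝ))) (fun N => by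
        rw [← mul_sum]
        calc 3 * β * _ ≤ 3 * β * (8 * (n : ℝ) ^ (-(1 / 2 : ℝ))) := by
              gcongr; exact tail_three_halves hn N
          _ = _ := by ring)
    have e : w * (1 - δ) + ∑ m ∈ Ioc 0 (n / 4), (var P m - m * δ * mass P m) =
        -((∑' m : ℕ, (var P m - m * δ * mass P m)) -
          ∑ m ∈ Ioc 0 (n / 4), (var P m - m * δ * mass P m)) := by
      linarith
    rw [e, abs_neg, div_eq_mul_one_div]
    calc _ ≤ (24 * β * (n : ℝ) ^ (-(1 / 2 : ℝ))) * (2 * (1 / (n : ℝ))) :=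
          mul_le_mul this hT1 (by positivity) (by positivity)
      _ = 48 * β * ((n : ℝ) ^ (-(1 / 2 : ℝ)) * (1 / (n : ℝ))) := by ring
      _ = _ := by rw [f3]

theorem mainErr_bounds (hd : 5 ≤ d) : ∃ K > 0, ∀ (β w : ℝ) (P : ℕ → LF d), LaceData d β w P →
    0 ≤ β → β * zeta32 ≤ 1 / 64 → ∀ (n : ℕ) (T : ℝ), 0 < n → n * delta w P ≤ T →
    SB (mainErr w P n T) (K * β * (n : ℝ) ^ (-(3 / 2 : ℝ)) * T ^ (-(d : ℝ) / 2)) ∧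
    (T ≤ 2 * n → NB n (mainErr w P n T) (K * β * (n : ℝ) ^ (-(3 / 2 : ℝ)))) := by
  obtain ⟨K1, hK1, H1⟩ := gauss_time_bounds d
  obtain ⟨K2, hK2, H2⟩ := remT_bounds (d := d) (by omega)
  set L : ℝ := 8 + 65536 * 2 ^ ((d : ℝ) / 2) with hL
  have hL1 : (8 : ℝ) ≤ L := by rw [hL]; exact le_add_of_nonneg_right (by positivity)
  have hKA := KA_pos d
  have hz := zeta32_nonneg
  refine ⟨(4 * K1 * zeta32 + 12 * K2 + 14 + 48 * KA d) * L, by positivity,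
    fun β w P h hβ hβ0 n T hn hT => ?_⟩
  obtain ⟨hTn, s1, s2, s3, s4⟩ := mainErr_scalars hd h hβ hβ0 hn hT
  obtain ⟨hδ1, hδ2, hδ3⟩ := h.delta_facts hd hβ hβ0
  have hn1 : (1 : ℝ) ≤ n := by exact_mod_cast hn
  have hT0 : 0 < T := by linarith
  have hδl : 7 / 8 ≤ delta w P := by have := (abs_le.1 hδ2).1; linarith
  have hw : |w| ≤ 2 := by
    rw [abs_of_nonneg (by linarith [h.w_ge])]; exact h.w_le
  have c1 : |1 - delta w P| ≤ T / 4 := by rw [abs_sub_comm]; linarith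
  have c2 : ∀ m ∈ Ioc 0 (n / 4), |-((m : ℝ) * delta w P)| ≤ T / 4 := by
    intro m hm
    have : 4 * m ≤ n := by have := (mem_Ioc.1 hm).2; omega
    have hm' : 4 * (m : ℝ) ≤ n := by exact_mod_cast this
    rw [abs_neg, abs_of_nonneg (by positivity)]
    have := mul_le_mul_of_nonneg_right hm' (by linarith : 0 ≤ delta w P)
    linarith
  set r := (n : ℝ) ^ (-(3 / 2 : ℝ)) with hr
  have hr0 : 0 ≤ r := by positivity
  rw [mainErr_eq]
  set δ := delta w P
  set π' := 1 - w - ∑ m ∈ Ioc 0 (n / 4), mass P m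
  set v' := w * (1 - δ) + ∑ m ∈ Ioc 0 (n / 4), (var P m - m * δ * mass P m)
  have s4' : |v'| * (KA d / T) ≤ 48 * KA d * β * r := by
    calc |v'| * (KA d / T) = KA d * (|v'| / T) := by ring
      _ ≤ KA d * (48 * β * r) := by gcongr
      _ = _ := by ring
  have s1' : |w| * (K1 * ((1 - δ) / T) ^ 2) ≤ 4 * K1 * zeta32 * β * r := by
    calc |w| * (K1 * ((1 - δ) / T) ^ 2) ≤ 2 * (K1 * (2 * zeta32 * β * r)) := by gcongr
      _ = _ := by ring
  have s2' : ∑ m ∈ Ioc 0 (n / 4), K2 * (β * (m : ℝ) ^ (-((d : ℝ) / 2)) *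
      ((-(m * δ) / T) ^ 2 + (m / T) ^ 2)) ≤ 12 * K2 * β * r := by
    rw [← mul_sum]
    calc _ ≤ K2 * (12 * β * r) := by gcongr
      _ = _ := by ring
  have tot : ∀ M : ℝ, 0 ≤ M → ∀ y1 y2 y3 y4 : ℝ, y1 ≤ 4 * K1 * zeta32 * β * r →
      y2 ≤ 12 * K2 * β * r → y3 ≤ 14 * β * r → y4 ≤ 48 * KA d * β * r →
      y1 * M + y2 * M + y3 * M + y4 * M ≤
        (4 * K1 * zeta32 + 12 * K2 + 14 + 48 * KA d) * β * r * M := by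
    intro M hM y1 y2 y3 y4 h1 h2 h3 h4
    rw [← add_mul, ← add_mul, ← add_mul]
    refine mul_le_mul_of_nonneg_right ?_ hM
    linarith
  constructor
  · have hM : 0 ≤ T ^ (-(d : ℝ) / 2) := by positivity
    have b1 := ((H1 T (1 - δ) hT0 c1).1.smul w).neg
    have b2 := SB.sum (Ioc 0 (n / 4)) fun m hm => (H2 T (-(m * δ)) hT0 (c2 m hm) (P m) m _
      (mem_Ioc.1 hm).1 (by positivity) (h.sym m) (h.nb m (mem_Ioc.1 hm).1)).1
    have b3 := (SB_G (d := d) hT0).smul π'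
    have b4 := (SB_AT (d := d) hT0).smul v'
    refine (((b1.sub b2).add b3).sub b4).mono ?_
    rw [← sum_mul]
    have := tot _ hM _ _ _ _ s1' s2' s3 s4'
    refine le_trans (le_of_eq ?_) (this.trans ?_)
    · ring
    · have e : (4 * K1 * zeta32 + 12 * K2 + 14 + 48 * KA d) * β * r * T ^ (-(d : ℝ) / 2) * 1 ≤
        (4 * K1 * zeta32 + 12 * K2 + 14 + 48 * KA d) * β * r * T ^ (-(d : ℝ) / 2) * L := by
        gcongr; linarith
      linarith
  · intro hT2
    have hM : 0 ≤ L := by linarith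
    have g1 : NB n (G d T) L := by
      refine (NB_G n hT0).mono ?_
      rw [hL]
      have : T ^ 2 / (n : ℝ) ^ 2 ≤ 4 := by
        rw [div_le_iff₀ (by positivity)]
        have : T ^ 2 ≤ (2 * n) ^ 2 := by gcongr
        linarith
      have h2 : (0 : ℝ) ≤ 2 ^ ((d : ℝ) / 2) := by positivity
      have := mul_le_mul_of_nonneg_left this (by positivity : 0 ≤ 256 * (2 : ℝ) ^ ((d : ℝ) / 2))
      linarith
    have b1 := (((H1 T (1 - δ) hT0 c1).2 n hT2).smul w).neg
    have b2 := NB.sum (n := n) (Ioc 0 (n / 4)) (fun m hm => by positivity)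
      fun m hm => (H2 T (-(m * δ)) hT0 (c2 m hm) (P m) m _
      (mem_Ioc.1 hm).1 (by positivity) (h.sym m) (h.nb m (mem_Ioc.1 hm).1)).2 n hT2
    have b3 := g1.smul π'
    have b4 := (NB_AT (d := d) hT0 hT2).smul v'
    have y2 : 0 ≤ ∑ m ∈ Ioc 0 (n / 4), K2 * (β * (m : ℝ) ^ (-((d : ℝ) / 2)) *
      ((-(m * δ) / T) ^ 2 + (m / T) ^ 2)) := sum_nonneg fun m _ => by positivity
    refine (((b1.sub (by positivity) y2 b2).add (by positivity) (by positivity) b3).sub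
      (by positivity) (by positivity) b4).mono ?_
    have := tot L hM _ _ _ _ s1' s2' s3 s4'
    have k1 : |w| * (K1 * ((1 - δ) / T) ^ 2) * 1 ≤ |w| * (K1 * ((1 - δ) / T) ^ 2) * L := by
      gcongr; linarith
    have k2 := mul_le_mul_of_nonneg_left (by linarith : (1 : ℝ) ≤ L) y2
    rw [← mul_assoc |v'|]
    have e : (4 * K1 * zeta32 + 12 * K2 + 14 + 48 * KA d) * L * β * r =
      (4 * K1 * zeta32 + 12 * K2 + 14 + 48 * KA d) * β * r * L := by ring
    rw [e]
    linarith

/-- The reference Gaussian sequence. -/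
def phiD (w : ℝ) (P : ℕ → LF d) (n : ℕ) : LF d := G d (n * delta w P)

/-- Lace coefficients including the free step. -/
def pfull (w : ℝ) (P : ℕ → LF d) (m : ℕ) : LF d := P m + if m = 1 then w • G d 1 else 0

/-- The defect of the reference sequence as an approximate solution of the recursion. -/
def errE (w : ℝ) (P : ℕ → LF d) (n : ℕ) : LF d :=
  phiD w P n - pfull w P n - ∑ m ∈ Ioo 0 n, pfull w P m * phiD w P (n - m)

theorem phiD_add {w : ℝ} {P : ℕ → LF d} (hδ : 0 < delta w P) {a b : ℕ} (ha : 0 < a) (hb : 0 < b) :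
    phiD w P (a + b) = phiD w P a * phiD w P b := by
  unfold phiD
  rw [G_mul_G (by positivity) (by positivity)]
  push_cast; ring_nf

theorem Ioc_zero_eq_insert {n : ℕ} (hn : 0 < n) : Ioc 0 n = insert n (Ioo 0 n) := by
  ext; simp; omega

theorem sum_Ioc_split (f : ℕ → LF d) {a b : ℕ} (h : a ≤ b) :
    ∑ m ∈ Ioc 0 b, f m = ∑ m ∈ Ioc 0 a, f m + ∑ m ∈ Ioc a b, f m := by
  rw [← sum_union (Finset.disjoint_left.2 fun x hx hx' => by simp at hx hx'; omega)]
  congr 1; ext; simp; omega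

theorem errE_free {w : ℝ} {P : ℕ → LF d} (hδ : 0 < delta w P) {n : ℕ} (hn : 0 < n) :
    pfull w P n + ∑ m ∈ Ioo 0 n, pfull w P m * phiD w P (n - m) =
      P n + ∑ m ∈ Ioo 0 n, P m * phiD w P (n - m) + w • G d (n * delta w P + (1 - delta w P)) := by
  have key : (if n = 1 then w • G d 1 else 0 : LF d) +
      ∑ m ∈ Ioo 0 n, (if m = 1 then w • G d 1 else 0 : LF d) * phiD w P (n - m) =
      w • G d (n * delta w P + (1 - delta w P)) := by
    by_cases h1 : n = 1
    · subst h1; simp [Ioo_zero_one]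
    · have hmem : 1 ∈ Ioo 0 n := by simp; omega
      rw [if_neg h1, zero_add, sum_eq_single_of_mem 1 hmem
        (fun b _ hb => by rw [if_neg hb, zero_mul]), if_pos rfl, smul_mul_assoc]
      congr 1
      unfold phiD
      have : 0 < n - 1 := by omega
      rw [G_mul_G one_pos (by positivity)]
      rw [Nat.cast_sub hn]; push_cast; ring_nf
  rw [← key]
  simp only [pfull, add_mul, sum_add_distrib]
  abel

theorem errE_eq {w : ℝ} {P : ℕ → LF d} (hδ : 0 < delta w P) {n : ℕ} (hn : 0 < n) :
    errE w P n = mainErr w P n (n * delta w P) -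
      ∑ m ∈ Ioc (n / 4) n, if m = n then P n else P m * phiD w P (n - m) := by
  have h := errE_free hδ hn (P := P)
  have h2 : P n + ∑ m ∈ Ioo 0 n, P m * phiD w P (n - m) =
      ∑ m ∈ Ioc 0 (n / 4), P m * G d (n * delta w P + -(m * delta w P)) +
      ∑ m ∈ Ioc (n / 4) n, if m = n then P n else P m * phiD w P (n - m) := by
    have : ∑ m ∈ Ioc 0 n, (if m = n then P n else P m * phiD w P (n - m)) =
        P n + ∑ m ∈ Ioo 0 n, P m * phiD w P (n - m) := by
      rw [Ioc_zero_eq_insert hn, sum_insert (by simp), if_pos rfl]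
      congr 1
      refine sum_congr rfl fun m hm => ?_
      simp at hm
      rw [if_neg (by omega)]
    rw [← this, sum_Ioc_split _ (Nat.div_le_self n 4)]
    congr 1
    refine sum_congr rfl fun m hm => ?_
    simp at hm
    rw [if_neg (by omega), phiD, Nat.cast_sub (by omega)]
    ring_nf
  unfold errE
  rw [sub_sub, h, h2, mainErr, phiD]
  abel

theorem G_mul_errE {w : ℝ} {P : ℕ → LF d} (hδ : 0 < delta w P) {n : ℕ} (hn : 0 < n) {t : ℝ}
    (ht : 0 < t) (hfree : 0 < n * delta w P + (1 - delta w P)) :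
    G d t * errE w P n = mainErr w P n (n * delta w P + t) -
      ∑ m ∈ Ioc (n / 4) n, P m * G d ((n - m : ℕ) * delta w P + t) := by
  have h := errE_free hδ hn (P := P)
  have h2 : G d t * (P n + ∑ m ∈ Ioo 0 n, P m * phiD w P (n - m)) =
      ∑ m ∈ Ioc 0 (n / 4), P m * G d (n * delta w P + t + -(m * delta w P)) +
      ∑ m ∈ Ioc (n / 4) n, P m * G d ((n - m : ℕ) * delta w P + t) := by
    have : ∑ m ∈ Ioc 0 n, P m * G d ((n - m : ℕ) * delta w P + t) =
        G d t * (P n + ∑ m ∈ Ioo 0 n, P m * phiD w P (n - m)) := by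
      rw [Ioc_zero_eq_insert hn, sum_insert (by simp), mul_add, mul_sum]
      congr 1
      · simp [mul_comm]
      refine sum_congr rfl fun m hm => ?_
      simp at hm
      have : 0 < n - m := by omega
      rw [mul_left_comm, phiD, G_mul_G ht (by positivity), add_comm]
    rw [← this, sum_Ioc_split _ (Nat.div_le_self n 4)]
    congr 1
    refine sum_congr rfl fun m hm => ?_
    simp at hm
    rw [Nat.cast_sub (by omega)]
    ring_nf
  unfold errE
  rw [sub_sub, h, mul_sub, mul_add, h2, mainErr, mul_smul_comm, phiD, G_mul_G ht (by positivity),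
    G_mul_G ht hfree, add_comm t, add_comm t, add_right_comm]
  abel_nf

theorem rpow_le_scaled {c x y a : ℝ} (hc : 0 < c) (hx : 0 < x) (hxy : c * x ≤ y) (ha : 0 ≤ a) :
    y ^ (-a) ≤ c⁻¹ ^ a * x ^ (-a) := by
  refine (Real.rpow_le_rpow_of_nonpos (by positivity) hxy (by linarith)).trans (le_of_eq ?_)
  rw [Real.mul_rpow hc.le hx.le, Real.inv_rpow hc.le, Real.rpow_neg hc.le]

theorem sum_Ioc_reflect_le (f : ℕ → ℝ) (hf : ∀ j, 0 ≤ f j) (a n : ℕ) :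
    ∑ m ∈ Ioc a n, f (n - m) ≤ f 0 + ∑ j ∈ Ioc 0 n, f j := by
  rw [← sum_image (g := fun m => n - m) (f := f)]
  · rw [← sum_insert (by simp)]
    refine sum_le_sum_of_subset_of_nonneg (fun j hj => ?_) fun j _ _ => hf j
    simp at hj ⊢; omega
  · intro x hx y hy hxy
    simp at hx hy hxy; omega

/-- Uniform bounds on the defect. -/
theorem errE_bounds (hd : 5 ≤ d) : ∃ K > 0, ∀ (β w : ℝ) (P : ℕ → LF d), LaceData d β w P →
    0 ≤ β → β * zeta32 ≤ 1 / 64 → ∀ n : ℕ, 0 < n →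
    NB n (errE w P n) (K * β * (n : ℝ) ^ (-(3 / 2 : ℝ))) ∧
    ∀ t : ℝ, 1 ≤ t → SB (G d t * errE w P n : LF d)
      (K * β * ((n : ℝ) ^ (-((d : ℝ) / 2)) * t ^ (-(3 / 2 : ℝ)))) := by
  obtain ⟨K, hK, H⟩ := mainErr_bounds hd
  set s : ℝ := (d : ℝ) / 2 with hs
  have hs5 : 5 / 2 ≤ s := half_d_ge hd
  set L : ℝ := 8 + 256 * 2 ^ s * 2 with hL
  have hL1 : 1 ≤ L := by
    have : 0 ≤ 256 * (2 : ℝ) ^ s * 2 := by positivity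
    linarith
  set K1 : ℝ := K + 14 * L with hK1
  set c7 : ℝ := (7 / 8 : ℝ)⁻¹ with hc7
  set K2 : ℝ := K * c7 ^ (s - 3 / 2) + 4 ^ s * c7 ^ s * (8 / 3) with hK2
  have hc7p : 0 < c7 := by rw [hc7]; norm_num
  refine ⟨K1 + K2, by positivity, fun β w P h hβ hβ0 n hn => ?_⟩
  obtain ⟨-, hδ1, -⟩ := h.delta_facts hd hβ hβ0
  set δ := delta w P with hδ
  have hδlo : 7 / 8 ≤ δ := by have := (abs_le.1 hδ1).1; linarith
  have hδhi : δ ≤ 9 / 8 := by have := (abs_le.1 hδ1).2; linarith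
  have hδ0 : 0 < δ := by linarith
  have hn' : (0 : ℝ) < n := by exact_mod_cast hn
  have hn1 : (1 : ℝ) ≤ n := by exact_mod_cast hn
  constructor
  · rw [errE_eq hδ0 hn]
    have h1 := (H β w P h hβ hβ0 n (n * δ) hn le_rfl).2 (by nlinarith)
    have h2 : NB n (∑ m ∈ Ioc (n / 4) n, if m = n then P n else P m * phiD w P (n - m) : LF d)
        (∑ m ∈ Ioc (n / 4) n, β * (m : ℝ) ^ (-s) * L) := by
      refine NB.sum _ (fun m _ => by positivity) fun m hm => ?_
      simp at hm
      have hm0 : 0 < m := by omega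
      split_ifs with hmn
      · subst hmn
        exact (h.nb m hm0).mono (le_mul_of_one_le_right (by positivity) hL1)
      · have hj : 0 < n - m := by omega
        have hj' : (0 : ℝ) < (n - m : ℕ) := by exact_mod_cast hj
        have hG : NB (n - m) (phiD w P (n - m)) L := by
          refine (NB_G (n - m) (T := (n - m : ℕ) * δ) (by positivity)).mono ?_
          rw [hL]
          gcongr
          rw [mul_pow, mul_div_cancel_left₀ _ (by positivity)]
          nlinarith
        have := NB.mul hm0 hj (by positivity) (h.nb m hm0) hG
        rwa [Nat.add_sub_cancel' hm.2] at this
    have h3 : ∑ m ∈ Ioc (n / 4) n, β * (m : ℝ) ^ (-s) * L ≤ 14 * L * β * (n : ℝ) ^ (-(3 / 2 : ℝ)) := by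
      calc ∑ m ∈ Ioc (n / 4) n, β * (m : ℝ) ^ (-s) * L
          ≤ ∑ m ∈ Ioc (n / 4) n, (β * L) * (m : ℝ) ^ (-(5 / 2 : ℝ)) := by
            refine sum_le_sum fun m _ => ?_
            have := mul_le_mul_of_nonneg_left (pow_s_le_52 hd m) (by positivity : 0 ≤ β * L)
            linarith
        _ = (β * L) * ∑ m ∈ Ioc (n / 4) n, (m : ℝ) ^ (-(5 / 2 : ℝ)) := by rw [mul_sum]
        _ ≤ (β * L) * (14 * (n : ℝ) ^ (-(3 / 2 : ℝ))) :=
            mul_le_mul_of_nonneg_left (tail_five_halves hn n) (by positivity)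
        _ = _ := by ring
    refine (h1.sub (by positivity) (sum_nonneg fun m _ => by positivity) h2).mono ?_
    have h4 : 0 ≤ K2 * (β * (n : ℝ) ^ (-(3 / 2 : ℝ))) := by positivity
    rw [hK1]
    linarith
  · intro t ht
    have ht0 : 0 < t := by linarith
    have hfree : 0 < n * δ + (1 - δ) := by nlinarith
    rw [G_mul_errE hδ0 hn ht0 hfree]
    have h1 := (H β w P h hβ hβ0 n (n * δ + t) hn (by linarith)).1
    have hT : K * β * (n : ℝ) ^ (-(3 / 2 : ℝ)) * (n * δ + t) ^ (-(d : ℝ) / 2) ≤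
        K * c7 ^ (s - 3 / 2) * β * ((n : ℝ) ^ (-s) * t ^ (-(3 / 2 : ℝ))) := by
      have e1 : (n * δ + t) ^ (-(d : ℝ) / 2) =
          (n * δ + t) ^ (-(s - 3 / 2)) * (n * δ + t) ^ (-(3 / 2 : ℝ)) := by
        rw [← Real.rpow_add (by positivity), hs, neg_div]; congr 1; ring
      have e2 : (n * δ + t) ^ (-(s - 3 / 2)) ≤ c7 ^ (s - 3 / 2) * (n : ℝ) ^ (-(s - 3 / 2)) :=
        rpow_le_scaled (by norm_num) hn' (by nlinarith) (by linarith)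
      have e3 : (n * δ + t) ^ (-(3 / 2 : ℝ)) ≤ t ^ (-(3 / 2 : ℝ)) :=
        Real.rpow_le_rpow_of_nonpos ht0 (by nlinarith) (by norm_num)
      have e4 : (n : ℝ) ^ (-s) = (n : ℝ) ^ (-(3 / 2 : ℝ)) * (n : ℝ) ^ (-(s - 3 / 2)) := by
        rw [← Real.rpow_add hn']; congr 1; ring
      rw [e1, e4]
      calc K * β * (n : ℝ) ^ (-(3 / 2 : ℝ)) *
            ((n * δ + t) ^ (-(s - 3 / 2)) * (n * δ + t) ^ (-(3 / 2 : ℝ)))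
          ≤ K * β * (n : ℝ) ^ (-(3 / 2 : ℝ)) *
            ((c7 ^ (s - 3 / 2) * (n : ℝ) ^ (-(s - 3 / 2))) * t ^ (-(3 / 2 : ℝ))) :=
            mul_le_mul_of_nonneg_left (mul_le_mul e2 e3 (by positivity) (by positivity))
              (by positivity)
        _ = _ := by ring
    have h2 : SB (∑ m ∈ Ioc (n / 4) n, P m * G d ((n - m : ℕ) * δ + t) : LF d)
        (∑ m ∈ Ioc (n / 4) n, (β * 4 ^ s * c7 ^ s * (n : ℝ) ^ (-s)) *
          (((n - m : ℕ) : ℝ) + t) ^ (-(5 / 2 : ℝ))) := by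
      refine SB.sum _ fun m hm => ?_
      simp at hm
      have hm0 : 0 < m := by omega
      have hj' : (0 : ℝ) ≤ (n - m : ℕ) := by positivity
      refine ((h.nb m hm0).mul_SB (by positivity)
        (SB_G (T := (n - m : ℕ) * δ + t) (by positivity))).mono ?_
      have hmq : (n : ℝ) / 4 ≤ m := by
        have : n ≤ 4 * m := by omega
        have : (n : ℝ) ≤ 4 * m := by exact_mod_cast this
        linarith
      have e1 := rpow_quarter hn (a := s) (by linarith) hmq
      have e2 : ((n - m : ℕ) * δ + t) ^ (-(d : ℝ) / 2) ≤
          c7 ^ s * (((n - m : ℕ) : ℝ) + t) ^ (-s) := by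
        rw [neg_div]
        exact rpow_le_scaled (by norm_num) (by positivity) (by nlinarith) (by linarith)
      have e3 : (((n - m : ℕ) : ℝ) + t) ^ (-s) ≤ (((n - m : ℕ) : ℝ) + t) ^ (-(5 / 2 : ℝ)) :=
        Real.rpow_le_rpow_of_exponent_le (by linarith) (by linarith)
      calc β * (m : ℝ) ^ (-s) * ((n - m : ℕ) * δ + t) ^ (-(d : ℝ) / 2)
          ≤ β * (4 ^ s * (n : ℝ) ^ (-s)) * (c7 ^ s * (((n - m : ℕ) : ℝ) + t) ^ (-(5 / 2 : ℝ))) := by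
            refine mul_le_mul (mul_le_mul_of_nonneg_left e1 hβ) (e2.trans ?_) (by positivity)
              (by positivity)
            exact mul_le_mul_of_nonneg_left e3 (by positivity)
        _ = _ := by ring
    have h3 : ∑ m ∈ Ioc (n / 4) n, (((n - m : ℕ) : ℝ) + t) ^ (-(5 / 2 : ℝ)) ≤
        8 / 3 * t ^ (-(3 / 2 : ℝ)) := by
      refine (sum_Ioc_reflect_le (fun j => ((j : ℝ) + t) ^ (-(5 / 2 : ℝ)))
        (fun j => by positivity) _ n).trans ?_
      have a1 := sum_Ioc_five_halves 0 n ht0.le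
      have a2 : ((0 : ℕ) + 1 + t : ℝ) ^ (-(3 / 2 : ℝ)) ≤ t ^ (-(3 / 2 : ℝ)) :=
        Real.rpow_le_rpow_of_nonpos ht0 (by push_cast; linarith) (by norm_num)
      have a3 : ((0 : ℕ) + t : ℝ) ^ (-(5 / 2 : ℝ)) ≤ t ^ (-(3 / 2 : ℝ)) := by
        rw [Nat.cast_zero, zero_add]
        exact Real.rpow_le_rpow_of_exponent_le ht (by norm_num)
      linarith
    refine ((h1.mono hT).sub h2).mono ?_
    rw [← mul_sum]
    have h4 := mul_le_mul_of_nonneg_left h3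
      (by positivity : 0 ≤ β * 4 ^ s * c7 ^ s * (n : ℝ) ^ (-s))
    have h5 : 0 ≤ K1 * β * ((n : ℝ) ^ (-s) * t ^ (-(3 / 2 : ℝ))) := by positivity
    have h6 : K2 * β * ((n : ℝ) ^ (-s) * t ^ (-(3 / 2 : ℝ))) =
      K * c7 ^ (s - 3 / 2) * β * ((n : ℝ) ^ (-s) * t ^ (-(3 / 2 : ℝ))) +
      β * 4 ^ s * c7 ^ s * (n : ℝ) ^ (-s) * (8 / 3 * t ^ (-(3 / 2 : ℝ))) := by rw [hK2]; ring
    linarith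

/-- The solution of the renewal recursion driven by `pfull w P`. -/
def uren (w : ℝ) (P : ℕ → LF d) (n : ℕ) : LF d :=
  pfull w P n + ∑ m : Fin (n - 1), pfull w P (m + 1) * uren w P (n - (m + 1))
termination_by n
decreasing_by have := m.2; omega

/-- One-step difference of `uren` with respect to the reference kernel. -/
def Fren (w : ℝ) (P : ℕ → LF d) (n : ℕ) : LF d :=
  uren w P n - if n = 1 then phiD w P 1 else phiD w P 1 * uren w P (n - 1)

theorem uren_eq (w : ℝ) (P : ℕ → LF d) (n : ℕ) :
    uren w P n = pfull w P n + ∑ m ∈ Ioo 0 n, pfull w P m * uren w P (n - m) := by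
  rw [uren, Fin.sum_univ_eq_sum_range (fun i => pfull w P (i + 1) * uren w P (n - (i + 1)))]
  congr 1
  refine sum_bij (fun i _ => i + 1) ?_ ?_ ?_ ?_
  · intro i hi; simp at hi ⊢; omega
  · intro i _ j _ h; omega
  · intro b hb; simp at hb; exact ⟨b - 1, by simp; omega, by omega⟩
  · intro i _; rfl

theorem renewal_uren {w : ℝ} {P : ℕ → LF d} (hδ : 0 < delta w P) :
    Renewal (pfull w P) (phiD w P) (uren w P) (errE w P) (Fren w P) where
  hφ := fun _ _ ha hb => phiD_add hδ ha hb
  hu := fun n _ => uren_eq w P n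
  hE := fun _ _ => rfl
  hF1 := by simp [Fren]
  hF := fun n hn => by simp [Fren, show n ≠ 0 by omega]

theorem rpow_half {n x a : ℝ} (hn : 0 < n) (ha : 0 ≤ a) (hx : n ≤ 2 * x) :
    x ^ (-a) ≤ 2 ^ a * n ^ (-a) := by
  have := rpow_le_scaled (c := 1 / 2) (by norm_num) hn (show 1 / 2 * n ≤ x by linarith) ha
  norm_num at this ⊢; exact this

theorem sum_32_le (s : Finset ℕ) : ∑ m ∈ s, (m : ℝ) ^ (-(3 / 2 : ℝ)) ≤ zeta32 :=
  summable_32.sum_le_tsum _ fun _ _ => by positivity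

theorem sum_32_sym_le (n : ℕ) :
    ∑ m ∈ Ioo 0 n, ((m : ℝ) ^ (-(3 / 2 : ℝ)) + ((n - m : ℕ) : ℝ) ^ (-(3 / 2 : ℝ))) ≤ 2 * zeta32 := by
  rw [sum_add_distrib]
  have h2 : ∑ m ∈ Ioo 0 n, ((n - m : ℕ) : ℝ) ^ (-(3 / 2 : ℝ)) =
      ∑ j ∈ (Ioo 0 n).image (fun m => n - m), (j : ℝ) ^ (-(3 / 2 : ℝ)) := by
    rw [sum_image]
    intro x hx y hy hxy
    simp at hx hy hxy; omega
  rw [h2]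
  linarith [sum_32_le (Ioo 0 n), sum_32_le ((Ioo 0 n).image (fun m => n - m))]

theorem conv_32_le {n m : ℕ} (hm : m ∈ Ioo 0 n) :
    (m : ℝ) ^ (-(3 / 2 : ℝ)) * ((n - m : ℕ) : ℝ) ^ (-(3 / 2 : ℝ)) ≤
      2 ^ (3 / 2 : ℝ) * (n : ℝ) ^ (-(3 / 2 : ℝ)) *
        ((m : ℝ) ^ (-(3 / 2 : ℝ)) + ((n - m : ℕ) : ℝ) ^ (-(3 / 2 : ℝ))) := by
  simp at hm
  have hn : (0 : ℝ) < n := by exact_mod_cast (by omega : 0 < n)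
  have hm0 : (0 : ℝ) ≤ (m : ℝ) ^ (-(3 / 2 : ℝ)) := by positivity
  have hk0 : (0 : ℝ) ≤ ((n - m : ℕ) : ℝ) ^ (-(3 / 2 : ℝ)) := by positivity
  have hc0 : 0 ≤ 2 ^ (3 / 2 : ℝ) * (n : ℝ) ^ (-(3 / 2 : ℝ)) := by positivity
  rw [mul_add]
  rcases le_total n (2 * (n - m)) with h | h
  · have := rpow_half hn (a := 3 / 2) (by norm_num)
      (show (n : ℝ) ≤ 2 * ((n - m : ℕ) : ℝ) by exact_mod_cast h)
    have h2 := mul_le_mul_of_nonneg_left this hm0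
    have := mul_nonneg hc0 hk0
    linarith
  · have := rpow_half hn (a := 3 / 2) (by norm_num)
      (show (n : ℝ) ≤ 2 * (m : ℝ) by exact_mod_cast (by omega : n ≤ 2 * m))
    have h2 := mul_le_mul_of_nonneg_right this hk0
    have := mul_nonneg hc0 hm0
    linarith

/-- Convolution sup bound: use the sup norm of the factor with the larger index. -/
theorem SB_conv_term {n m : ℕ} (hm : m ∈ Ioo 0 n) {s a b t : ℝ} (hs : 0 ≤ s) (ha : 0 ≤ a)
    (hb : 0 ≤ b) {g A B : LF d} (hA : NB m A (a * (m : ℝ) ^ (-(3 / 2 : ℝ))))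
    (hB : NB (n - m) B (b * ((n - m : ℕ) : ℝ) ^ (-(3 / 2 : ℝ)))) (ht : 0 ≤ t)
    (hA' : SB (g * A : LF d) (a * ((m : ℝ) ^ (-s) * t)))
    (hB' : SB (g * B : LF d) (b * (((n - m : ℕ) : ℝ) ^ (-s) * t))) :
    SB (g * (A * B) : LF d) (a * b * 2 ^ s * ((n : ℝ) ^ (-s) * t) *
      ((m : ℝ) ^ (-(3 / 2 : ℝ)) + ((n - m : ℕ) : ℝ) ^ (-(3 / 2 : ℝ)))) := by
  simp at hm
  have hn : (0 : ℝ) < n := by exact_mod_cast (by omega : 0 < n)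
  have hm0 : (0 : ℝ) ≤ (m : ℝ) ^ (-(3 / 2 : ℝ)) := by positivity
  have hk0 : (0 : ℝ) ≤ ((n - m : ℕ) : ℝ) ^ (-(3 / 2 : ℝ)) := by positivity
  have hc0 : 0 ≤ a * b * 2 ^ s * ((n : ℝ) ^ (-s) * t) := by positivity
  rcases le_total n (2 * (n - m)) with h | h
  · have h1 := rpow_half hn hs
      (show (n : ℝ) ≤ 2 * ((n - m : ℕ) : ℝ) by exact_mod_cast h)
    rw [mul_left_comm]
    refine (hA.mul_SB (by positivity) hB').mono ?_
    have h2 := mul_le_mul_of_nonneg_left h1 (by positivity : 0 ≤ a * b * t * (m : ℝ) ^ (-(3 / 2 : ℝ)))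
    have := mul_nonneg hc0 hk0
    linarith
  · have h1 := rpow_half hn hs
      (show (n : ℝ) ≤ 2 * (m : ℝ) by exact_mod_cast (by omega : n ≤ 2 * m))
    rw [← mul_assoc, mul_comm]
    refine (hB.mul_SB (by positivity) hA').mono ?_
    have h2 := mul_le_mul_of_nonneg_left h1
      (by positivity : 0 ≤ a * b * t * ((n - m : ℕ) : ℝ) ^ (-(3 / 2 : ℝ)))
    have := mul_nonneg hc0 hm0
    linarith

theorem Fren_bounds {w : ℝ} {P : ℕ → LF d} (hδ : 0 < delta w P) {α s : ℝ} (hs : 3 / 2 ≤ s)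
    (hα : 0 ≤ α) (hα1 : α * (4 * 2 ^ s * zeta32) ≤ 1)
    (hE : ∀ n : ℕ, 0 < n → NB n (errE w P n) (α * (n : ℝ) ^ (-(3 / 2 : ℝ))) ∧
      ∀ t : ℝ, 1 ≤ t → SB (G d t * errE w P n : LF d)
        (α * ((n : ℝ) ^ (-s) * t ^ (-(3 / 2 : ℝ))))) (n : ℕ) (hn : 0 < n) :
    NB n (Fren w P n) (2 * α * (n : ℝ) ^ (-(3 / 2 : ℝ))) ∧
      ∀ t : ℝ, 1 ≤ t → SB (G d t * Fren w P n : LF d)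
        (2 * α * ((n : ℝ) ^ (-s) * t ^ (-(3 / 2 : ℝ)))) := by
  have hz := zeta32_nonneg
  induction n using Nat.strong_induction_on with
  | _ n ih =>
  have hn' : (0 : ℝ) < n := by exact_mod_cast hn
  have hF := (renewal_uren hδ).F_eq n hn
  have h23 : (2 : ℝ) ^ (3 / 2 : ℝ) ≤ 2 ^ s := Real.rpow_le_rpow_of_exponent_le (by norm_num) hs
  constructor
  · have h1 : NB n (∑ m ∈ Ioo 0 n, errE w P m * Fren w P (n - m) : LF d)
        (∑ m ∈ Ioo 0 n, (2 * α * α * 2 ^ s * (n : ℝ) ^ (-(3 / 2 : ℝ))) *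
          ((m : ℝ) ^ (-(3 / 2 : ℝ)) + ((n - m : ℕ) : ℝ) ^ (-(3 / 2 : ℝ)))) := by
      refine NB.sum _ (fun m _ => by positivity) fun m hm => ?_
      have hm2 := hm
      simp at hm
      have := NB.mul hm.1 (by omega : 0 < n - m) (by positivity) (hE m hm.1).1
        (ih (n - m) (by omega) (by omega)).1
      rw [Nat.add_sub_cancel' hm.2.le] at this
      refine this.mono ?_
      have h2 := mul_le_mul_of_nonneg_left (conv_32_le hm2) (by positivity : 0 ≤ 2 * α * α)
      have h3 := mul_le_mul_of_nonneg_left h23 (by positivity : 0 ≤ 2 * α * α *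
        (n : ℝ) ^ (-(3 / 2 : ℝ)) * ((m : ℝ) ^ (-(3 / 2 : ℝ)) + ((n - m : ℕ) : ℝ) ^ (-(3 / 2 : ℝ))))
      linarith
    rw [hF]
    refine ((hE n hn).1.neg.sub (by positivity) (sum_nonneg fun m _ => by positivity) h1).mono ?_
    rw [← mul_sum]
    have h4 := mul_le_mul_of_nonneg_left (sum_32_sym_le n)
      (by positivity : 0 ≤ 2 * α * α * 2 ^ s * (n : ℝ) ^ (-(3 / 2 : ℝ)))
    have h5 := mul_le_mul_of_nonneg_left hα1 (by positivity : 0 ≤ α * (n : ℝ) ^ (-(3 / 2 : ℝ)))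
    linarith
  · intro t ht
    have ht0 : 0 < t := by linarith
    have h1 : SB (∑ m ∈ Ioo 0 n, G d t * (errE w P m * Fren w P (n - m)) : LF d)
        (∑ m ∈ Ioo 0 n, (α * (2 * α) * 2 ^ s * ((n : ℝ) ^ (-s) * t ^ (-(3 / 2 : ℝ)))) *
          ((m : ℝ) ^ (-(3 / 2 : ℝ)) + ((n - m : ℕ) : ℝ) ^ (-(3 / 2 : ℝ)))) := by
      refine SB.sum _ fun m hm => ?_
      have hm2 := hm
      simp at hm
      have e := hE m hm.1
      have f := ih (n - m) (by omega) (by omega)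
      exact SB_conv_term hm2 (by linarith) hα (by positivity) e.1 f.1 (by positivity)
        (e.2 t ht) (f.2 t ht)
    rw [hF, mul_sub, mul_neg, mul_sum]
    refine (((hE n hn).2 t ht).neg.sub h1).mono ?_
    rw [← mul_sum]
    have h4 := mul_le_mul_of_nonneg_left (sum_32_sym_le n)
      (by positivity : 0 ≤ α * (2 * α) * 2 ^ s * ((n : ℝ) ^ (-s) * t ^ (-(3 / 2 : ℝ))))
    have h5 := mul_le_mul_of_nonneg_left hα1
      (by positivity : 0 ≤ α * ((n : ℝ) ^ (-s) * t ^ (-(3 / 2 : ℝ))))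
    linarith

set_option maxHeartbeats 1000000 in
/-- All bounds on the renewal sequence that follow from bounds on the lace coefficients. -/
theorem uren_bounds (hd : 5 ≤ d) : ∃ K > 0, ∃ β0 > 0, ∀ (β w : ℝ) (P : ℕ → LF d),
    LaceData d β w P → 0 ≤ β → β ≤ β0 →
    |delta w P - 1| ≤ 1 / 8 ∧ ∀ n : ℕ, 0 < n →
    NB n (errE w P n) (K * β * (n : ℝ) ^ (-(3 / 2 : ℝ))) ∧
    NB n (Fren w P n) (K * β * (n : ℝ) ^ (-(3 / 2 : ℝ))) ∧
    (∀ t : ℝ, 1 ≤ t → SB (G d t * Fren w P n : LF d)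
      (K * β * ((n : ℝ) ^ (-((d : ℝ) / 2)) * t ^ (-(3 / 2 : ℝ))))) ∧
    NB n (uren w P n) K ∧ SB (G d 1 * uren w P n : LF d) (K * (n : ℝ) ^ (-((d : ℝ) / 2))) := by
  obtain ⟨K, hK, H⟩ := errE_bounds hd
  set s : ℝ := (d : ℝ) / 2 with hs
  have hs5 : 5 / 2 ≤ s := half_d_ge hd
  set L : ℝ := 8 + 256 * 2 ^ s * 2 with hL
  have hL1 : 1 ≤ L := by
    have : 0 ≤ 256 * (2 : ℝ) ^ s * 2 := by positivity
    linarith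
  set c7 : ℝ := (7 / 8 : ℝ)⁻¹ with hc7
  have hc7p : 0 < c7 := by rw [hc7]; norm_num
  have hc71 : 1 ≤ c7 := by rw [hc7]; norm_num
  have hz := zeta32_nonneg
  set Z : ℝ := zeta32 + 1 with hZ
  have hZ1 : 1 ≤ Z := by linarith
  set M : ℝ := c7 ^ s * 2 ^ s with hM
  have hc7s : 1 ≤ c7 ^ s := Real.one_le_rpow hc71 (by linarith)
  have h2s : (1 : ℝ) ≤ 2 ^ s := Real.one_le_rpow (by norm_num) (by linarith)
  have hM1 : 1 ≤ M := by nlinarith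
  set β0 : ℝ := min (1 / (64 * Z)) (1 / (K * (4 * 2 ^ s * Z))) with hβ0
  set K' : ℝ := 2 * K + L * 4 + M * 8 + 4 with hK'
  refine ⟨K', by positivity, β0, by positivity, fun β w P h hβ hββ => ?_⟩
  have hb1 : β * zeta32 ≤ 1 / 64 := by
    have : β ≤ 1 / (64 * Z) := hββ.trans (min_le_left _ _)
    rw [le_div_iff₀ (by positivity)] at this
    nlinarith
  have hα1 : K * β * (4 * 2 ^ s * Z) ≤ 1 := by
    have : β ≤ 1 / (K * (4 * 2 ^ s * Z)) := hββ.trans (min_le_right _ _)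
    rw [le_div_iff₀ (by positivity)] at this
    linarith
  obtain ⟨-, hδ1, -⟩ := h.delta_facts hd hβ hb1
  refine ⟨hδ1, ?_⟩
  set δ := delta w P with hδ
  have hδlo : 7 / 8 ≤ δ := by have := (abs_le.1 hδ1).1; linarith
  have hδhi : δ ≤ 9 / 8 := by have := (abs_le.1 hδ1).2; linarith
  have hδ0 : 0 < δ := by linarith
  set α := K * β with hα
  have hα0 : 0 ≤ α := by positivity
  have hE := H β w P h hβ hb1
  have hF := Fren_bounds hδ0 (s := s) (α := α) (by linarith) hα0
    (le_trans (by gcongr; linarith) hα1) hE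
  have hαZ : α * Z ≤ 1 := by
    have : 1 * (α * Z) ≤ (4 * 2 ^ s) * (α * Z) := by
      gcongr; linarith
    linarith
  have hαz : α * zeta32 ≤ 1 := le_trans (by gcongr; linarith) hαZ
  have hα1' : α ≤ 1 := by nlinarith
  intro n hn
  have hn' : (0 : ℝ) < n := by exact_mod_cast hn
  have hn1 : (1 : ℝ) ≤ n := by exact_mod_cast hn
  have hKβ : 2 * α ≤ K' * β := by
    rw [hα, hK']
    have : 0 ≤ (L * 4 + M * 8 + 4) * β := by positivity
    linarith
  have hphi : ∀ j : ℕ, 0 < j → NB j (phiD w P j) L := fun j hj => by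
    have hj' : (0 : ℝ) < j := by exact_mod_cast hj
    refine (NB_G j (T := j * δ) (by positivity)).mono ?_
    rw [hL]
    gcongr
    rw [mul_pow, mul_div_cancel_left₀ _ (by positivity)]
    nlinarith
  have hn32 : (n : ℝ) ^ (-(3 / 2 : ℝ)) ≤ 1 :=
    Real.rpow_le_one_of_one_le_of_nonpos hn1 (by norm_num)
  have hu := (renewal_uren hδ0).u_eq n hn
  refine ⟨(hE n hn).1.mono ?_, (hF n hn).1.mono ?_, fun t ht => ((hF n hn).2 t ht).mono ?_, ?_, ?_⟩
  · exact mul_le_mul_of_nonneg_right (by linarith) (by positivity)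
  · exact mul_le_mul_of_nonneg_right hKβ (by positivity)
  · exact mul_le_mul_of_nonneg_right hKβ (by positivity)
  · have h1 : NB n (∑ m ∈ Ioo 0 n, phiD w P (n - m) * Fren w P m : LF d)
        (∑ m ∈ Ioo 0 n, L * (2 * α * (m : ℝ) ^ (-(3 / 2 : ℝ)))) := by
      refine NB.sum _ (fun m _ => by positivity) fun m hm => ?_
      simp at hm
      have := NB.mul (by omega : 0 < n - m) hm.1 (by positivity) (hphi (n - m) (by omega))
        (hF m hm.1).1
      rwa [Nat.sub_add_cancel hm.2.le] at this
    rw [hu]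
    refine (((hphi n hn).add (by positivity) (by positivity) (hF n hn).1).add (by positivity)
      (sum_nonneg fun m _ => by positivity) h1).mono ?_
    rw [← mul_sum, ← mul_sum]
    have h2 := mul_le_mul_of_nonneg_left (sum_32_le (Ioo 0 n)) (by positivity : 0 ≤ L * (2 * α))
    have h3 := mul_le_mul_of_nonneg_left hαz (by positivity : 0 ≤ L * 2)
    have h4 := mul_le_mul_of_nonneg_left hn32 (by positivity : 0 ≤ 2 * α)
    rw [hK']
    linarith
  · have hG : ∀ (j : ℕ) (T : ℝ), 0 < j → j * δ ≤ T → n ≤ 2 * j → SB (G d T) (M * (n : ℝ) ^ (-s)) := by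
      intro j T hj hT hnj
      have hj' : (0 : ℝ) < j := by exact_mod_cast hj
      have hT0 : 0 < T := lt_of_lt_of_le (by positivity) hT
      refine (SB_G hT0).mono ?_
      rw [neg_div, ← hs]
      have e1 : T ^ (-s) ≤ c7 ^ s * (j : ℝ) ^ (-s) :=
        rpow_le_scaled (by norm_num) hj' (by nlinarith) (by linarith)
      have e2 : (j : ℝ) ^ (-s) ≤ 2 ^ s * (n : ℝ) ^ (-s) :=
        rpow_half hn' (by linarith) (by exact_mod_cast hnj)
      have := mul_le_mul_of_nonneg_left e2 (by positivity : 0 ≤ c7 ^ s)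
      rw [hM]; linarith
    have h1 : SB (∑ m ∈ Ioo 0 n, G d 1 * (phiD w P (n - m) * Fren w P m) : LF d)
        (∑ m ∈ Ioo 0 n, (2 * α * M * (n : ℝ) ^ (-s)) *
          ((m : ℝ) ^ (-(3 / 2 : ℝ)) + ((n - m : ℕ) : ℝ) ^ (-(3 / 2 : ℝ)))) := by
      refine SB.sum _ fun m hm => ?_
      simp at hm
      have hm0 : (0 : ℝ) ≤ (m : ℝ) ^ (-(3 / 2 : ℝ)) := by positivity
      have hk0 : (0 : ℝ) ≤ ((n - m : ℕ) : ℝ) ^ (-(3 / 2 : ℝ)) := by positivity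
      have hc0 : 0 ≤ 2 * α * M * (n : ℝ) ^ (-s) := by positivity
      have hj : 0 < n - m := by omega
      have hj' : (0 : ℝ) < (n - m : ℕ) := by exact_mod_cast hj
      rw [← mul_assoc, phiD, G_mul_G one_pos (by positivity)]
      rcases le_total n (2 * (n - m)) with hh | hh
      · rw [mul_comm]
        refine ((hF m hm.1).1.mul_SB (by positivity)
          (hG (n - m) (1 + (n - m : ℕ) * δ) hj (by linarith) hh)).mono ?_
        have := mul_nonneg hc0 hk0
        linarith
      · refine ((hF m hm.1).2 (1 + (n - m : ℕ) * δ) (by nlinarith)).mono ?_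
        have e1 : (m : ℝ) ^ (-s) ≤ 2 ^ s * (n : ℝ) ^ (-s) :=
          rpow_half hn' (by linarith) (by exact_mod_cast (by omega : n ≤ 2 * m))
        have e2 : (1 + (n - m : ℕ) * δ) ^ (-(3 / 2 : ℝ)) ≤
            c7 ^ (3 / 2 : ℝ) * ((n - m : ℕ) : ℝ) ^ (-(3 / 2 : ℝ)) :=
          rpow_le_scaled (by norm_num) hj' (by nlinarith) (by norm_num)
        have e3 : c7 ^ (3 / 2 : ℝ) ≤ c7 ^ s :=
          Real.rpow_le_rpow_of_exponent_le hc71 (by linarith)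
        have e4 := e2.trans (mul_le_mul_of_nonneg_right e3 hk0)
        have e5 := mul_le_mul_of_nonneg_left (mul_le_mul e1 e4 (by positivity) (by positivity))
          (by positivity : 0 ≤ 2 * α)
        have := mul_nonneg hc0 hm0
        rw [hM] at this ⊢
        linarith
    rw [hu, mul_add, mul_add, mul_sum]
    have a1 : SB (G d 1 * phiD w P n : LF d) (M * (n : ℝ) ^ (-s)) := by
      rw [phiD, G_mul_G one_pos (by positivity)]
      exact hG n _ hn (by linarith) (by omega)
    refine ((a1.add ((hF n hn).2 1 le_rfl)).add h1).mono ?_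
    rw [← mul_sum, Real.one_rpow]
    have hns : 0 ≤ (n : ℝ) ^ (-s) := by positivity
    have h2 := mul_le_mul_of_nonneg_left (sum_32_sym_le n)
      (by positivity : 0 ≤ 2 * α * M * (n : ℝ) ^ (-s))
    have h3 := mul_le_mul_of_nonneg_left hαz (by positivity : 0 ≤ M * (n : ℝ) ^ (-s))
    have h4 := mul_le_mul_of_nonneg_right hα1' hns
    have h5 : 0 ≤ (2 * K + L * 4) * (n : ℝ) ^ (-s) := by positivity
    have h6 : 0 ≤ M * (n : ℝ) ^ (-s) := by positivity
    rw [hK']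
    linarith

theorem jhat_le_two_pow {e u : ℕ → ℕ → ℝ≥0∞} (heu : ∀ i j, e i j + u i j = 1) (q p m : ℕ)
    (h : p ≤ m) : jhat e u q p m ≤ 2 ^ (m - p) := by
  induction k : m - p using Nat.strong_induction_on generalizing q p with
  | _ k ih =>
  rcases h.eq_or_lt with rfl | h
  · rw [jhat_self]; exact one_le_pow₀ (by norm_num)
  · rw [jhat_of_lt e u h, ← k, ← sum_two_pow p m h.le]
    refine le_trans (sum_le_sum fun t ht => ?_) le_add_self
    simp at ht
    exact (mul_le_of_le_one_left' (Vp_mul_Kp_le_one heu q p t)).trans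
      (ih (m - t) (by omega) p t ht.2 rfl)

/-- Functions bounded by a multiple of a Gaussian density. -/
structure GB (f : Ed d → ℝ≥0∞) (c t : ℝ) : Prop where
  meas : Measurable f
  c_nonneg : 0 ≤ c
  t_pos : 0 < t
  le : ∀ x, f x ≤ ENNReal.ofReal (c * gauss d t x)

theorem GB.ne_top {f : Ed d → ℝ≥0∞} {c t : ℝ} (h : GB f c t) (x : Ed d) : f x ≠ ⊤ :=
  ((h.le x).trans_lt ENNReal.ofReal_lt_top).ne

theorem GB.toReal_le {f : Ed d → ℝ≥0∞} {c t : ℝ} (h : GB f c t) (x : Ed d) :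
    (f x).toReal ≤ c * gauss d t x :=
  ENNReal.toReal_le_of_le_ofReal (mul_nonneg h.c_nonneg (gauss_nonneg h.t_pos.le x)) (h.le x)

theorem GB.mem {f : Ed d → ℝ≥0∞} {c t : ℝ} (h : GB f c t) : (fun x => (f x).toReal) ∈ Lsub d := by
  refine ⟨h.meas.ennreal_toReal, ?_, c * t ^ (-(d : ℝ) / 2), fun x => ?_⟩
  · refine ((integrable_gauss h.t_pos).const_mul c).mono'
      h.meas.ennreal_toReal.aestronglyMeasurable (Eventually.of_forall fun x => ?_)
    rw [Real.norm_of_nonneg ENNReal.toReal_nonneg]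
    exact h.toReal_le x
  · rw [abs_of_nonneg ENNReal.toReal_nonneg]
    exact (h.toReal_le x).trans (mul_le_mul_of_nonneg_left (gauss_le h.t_pos x) h.c_nonneg)

/-- The element of the convolution ring given by a function dominated by a Gaussian. -/
def toLF (f : Ed d → ℝ≥0∞) : LF d :=
  if h : ∃ c t : ℝ, GB f c t then ⟨fun x => (f x).toReal, h.choose_spec.choose_spec.mem⟩ else 0

theorem GB.toLF_apply {f : Ed d → ℝ≥0∞} {c t : ℝ} (h : GB f c t) (x : Ed d) :
    toLF f x = (f x).toReal := by
  rw [toLF, dif_pos ⟨c, t, h⟩]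

theorem toLF_nonneg (f : Ed d → ℝ≥0∞) (x : Ed d) : 0 ≤ toLF f x := by
  unfold toLF
  split_ifs
  · exact ENNReal.toReal_nonneg
  · simp

theorem GB.ofReal_toLF {f : Ed d → ℝ≥0∞} {c t : ℝ} (h : GB f c t) (x : Ed d) :
    ENNReal.ofReal (toLF f x) = f x := by
  rw [h.toLF_apply, ENNReal.ofReal_toReal (h.ne_top x)]

theorem lconv_ofReal (f g : LF d) (hf : ∀ x, 0 ≤ f x) (hg : ∀ x, 0 ≤ g x) (x : Ed d) :
    lconv (fun z => ENNReal.ofReal (f z)) (fun z => ENNReal.ofReal (g z)) x =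
      ENNReal.ofReal ((f * g : LF d) x) := by
  rw [LF.mul_apply, ofReal_integral_eq_lintegral_ofReal (f.integrable_mul_sub g x)
    (Eventually.of_forall fun y => mul_nonneg (hf _) (hg _))]
  exact lintegral_congr fun y => (ENNReal.ofReal_mul (hf y)).symm

theorem GB.toLF_mul {f g : Ed d → ℝ≥0∞} {c t c' t' : ℝ} (hf : GB f c t) (hg : GB g c' t')
    (x : Ed d) : (toLF f * toLF g : LF d) x = (lconv f g x).toReal := by
  have := lconv_ofReal (toLF f) (toLF g) (toLF_nonneg f) (toLF_nonneg g) x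
  simp only [hf.ofReal_toLF, hg.ofReal_toLF] at this
  rw [this, ENNReal.toReal_ofReal]
  rw [LF.mul_apply]
  exact integral_nonneg fun y => mul_nonneg (toLF_nonneg f _) (toLF_nonneg g _)

theorem GB.lconv_ne_top {f g : Ed d → ℝ≥0∞} {c t c' t' : ℝ} (hf : GB f c t) (hg : GB g c' t')
    (x : Ed d) : lconv f g x ≠ ⊤ := by
  have := lconv_ofReal (toLF f) (toLF g) (toLF_nonneg f) (toLF_nonneg g) x
  simp only [hf.ofReal_toLF, hg.ofReal_toLF] at this
  rw [this]; exact ENNReal.ofReal_ne_top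

theorem lconv_mono {f f' g g' : Ed d → ℝ≥0∞} (hf : ∀ x, f x ≤ f' x) (hg : ∀ x, g x ≤ g' x)
    (x : Ed d) : lconv f g x ≤ lconv f' g' x :=
  lintegral_mono fun z => mul_le_mul' (hf z) (hg _)

/-! The concrete weights. -/

/-- Gaussian step weight. -/
def Dg (d : ℕ) (x : Ed d) : ℝ≥0∞ := ENNReal.ofReal (gauss d 1 x)
/-- Strength of the repulsion. -/
def Ug (d : ℕ) (lam ρ : ℝ) (x : Ed d) : ℝ≥0∞ := ENNReal.ofReal (lam * indBall d ρ x)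
/-- Pair interaction. -/
def Eg (d : ℕ) (lam ρ : ℝ) (x : Ed d) : ℝ≥0∞ := ENNReal.ofReal (1 - lam * indBall d ρ x)

theorem measurable_indBall (ρ : ℝ) : Measurable (indBall d ρ) := by
  unfold indBall
  exact Measurable.ite (measurableSet_le measurable_norm measurable_const) measurable_const
    measurable_const

theorem measurable_Dg : Measurable (Dg d) := (continuous_gauss 1).measurable.ennreal_ofReal
theorem measurable_Ug (lam ρ : ℝ) : Measurable (Ug d lam ρ) :=
  ((measurable_indBall ρ).const_mul lam).ennreal_ofReal
theorem measurable_Eg (lam ρ : ℝ) : Measurable (Eg d lam ρ) :=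
  (((measurable_indBall ρ).const_mul lam).const_sub 1).ennreal_ofReal

theorem lam_indBall_mem {lam : ℝ} (h0 : 0 ≤ lam) (h1 : lam ≤ 1) (ρ : ℝ) (x : Ed d) :
    0 ≤ lam * indBall d ρ x ∧ lam * indBall d ρ x ≤ 1 := by
  unfold indBall
  split_ifs <;> constructor <;> simp <;> assumption

theorem Eg_add_Ug {lam : ℝ} (h0 : 0 ≤ lam) (h1 : lam ≤ 1) (ρ : ℝ) (x : Ed d) :
    Eg d lam ρ x + Ug d lam ρ x = 1 := by
  have := lam_indBall_mem h0 h1 ρ x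
  rw [Eg, Ug, ← ENNReal.ofReal_add (by linarith) this.1]
  simp

theorem GB_Cn {E U : Ed d → ℝ≥0∞} (hE : Measurable E) (heu : ∀ x, E x + U x = 1) {n : ℕ}
    (hn : 0 < n) : GB (Cn (Dg d) E n) 1 n := by
  refine ⟨measurable_Cn measurable_Dg hE n, zero_le_one, by exact_mod_cast hn, ?_⟩
  have hE1 : ∀ x, E x ≤ 1 := fun x => (heu x) ▸ le_self_add
  induction n, hn using Nat.le_induction with
  | base =>
    intro x
    show Cn (Dg d) E 1 x ≤ ENNReal.ofReal (1 * gauss d ((1 : ℕ) : ℝ) x)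
    rw [Cn_one, one_mul, Nat.cast_one]
    exact mul_le_of_le_one_left' (hE1 x)
  | succ n hn ih =>
    intro x
    have hn' : (0 : ℝ) < n := by exact_mod_cast hn
    refine (Cn_add_le measurable_Dg hE heu hn one_pos x).trans ?_
    have h1 : ∀ x, Cn (Dg d) E n x ≤ ENNReal.ofReal (G d n x) := fun x => by
      rw [G_apply hn']; simpa using ih x
    have h2 : ∀ x, Cn (Dg d) E 1 x ≤ ENNReal.ofReal (G d 1 x) := fun x => by
      rw [G_apply one_pos, Cn_one]; exact mul_le_of_le_one_left' (hE1 x)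
    refine (lconv_mono h1 h2 x).trans ?_
    rw [lconv_ofReal _ _ (G_nonneg _) (G_nonneg _), G_mul_G hn' one_pos, G_apply (by positivity)]
    simp

theorem GB_Pn {E U : Ed d → ℝ≥0∞} (hE : Measurable E) (hU : Measurable U)
    (heu : ∀ x, E x + U x = 1) (σ : Bool) {m : ℕ} (hm : 0 < m) :
    GB (Pn (Dg d) E U σ m) (2 ^ m) m := by
  refine ⟨measurable_Pn measurable_Dg hE hU σ m, by positivity, by exact_mod_cast hm, fun x => ?_⟩
  have hfree := (GB_Cn (d := d) (E := fun _ => 1) (U := fun _ => 0) measurable_const (by simp) hm).le x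
  have hj : ∀ y : ℕ → Ed d, Kp (pw E y) 0 1 * jfun (pw E y) (pw U y) σ 0 1 m * Phi (Dg d) 0 m y ≤
      2 ^ m * Wline (Dg d) (fun _ => 1) 0 m y := by
    intro y
    have h1 : jfun (pw E y) (pw U y) σ 0 1 m ≤ 2 ^ m := by
      refine le_trans ?_ ((jhat_le_two_pow (pw_add heu y) 0 1 m hm).trans
        (pow_le_pow_right₀ (by norm_num) (Nat.sub_le m 1)))
      cases σ
      · exact le_add_self
      · exact le_self_add
    have h2 : Wline (Dg d) (fun _ => 1) 0 m y = Phi (Dg d) 0 m y := by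
      simp [Wline, Kp, pw]
    rw [h2]
    exact mul_le_mul' ((mul_le_of_le_one_left' (Kp_le_one (pw_add heu y) 0 1)).trans h1) le_rfl
  refine (marg_mono hj (pt x)).trans ?_
  have hmul : marg (Ioo 0 m) (fun y => 2 ^ m * Wline (Dg d) (fun _ => 1) 0 m y) (pt x) =
      2 ^ m * Cn (Dg d) (fun _ => 1) m x :=
    marg_mul_left (S := ∅) (g := fun _ => 2 ^ m) (fun _ _ _ => rfl) (by simp)
      (measurable_Wline measurable_Dg measurable_const 0 m) (pt x)
  rw [hmul, ENNReal.ofReal_mul (by positivity), ENNReal.ofReal_pow (by norm_num)]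
  refine mul_le_mul' (by simp) ?_
  simpa using hfree

/-! The convolution recursion in the ring. -/

section

variable (d) (lam ρ : ℝ)

/-- The two-point function in the ring. -/
def cLF (n : ℕ) : LF d := if n = 0 then 0 else toLF (Cn (Dg d) (Eg d lam ρ) n)

/-- The alternating lace coefficient. -/
def pLF (m : ℕ) : LF d := if m = 0 then 0 else
  toLF (Pn (Dg d) (Eg d lam ρ) (Ug d lam ρ) true m) -
    toLF (Pn (Dg d) (Eg d lam ρ) (Ug d lam ρ) false m)

/-- The lace coefficient without the free step. -/
def piLF (m : ℕ) : LF d := pLF d lam ρ m - if m = 1 then G d 1 else 0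

end

variable {lam ρ : ℝ}

theorem cLF_apply (h0 : 0 ≤ lam) (h1 : lam ≤ 1) {n : ℕ} (hn : 0 < n) (x : Ed d) :
    cLF d lam ρ n x = (Cn (Dg d) (Eg d lam ρ) n x).toReal := by
  rw [cLF, if_neg hn.ne', (GB_Cn (measurable_Eg lam ρ) (Eg_add_Ug h0 h1 ρ) hn).toLF_apply]

theorem cLF_nonneg (n : ℕ) (x : Ed d) : 0 ≤ cLF d lam ρ n x := by
  unfold cLF; split_ifs
  · simp
  · exact toLF_nonneg _ _

theorem ofReal_cLF (h0 : 0 ≤ lam) (h1 : lam ≤ 1) {n : ℕ} (hn : 0 < n) (x : Ed d) :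
    ENNReal.ofReal (cLF d lam ρ n x) = Cn (Dg d) (Eg d lam ρ) n x := by
  rw [cLF, if_neg hn.ne', (GB_Cn (measurable_Eg lam ρ) (Eg_add_Ug h0 h1 ρ) hn).ofReal_toLF]

theorem pLF_apply (h0 : 0 ≤ lam) (h1 : lam ≤ 1) {m : ℕ} (hm : 0 < m) (x : Ed d) :
    pLF d lam ρ m x = (Pn (Dg d) (Eg d lam ρ) (Ug d lam ρ) true m x).toReal -
      (Pn (Dg d) (Eg d lam ρ) (Ug d lam ρ) false m x).toReal := by
  have h := fun σ => GB_Pn (measurable_Eg lam ρ) (measurable_Ug lam ρ) (Eg_add_Ug h0 h1 ρ) σ hm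
    (d := d)
  rw [pLF, if_neg hm.ne', LF.sub_apply, (h true).toLF_apply, (h false).toLF_apply]

theorem toReal_lconvC (h0 : 0 ≤ lam) (h1 : lam ≤ 1) (σ : Bool) {m : ℕ} (hm : 0 < m) (k : ℕ)
    (x : Ed d) :
    lconvC (Dg d) (Eg d lam ρ) (Pn (Dg d) (Eg d lam ρ) (Ug d lam ρ) σ m) k x ≠ ⊤ ∧
    (lconvC (Dg d) (Eg d lam ρ) (Pn (Dg d) (Eg d lam ρ) (Ug d lam ρ) σ m) k x).toReal =
      (if k = 0 then toLF (Pn (Dg d) (Eg d lam ρ) (Ug d lam ρ) σ m) else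
        toLF (Pn (Dg d) (Eg d lam ρ) (Ug d lam ρ) σ m) * cLF d lam ρ k : LF d) x := by
  have h := GB_Pn (measurable_Eg lam ρ) (measurable_Ug lam ρ) (Eg_add_Ug h0 h1 ρ) σ hm (d := d)
  unfold lconvC
  by_cases hk : k = 0
  · simp only [hk, if_true]
    exact ⟨h.ne_top x, (h.toLF_apply x).symm⟩
  · simp only [hk, if_false, cLF]
    have hc := GB_Cn (measurable_Eg lam ρ) (Eg_add_Ug h0 h1 ρ) (d := d) (Nat.pos_of_ne_zero hk)
    exact ⟨h.lconv_ne_top hc x, (h.toLF_mul hc x).symm⟩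

theorem cLF_eq (h0 : 0 ≤ lam) (h1 : lam ≤ 1) {n : ℕ} (hn : 0 < n) :
    cLF d lam ρ n = pLF d lam ρ n + ∑ m ∈ Ioo 0 n, pLF d lam ρ m * cLF d lam ρ (n - m) := by
  have hIcc : Icc 1 n = insert n (Ioo 0 n) := by ext; simp; omega
  have key : ∀ (σ : Bool) (x : Ed d), (∑ m ∈ Icc 1 n, lconvC (Dg d) (Eg d lam ρ)
      (Pn (Dg d) (Eg d lam ρ) (Ug d lam ρ) σ m) (n - m) x).toReal =
      (toLF (Pn (Dg d) (Eg d lam ρ) (Ug d lam ρ) σ n) + ∑ m ∈ Ioo 0 n,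
        toLF (Pn (Dg d) (Eg d lam ρ) (Ug d lam ρ) σ m) * cLF d lam ρ (n - m) : LF d) x := by
    intro σ x
    rw [ENNReal.toReal_sum fun m hm => (toReal_lconvC h0 h1 σ (mem_Icc.1 hm).1 _ x).1, hIcc,
      sum_insert (by simp), LF.add_apply, LF.sum_apply]
    congr 1
    · rw [(toReal_lconvC h0 h1 σ hn _ x).2]; simp
    · refine sum_congr rfl fun m hm => ?_
      simp at hm
      rw [(toReal_lconvC h0 h1 σ hm.1 _ x).2, if_neg (by omega)]
  have hne : ∀ (σ : Bool) (x : Ed d), ∑ m ∈ Icc 1 n, lconvC (Dg d) (Eg d lam ρ)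
      (Pn (Dg d) (Eg d lam ρ) (Ug d lam ρ) σ m) (n - m) x ≠ ⊤ := fun σ x =>
    ENNReal.sum_ne_top.2 fun m hm => (toReal_lconvC h0 h1 σ (mem_Icc.1 hm).1 _ x).1
  have hsum : cLF d lam ρ n + (toLF (Pn (Dg d) (Eg d lam ρ) (Ug d lam ρ) false n) +
        ∑ m ∈ Ioo 0 n, toLF (Pn (Dg d) (Eg d lam ρ) (Ug d lam ρ) false m) * cLF d lam ρ (n - m)) =
      toLF (Pn (Dg d) (Eg d lam ρ) (Ug d lam ρ) true n) +
        ∑ m ∈ Ioo 0 n, toLF (Pn (Dg d) (Eg d lam ρ) (Ug d lam ρ) true m) * cLF d lam ρ (n - m) := by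
    ext x
    have hl := lace_expansion measurable_Dg (measurable_Eg lam ρ) (measurable_Ug lam ρ)
      (Eg_add_Ug h0 h1 ρ) hn x
    rw [← key true x, ← hl, ENNReal.toReal_add
      ((GB_Cn (measurable_Eg lam ρ) (Eg_add_Ug h0 h1 ρ) hn).ne_top x) (hne false x), LF.add_apply,
      cLF_apply h0 h1 hn, key false x]
  have hp : ∑ m ∈ Ioo 0 n, pLF d lam ρ m * cLF d lam ρ (n - m) =
      ∑ m ∈ Ioo 0 n, toLF (Pn (Dg d) (Eg d lam ρ) (Ug d lam ρ) true m) * cLF d lam ρ (n - m) -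
      ∑ m ∈ Ioo 0 n, toLF (Pn (Dg d) (Eg d lam ρ) (Ug d lam ρ) false m) * cLF d lam ρ (n - m) := by
    rw [← sum_sub_distrib]
    refine sum_congr rfl fun m hm => ?_
    simp at hm
    rw [pLF, if_neg (by omega), sub_mul]
  rw [hp, pLF, if_neg hn.ne']
  have := eq_sub_of_add_eq hsum
  rw [this]; abel

theorem Sym.of_isometry {f : LF d} {m : ℕ} {c : ℝ} (hm : 0 < m) (h : NB m f c)
    (hf : ∀ (L : Ed d ≃ₗᵢ[ℝ] Ed d) (x : Ed d), f (L x) = f x) : Sym f := by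
  have key : ∀ v w : Ed d, ‖v‖ = ‖w‖ → ∫ y, f y * ⟪v, y⟫ ^ 2 = ∫ y, f y * ⟪w, y⟫ ^ 2 := by
    intro v w hvw
    set L := (ℝ ∙ (v - w))ᗮ.reflection with hL
    have hLv : L v = w := Submodule.reflection_sub hvw
    rw [← (L.measurePreserving).integral_comp L.toHomeomorph.measurableEmbedding
      (fun y => f y * ⟪w, y⟫ ^ 2)]
    refine integral_congr_ae (Eventually.of_forall fun y => ?_)
    simp only
    rw [hf, ← hLv, L.inner_map_map]
  refine ⟨fun x => hf (LinearIsometryEquiv.neg ℝ) x, fun x => ?_⟩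
  rcases Nat.eq_zero_or_pos d with rfl | hd
  · have : x = 0 := Subsingleton.elim _ _
    simp [this]
  have hi : ∀ i : Fin d, ∫ y, f y * ⟪x, y⟫ ^ 2 = ‖x‖ ^ 2 * ∫ y : Ed d, f y * (y i) ^ 2 := by
    intro i
    rw [key x (‖x‖ • EuclideanSpace.single i (1 : ℝ)) (by simp [norm_smul]), ← integral_const_mul]
    refine integral_congr_ae (Eventually.of_forall fun y => ?_)
    simp only [inner_smul_left, EuclideanSpace.inner_single_left]
    simp
    ring
  have hint : ∀ i : Fin d, Integrable fun y : Ed d => f y * (y i) ^ 2 := by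
    intro i
    have := integrable_mul_inner_sq hm h (EuclideanSpace.single i (1 : ℝ))
    simpa [EuclideanSpace.inner_single_left] using this
  have hd' : (d : ℝ) ≠ 0 := by positivity
  have hs : (d : ℝ) * ∫ y, f y * ⟪x, y⟫ ^ 2 = ‖x‖ ^ 2 * ∫ y, ‖y‖ ^ 2 * f y := by
    have : ∑ i : Fin d, ∫ y, f y * ⟪x, y⟫ ^ 2 = ‖x‖ ^ 2 * ∑ i : Fin d, ∫ y : Ed d, f y * (y i) ^ 2 := by
      rw [mul_sum]; exact sum_congr rfl fun i _ => hi i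
    rw [sum_const, Finset.card_univ, Fintype.card_fin, nsmul_eq_mul] at this
    rw [this, ← integral_finsetSum _ fun i _ => hint i]
    congr 1
    refine integral_congr_ae (Eventually.of_forall fun y => ?_)
    simp only
    rw [EuclideanSpace.norm_sq_eq, sum_mul]
    exact sum_congr rfl fun i _ => by simp [mul_comm]
  field_simp
  linarith

theorem Pn_isometry {lam ρ : ℝ} (σ : Bool) (m : ℕ) (L : Ed d ≃ₗᵢ[ℝ] Ed d) (x : Ed d) :
    Pn (Dg d) (Eg d lam ρ) (Ug d lam ρ) σ m (L x) = Pn (Dg d) (Eg d lam ρ) (Ug d lam ρ) σ m x := by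
  refine marg_comp_pt (measurable_Pn_integrand measurable_Dg (measurable_Eg lam ρ)
    (measurable_Ug lam ρ) σ m) L.toMeasurableEquiv L.measurePreserving (map_zero L) (fun y => ?_) _ x
  have hE : pw (Eg d lam ρ) (fun i => L (y i)) = pw (Eg d lam ρ) y := by
    funext i j; simp only [pw, Eg, indBall, ← map_sub, L.norm_map]
  have hU : pw (Ug d lam ρ) (fun i => L (y i)) = pw (Ug d lam ρ) y := by
    funext i j; simp only [pw, Ug, indBall, ← map_sub, L.norm_map]
  have hD : Phi (Dg d) 0 m (fun i => L (y i)) = Phi (Dg d) 0 m y := by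
    simp only [Phi, Dg, gauss, ← map_sub, L.norm_map]
  exact congrArg₂ _ (congrArg₂ _ (congrArg (fun e => Kp e 0 1) hE)
    (congrArg₂ (fun e u => jfun e u σ 0 1 m) hE hU)) hD

theorem piLF_isometry (h0 : 0 ≤ lam) (h1 : lam ≤ 1) (m : ℕ) (L : Ed d ≃ₗᵢ[ℝ] Ed d) (x : Ed d) :
    piLF d lam ρ m (L x) = piLF d lam ρ m x := by
  have hp : pLF d lam ρ m (L x) = pLF d lam ρ m x := by
    rcases Nat.eq_zero_or_pos m with rfl | hm
    · simp [pLF]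
    · rw [pLF_apply h0 h1 hm, pLF_apply h0 h1 hm, Pn_isometry, Pn_isometry]
  rw [piLF, LF.sub_apply, LF.sub_apply, hp]
  split_ifs
  · rw [G_apply one_pos, G_apply one_pos]; simp [gauss]
  · simp

theorem abs_pLF_le (h0 : 0 ≤ lam) (h1 : lam ≤ 1) {m : ℕ} (hm : 0 < m) (x : Ed d) :
    |pLF d lam ρ m x| ≤ 2 ^ (m + 1) * gauss d m x := by
  have h := fun σ => (GB_Pn (measurable_Eg lam ρ) (measurable_Ug lam ρ) (Eg_add_Ug h0 h1 ρ) σ hm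
    (d := d)).toReal_le x
  rw [pLF_apply h0 h1 hm, pow_succ]
  refine (abs_sub _ _).trans ?_
  rw [abs_of_nonneg ENNReal.toReal_nonneg, abs_of_nonneg ENNReal.toReal_nonneg]
  linarith [h true, h false]

theorem sym_zero : Sym (0 : LF d) := ⟨fun x => by simp, fun x => by simp⟩

theorem Sym.smul {f : LF d} (h : Sym f) (a : ℝ) : Sym (a • f : LF d) := by
  refine ⟨fun x => by simp [h.even], fun x => ?_⟩
  simp only [LF.smul_apply, mul_assoc, mul_left_comm _ a, integral_const_mul, h.iso]

theorem sym_piLF (h0 : 0 ≤ lam) (h1 : lam ≤ 1) (m : ℕ) : Sym (piLF d lam ρ m) := by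
  rcases Nat.eq_zero_or_pos m with rfl | hm
  · simpa [piLF, pLF] using sym_zero
  have hm' : (0 : ℝ) < m := by exact_mod_cast hm
  have hp : NB m (pLF d lam ρ m) (|2 ^ (m + 1)| * _) :=
    ((NB_G m hm').smul (2 ^ (m + 1))).of_abs_le fun x => by
      rw [LF.smul_apply, G_apply hm', abs_of_nonneg (mul_nonneg (by positivity)
        (gauss_nonneg hm'.le x))]
      exact abs_pLF_le h0 h1 hm x
  refine Sym.of_isometry hm (hp.sub (by positivity) ?_ (f := pLF d lam ρ m)
    (g := if m = 1 then G d 1 else 0) (c' := 8 + 256 * 2 ^ ((d : ℝ) / 2) * (1 ^ 2 / m ^ 2)) ?_)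
    (piLF_isometry h0 h1 m)
  · positivity
  · refine (NB_G m one_pos).of_abs_le fun x => ?_
    split_ifs
    · rfl
    · simp

/-! Identification with the connectivity function. -/

theorem Csaw_eq (h0 : 0 ≤ lam) (h1 : lam ≤ 1) {n : ℕ} (hn : 0 < n) (x : Ed d) :
    Csaw d lam ρ n x = cLF d lam ρ n x := by
  have hK : ∀ y : ℕ → Ed d, Kp (pw (Eg d lam ρ) y) 0 n = ENNReal.ofReal (Ksaw d lam ρ 0 n y) := by
    intro y
    have hnn : ∀ z : Ed d, 0 ≤ 1 - lam * indBall d ρ z := fun z => by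
      linarith [(lam_indBall_mem h0 h1 ρ z).2]
    rw [Ksaw, ENNReal.ofReal_prod_of_nonneg fun p _ => hnn _, Kp, prod_sigma']
    refine prod_nbij' (fun p => (p.2, p.1)) (fun p => ⟨p.2, p.1⟩) ?_ ?_ ?_ ?_ ?_
    · rintro ⟨j, i⟩ h; simp at h ⊢; omega
    · rintro ⟨i, j⟩ h; simp at h ⊢; omega
    · rintro ⟨j, i⟩ h; rfl
    · rintro ⟨i, j⟩ h; rfl
    · rintro ⟨j, i⟩ h; rfl
  have hP : ∀ y : ℕ → Ed d, Phi (Dg d) 0 n y = ENNReal.ofReal (PhiProd d 0 n y) := by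
    intro y
    rw [PhiProd, ENNReal.ofReal_prod_of_nonneg fun p _ => gauss_nonneg zero_le_one _, Phi]
    rfl
  have hKn : ∀ y : ℕ → Ed d, 0 ≤ Ksaw d lam ρ 0 n y := fun y => prod_nonneg fun p _ => by
    linarith [(lam_indBall_mem h0 h1 ρ (y p.2 - y p.1)).2]
  have hPn : ∀ y : ℕ → Ed d, 0 ≤ PhiProd d 0 n y := fun y => prod_nonneg fun p _ =>
    gauss_nonneg zero_le_one _
  have hW : ∀ y : ℕ → Ed d, Wline (Dg d) (Eg d lam ρ) 0 n y =
      ENNReal.ofReal (Ksaw d lam ρ 0 n y * PhiProd d 0 n y) := fun y => by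
    rw [Wline, hK, hP, ENNReal.ofReal_mul (hKn y)]
  have hpath : Measurable fun z : Fin (n - 1) → Ed d => sawPath d n x (extPath d (n - 1) z) := by
    refine measurable_pi_lambda _ fun j => ?_
    unfold sawPath extPath
    split_ifs <;> fun_prop
  have hWm := measurable_Wline (measurable_Dg (d := d)) (measurable_Eg lam ρ) 0 n
  rw [Csaw, integral_eq_lintegral_of_nonneg_ae (Eventually.of_forall fun z => mul_nonneg (hKn _)
    (hPn _))]
  · rw [cLF_apply h0 h1 hn]
    congr 1
    simp only [← hW]
    let e : Fin (n - 1) → ℕ := fun i => i + 1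
    have he : Function.Injective e := fun i j h => by
      apply Fin.ext; simpa [e] using h
    have hs : Ioo 0 n = Finset.univ.image e := by
      ext k
      simp only [mem_Ioo, mem_image, mem_univ, true_and, e]
      constructor
      · rintro ⟨hk, hk'⟩
        exact ⟨⟨k - 1, by omega⟩, by simp; omega⟩
      · rintro ⟨i, rfl⟩; have := i.2; omega
    rw [Cn, hs]
    have h := lmarginal_image (X := fun _ : ℕ => Ed d) (μ := fun _ => (volume : Measure (Ed d))) he
      Finset.univ (hWm.comp hpath) (pt x)
    rw [lmarginal_univ] at h
    refine h.symm.trans (lintegral_congr fun z => ?_)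
    refine dependsOn_Wline 0 n fun i hi => ?_
    have hi' : i ≤ n := hi.2
    have hupd : ∀ j : ℕ, 1 ≤ j → ∀ h : j - 1 < n - 1,
        Function.updateFinset (pt x) (Finset.univ.image e) z (e ⟨j - 1, h⟩) =
        Function.updateFinset (pt x) (Finset.univ.image e) z j := fun j hj h => by
      congr 1; simp [e]; omega
    by_cases h0 : i = 0
    · subst h0
      have : (0 : ℕ) ∉ Finset.univ.image e := by rw [← hs]; simp
      simp [sawPath, Function.updateFinset, this, pt]
    · by_cases h2 : i = n
      · subst h2
        have : i ∉ Finset.univ.image e := by rw [← hs]; simp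
        simp [sawPath, Function.updateFinset, this, pt, h0]
      · have h3 : 1 ≤ i ∧ i ≤ n - 1 := by omega
        simp only [sawPath, h0, h2, if_false, extPath, dif_pos h3]
        exact hupd i h3.1 _
  · have : (fun z : Fin (n - 1) → Ed d => Ksaw d lam ρ 0 n (sawPath d n x (extPath d (n - 1) z)) *
        PhiProd d 0 n (sawPath d n x (extPath d (n - 1) z))) =
        fun z => (Wline (Dg d) (Eg d lam ρ) 0 n (sawPath d n x (extPath d (n - 1) z))).toReal := by
      funext z
      rw [hW, ENNReal.toReal_ofReal (mul_nonneg (hKn _) (hPn _))]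
    rw [this]
    exact ((hWm.comp hpath).ennreal_toReal).aestronglyMeasurable

/-- Weighted mass and supremum bounds on the two-point functions up to time `R`. -/
def TwoPointBound (d : ℕ) (lam ρ A w : ℝ) (R : ℕ) : Prop :=
  ∀ n : ℕ, 0 < n → n ≤ R → NB n (w ^ n • cLF d lam ρ n : LF d) A ∧
    ∀ x, wt n x * (w ^ n * cLF d lam ρ n x) ≤ A * (n : ℝ) ^ (-((d : ℝ) / 2))

theorem lintegral_Ug_le (h0 : 0 ≤ lam) (hρ : ρ ≤ 1) :
    ∫⁻ x, Ug d lam ρ x ≤ ENNReal.ofReal (lam * (volume.real (Metric.closedBall (0 : Ed d) 1))) := by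
  rw [ENNReal.ofReal_mul h0, Measure.real, ENNReal.ofReal_toReal measure_closedBall_lt_top.ne,
    ← lintegral_indicator_const Metric.isClosed_closedBall.measurableSet]
  refine lintegral_mono fun x => ?_
  unfold Ug indBall Set.indicator
  split_ifs with h1 h2 h2
  · simp
  · exact absurd (by simpa using h1.trans hρ) h2
  · simp
  · simp

theorem lintegral_lace_bound (hd : 5 ≤ d) {A : ℝ} (hA : 0 < A) : ∃ L > 0, ∃ lam0 > 0, lam0 ≤ 1 ∧
    ∀ lam ρ : ℝ, 0 ≤ lam → lam ≤ lam0 → ρ ≤ 1 → ∀ w, 0 < w → ∀ R,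
    TwoPointBound d lam ρ A w R → ∀ m, 2 ≤ m → m ≤ R + 1 →
    ∫⁻ x, ENNReal.ofReal (w ^ m * wt m x) * (Pn (Dg d) (Eg d lam ρ) (Ug d lam ρ) true m x +
      Pn (Dg d) (Eg d lam ρ) (Ug d lam ρ) false m x) ≤
      ENNReal.ofReal (L * lam * (m : ℝ) ^ (-((d : ℝ) / 2))) := by
  set s : ℝ := (d : ℝ) / 2 with hs
  have hs5 : 5 / 2 ≤ s := half_d_ge hd
  set v : ℝ := volume.real (Metric.closedBall (0 : Ed d) 1) with hv
  have hv0 : 0 < v := ENNReal.toReal_pos (Metric.measure_closedBall_pos _ _ one_pos).ne'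
    measure_closedBall_lt_top.ne
  have hgs : Summable fun n : ℕ => (n : ℝ) ^ (-(s / 2)) := Real.summable_nat_rpow.2 (by linarith)
  set Gs : ℝ := ∑' n : ℕ, (n : ℝ) ^ (-(s / 2)) with hGs
  have hG0 : 0 ≤ Gs := tsum_nonneg fun n => by positivity
  set Q : ℝ := 3 ^ s with hQ
  have hQ1 : 1 ≤ Q := Real.one_le_rpow (by norm_num) (by linarith)
  set Z : ℝ := 2 * (A + A * A) * v * (Q * (2 * Gs + 3 * (Gs * Gs))) with hZ
  have hZ0 : 0 ≤ Z := by positivity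
  refine ⟨A * (2 * v * A) * Q, by positivity, 1 / (1 + Z), by positivity, ?_, ?_⟩
  · rw [div_le_one (by positivity)]; linarith
  intro lam ρ h0 h1 hρ w hw R hB m hm hmR
  have hlam1 : lam ≤ 1 := h1.trans (by rw [div_le_one (by positivity)]; linarith)
  have hlZ : lam * Z ≤ 1 := by
    rw [le_div_iff₀ (by positivity)] at h1
    nlinarith
  let q : ℕ → ℝ≥0∞ := fun n => if n = 0 then 1 else ENNReal.ofReal ((n : ℝ) ^ (-s))
  let g : ℕ → ℝ≥0∞ := fun n => ENNReal.ofReal ((n : ℝ) ^ (-(s / 2)))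
  have hq : ∀ n : ℕ, 0 < n → q n = ENNReal.ofReal ((n : ℝ) ^ (-s)) := fun n hn => by
    simp [q, hn.ne']
  have key := lintegral_Pn_bound (d := d) (D := Dg d) (E := Eg d lam ρ) (U := Ug d lam ρ)
    (θ := fun n x => ENNReal.ofReal (w ^ n * wt n x)) measurable_Dg (measurable_Eg lam ρ)
    (measurable_Ug lam ρ) (fun n => ((measurable_wt n).const_mul _).ennreal_ofReal)
    (Eg_add_Ug h0 hlam1 ρ) ?_ (q := q) (g := g) (Q := ENNReal.ofReal Q) (A := ENNReal.ofReal A)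
    (β := ENNReal.ofReal (2 * v * A * lam)) (R := R) ?_ ?_ ?_ ?_ (G := ENNReal.ofReal Gs)
    (Λ := ENNReal.ofReal (lam * v)) ?_ (lintegral_Ug_le h0 hρ) ?_ ?_ ?_ hm hmR
  · refine key.trans ?_
    rw [hq m (by omega), ← ENNReal.ofReal_mul hA.le, ← ENNReal.ofReal_mul (by positivity),
      ← ENNReal.ofReal_mul (by positivity)]
    refine ENNReal.ofReal_le_ofReal (le_of_eq ?_)
    ring
  · intro m l x y hm hl
    rw [← ENNReal.ofReal_mul (mul_nonneg (by positivity) (wt_nonneg _ _))]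
    refine ENNReal.ofReal_le_ofReal ?_
    calc w ^ (m + l) * wt (m + l) (x + y) ≤ w ^ (m + l) * (wt m x * wt l y) :=
          mul_le_mul_of_nonneg_left (wt_add_le hm hl x y) (by positivity)
      _ = _ := by rw [pow_add]; ring
  · intro a c ha hac
    have ha' : (0 : ℝ) < a := by exact_mod_cast ha
    have hc' : (0 : ℝ) < c := by exact_mod_cast ha.trans_le hac
    have hac' : (a : ℝ) ≤ c := by exact_mod_cast hac
    rw [hq c (by omega), ← ENNReal.ofReal_mul (by positivity)]
    refine ENNReal.ofReal_le_ofReal ?_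
    rw [show -s = -(s / 2) + -(s / 2) by ring, Real.rpow_add hc']
    exact mul_le_mul_of_nonneg_right (Real.rpow_le_rpow_of_nonpos ha' hac' (by linarith))
      (by positivity)
  · intro a r ha har
    have ha' : (1 : ℝ) ≤ a := by exact_mod_cast ha
    rw [hq a ha]
    rcases Nat.eq_zero_or_pos r with hr | hr
    · simp only [hr, q, if_true, mul_one]
      refine ENNReal.ofReal_le_ofReal (le_trans ?_ hQ1)
      exact Real.rpow_le_one_of_one_le_of_nonpos ha' (by linarith)
    · rw [hq r hr, ← ENNReal.ofReal_mul (by positivity)]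
      refine ENNReal.ofReal_le_ofReal ?_
      have hr' : (0 : ℝ) < r := by exact_mod_cast hr
      have har' : (r : ℝ) ≤ 3 * a := by exact_mod_cast har
      have := rpow_le_scaled (c := 1 / 3) (x := r) (y := a) (a := s) (by norm_num) hr'
        (by linarith) (by linarith)
      simpa using this
  · intro n hn
    rw [hq n hn]
    refine ENNReal.ofReal_le_ofReal ?_
    exact Real.rpow_le_rpow_of_exponent_le (by exact_mod_cast hn) (by linarith)
  · simpa using ENNReal.ofReal_le_ofReal hQ1
  · rw [hGs, ENNReal.ofReal_tsum_of_nonneg (fun n => by positivity) hgs]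
  · have e : ENNReal.ofReal (lam * v) * (ENNReal.ofReal A + (ENNReal.ofReal A +
        ENNReal.ofReal A * ENNReal.ofReal A) * ENNReal.ofReal (2 * v * A * lam) *
        (ENNReal.ofReal Q * (2 * ENNReal.ofReal Gs + 3 * (ENNReal.ofReal Gs * ENNReal.ofReal Gs)))) =
        ENNReal.ofReal (lam * v * (A + (A + A * A) * (2 * v * A * lam) *
          (Q * (2 * Gs + 3 * (Gs * Gs))))) := by
      have h2 : (2 : ℝ≥0∞) = ENNReal.ofReal 2 := by simp
      have h3 : (3 : ℝ≥0∞) = ENNReal.ofReal 3 := by simp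
      rw [h2, h3]
      repeat first
        | rw [← ENNReal.ofReal_mul (by positivity)]
        | rw [← ENNReal.ofReal_add (by positivity) (by positivity)]
    rw [e]
    refine ENNReal.ofReal_le_ofReal ?_
    have : lam * v * (A + (A + A * A) * (2 * v * A * lam) * (Q * (2 * Gs + 3 * (Gs * Gs)))) =
        lam * v * A * (1 + lam * Z) := by rw [hZ]; ring
    rw [this]
    have h5 : lam * v * A * (1 + lam * Z) ≤ lam * v * A * 2 :=
      mul_le_mul_of_nonneg_left (by linarith) (by positivity)
    linarith
  · intro n hn hnR
    refine le_trans (le_of_eq (lintegral_congr fun x => ?_)) (hB n hn hnR).1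
    rw [ut, ← ofReal_cLF h0 hlam1 hn, ← ENNReal.ofReal_mul (mul_nonneg (by positivity)
      (wt_nonneg _ _)), LF.smul_apply, abs_of_nonneg (mul_nonneg (by positivity) (cLF_nonneg _ _))]
    congr 1; ring
  · intro n hn hnR x
    rw [ut, ← ofReal_cLF h0 hlam1 hn, ← ENNReal.ofReal_mul (mul_nonneg (by positivity)
      (wt_nonneg _ _)), hq n hn, ← ENNReal.ofReal_mul hA.le]
    refine ENNReal.ofReal_le_ofReal (le_trans (le_of_eq ?_) ((hB n hn hnR).2 x))
    ring

theorem piLF_one_apply (h0 : 0 ≤ lam) (h1 : lam ≤ 1) (x : Ed d) :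
    piLF d lam ρ 1 x = -(lam * indBall d ρ x * gauss d 1 x) := by
  have hp := pLF_apply (d := d) (ρ := ρ) h0 h1 one_pos x
  have ht : Pn (Dg d) (Eg d lam ρ) (Ug d lam ρ) true 1 x = Eg d lam ρ x * Dg d x := by
    rw [← Cn_one, Pn, Cn]
    refine lintegral_congr fun z => ?_
    simp [jfun_self, Wline]
  have hf : Pn (Dg d) (Eg d lam ρ) (Ug d lam ρ) false 1 x = 0 := by
    simp [Pn, marg, jfun_self, lmarginal]
  have hnn : 0 ≤ 1 - lam * indBall d ρ x := by linarith [(lam_indBall_mem h0 h1 ρ x).2]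
  rw [ht, hf, Eg, Dg, ← ENNReal.ofReal_mul hnn, ENNReal.toReal_ofReal
    (mul_nonneg hnn (gauss_nonneg zero_le_one x))] at hp
  rw [piLF, LF.sub_apply, if_pos rfl, hp, G_apply one_pos]
  simp; ring

theorem NB_piLF_bound (hd : 5 ≤ d) {A : ℝ} (hA : 0 < A) : ∃ L > 0, ∃ lam0 > 0, lam0 ≤ 1 ∧
    ∀ lam ρ : ℝ, 0 ≤ lam → lam ≤ lam0 → 0 < ρ → ρ ≤ 1 → ∀ w, 0 < w → w ≤ 2 → ∀ R,
    TwoPointBound d lam ρ A w R → ∀ m, 0 < m → m ≤ R + 1 →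
    NB m (w ^ m • piLF d lam ρ m : LF d) (L * lam * (m : ℝ) ^ (-((d : ℝ) / 2))) := by
  obtain ⟨L, hL, lam0, hl0, hl1, H⟩ := lintegral_lace_bound hd hA
  refine ⟨L + 32, by positivity, lam0, hl0, hl1, fun lam ρ h0 h1 hρ0 hρ w hw hw2 R hB m hm hmR => ?_⟩
  rcases (show 1 ≤ m from hm).eq_or_lt with rfl | hm2
  · have hI : NB 1 (w ^ 1 • piLF d lam ρ 1 : LF d) (32 * lam) := by
      unfold NB
      have hle : ∀ x : Ed d, ENNReal.ofReal (|(w ^ 1 • piLF d lam ρ 1 : LF d) x| * wt 1 x) ≤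
          ENNReal.ofReal (32 * lam * gauss d 1 x) := fun x => by
        refine ENNReal.ofReal_le_ofReal ?_
        have hg := gauss_nonneg (d := d) zero_le_one x
        rw [LF.smul_apply, piLF_one_apply h0 (h1.trans hl1), abs_mul, abs_neg, pow_one, abs_of_pos hw,
          abs_of_nonneg (mul_nonneg (lam_indBall_mem h0 (h1.trans hl1) ρ x).1 hg)]
        unfold indBall
        split_ifs with h
        · have hx : ‖x‖ ^ 4 ≤ 1 := pow_le_one₀ (norm_nonneg x) (h.trans hρ)
          have hwt : wt 1 x ≤ 16 := by unfold wt; simp; linarith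
          have hlg : 0 ≤ lam * gauss d 1 x := mul_nonneg h0 hg
          calc w * (lam * 1 * gauss d 1 x) * wt 1 x ≤ 2 * (lam * gauss d 1 x) * 16 := by
                rw [mul_one]
                exact mul_le_mul (mul_le_mul_of_nonneg_right hw2 hlg) hwt (wt_nonneg _ _)
                  (by positivity)
            _ = _ := by ring
        · simp; positivity
      refine (lintegral_mono hle).trans (le_of_eq ?_)
      rw [← ofReal_integral_eq_lintegral_ofReal ((integrable_gauss one_pos).const_mul _)
        (Eventually.of_forall fun x => mul_nonneg (by positivity) (gauss_nonneg zero_le_one x)),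
        integral_const_mul, integral_gauss one_pos, mul_one]
    refine hI.mono ?_
    simp only [Nat.cast_one, Real.one_rpow, mul_one]
    nlinarith
  · have hb := H lam ρ h0 h1 hρ w hw R hB m hm2 hmR
    have hm1 : m ≠ 1 := by omega
    have hlam1 := h1.trans hl1
    have hI : NB m (w ^ m • piLF d lam ρ m : LF d) (L * lam * (m : ℝ) ^ (-((d : ℝ) / 2))) := by
      refine le_trans (lintegral_mono fun x => ?_) hb
      have hne := fun σ => (GB_Pn (measurable_Eg lam ρ) (measurable_Ug lam ρ)
        (Eg_add_Ug h0 hlam1 ρ) σ hm (d := d)).ne_top x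
      rw [← ENNReal.ofReal_toReal (hne true), ← ENNReal.ofReal_toReal (hne false),
        ← ENNReal.ofReal_add ENNReal.toReal_nonneg ENNReal.toReal_nonneg,
        ← ENNReal.ofReal_mul (mul_nonneg (by positivity) (wt_nonneg _ _))]
      refine ENNReal.ofReal_le_ofReal ?_
      rw [LF.smul_apply, piLF, if_neg hm1, sub_zero, pLF_apply h0 hlam1 hm, abs_mul,
        abs_of_pos (pow_pos hw m), mul_right_comm]
      refine mul_le_mul_of_nonneg_left ((abs_sub _ _).trans ?_)
        (mul_nonneg (by positivity) (wt_nonneg _ _))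
      rw [abs_of_nonneg ENNReal.toReal_nonneg, abs_of_nonneg ENNReal.toReal_nonneg]
    refine hI.mono ?_
    gcongr
    linarith

theorem LF.mul_le_mul {f f' g g' : LF d} (hf : ∀ x, 0 ≤ f x) (hff : ∀ x, f x ≤ f' x)
    (hg : ∀ x, 0 ≤ g x) (hgg : ∀ x, g x ≤ g' x) (x : Ed d) : (f * g : LF d) x ≤ (f' * g' : LF d) x := by
  rw [LF.mul_apply, LF.mul_apply]
  exact integral_mono (f.integrable_mul_sub g x) (f'.integrable_mul_sub g' x) fun y =>
    _root_.mul_le_mul (hff y) (hgg _) (hg _) ((hf y).trans (hff y))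

theorem cLF_add_le (h0 : 0 ≤ lam) (h1 : lam ≤ 1) {a b : ℕ} (ha : 0 < a) (hb : 0 < b) (x : Ed d) :
    cLF d lam ρ (a + b) x ≤ (cLF d lam ρ a * cLF d lam ρ b : LF d) x := by
  have hE := measurable_Eg (d := d) lam ρ
  have ga := GB_Cn hE (Eg_add_Ug h0 h1 ρ) ha
  have gb := GB_Cn hE (Eg_add_Ug h0 h1 ρ) hb
  rw [cLF_apply h0 h1 (by omega), cLF, if_neg ha.ne', cLF, if_neg hb.ne', ga.toLF_mul gb]
  exact ENNReal.toReal_mono (ga.lconv_ne_top gb x)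
    (Cn_add_le measurable_Dg hE (Eg_add_Ug h0 h1 ρ) ha hb x)

theorem cLF_le_gauss (h0 : 0 ≤ lam) (h1 : lam ≤ 1) {n : ℕ} (hn : 0 < n) (x : Ed d) :
    cLF d lam ρ n x ≤ gauss d n x := by
  rw [cLF_apply h0 h1 hn]
  simpa using (GB_Cn (measurable_Eg (d := d) lam ρ) (Eg_add_Ug h0 h1 ρ) hn).toReal_le x

theorem wt_le_add {n a b : ℕ} (ha : 0 < a) (hb : 0 < b) (hn : n = a + b) (x y : Ed d) :
    wt n x ≤ 8 * (wt a y + wt b (x - y)) := by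
  have h := norm_add_pow_four_le y (x - y)
  rw [add_sub_cancel] at h
  have ha' : (0 : ℝ) < a := by exact_mod_cast ha
  have hb' : (0 : ℝ) < b := by exact_mod_cast hb
  have hn' : (n : ℝ) = a + b := by rw [hn]; push_cast; ring
  unfold wt
  have h1 : ‖x‖ ^ 4 / (n : ℝ) ^ 2 ≤ 8 * (‖y‖ ^ 4 / (a : ℝ) ^ 2 + ‖x - y‖ ^ 4 / (b : ℝ) ^ 2) := by
    have e1 : ‖y‖ ^ 4 / (n : ℝ) ^ 2 ≤ ‖y‖ ^ 4 / (a : ℝ) ^ 2 := by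
      rw [hn']; gcongr; linarith
    have e2 : ‖x - y‖ ^ 4 / (n : ℝ) ^ 2 ≤ ‖x - y‖ ^ 4 / (b : ℝ) ^ 2 := by
      rw [hn']; gcongr; linarith
    have e3 : ‖x‖ ^ 4 / (n : ℝ) ^ 2 ≤ 8 * (‖y‖ ^ 4 + ‖x - y‖ ^ 4) / (n : ℝ) ^ 2 := by gcongr
    have e4 : 8 * (‖y‖ ^ 4 + ‖x - y‖ ^ 4) / (n : ℝ) ^ 2 =
      8 * (‖y‖ ^ 4 / (n : ℝ) ^ 2 + ‖x - y‖ ^ 4 / (n : ℝ) ^ 2) := by ring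
    linarith
  linarith

theorem wt_mul_conv_le {f g : LF d} (hf0 : ∀ x, 0 ≤ f x) (hg0 : ∀ x, 0 ≤ g x) {n a b : ℕ}
    (ha : 0 < a) (hb : 0 < b) (hn : n = a + b) {K c c' : ℝ} (hK : 0 ≤ K) (hf : NB a f K)
    (hg : NB b g K) (hfs : SB f c) (hgs : SB g c') (x : Ed d) :
    wt n x * (f * g : LF d) x ≤ 8 * (K * c' + K * c) := by
  have i1 := hf.integrable
  have i2 : Integrable fun y => |g (x - y)| * wt b (x - y) := hg.integrable.comp_sub_left x
  have e1 := hf.integral_le hK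
  have e2 : ∫ y, |g (x - y)| * wt b (x - y) ≤ K := by
    rw [integral_sub_left_eq_self (fun y => |g y| * wt b y) volume x]; exact hg.integral_le hK
  have hc : 0 ≤ c := hfs.nonneg
  have hc' : 0 ≤ c' := hgs.nonneg
  have hint : Integrable fun y => 8 * (|f y| * wt a y * c' + |g (x - y)| * wt b (x - y) * c) :=
    ((i1.mul_const c').add (i2.mul_const c)).const_mul 8
  rw [LF.mul_apply, ← integral_const_mul]
  calc ∫ y, wt n x * (f y * g (x - y)) ≤
        ∫ y, 8 * (|f y| * wt a y * c' + |g (x - y)| * wt b (x - y) * c) := by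
        refine integral_mono ((f.integrable_mul_sub g x).const_mul _) hint fun y => ?_
        have hfy := hfs y
        have hgy := hgs (x - y)
        simp only
        rw [abs_of_nonneg (hf0 y)] at hfy ⊢
        rw [abs_of_nonneg (hg0 (x - y))] at hgy ⊢
        have hw := mul_le_mul_of_nonneg_right (wt_le_add ha hb hn x y)
          (mul_nonneg (hf0 y) (hg0 (x - y)))
        have t1 : f y * wt a y * g (x - y) ≤ f y * wt a y * c' :=
          mul_le_mul_of_nonneg_left hgy (mul_nonneg (hf0 y) (wt_nonneg _ _))
        have t2 : g (x - y) * wt b (x - y) * f y ≤ g (x - y) * wt b (x - y) * c :=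
          mul_le_mul_of_nonneg_left hfy (mul_nonneg (hg0 _) (wt_nonneg _ _))
        linarith
    _ = 8 * ((∫ y, |f y| * wt a y) * c' + (∫ y, |g (x - y)| * wt b (x - y)) * c) := by
        rw [integral_const_mul, integral_add (i1.mul_const c') (i2.mul_const c),
          integral_mul_const, integral_mul_const]
    _ ≤ _ := by gcongr

theorem twoPointBound_of_NB (hd : 5 ≤ d) {K : ℝ} (hK : 0 < K) : ∃ A > 0, ∀ lam ρ : ℝ, 0 ≤ lam →
    lam ≤ 1 → ∀ w, 0 < w → w ≤ 2 → ∀ R, (∀ n, 0 < n → n ≤ R →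
      NB n (w ^ n • cLF d lam ρ n : LF d) K ∧
      SB (G d 1 * (w ^ n • cLF d lam ρ n) : LF d) (K * (n : ℝ) ^ (-((d : ℝ) / 2)))) →
    TwoPointBound d lam ρ A w R := by
  set s : ℝ := (d : ℝ) / 2 with hs
  have hs5 : 5 / 2 ≤ s := half_d_ge hd
  set K1 : ℝ := 2 + 2 * K * 2 ^ s with hK1
  set B1 : ℝ := 16 * (1 + 32 * 2 ^ s) with hB1
  set B2 : ℝ := 16 * K * K1 * 3 ^ s with hB2
  refine ⟨K + B1 + B2, by positivity, fun lam ρ h0 h1 w hw hw2 R H n hn hnR => ⟨?_, ?_⟩⟩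
  · exact (H n hn hnR).1.mono (by have : 0 ≤ B1 + B2 := by positivity
                                  linarith)
  have hu0 : ∀ (n : ℕ) (x : Ed d), 0 ≤ (w ^ n • cLF d lam ρ n : LF d) x := fun n x => by
    rw [LF.smul_apply]; exact mul_nonneg (by positivity) (cLF_nonneg _ _)
  have hsup : ∀ n, 0 < n → n ≤ R → SB (w ^ n • cLF d lam ρ n : LF d) (K1 * (n : ℝ) ^ (-s)) := by
    intro n hn hnR x
    rw [abs_of_nonneg (hu0 n x)]
    rcases (show 1 ≤ n from hn).eq_or_lt with rfl | hn2
    · have e := (cLF_le_gauss (ρ := ρ) h0 h1 one_pos x).trans (gauss_le (by simp) x)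
      simp only [Nat.cast_one, Real.one_rpow] at e
      have hc := cLF_nonneg (d := d) (lam := lam) (ρ := ρ) 1 x
      simp only [LF.smul_apply, Nat.cast_one, Real.one_rpow, mul_one, pow_one]
      have : 0 ≤ 2 * K * (2 : ℝ) ^ s := by positivity
      nlinarith
    · obtain ⟨k, rfl⟩ : ∃ k, n = 1 + k := ⟨n - 1, by omega⟩
      have hk : 0 < k := by omega
      have e1 : (w ^ (1 + k) • cLF d lam ρ (1 + k) : LF d) x ≤
          w * (G d 1 * (w ^ k • cLF d lam ρ k) : LF d) x := by
        rw [mul_smul_comm, LF.smul_apply, LF.smul_apply, pow_add, pow_one, mul_assoc]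
        refine mul_le_mul_of_nonneg_left (mul_le_mul_of_nonneg_left ?_ (by positivity)) hw.le
        refine (cLF_add_le h0 h1 one_pos hk x).trans (LF.mul_le_mul (cLF_nonneg 1) (fun x => ?_)
          (cLF_nonneg k) (fun _ => le_rfl) x)
        rw [G_apply one_pos]; simpa using cLF_le_gauss (ρ := ρ) h0 h1 one_pos x
      have e2 := (le_abs_self _).trans ((H k hk (by omega)).2 x)
      have hk' : (1 : ℝ) ≤ k := by exact_mod_cast hk
      have e3 : (k : ℝ) ^ (-s) ≤ 2 ^ s * ((1 + k : ℕ) : ℝ) ^ (-s) :=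
        rpow_half (by positivity) (by linarith) (by push_cast; linarith)
      have hp : (0 : ℝ) ≤ ((1 + k : ℕ) : ℝ) ^ (-s) := by positivity
      calc _ ≤ _ := e1
        _ ≤ 2 * (K * (k : ℝ) ^ (-s)) := mul_le_mul hw2 e2
            (by rw [LF.mul_apply]; exact integral_nonneg fun y => mul_nonneg (G_nonneg _ _) (hu0 k _))
            (by norm_num)
        _ ≤ 2 * (K * (2 ^ s * ((1 + k : ℕ) : ℝ) ^ (-s))) := by gcongr
        _ = 2 * K * 2 ^ s * ((1 + k : ℕ) : ℝ) ^ (-s) := by ring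
        _ ≤ K1 * ((1 + k : ℕ) : ℝ) ^ (-s) := mul_le_mul_of_nonneg_right (by rw [hK1]; linarith) hp
  intro x
  have hB10 : 0 ≤ B1 := by positivity
  have hB20 : 0 ≤ B2 := by positivity
  rcases (show 1 ≤ n from hn).eq_or_lt with rfl | hn2
  · have e := cLF_le_gauss (ρ := ρ) h0 h1 one_pos x
    simp only [Nat.cast_one] at e
    have hg := gauss_le (d := d) one_pos x
    have hg2 := gauss_le (d := d) (t := 2 * 1) (by norm_num) x
    have h2 : ((2 : ℝ) * 1) ^ (-(d : ℝ) / 2) ≤ 1 := by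
      rw [neg_div]
      exact Real.rpow_le_one_of_one_le_of_nonpos (by norm_num) (by rw [← hs]; linarith)
    rw [Real.one_rpow] at hg
    have h4 := gauss_mul_pow_four_le (d := d) one_pos x
    rw [← hs, one_pow, mul_one] at h4
    have h5 : 32 * (2 : ℝ) ^ s * gauss d (2 * 1) x ≤ 32 * (2 : ℝ) ^ s * 1 :=
      mul_le_mul_of_nonneg_left (hg2.trans h2) (by positivity)
    simp only [pow_one, Nat.cast_one, Real.one_rpow, mul_one]
    have h6 : wt 1 x * (w * cLF d lam ρ 1 x) ≤ wt 1 x * (2 * gauss d 1 x) :=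
      mul_le_mul_of_nonneg_left (mul_le_mul hw2 e (cLF_nonneg _ _) (by norm_num)) (wt_nonneg _ _)
    have h7 : wt 1 x * (2 * gauss d 1 x) = 16 * (gauss d 1 x + gauss d 1 x * ‖x‖ ^ 4) := by
      unfold wt; simp; ring
    linarith
  · set a := n / 2 with ha
    set b := n - n / 2 with hb
    have ha0 : 0 < a := by omega
    have hb0 : 0 < b := by omega
    have hnab : n = a + b := by omega
    have e1 : w ^ n * cLF d lam ρ n x ≤
        ((w ^ a • cLF d lam ρ a) * (w ^ b • cLF d lam ρ b) : LF d) x := by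
      rw [smul_mul_smul_comm, ← pow_add, ← hnab, LF.smul_apply]
      refine mul_le_mul_of_nonneg_left ?_ (by positivity)
      conv_lhs => rw [hnab]
      exact cLF_add_le h0 h1 ha0 hb0 x
    have e2 := wt_mul_conv_le (hu0 a) (hu0 b) ha0 hb0 hnab hK.le (H a ha0 (by omega)).1
      (H b hb0 (by omega)).1 (hsup a ha0 (by omega)) (hsup b hb0 (by omega)) x
    have hn' : (0 : ℝ) < n := by exact_mod_cast hn
    have hr : ∀ k : ℕ, n ≤ 3 * k → (k : ℝ) ^ (-s) ≤ 3 ^ s * (n : ℝ) ^ (-s) := fun k hk => by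
      have hk' : (n : ℝ) ≤ 3 * k := by exact_mod_cast hk
      have := rpow_le_scaled (c := 1 / 3) (x := n) (y := k) (a := s) (by norm_num) hn'
        (by linarith) (by linarith)
      simpa using this
    have hK10 : 0 ≤ K1 := by positivity
    have hp : (0 : ℝ) ≤ (n : ℝ) ^ (-s) := by positivity
    calc wt n x * (w ^ n * cLF d lam ρ n x) ≤ _ := mul_le_mul_of_nonneg_left e1 (wt_nonneg _ _)
      _ ≤ _ := e2
      _ ≤ 8 * (K * (K1 * (3 ^ s * (n : ℝ) ^ (-s))) + K * (K1 * (3 ^ s * (n : ℝ) ^ (-s)))) := by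
          have := hr a (by omega)
          have := hr b (by omega)
          gcongr
      _ = B2 * (n : ℝ) ^ (-s) := by rw [hB2]; ring
      _ ≤ _ := mul_le_mul_of_nonneg_right (by linarith) hp

theorem pfull_smul_piLF (w : ℝ) {P : ℕ → LF d} {m : ℕ} (h : P m = w ^ m • piLF d lam ρ m) :
    pfull w P m = w ^ m • pLF d lam ρ m := by
  rw [pfull, h, piLF, smul_sub]
  split_ifs with hm
  · subst hm; simp
  · simp

theorem uren_eq_cLF (h0 : 0 ≤ lam) (h1 : lam ≤ 1) {w : ℝ} {P : ℕ → LF d} {R : ℕ}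
    (hP : ∀ m, m ≤ R → P m = w ^ m • piLF d lam ρ m) (n : ℕ) (hn : n ≤ R) :
    uren w P n = w ^ n • cLF d lam ρ n := by
  induction n using Nat.strong_induction_on with
  | _ n ih =>
  rw [uren_eq, pfull_smul_piLF w (hP n hn)]
  rcases Nat.eq_zero_or_pos n with rfl | hn0
  · simp [pLF, cLF]
  rw [cLF_eq h0 h1 hn0, smul_add, Finset.smul_sum]
  congr 1
  refine sum_congr rfl fun m hm => ?_
  simp at hm
  rw [pfull_smul_piLF w (hP m (by omega)), ih (n - m) (by omega) (by omega), smul_mul_smul_comm,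
    ← pow_add, Nat.add_sub_cancel' hm.2.le]

theorem exp_le_one_add_two_mul {t : ℝ} (h0 : 0 ≤ t) (h1 : t ≤ 1) : Real.exp t ≤ 1 + 2 * t := by
  have h := Real.abs_exp_sub_one_sub_id_le (x := t) (by rw [abs_of_nonneg h0]; exact h1)
  have h2 := (abs_le.1 h).2
  nlinarith

theorem one_add_inv_pow_le {m k : ℕ} (hk : 0 < k) (hm : m ≤ k) :
    (1 + 1 / (k : ℝ)) ^ m ≤ 1 + 2 * (m / k) := by
  have hk' : (0 : ℝ) < k := by exact_mod_cast hk
  have hm' : (m : ℝ) ≤ k := by exact_mod_cast hm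
  have h1 : 1 + 1 / (k : ℝ) ≤ Real.exp (1 / k) := by
    have := Real.add_one_le_exp (1 / (k : ℝ)); linarith
  calc (1 + 1 / (k : ℝ)) ^ m ≤ Real.exp (1 / k) ^ m := by gcongr
    _ = Real.exp (m / k) := by rw [← Real.exp_nat_mul]; congr 1; ring
    _ ≤ _ := exp_le_one_add_two_mul (by positivity) (by rw [div_le_one hk']; exact hm')

theorem sum_five_halves_le_zeta (N : ℕ) :
    ∑ m ∈ Icc 1 N, (m : ℝ) ^ (-(5 / 2 : ℝ)) ≤ zeta32 := by
  refine (sum_le_sum fun m hm => ?_).trans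
    (summable_32.sum_le_tsum (Icc 1 N) fun m _ => by positivity)
  refine Real.rpow_le_rpow_of_exponent_le ?_ (by norm_num)
  exact_mod_cast (mem_Icc.1 hm).1

/-- Continuation of the critical fugacity by one step. -/
theorem exists_next_fugacity {π : ℕ → ℝ} {w b : ℝ} {R : ℕ} (hw : 1 / 2 ≤ w) (hb : 0 ≤ b)
    (hbz : b * (1 + 2 * zeta32) ≤ 1 / 8) (hsum : w + ∑ m ∈ Icc 1 R, w ^ m * π m = 1)
    (hπ : ∀ m : ℕ, 0 < m → m ≤ R + 1 → |w ^ m * π m| ≤ b * (m : ℝ) ^ (-(5 / 2 : ℝ))) :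
    ∃ v, 1 / 2 ≤ v ∧ v ≤ 2 ∧ v + ∑ m ∈ Icc 1 (R + 1), v ^ m * π m = 1 ∧
      ∀ m, m ≤ R + 1 → v ^ m ≤ 3 * w ^ m := by
  set k := R + 1 with hk
  have hk0 : 0 < k := by omega
  have hk' : (1 : ℝ) ≤ k := by exact_mod_cast hk0
  have hkp : (0 : ℝ) < k := by linarith
  have hz := zeta32_nonneg
  set f : ℝ → ℝ := fun v => v + ∑ m ∈ Icc 1 k, v ^ m * π m - 1 with hf
  have hsplit : ∑ m ∈ Icc 1 k, w ^ m * π m = ∑ m ∈ Icc 1 R, w ^ m * π m + w ^ k * π k :=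
    sum_Icc_succ_top (by omega) _
  have hlast : |w ^ k * π k| ≤ b * (1 / k) := by
    refine (hπ k hk0 le_rfl).trans (mul_le_mul_of_nonneg_left ?_ hb)
    rw [one_div, ← Real.rpow_neg_one]
    exact Real.rpow_le_rpow_of_exponent_le hk' (by norm_num)
  have key : ∀ t : ℝ, (∀ m : ℕ, m ≤ k → |t ^ m - 1| ≤ 2 * (m / k)) →
      |f (w * t) - w * (t - 1)| ≤ 1 / 8 * (1 / k) := by
    intro t ht
    have e : f (w * t) - w * (t - 1) =
        w ^ k * π k + ∑ m ∈ Icc 1 k, (t ^ m - 1) * (w ^ m * π m) := by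
      have : ∑ m ∈ Icc 1 k, (w * t) ^ m * π m =
          ∑ m ∈ Icc 1 k, (t ^ m - 1) * (w ^ m * π m) + ∑ m ∈ Icc 1 k, w ^ m * π m := by
        rw [← sum_add_distrib]
        exact sum_congr rfl fun m _ => by rw [mul_pow]; ring
      rw [hf]
      simp only
      rw [this, hsplit]
      linear_combination hsum
    have e2 : |∑ m ∈ Icc 1 k, (t ^ m - 1) * (w ^ m * π m)| ≤ 2 * b * zeta32 * (1 / k) := by
      refine (abs_sum_le_sum_abs _ _).trans ?_
      calc _ ≤ ∑ m ∈ Icc 1 k, 2 * b * (1 / k) * (m : ℝ) ^ (-(3 / 2 : ℝ)) := by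
            refine sum_le_sum fun m hm => ?_
            rw [mem_Icc] at hm
            rw [abs_mul]
            calc _ ≤ 2 * ((m : ℝ) / k) * (b * (m : ℝ) ^ (-(5 / 2 : ℝ))) :=
                  mul_le_mul (ht m hm.2) (hπ m hm.1 hm.2) (abs_nonneg _) (by positivity)
              _ = 2 * b * (1 / k) * (m * (m : ℝ) ^ (-(5 / 2 : ℝ))) := by ring
              _ = _ := by rw [natcast_mul_rpow_52]
        _ = 2 * b * (1 / k) * ∑ m ∈ Icc 1 k, (m : ℝ) ^ (-(3 / 2 : ℝ)) := by rw [mul_sum]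
        _ ≤ 2 * b * (1 / k) * zeta32 := by
            refine mul_le_mul_of_nonneg_left ?_ (by positivity)
            exact summable_32.sum_le_tsum _ fun m _ => by positivity
        _ = _ := by ring
    rw [e]
    refine (abs_add_le _ _).trans ?_
    have : b * (1 / k) + 2 * b * zeta32 * (1 / k) = b * (1 + 2 * zeta32) * (1 / k) := by ring
    have h2 : b * (1 + 2 * zeta32) * (1 / (k : ℝ)) ≤ 1 / 8 * (1 / k) :=
      mul_le_mul_of_nonneg_right hbz (by positivity)
    linarith
  have hk1 : (0 : ℝ) ≤ 1 - 1 / k := by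
    have : 1 / (k : ℝ) ≤ 1 := by rw [div_le_one hkp]; exact hk'
    linarith
  have hinv : (0 : ℝ) < 1 / k := by positivity
  have hwk : 1 / 2 * (1 / (k : ℝ)) ≤ w * (1 / k) := mul_le_mul_of_nonneg_right hw hinv.le
  have hlo : f (w * (1 - 1 / k)) ≤ 0 := by
    have := key (1 - 1 / k) fun m hm => by
      have h1 : (1 - 1 / (k : ℝ)) ^ m ≤ 1 := pow_le_one₀ hk1 (by linarith)
      have h2 := one_add_mul_le_pow (a := -(1 / (k : ℝ))) (by linarith) m
      rw [abs_sub_comm, abs_of_nonneg (by linarith)]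
      have h3 : (m : ℝ) * -(1 / k) = -(m / k) := by ring
      have h4 : (0 : ℝ) ≤ m / k := by positivity
      rw [h3, ← sub_eq_add_neg, ← sub_eq_add_neg] at h2
      linarith
    have h := (abs_le.1 this).2
    have e : w * (1 - 1 / (k : ℝ) - 1) = -(w * (1 / k)) := by ring
    rw [e] at h
    linarith
  have hhi : 0 ≤ f (w * (1 + 1 / k)) := by
    have := key (1 + 1 / k) fun m hm => by
      have h1 : 1 ≤ (1 + 1 / (k : ℝ)) ^ m := one_le_pow₀ (by linarith)
      rw [abs_of_nonneg (by linarith)]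
      linarith [one_add_inv_pow_le hk0 hm]
    have h := (abs_le.1 this).1
    have e : w * (1 + 1 / (k : ℝ) - 1) = w * (1 / k) := by ring
    rw [e] at h
    linarith
  have hcont : Continuous f := by rw [hf]; fun_prop
  have hle : w * (1 - 1 / (k : ℝ)) ≤ w * (1 + 1 / k) :=
    mul_le_mul_of_nonneg_left (by linarith) (by linarith)
  obtain ⟨v, hv, hv0⟩ := intermediate_value_Icc hle hcont.continuousOn ⟨hlo, hhi⟩
  have hvn : 0 ≤ v := (mul_nonneg (by linarith) hk1).trans hv.1
  have hpow : ∀ m, m ≤ k → v ^ m ≤ 3 * w ^ m := by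
    intro m hm
    have hm' : (m : ℝ) / k ≤ 1 := by rw [div_le_one hkp]; exact_mod_cast hm
    calc v ^ m ≤ (w * (1 + 1 / k)) ^ m := by gcongr; exact hv.2
      _ = w ^ m * (1 + 1 / k) ^ m := mul_pow _ _ _
      _ ≤ w ^ m * 3 := by
          refine mul_le_mul_of_nonneg_left ?_ (by positivity)
          linarith [one_add_inv_pow_le hk0 hm]
      _ = _ := by ring
  have hS : |∑ m ∈ Icc 1 k, v ^ m * π m| ≤ 1 / 2 := by
    refine (abs_sum_le_sum_abs _ _).trans ?_
    calc _ ≤ ∑ m ∈ Icc 1 k, 3 * b * (m : ℝ) ^ (-(5 / 2 : ℝ)) := by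
          refine sum_le_sum fun m hm => ?_
          rw [mem_Icc] at hm
          have h1 := hπ m hm.1 hm.2
          rw [abs_mul, abs_of_nonneg (by positivity)] at h1 ⊢
          have h2 := mul_le_mul_of_nonneg_right (hpow m hm.2) (abs_nonneg (π m))
          linarith
      _ = 3 * b * ∑ m ∈ Icc 1 k, (m : ℝ) ^ (-(5 / 2 : ℝ)) := by rw [mul_sum]
      _ ≤ 3 * b * zeta32 := mul_le_mul_of_nonneg_left (sum_five_halves_le_zeta k) (by positivity)
      _ ≤ _ := by linarith
  have hv1 : v + ∑ m ∈ Icc 1 k, v ^ m * π m = 1 := by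
    have : v + ∑ m ∈ Icc 1 k, v ^ m * π m - 1 = 0 := hv0
    linarith
  have := abs_le.1 hS
  exact ⟨v, by linarith, by linarith, hv1, hpow⟩

theorem NB.of_tendsto {f : LF d} {m : ℕ} {c a0 : ℝ} (hc : 0 ≤ c) {a : ℕ → ℝ} (hpos : ∀ k, 0 < a k)
    (ha : Tendsto a atTop (nhds a0)) (h : ∀ᶠ k in atTop, NB m (a k • f : LF d) c) :
    NB m (a0 • f : LF d) c := by
  have ha0 : 0 ≤ a0 := ge_of_tendsto' ha fun k => (hpos k).le
  have e : ∀ b : ℝ, 0 ≤ b → (fun x => |(b • f : LF d) x| * wt m x) = fun x => b * (|f x| * wt m x) :=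
    fun b hb => by
      funext x; rw [LF.smul_apply, abs_mul, abs_of_nonneg hb, mul_assoc]
  have hi : Integrable fun x => |f x| * wt m x := by
    obtain ⟨k, hk⟩ := h.exists
    have := hk.integrable
    rw [e _ (hpos k).le] at this
    have h2 := this.const_mul (a k)⁻¹
    simpa [← mul_assoc, (hpos k).ne'] using h2
  refine NB.of_integral_le (by rw [e _ ha0]; exact hi.const_mul _) ?_
  rw [e _ ha0, integral_const_mul]
  refine le_of_tendsto (ha.mul_const (∫ x, |f x| * wt m x)) ?_
  filter_upwards [h] with k hk
  have := hk.integral_le hc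
  rwa [e _ (hpos k).le, integral_const_mul] at this

set_option maxHeartbeats 1000000 in
theorem lace_construction (hd : 5 ≤ d) {βt : ℝ} (hβt : 0 < βt) : ∃ A > 0, ∃ C > 0, ∃ lam0 > 0,
    lam0 ≤ 1 ∧ ∀ lam ρ : ℝ, 0 ≤ lam → lam ≤ lam0 → 0 < ρ → ρ ≤ 1 → ∃ w,
    LaceData d βt w (fun m => w ^ m • piLF d lam ρ m) ∧ (∀ R, TwoPointBound d lam ρ A w R) ∧
    ∀ m, 2 ≤ m → ∫⁻ x, ENNReal.ofReal (w ^ m * wt m x) *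
      (Pn (Dg d) (Eg d lam ρ) (Ug d lam ρ) true m x +
        Pn (Dg d) (Eg d lam ρ) (Ug d lam ρ) false m x) ≤
      ENNReal.ofReal (C * (m : ℝ) ^ (-((d : ℝ) / 2))) := by
  obtain ⟨K, hK, β0, hβ0, Hu⟩ := uren_bounds hd
  obtain ⟨A, hA, HA⟩ := twoPointBound_of_NB hd hK
  obtain ⟨L1, hL1, lam1, hlam1, hlam1', H1⟩ := NB_piLF_bound hd hA
  obtain ⟨L2, hL2, lam2, hlam2, hlam2', H2⟩ := lintegral_lace_bound hd hA
  have hz := zeta32_nonneg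
  set bs : ℝ := min (min (βt / 3) (β0 / 3)) (1 / (8 * (1 + 2 * zeta32))) with hbs
  have hbs0 : 0 < bs := by positivity
  refine ⟨A, hA, L2, hL2, min (min lam1 lam2) (bs / L1), by positivity,
    (min_le_left _ _).trans ((min_le_left _ _).trans hlam1'), ?_⟩
  intro lam ρ h0 hlam hρ0 hρ
  have hl1 : lam ≤ lam1 := hlam.trans ((min_le_left _ _).trans (min_le_left _ _))
  have hl2 : lam ≤ lam2 := hlam.trans ((min_le_left _ _).trans (min_le_right _ _))
  have hone : lam ≤ 1 := hl1.trans hlam1'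
  set b : ℝ := L1 * lam with hb
  have hb0 : 0 ≤ b := by positivity
  have hbbs : b ≤ bs := by
    have : lam ≤ bs / L1 := hlam.trans (min_le_right _ _)
    rw [le_div_iff₀ hL1] at this
    rw [hb]; linarith
  have hb1 : b ≤ βt / 3 := hbbs.trans ((min_le_left _ _).trans (min_le_left _ _))
  have hb2 : b ≤ β0 / 3 := hbbs.trans ((min_le_left _ _).trans (min_le_right _ _))
  have hb3 : b * (1 + 2 * zeta32) ≤ 1 / 8 := by
    have h3 : b ≤ 1 / (8 * (1 + 2 * zeta32)) := hbbs.trans (min_le_right _ _)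
    rw [le_div_iff₀ (by positivity)] at h3
    linarith
  set π : ℕ → ℝ := fun m => ∫ x, piLF d lam ρ m x with hπ
  have hint : ∀ (a : ℝ) (m : ℕ), ∫ x, (a • piLF d lam ρ m : LF d) x = a * π m := fun a m => by
    simp only [LF.smul_apply, integral_const_mul, hπ]
  have hpi0 : piLF d lam ρ 0 = 0 := by simp [piLF, pLF]
  have hπb : ∀ w R, 0 < w → w ≤ 2 → TwoPointBound d lam ρ A w R → ∀ m, 0 < m → m ≤ R + 1 →
      |w ^ m * π m| ≤ b * (m : ℝ) ^ (-(5 / 2 : ℝ)) := by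
    intro w R hw hw2 hT m hm hmR
    rw [← hint]
    refine ((H1 lam ρ h0 hl1 hρ0 hρ w hw hw2 R hT m hm hmR).abs_integral_le (by positivity)).trans ?_
    exact mul_le_mul_of_nonneg_left (pow_s_le_52 hd m) hb0
  have boot : ∀ R, ∃ w, 1 / 2 ≤ w ∧ w ≤ 2 ∧ w + ∑ m ∈ Icc 1 R, w ^ m * π m = 1 ∧
      TwoPointBound d lam ρ A w R := by
    intro R
    induction R with
    | zero => exact ⟨1, by norm_num, by norm_num, by simp, fun n hn hn' => by omega⟩
    | succ R ih =>
      obtain ⟨w, hw, hw2, hsum, hT⟩ := ih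
      have hw0 : 0 < w := by linarith
      obtain ⟨v, hv, hv2, hvs, hvp⟩ := exists_next_fugacity hw hb0 hb3 hsum
        (hπb w R hw0 hw2 hT)
      have hv0 : 0 < v := by linarith
      refine ⟨v, hv, hv2, hvs, ?_⟩
      set P : ℕ → LF d := fun m => if m ≤ R + 1 then v ^ m • piLF d lam ρ m else 0 with hP
      have hPm : ∀ m, m ≤ R + 1 → P m = v ^ m • piLF d lam ρ m := fun m hm => by simp [hP, hm]
      have hPn : ∀ m, ¬ m ≤ R + 1 → P m = 0 := fun m hm => by simp only [hP, if_neg hm]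
      have hD : LaceData d (3 * b) v P := by
        refine ⟨by rw [hPm 0 (by omega), hpi0, smul_zero], fun m => ?_, fun m hm => ?_, hv, hv2, ?_⟩
        · by_cases h : m ≤ R + 1
          · rw [hPm m h]; exact (sym_piLF h0 hone m).smul _
          · rw [hPn m h]; exact sym_zero
        · by_cases h : m ≤ R + 1
          · rw [hPm m h]
            have h3 := (H1 lam ρ h0 hl1 hρ0 hρ w hw0 hw2 R hT m hm h).smul 3
            rw [abs_of_pos (by norm_num : (0 : ℝ) < 3), ← mul_assoc] at h3
            refine h3.of_abs_le fun x => ?_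
            simp only [LF.smul_apply, abs_mul]
            rw [← mul_assoc]
            refine mul_le_mul_of_nonneg_right ?_ (abs_nonneg _)
            rw [abs_of_pos (pow_pos hv0 m), abs_of_pos (pow_pos hw0 m), abs_of_pos (by norm_num)]
            exact hvp m h
          · rw [hPn m h]
            unfold NB
            simp
        · rw [tsum_eq_sum (s := Icc 1 (R + 1))]
          · rw [← hvs]
            congr 1
            exact sum_congr rfl fun m hm => by
              rw [hPm m (mem_Icc.1 hm).2, hint]
          · intro m hm
            by_cases h : m ≤ R + 1
            · have : m = 0 := by
                by_contra h'
                exact hm (mem_Icc.2 ⟨by omega, h⟩)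
              rw [this, hPm 0 (by omega), hpi0]; simp
            · rw [hPn m h]; simp
      obtain ⟨-, hU⟩ := Hu (3 * b) v P hD (by positivity) (by linarith)
      refine HA lam ρ h0 hone v hv0 hv2 (R + 1) fun n hn hnR => ?_
      have := hU n hn
      rw [uren_eq_cLF h0 hone hPm n hnR] at this
      exact this.2.2.2
  choose W hW using boot
  obtain ⟨w, hwm, φ, hφ, hlim⟩ := isCompact_Icc.tendsto_subseq (s := Set.Icc (1 / 2 : ℝ) 2)
    (x := W) fun R => ⟨(hW R).1, (hW R).2.1⟩
  have hw0 : 0 < w := by linarith [hwm.1]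
  have hW0 : ∀ R, 0 < W R := fun R => by linarith [(hW R).1]
  have hlim' : ∀ m : ℕ, Tendsto (fun k => W (φ k) ^ m) atTop (nhds (w ^ m)) := fun m => hlim.pow m
  have hnb : ∀ m, 0 < m → NB m (w ^ m • piLF d lam ρ m : LF d) (b * (m : ℝ) ^ (-((d : ℝ) / 2))) := by
    intro m hm
    refine NB.of_tendsto (by positivity) (fun k => pow_pos (hW0 (φ k)) m) (hlim' m) ?_
    filter_upwards [eventually_ge_atTop m] with k hk
    exact H1 lam ρ h0 hl1 hρ0 hρ (W (φ k)) (hW0 _) (hW _).2.1 (φ k) (hW _).2.2.2 m hm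
      ((hk.trans (hφ.id_le k)).trans (Nat.le_succ _))
  have hmass : w + ∑' m, w ^ m * π m = 1 := by
    have hT : Tendsto (fun k => ∑' m, if 1 ≤ m ∧ m ≤ φ k then W (φ k) ^ m * π m else 0) atTop
        (nhds (∑' m, w ^ m * π m)) := by
      refine tendsto_tsum_of_dominated_convergence (bound := fun m => b * (m : ℝ) ^ (-(5 / 2 : ℝ)))
        (summable_52.mul_left b) (fun m => ?_) (Eventually.of_forall fun k m => ?_)
      · rcases Nat.eq_zero_or_pos m with rfl | hm
        · simp [hπ, hpi0]
        · refine ((hlim' m).mul_const (π m)).congr' ?_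
          filter_upwards [eventually_ge_atTop m] with k hk
          rw [if_pos ⟨hm, hk.trans (hφ.id_le k)⟩]
      · split_ifs with h
        · exact hπb _ (φ k) (hW0 _) (hW _).2.1 (hW _).2.2.2 m h.1 (by omega)
        · simp; positivity
    have heq : ∀ k, W (φ k) + ∑' m, (if 1 ≤ m ∧ m ≤ φ k then W (φ k) ^ m * π m else 0) = 1 := by
      intro k
      rw [← (hW (φ k)).2.2.1]
      congr 1
      rw [tsum_eq_sum (s := Icc 1 (φ k))]
      · exact sum_congr rfl fun m hm => by rw [if_pos (mem_Icc.1 hm)]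
      · intro m hm
        rw [if_neg]
        rwa [mem_Icc] at hm
    refine tendsto_nhds_unique (hlim.add hT) ?_
    simp only [Function.comp_def, heq]
    exact tendsto_const_nhds
  have hdata : ∀ β', b ≤ β' → LaceData d β' w (fun m => w ^ m • piLF d lam ρ m) := fun β' hβ' =>
    ⟨by simp [hpi0], fun m => (sym_piLF h0 hone m).smul _, fun m hm => (hnb m hm).mono
      (mul_le_mul_of_nonneg_right hβ' (by positivity)), hwm.1, hwm.2, by simpa only [hint] using hmass⟩
  have hTB : ∀ R, TwoPointBound d lam ρ A w R := by
    intro R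
    obtain ⟨-, hU⟩ := Hu b w _ (hdata b le_rfl) hb0 (by linarith)
    refine HA lam ρ h0 hone w hw0 hwm.2 R fun n hn hnR => ?_
    have := hU n hn
    rw [uren_eq_cLF (R := R) h0 hone (fun m _ => rfl) n hnR] at this
    exact this.2.2.2
  refine ⟨w, hdata βt (by linarith), hTB, fun m hm => ?_⟩
  refine (H2 lam ρ h0 hl2 hρ w hw0 m (hTB m) m hm (by omega)).trans
    (ENNReal.ofReal_le_ofReal ?_)
  refine mul_le_mul_of_nonneg_right ?_ (by positivity)
  nlinarith

section Truncation

variable {V : Type*} [NormedAddCommGroup V] [MeasureSpace V] [BorelSpace V]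
  [SecondCountableTopology V] [SigmaFinite (volume : Measure V)]
  [(volume : Measure V).IsAddHaarMeasure] {D E U : V → ℝ≥0∞}

/-- The contribution of the paths whose lace jumps from before `p` to the time `t`. -/
def exitTerm (D E U : V → ℝ≥0∞) (p s t n : ℕ) (x : V) : ℝ≥0∞ :=
  marg (Ioo 0 n) (fun y => pw U y s t * Kp (pw E y) p t * Kp (pw E y) t n * Phi D 0 n y) (pt x)

/-- Bound on the error in the lace expansion truncated at time `M`. -/
def exitBound (D E U : V → ℝ≥0∞) (M h n : ℕ) (x : V) : ℝ≥0∞ :=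
  ∑ t ∈ Ioc M h, (lconvC D E (Pn D E U true t) (n - t) x +
    lconvC D E (Pn D E U false t) (n - t) x) +
  2 ^ (M - 1) * ∑ p ∈ range (M + 1), ∑ s ∈ range p, ∑ t ∈ Ioc h n, exitTerm D E U p s t n x

theorem lace_truncated (hD : Measurable D) (hE : Measurable E) (hU : Measurable U)
    (heu : ∀ x, E x + U x = 1) {M h n : ℕ} (hM : 1 ≤ M) (hh : M ≤ h) (hn : h ≤ n) (x : V) :
    Cn D E n x + ∑ m ∈ Icc 1 M, lconvC D E (Pn D E U false m) (n - m) x ≤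
        ∑ m ∈ Icc 1 M, lconvC D E (Pn D E U true m) (n - m) x + exitBound D E U M h n x ∧
      ∑ m ∈ Icc 1 M, lconvC D E (Pn D E U true m) (n - m) x ≤
        Cn D E n x + ∑ m ∈ Icc 1 M, lconvC D E (Pn D E U false m) (n - m) x +
          exitBound D E U M h n x := by
  have mK : ∀ a b, Measurable fun y : ℕ → V => Kp (pw E y) a b := fun a b =>
    measurable_Kp (measurable_pw hE) a b
  have mP := measurable_Phi hD 0 n
  have hmeas := measurable_laceInt hD hE hU n
  have hcmul : ∀ (c : ℝ≥0∞) (f : (ℕ → V) → ℝ≥0∞), Measurable f → c * marg (Ioo 0 n) f (pt x) =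
      marg (Ioo 0 n) (fun y => c * f y) (pt x) := fun c f hf =>
    (lintegral_const_mul c (hf.comp measurable_updateFinset)).symm
  have hsum : ∀ σ, ∑ m ∈ Icc 1 M, lconvC D E (Pn D E U σ m) (n - m) x =
      marg (Ioo 0 n) (fun y => ∑ m ∈ Icc 1 M, laceInt D E U n σ m y) (pt x) := by
    intro σ
    rw [marg_sum _ (hmeas σ)]
    refine sum_congr rfl fun m hm => ?_
    rw [mem_Icc] at hm
    exact lconvC_Pn hD hE hU σ hm.1 (by omega) x
  have mex : ∀ p s t, Measurable fun y : ℕ → V =>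
      pw U y s t * Kp (pw E y) p t * Kp (pw E y) t n * Phi D 0 n y := fun p s t =>
    (((measurable_pw hU s t).mul (mK p t)).mul (mK t n)).mul mP
  have mA : Measurable fun y : ℕ → V => ∑ t ∈ Ioc M h,
      (laceInt D E U n true t y + laceInt D E U n false t y) :=
    Finset.measurable_sum _ fun t _ => (hmeas true t).add (hmeas false t)
  have mB : Measurable fun y : ℕ → V => ∑ p ∈ range (M + 1), ∑ s ∈ range p, ∑ t ∈ Ioc h n,
      pw U y s t * Kp (pw E y) p t * Kp (pw E y) t n * Phi D 0 n y :=
    Finset.measurable_sum _ fun p _ => Finset.measurable_sum _ fun s _ =>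
      Finset.measurable_sum _ fun t _ => mex p s t
  have hX : exitBound D E U M h n x = marg (Ioo 0 n) (fun y => ∑ t ∈ Ioc M h,
      (laceInt D E U n true t y + laceInt D E U n false t y) +
      2 ^ (M - 1) * ∑ p ∈ range (M + 1), ∑ s ∈ range p, ∑ t ∈ Ioc h n,
      pw U y s t * Kp (pw E y) p t * Kp (pw E y) t n * Phi D 0 n y) (pt x) := by
    rw [← marg_add mA, ← hcmul _ _ mB, exitBound]
    congr 2
    · rw [marg_sum (f := fun t y => _ + _) _ fun t => (hmeas true t).add (hmeas false t)]
      refine sum_congr rfl fun t ht => ?_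
      rw [mem_Ioc] at ht
      rw [lconvC_Pn hD hE hU true (by omega) (by omega),
        lconvC_Pn hD hE hU false (by omega) (by omega), marg_add (hmeas true t)]
    · rw [marg_sum _ fun p => Finset.measurable_sum _ fun s _ =>
        Finset.measurable_sum _ fun t _ => mex p s t]
      refine sum_congr rfl fun p _ => ?_
      rw [marg_sum _ fun s => Finset.measurable_sum _ fun t _ => mex p s t]
      refine sum_congr rfl fun s _ => ?_
      rw [marg_sum _ fun t => mex p s t]
      rfl
  have hpt : ∀ y : ℕ → V, Kp (pw E y) 0 1 * Phi D 0 n y * exitSum (pw E y) (pw U y) M n 0 1 ≤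
      ∑ t ∈ Ioc M h,
      (laceInt D E U n true t y + laceInt D E U n false t y) +
      2 ^ (M - 1) * ∑ p ∈ range (M + 1), ∑ s ∈ range p, ∑ t ∈ Ioc h n,
      pw U y s t * Kp (pw E y) p t * Kp (pw E y) t n * Phi D 0 n y := by
    intro y
    refine (mul_le_mul' le_rfl (exitSum_le (pw_add heu y) M h n 0 1 hM hh hn)).trans ?_
    rw [mul_add]
    refine add_le_add (le_of_eq ?_) ?_
    · rw [mul_sum]
      refine sum_congr rfl fun t _ => ?_
      simp only [jhat, laceInt]
      ring
    · calc _ ≤ 1 * Phi D 0 n y * _ :=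
            mul_le_mul' (mul_le_mul' (Kp_le_one (pw_add heu y) 0 1) le_rfl) le_rfl
        _ = _ := by
            simp only [← sum_mul]
            ring
  have hW : ∀ y : ℕ → V, Wline D E 0 n y =
      Kp (pw E y) 0 1 * Phi D 0 n y * Tp (pw E y) 0 1 n := by
    intro y
    rw [Wline, Kp_eq_mul_Tp (pw E y) (Nat.zero_le 1) (by omega)]
    ring
  have hS : ∀ (σ : Bool) (y : ℕ → V), ∑ m ∈ Icc 1 M, laceInt D E U n σ m y =
      Kp (pw E y) 0 1 * Phi D 0 n y * ∑ m ∈ Icc 1 M, jfun (pw E y) (pw U y) σ 0 1 m *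
        Kp (pw E y) m n := by
    intro σ y
    rw [mul_sum]
    exact sum_congr rfl fun m _ => by rw [laceInt]; ring
  have mS : ∀ σ, Measurable fun y : ℕ → V => ∑ m ∈ Icc 1 M, laceInt D E U n σ m y := fun σ =>
    Finset.measurable_sum _ fun m _ => hmeas σ m
  have mW := measurable_Wline hD hE 0 n
  have mWS : Measurable fun y : ℕ → V => Wline D E 0 n y +
      ∑ m ∈ Icc 1 M, laceInt D E U n false m y := mW.add (mS false)
  rw [hsum, hsum, hX, Cn, marg_add mW, marg_add (mS true), marg_add mWS]
  constructor
  · refine marg_mono (fun y => ?_) _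
    rw [hW, hS, hS, ← mul_add]
    refine (mul_le_mul' le_rfl (truncated_lace (pw_add heu y) M n 0 1 hM (by omega)).1).trans ?_
    rw [mul_add]
    exact add_le_add le_rfl (hpt y)
  · refine marg_mono (fun y => ?_) _
    simp only [hW, hS, ← mul_add]
    refine (mul_le_mul' le_rfl (truncated_lace (pw_add heu y) M n 0 1 hM (by omega)).2).trans ?_
    rw [mul_add]
    exact add_le_add le_rfl (hpt y)

theorem exitTerm_eq (hD : Measurable D) (hE : Measurable E) (hU : Measurable U) {p s t n : ℕ}
    (hs : s < p) (hpt : p < t) (htn : t ≤ n) (x : V) : exitTerm D E U p s t n x =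
      lconvC D E (fun z => lconv (fun v => marg (Ioo 0 p) (fun y => U (z - y s) * Phi D 0 p y) (pt v))
        (Cn D E (t - p)) z) (n - t) x := by
  have hz : ∀ z, marg (Ioo 0 t) (fun y => pw U y s t * Phi D 0 p y * Wline D E p t y) (pt z) =
      lconv (fun v => marg (Ioo 0 p) (fun y => U (z - y s) * Phi D 0 p y) (pt v))
        (Cn D E (t - p)) z := by
    intro z
    rw [← marg_concat_Cn (f := fun y => U (z - y s) * Phi D 0 p y) hD hE (by omega) hpt
      ((hU.comp (measurable_const.sub (measurable_pi_apply s))).mul (measurable_Phi hD 0 p))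
      (fun a b h => by
        simp only
        rw [h s hs.le, dependsOn_Phi 0 p fun i hi => h i hi.2]) z]
    refine lintegral_congr fun v => ?_
    have : Function.updateFinset (pt z) (Ioo 0 t) v t = z := by
      rw [Function.updateFinset, dif_neg (by simp), pt_pos z (by omega)]
    simp only [pw, this]
  have hsplit : ∀ y : ℕ → V, pw U y s t * Kp (pw E y) p t * Kp (pw E y) t n * Phi D 0 n y =
      pw U y s t * Phi D 0 p y * Wline D E p t y * Wline D E t n y := by
    intro y
    rw [Phi_mul (Nat.zero_le t) htn, Phi_mul (Nat.zero_le p) hpt.le, Wline, Wline]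
    ring
  rw [exitTerm]
  simp only [hsplit]
  rcases htn.eq_or_lt with h | h
  · subst h
    rw [Nat.sub_self, lconvC, if_pos rfl, ← hz]
    congr 1
    funext y
    simp [Wline, Kp_self, Phi]
  · rw [lconvC, if_neg (by omega), marg_concat_Cn
      (f := fun y => pw U y s t * Phi D 0 p y * Wline D E p t y) hD hE (by omega) h
      (((measurable_pw hU s t).mul (measurable_Phi hD 0 p)).mul (measurable_Wline hD hE p t))]
    · simp only [hz]
    · intro a b hab
      simp only [pw]
      rw [hab s (by simp; omega), hab t (by simp), dependsOn_Phi 0 p fun i hi => hab i (by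
        have := hi.2; simp; omega), dependsOn_Wline p t fun i hi => hab i hi.2]

end Truncation

theorem lintegral_marked_walk {d : ℕ} {D : Ed d → ℝ≥0∞} (hD : Measurable D)
    {g : Ed d → ℝ≥0∞} (hg : Measurable g) {p s : ℕ}
    (hs : s < p) : ∫⁻ v, marg (Ioo 0 p) (fun y => g (y s) * Phi D 0 p y) (pt v) =
      if s = 0 then g 0 * ∫⁻ v, Cn D 1 p v
      else (∫⁻ b, g b * Cn D 1 s b) * ∫⁻ v, Cn D 1 (p - s) v := by
  have hone : ∀ a b (y : ℕ → Ed d), Wline D 1 a b y = Phi D a b y := by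
    intro a b y
    simp [Wline, Kp, pw]
  have mE : Measurable (1 : Ed d → ℝ≥0∞) := measurable_const
  split_ifs with h0
  · subst h0
    rw [← lintegral_const_mul _ (measurable_Cn hD mE p)]
    refine lintegral_congr fun v => ?_
    rw [marg_mul_left (g := fun y => g (y 0)) (S := {0}) (fun a b h => by simp only; rw [h 0 rfl]) (by simp)
      (measurable_Phi hD 0 p), Cn, pt_zero]
    congr 2
    funext y
    rw [hone]
  · have h1 : ∀ v, marg (Ioo 0 p) (fun y => g (y s) * Phi D 0 p y) (pt v) =
        lconv (fun b => g b * Cn D 1 s b) (Cn D 1 (p - s)) v := by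
      intro v
      have := marg_concat_Cn (f := fun y => g (y s) * Phi D 0 s y) hD mE (by omega) hs
        ((hg.comp (measurable_pi_apply s)).mul (measurable_Phi hD 0 s)) (fun a b h => by
          simp only
          rw [h s (by simp), dependsOn_Phi 0 s fun i hi => h i hi.2]) v
      simp only [hone] at this
      rw [show (fun y : ℕ → Ed d => g (y s) * Phi D 0 p y) =
        fun y => g (y s) * Phi D 0 s y * Phi D s p y by
          funext y; rw [Phi_mul (Nat.zero_le s) hs.le]; ring, this]
      congr 1
      funext b
      rw [marg_mul_left (g := fun y => g (y s)) (S := {s}) (fun a b h => by simp only; rw [h s rfl]) (by simp)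
        (measurable_Phi hD 0 s), Cn, pt_pos b (by omega)]
      congr 2
      funext y
      rw [hone]
    simp only [h1]
    exact lintegral_lconv (hg.mul (measurable_Cn hD mE s)) (measurable_Cn hD mE (p - s))

/-- A Gaussian of variance `s + 1` followed by a walk of length `j`. -/
def gaussC (d : ℕ) (lam ρ : ℝ) (s j : ℕ) : LF d :=
  if j = 0 then G d (s + 1) else G d (s + 1) * cLF d lam ρ j

theorem lintegral_free_le {p : ℕ} (hp : 0 < p) : ∫⁻ v, Cn (Dg d) 1 p v ≤ 1 := by
  have h := GB_Cn (d := d) (E := 1) (U := 0) measurable_const (by simp) hp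
  calc _ ≤ ∫⁻ v, ENNReal.ofReal (1 * gauss d p v) := lintegral_mono h.le
    _ = 1 := by
      simp only [one_mul]
      rw [← ofReal_integral_eq_lintegral_ofReal (integrable_gauss h.t_pos)
        (Eventually.of_forall fun x => gauss_nonneg h.t_pos.le x), integral_gauss h.t_pos]
      simp

theorem Ug_le_gauss (d : ℕ) : ∃ c > 0, ∀ lam ρ : ℝ, 0 ≤ lam → lam ≤ 1 → ρ ≤ 1 → ∀ x : Ed d,
    Ug d lam ρ x ≤ ENNReal.ofReal (c * gauss d 1 x) := by
  set K : ℝ := (2 * Real.pi * 1) ^ (-(d : ℝ) / 2) with hK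
  have hKp : 0 < K := by positivity
  refine ⟨Real.exp (1 / 2) / K, by positivity, fun lam ρ h0 h1 hρ x => ?_⟩
  refine ENNReal.ofReal_le_ofReal ?_
  unfold indBall
  split_ifs with h
  · rw [gauss, ← hK, ← mul_assoc, div_mul_cancel₀ _ hKp.ne', ← Real.exp_add, mul_one]
    refine h1.trans (Real.one_le_exp ?_)
    have : ‖x‖ ^ 2 ≤ 1 := pow_le_one₀ (norm_nonneg x) (h.trans hρ)
    linarith
  · rw [mul_zero]
    exact mul_nonneg (by positivity) (gauss_nonneg zero_le_one x)

theorem exitTerm_le (d : ℕ) : ∃ c > 0, ∀ lam ρ : ℝ, 0 ≤ lam → lam ≤ 1 → ρ ≤ 1 →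
    ∀ (p s t n : ℕ) (S : ℝ), s < p → p < t → t ≤ n → 0 ≤ S → (∀ v, cLF d lam ρ (t - p) v ≤ S) →
    ∀ x : Ed d, exitTerm (Dg d) (Eg d lam ρ) (Ug d lam ρ) p s t n x ≤
      ENNReal.ofReal (c * S * gaussC d lam ρ s (n - t) x) := by
  obtain ⟨c, hc, hU⟩ := Ug_le_gauss d
  refine ⟨c, hc, fun lam ρ h0 h1 hρ p s t n S hs hpt htn hS0 hS x => ?_⟩
  have mU := measurable_Ug (d := d) lam ρ
  have mE := measurable_Eg (d := d) lam ρ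
  have hinner : ∀ z, lconv (fun v => marg (Ioo 0 p) (fun y => Ug d lam ρ (z - y s) *
      Phi (Dg d) 0 p y) (pt v)) (Cn (Dg d) (Eg d lam ρ) (t - p)) z ≤
      ENNReal.ofReal (((c * S) • G d (s + 1) : LF d) z) := by
    intro z
    have mg : Measurable fun b => Ug d lam ρ (z - b) := mU.comp (measurable_const.sub measurable_id)
    have mf : Measurable fun y : ℕ → Ed d => Ug d lam ρ (z - y s) * Phi (Dg d) 0 p y :=
      (mg.comp (measurable_pi_apply s)).mul (measurable_Phi measurable_Dg 0 p)
    refine (lconv_le_of_right ((measurable_marg mf).comp measurable_pt)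
      (c := ENNReal.ofReal S) (fun v => ?_) z).trans ?_
    · rw [← ofReal_cLF h0 h1 (by omega)]
      exact ENNReal.ofReal_le_ofReal (hS v)
    have hm : ∫⁻ v, marg (Ioo 0 p) (fun y => Ug d lam ρ (z - y s) * Phi (Dg d) 0 p y) (pt v) ≤
        ENNReal.ofReal ((c • G d (s + 1) : LF d) z) := by
      rw [lintegral_marked_walk measurable_Dg mg hs]
      split_ifs with hs0
      · subst hs0
        refine (mul_le_mul' le_rfl (lintegral_free_le (by omega))).trans ?_
        rw [mul_one, sub_zero, LF.smul_apply, Nat.cast_zero, zero_add, G_apply one_pos]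
        exact hU lam ρ h0 h1 hρ z
      · have hsp : (0 : ℝ) < s := by exact_mod_cast Nat.pos_of_ne_zero hs0
        refine (mul_le_mul' le_rfl (lintegral_free_le (by omega))).trans ?_
        rw [mul_one]
        have hfree := GB_Cn (d := d) (E := 1) (U := 0) measurable_const (by simp)
          (Nat.pos_of_ne_zero hs0)
        calc ∫⁻ b, Ug d lam ρ (z - b) * Cn (Dg d) 1 s b
            ≤ lconv (fun b => ENNReal.ofReal (G d s b))
              (fun b => ENNReal.ofReal ((c • G d 1 : LF d) b)) z := by
              refine lintegral_mono fun b => ?_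
              rw [mul_comm]
              refine mul_le_mul' ?_ ?_
              · beta_reduce
                rw [G_apply hsp]
                simpa using hfree.le b
              · beta_reduce
                rw [LF.smul_apply, G_apply one_pos]
                exact hU lam ρ h0 h1 hρ _
          _ = _ := by
              rw [lconv_ofReal _ _ (G_nonneg _) fun b => by
                rw [LF.smul_apply]; exact mul_nonneg hc.le (G_nonneg _ _), mul_smul_comm,
                G_mul_G hsp one_pos]
    refine (mul_le_mul' hm le_rfl).trans (le_of_eq ?_)
    rw [← ENNReal.ofReal_mul (by rw [LF.smul_apply]; exact mul_nonneg hc.le (G_nonneg _ _))]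
    simp only [LF.smul_apply]
    ring_nf
  rw [exitTerm_eq measurable_Dg mE mU hs hpt htn, lconvC, gaussC]
  have hcS : 0 ≤ c * S := by positivity
  split_ifs with hj
  · refine (hinner x).trans (le_of_eq ?_)
    rw [LF.smul_apply]
  · refine (lconv_mono hinner (fun z => (ofReal_cLF h0 h1 (Nat.pos_of_ne_zero hj) z).ge) x).trans ?_
    rw [lconv_ofReal _ _ (fun b => by rw [LF.smul_apply]; exact mul_nonneg hcS (G_nonneg _ _))
      (cLF_nonneg _), smul_mul_assoc, LF.smul_apply]

theorem gaussC_nonneg (lam ρ : ℝ) (s j : ℕ) (x : Ed d) : 0 ≤ gaussC d lam ρ s j x := by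
  unfold gaussC
  split_ifs
  · exact G_nonneg _ _
  · rw [LF.mul_apply]
    exact integral_nonneg fun y => mul_nonneg (G_nonneg _ _) (cLF_nonneg _ _)

theorem gaussC_le_gauss {lam ρ : ℝ} (h0 : 0 ≤ lam) (h1 : lam ≤ 1) (s j : ℕ) (x : Ed d) :
    gaussC d lam ρ s j x ≤ gauss d (s + 1 + j) x := by
  have hs : (0 : ℝ) < s + 1 := by positivity
  unfold gaussC
  split_ifs with h
  · subst h
    rw [G_apply hs, Nat.cast_zero, add_zero]
  · have hj : (0 : ℝ) < j := by exact_mod_cast Nat.pos_of_ne_zero h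
    rw [← G_apply (by positivity), ← G_mul_G hs hj]
    exact LF.mul_le_mul (G_nonneg _) (fun _ => le_rfl) (cLF_nonneg _) (fun y => by
      rw [G_apply hj]; exact cLF_le_gauss h0 h1 (Nat.pos_of_ne_zero h) y) x

theorem gaussC_le {lam ρ c : ℝ} (s : ℕ) {j : ℕ} (hj : 0 < j)
    (h : ∀ y, cLF d lam ρ j y ≤ c) (x : Ed d) : gaussC d lam ρ s j x ≤ c := by
  rw [gaussC, if_neg hj.ne']
  have hs : (0 : ℝ) < s + 1 := by positivity
  have h1 : ∫ y, |G d (s + 1) y| ≤ 1 := by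
    simp only [abs_of_nonneg (G_nonneg _ _)]
    rw [integral_G hs]
  have := SB.mul_of_integral h1 (g := cLF d lam ρ j) (c := c)
    (fun y => by rw [abs_of_nonneg (cLF_nonneg _ _)]; exact h y) x
  rw [one_mul] at this
  exact (le_abs_self _).trans this

/-- The filter of pairs `(n, x)` with `n` large and `x` far from the origin. -/
def far (d : ℕ) : Filter (ℕ × Ed d) := atTop ×ˢ comap norm atTop

theorem eventually_far {p : ℕ × Ed d → Prop} :
    (∀ᶠ q in far d, p q) ↔ ∃ (N : ℕ) (r : ℝ), ∀ n ≥ N, ∀ x : Ed d, r ≤ ‖x‖ → p (n, x) := by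
  rw [far, (atTop_basis.prod (atTop_basis.comap norm)).eventually_iff]
  constructor
  · rintro ⟨⟨N, r⟩, -, h⟩
    exact ⟨N, r, fun n hn x hx => h ⟨hn, hx⟩⟩
  · rintro ⟨N, r, h⟩
    exact ⟨⟨N, r⟩, ⟨trivial, trivial⟩, fun q hq => h q.1 hq.1 q.2 hq.2⟩

theorem tendsto_gauss_far {t : ℝ} (ht : 0 < t) :
    Tendsto (fun x : Ed d => gauss d t x) (comap norm atTop) (nhds 0) := by
  have h1 : Tendsto (fun r : ℝ => (2 * Real.pi * t) ^ (-(d : ℝ) / 2) * Real.exp (-r ^ 2 / (2 * t)))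
      atTop (nhds 0) := by
    rw [show (0 : ℝ) = (2 * Real.pi * t) ^ (-(d : ℝ) / 2) * 0 by simp]
    refine Tendsto.const_mul _ (Real.tendsto_exp_atBot.comp ?_)
    have : Tendsto (fun r : ℝ => r ^ 2 / (2 * t)) atTop atTop :=
      (tendsto_pow_atTop two_ne_zero).atTop_div_const (by positivity)
    refine (tendsto_neg_atTop_atBot.comp this).congr fun r => ?_
    simp [neg_div]
  exact h1.comp tendsto_comap

theorem abs_cLF_sub_le (h0 : 0 ≤ lam) (h1 : lam ≤ 1) {M h n : ℕ} (hM : 1 ≤ M) (hh : M ≤ h)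
    (hn : h < n) (x : Ed d) {X : ℝ} (hX0 : 0 ≤ X)
    (hX : exitBound (Dg d) (Eg d lam ρ) (Ug d lam ρ) M h n x ≤ ENNReal.ofReal X) :
    |cLF d lam ρ n x - ∑ m ∈ Icc 1 M, (pLF d lam ρ m * cLF d lam ρ (n - m) : LF d) x| ≤ X := by
  set f : Bool → ℕ → LF d := fun σ m => toLF (Pn (Dg d) (Eg d lam ρ) (Ug d lam ρ) σ m) with hf
  have hnn : ∀ σ m, 0 ≤ (f σ m * cLF d lam ρ (n - m) : LF d) x := fun σ m => by
    rw [LF.mul_apply]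
    exact integral_nonneg fun y => mul_nonneg (toLF_nonneg _ _) (cLF_nonneg _ _)
  have hsum : ∀ σ, ∑ m ∈ Icc 1 M, lconvC (Dg d) (Eg d lam ρ)
      (Pn (Dg d) (Eg d lam ρ) (Ug d lam ρ) σ m) (n - m) x =
      ENNReal.ofReal (∑ m ∈ Icc 1 M, (f σ m * cLF d lam ρ (n - m) : LF d) x) := by
    intro σ
    rw [ENNReal.ofReal_sum_of_nonneg fun m _ => hnn σ m]
    refine sum_congr rfl fun m hm => ?_
    rw [mem_Icc] at hm
    obtain ⟨ht, he⟩ := toReal_lconvC (d := d) (ρ := ρ) h0 h1 σ (show 0 < m by omega) (n - m) x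
    rw [if_neg (by omega)] at he
    rw [hf, ← he, ENNReal.ofReal_toReal ht]
  have hp : ∑ m ∈ Icc 1 M, (pLF d lam ρ m * cLF d lam ρ (n - m) : LF d) x =
      ∑ m ∈ Icc 1 M, (f true m * cLF d lam ρ (n - m) : LF d) x -
        ∑ m ∈ Icc 1 M, (f false m * cLF d lam ρ (n - m) : LF d) x := by
    rw [← sum_sub_distrib]
    refine sum_congr rfl fun m hm => ?_
    rw [mem_Icc] at hm
    rw [pLF, if_neg (by omega), sub_mul, LF.sub_apply]
  have key := lace_truncated (measurable_Dg (d := d)) (measurable_Eg lam ρ) (measurable_Ug lam ρ)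
    (Eg_add_Ug h0 h1 ρ) hM hh hn.le x
  rw [hsum, hsum, ← ofReal_cLF h0 h1 (by omega)] at key
  have hc := cLF_nonneg (d := d) (lam := lam) (ρ := ρ) n x
  have hs := fun σ => sum_nonneg fun m (_ : m ∈ Icc 1 M) => hnn σ m
  have k1 := key.1.trans (add_le_add le_rfl hX)
  have k2 := key.2.trans (add_le_add le_rfl hX)
  rw [← ENNReal.ofReal_add hc (hs false), ← ENNReal.ofReal_add (hs true) hX0,
    ENNReal.ofReal_le_ofReal_iff (add_nonneg (hs true) hX0)] at k1
  rw [← ENNReal.ofReal_add hc (hs false), ← ENNReal.ofReal_add (add_nonneg hc (hs false)) hX0,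
    ENNReal.ofReal_le_ofReal_iff (add_nonneg (add_nonneg hc (hs false)) hX0)] at k2
  rw [hp, abs_le]
  constructor <;> linarith

theorem TwoPointBound.cLF_le {A w : ℝ} (hw : 0 < w)
    (hB : ∀ R, TwoPointBound d lam ρ A w R) {n : ℕ} (hn : 0 < n) (x : Ed d) :
    w ^ n * cLF d lam ρ n x ≤ A * (n : ℝ) ^ (-((d : ℝ) / 2)) := by
  refine le_trans ?_ ((hB n n hn le_rfl).2 x)
  exact le_mul_of_one_le_left (mul_nonneg (by positivity) (cLF_nonneg _ _))
    (by linarith [wt_ge n x])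

theorem sum_Ioc_reflect {h n : ℕ} (f : ℕ → ℝ) :
    ∑ t ∈ Ioc h n, f (n - t) = ∑ j ∈ range (n - h), f j := by
  refine sum_bij' (fun t _ => n - t) (fun j _ => n - j) ?_ ?_ ?_ ?_ ?_ <;>
    intro a ha <;> simp only [mem_Ioc, mem_range] at ha ⊢
  all_goals omega

theorem sum_gaussC_le (hd : 5 ≤ d) {A w : ℝ} (h0 : 0 ≤ lam) (h1 : lam ≤ 1) (hA : 0 ≤ A)
    (hw : 0 < w) (hw2 : w ≤ 2) (hB : ∀ R, TwoPointBound d lam ρ A w R) (s h n J : ℕ) (x : Ed d) :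
    ∑ t ∈ Ioc h n, w ^ (n - t) * gaussC d lam ρ s (n - t) x ≤
      ∑ j ∈ range (J + 1), 2 ^ j * gauss d (s + 1 + j) x +
        A * (5 / 3 * ((J : ℝ) + 1) ^ (-(3 / 2 : ℝ))) := by
  rw [sum_Ioc_reflect fun j => w ^ j * gaussC d lam ρ s j x]
  have hnn : ∀ j, 0 ≤ w ^ j * gaussC d lam ρ s j x := fun j =>
    mul_nonneg (by positivity) (gaussC_nonneg _ _ _ _ _)
  calc _ ≤ ∑ j ∈ range (J + 1) ∪ Ioc J n, w ^ j * gaussC d lam ρ s j x := by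
        refine sum_le_sum_of_subset_of_nonneg (fun j hj => ?_) fun j _ _ => hnn j
        simp only [mem_range, mem_union, mem_Ioc] at hj ⊢
        omega
    _ ≤ ∑ j ∈ range (J + 1), w ^ j * gaussC d lam ρ s j x +
        ∑ j ∈ Ioc J n, w ^ j * gaussC d lam ρ s j x := by
        refine le_of_eq (sum_union (Finset.disjoint_left.2 fun j hj hj' => ?_))
        simp only [mem_range, mem_Ioc] at hj hj'
        omega
    _ ≤ _ := by
        refine add_le_add (sum_le_sum fun j _ => ?_) ?_
        · exact mul_le_mul (pow_le_pow_left₀ hw.le hw2 j) (gaussC_le_gauss h0 h1 s j x)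
            (gaussC_nonneg _ _ _ _ _) (by positivity)
        · have := sum_Ioc_five_halves J n le_rfl
          simp only [add_zero] at this
          refine le_trans ?_ (mul_le_mul_of_nonneg_left this hA)
          rw [mul_sum]
          refine sum_le_sum fun j hj => ?_
          rw [mem_Ioc] at hj
          have hwj : 0 < w ^ j := by positivity
          have := gaussC_le (d := d) (lam := lam) (ρ := ρ) s (show 0 < j by omega)
            (c := A * (j : ℝ) ^ (-((d : ℝ) / 2)) / w ^ j) (fun y => by
              rw [le_div_iff₀ hwj, mul_comm]
              exact TwoPointBound.cLF_le hw hB (by omega) y) x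
          rw [le_div_iff₀ hwj, mul_comm] at this
          exact this.trans (mul_le_mul_of_nonneg_left (pow_s_le_52 hd j) hA)

theorem exitBound_le (d : ℕ) : ∃ c > 0, ∀ lam ρ A C w : ℝ, 0 ≤ lam → lam ≤ 1 → ρ ≤ 1 →
    0 ≤ A → 0 ≤ C → 0 < w → (∀ R, TwoPointBound d lam ρ A w R) →
    (∀ m : ℕ, 2 ≤ m → ∫⁻ x, ENNReal.ofReal (w ^ m * wt m x) *
      (Pn (Dg d) (Eg d lam ρ) (Ug d lam ρ) true m x +
        Pn (Dg d) (Eg d lam ρ) (Ug d lam ρ) false m x) ≤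
      ENNReal.ofReal (C * (m : ℝ) ^ (-((d : ℝ) / 2)))) →
    ∀ M h n : ℕ, 1 ≤ M → M ≤ h → h < n → ∀ x : Ed d,
    exitBound (Dg d) (Eg d lam ρ) (Ug d lam ρ) M h n x ≤ ENNReal.ofReal
      (∑ t ∈ Ioc M h, C * (t : ℝ) ^ (-((d : ℝ) / 2)) / w ^ t *
        (A * ((n - t : ℕ) : ℝ) ^ (-((d : ℝ) / 2)) / w ^ (n - t)) +
      2 ^ (M - 1) * ∑ p ∈ range (M + 1), ∑ s ∈ range p, ∑ t ∈ Ioc h n,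
        c * (A * ((t - p : ℕ) : ℝ) ^ (-((d : ℝ) / 2)) / w ^ (t - p)) *
          gaussC d lam ρ s (n - t) x) := by
  obtain ⟨c, hc, hexit⟩ := exitTerm_le d
  refine ⟨c, hc, fun lam ρ A C w h0 h1 hρ hA hC hw hB hPi M h n hM hh hn x => ?_⟩
  have hS : ∀ k : ℕ, 0 < k → ∀ v, cLF d lam ρ k v ≤
      A * (k : ℝ) ^ (-((d : ℝ) / 2)) / w ^ k := fun k hk v => by
    rw [le_div_iff₀ (by positivity), mul_comm]
    exact TwoPointBound.cLF_le hw hB hk v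
  have hS0 : ∀ k : ℕ, 0 ≤ A * (k : ℝ) ^ (-((d : ℝ) / 2)) / w ^ k := fun k => by positivity
  have hC0 : ∀ k : ℕ, 0 ≤ C * (k : ℝ) ^ (-((d : ℝ) / 2)) / w ^ k := fun k => by positivity
  have hsumnn : ∀ p s t : ℕ, 0 ≤ c * (A * ((t - p : ℕ) : ℝ) ^ (-((d : ℝ) / 2)) / w ^ (t - p)) *
      gaussC d lam ρ s (n - t) x := fun p s t =>
    mul_nonneg (mul_nonneg hc.le (hS0 _)) (gaussC_nonneg _ _ _ _ _)
  have mP := fun σ m => measurable_Pn (measurable_Dg (d := d)) (measurable_Eg lam ρ)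
    (measurable_Ug lam ρ) σ m
  rw [ENNReal.ofReal_add (sum_nonneg fun t _ => mul_nonneg (hC0 _) (hS0 _))
    (mul_nonneg (by positivity) (sum_nonneg fun p _ => sum_nonneg fun s _ =>
      sum_nonneg fun t _ => hsumnn p s t)), exitBound]
  refine add_le_add ?_ ?_
  · rw [ENNReal.ofReal_sum_of_nonneg fun t _ => mul_nonneg (hC0 _) (hS0 _)]
    refine sum_le_sum fun t ht => ?_
    rw [mem_Ioc] at ht
    have hσ : ∀ σ, lconvC (Dg d) (Eg d lam ρ) (Pn (Dg d) (Eg d lam ρ) (Ug d lam ρ) σ t) (n - t) x ≤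
        (∫⁻ y, Pn (Dg d) (Eg d lam ρ) (Ug d lam ρ) σ t y) *
          ENNReal.ofReal (A * ((n - t : ℕ) : ℝ) ^ (-((d : ℝ) / 2)) / w ^ (n - t)) := by
      intro σ
      rw [lconvC, if_neg (by omega)]
      refine lconv_le_of_right (mP σ t) (fun v => ?_) x
      rw [← ofReal_cLF h0 h1 (by omega)]
      exact ENNReal.ofReal_le_ofReal (hS _ (by omega) v)
    refine (add_le_add (hσ true) (hσ false)).trans ?_
    rw [← add_mul, ENNReal.ofReal_mul (hC0 _), ← lintegral_add_left (mP true t)]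
    refine mul_le_mul' ?_ le_rfl
    have madd : Measurable fun y => Pn (Dg d) (Eg d lam ρ) (Ug d lam ρ) true t y +
        Pn (Dg d) (Eg d lam ρ) (Ug d lam ρ) false t y := (mP true t).add (mP false t)
    rw [ENNReal.ofReal_div_of_pos (by positivity), ENNReal.le_div_iff_mul_le
      (Or.inl (by simpa using pow_pos hw t)) (Or.inl ENNReal.ofReal_ne_top), mul_comm,
      ← lintegral_const_mul _ madd]
    refine le_trans (lintegral_mono fun y => mul_le_mul' (ENNReal.ofReal_le_ofReal ?_) le_rfl)
      (hPi t (by omega))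
    exact le_mul_of_one_le_right (by positivity) (by linarith [wt_ge t y])
  · rw [ENNReal.ofReal_mul (by positivity), ENNReal.ofReal_pow (by norm_num)]
    refine mul_le_mul' (by simp) ?_
    rw [ENNReal.ofReal_sum_of_nonneg fun p _ => sum_nonneg fun s _ =>
      sum_nonneg fun t _ => hsumnn p s t]
    refine sum_le_sum fun p hp => ?_
    rw [ENNReal.ofReal_sum_of_nonneg fun s _ => sum_nonneg fun t _ => hsumnn p s t]
    refine sum_le_sum fun s hs => ?_
    rw [ENNReal.ofReal_sum_of_nonneg fun t _ => hsumnn p s t]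
    refine sum_le_sum fun t ht => ?_
    rw [mem_range] at hp hs
    rw [mem_Ioc] at ht
    exact hexit lam ρ h0 h1 hρ p s t n _ hs (by omega) ht.2 (hS0 _) (hS _ (by omega)) x

/-- Hypotheses under which the lace expansion can be truncated far from the origin. -/
structure LaceBounds (d : ℕ) (lam ρ A C w : ℝ) : Prop where
  lam_nonneg : 0 ≤ lam
  lam_le : lam ≤ 1
  ρ_le : ρ ≤ 1
  A_pos : 0 < A
  C_pos : 0 < C
  w_pos : 0 < w
  w_le : w ≤ 2
  two_point : ∀ R, TwoPointBound d lam ρ A w R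
  lace : ∀ m : ℕ, 2 ≤ m → ∫⁻ x, ENNReal.ofReal (w ^ m * wt m x) *
      (Pn (Dg d) (Eg d lam ρ) (Ug d lam ρ) true m x +
        Pn (Dg d) (Eg d lam ρ) (Ug d lam ρ) false m x) ≤
      ENNReal.ofReal (C * (m : ℝ) ^ (-((d : ℝ) / 2)))

theorem truncation_error_le (hd : 5 ≤ d) : ∃ c > 0, ∀ lam ρ A C w : ℝ, LaceBounds d lam ρ A C w →
    ∀ M n J : ℕ, 1 ≤ M → 4 * M + 4 ≤ n → ∀ x : Ed d,
    |(w ^ n • cLF d lam ρ n : LF d) x - ∑ m ∈ Icc 1 M,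
      ((w ^ m • pLF d lam ρ m) * (w ^ (n - m) • cLF d lam ρ (n - m)) : LF d) x| ≤
    (C * A * 2 ^ ((d : ℝ) / 2) * (5 / 3 * ((M : ℝ) + 1) ^ (-(3 / 2 : ℝ))) +
      2 ^ (M - 1) * (c * A * 4 ^ ((d : ℝ) / 2) * 2 ^ M) * ∑ p ∈ range (M + 1), ∑ s ∈ range p,
        (∑ j ∈ range (J + 1), 2 ^ j * gauss d (s + 1 + j) x +
          A * (5 / 3 * ((J : ℝ) + 1) ^ (-(3 / 2 : ℝ))))) * (n : ℝ) ^ (-((d : ℝ) / 2)) := by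
  obtain ⟨c, hc, hbd⟩ := exitBound_le d
  refine ⟨c, hc, fun lam ρ A C w H M n J hM hn x => ?_⟩
  have hs0 : 0 ≤ (d : ℝ) / 2 := by positivity
  set s' : ℝ := (d : ℝ) / 2 with hs'
  have hw := H.w_pos
  have hA := H.A_pos
  have hC := H.C_pos
  have hX := hbd lam ρ A C w H.lam_nonneg H.lam_le H.ρ_le hA.le hC.le hw H.two_point H.lace
    M (n / 2) n hM (by omega) (by omega) x
  have hX0 : 0 ≤ ∑ t ∈ Ioc M (n / 2), C * (t : ℝ) ^ (-s') / w ^ t *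
        (A * ((n - t : ℕ) : ℝ) ^ (-s') / w ^ (n - t)) +
      2 ^ (M - 1) * ∑ p ∈ range (M + 1), ∑ s ∈ range p, ∑ t ∈ Ioc (n / 2) n,
        c * (A * ((t - p : ℕ) : ℝ) ^ (-s') / w ^ (t - p)) * gaussC d lam ρ s (n - t) x := by
    refine add_nonneg (sum_nonneg fun t _ => by positivity) (mul_nonneg (by positivity)
      (sum_nonneg fun p _ => sum_nonneg fun s _ => sum_nonneg fun t _ =>
        mul_nonneg (by positivity) (gaussC_nonneg _ _ _ _ _)))
  have hmain := abs_cLF_sub_le H.lam_nonneg H.lam_le hM (by omega) (by omega) x hX0 hX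
  have heq : (w ^ n • cLF d lam ρ n : LF d) x - ∑ m ∈ Icc 1 M,
      ((w ^ m • pLF d lam ρ m) * (w ^ (n - m) • cLF d lam ρ (n - m)) : LF d) x =
      w ^ n * (cLF d lam ρ n x - ∑ m ∈ Icc 1 M, (pLF d lam ρ m * cLF d lam ρ (n - m) : LF d) x) := by
    rw [mul_sub, mul_sum, LF.smul_apply]
    congr 1
    refine sum_congr rfl fun m hm => ?_
    rw [mem_Icc] at hm
    rw [smul_mul_assoc, mul_smul_comm, LF.smul_apply, LF.smul_apply, ← mul_assoc, ← pow_add,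
      show m + (n - m) = n by omega]
  rw [heq, abs_mul, abs_of_pos (pow_pos hw n)]
  refine (mul_le_mul_of_nonneg_left hmain (pow_pos hw n).le).trans ?_
  have hnpos : (0 : ℝ) < n := by exact_mod_cast (show 0 < n by omega)
  rw [mul_add, add_mul]
  refine add_le_add ?_ ?_
  · have h5 := sum_Ioc_five_halves M (n / 2) le_rfl
    simp only [add_zero] at h5
    calc _ ≤ ∑ t ∈ Ioc M (n / 2), C * A * 2 ^ s' * (n : ℝ) ^ (-s') * (t : ℝ) ^ (-(5 / 2 : ℝ)) := by
          rw [mul_sum]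
          refine sum_le_sum fun t ht => ?_
          rw [mem_Ioc] at ht
          have e1 : w ^ n = w ^ t * w ^ (n - t) := by rw [← pow_add]; congr 1; omega
          have e2 : ((n - t : ℕ) : ℝ) ^ (-s') ≤ 2 ^ s' * (n : ℝ) ^ (-s') :=
            rpow_half hnpos hs0 (by exact_mod_cast (show n ≤ 2 * (n - t) by omega))
          have e3 := pow_s_le_52 hd t
          rw [← hs'] at e3
          calc _ = C * A * (((n - t : ℕ) : ℝ) ^ (-s') * (t : ℝ) ^ (-s')) := by
                rw [e1]; field_simp
            _ ≤ C * A * (2 ^ s' * (n : ℝ) ^ (-s') * (t : ℝ) ^ (-(5 / 2 : ℝ))) := by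
                refine mul_le_mul_of_nonneg_left (mul_le_mul e2 e3 ?_ ?_) ?_ <;> positivity
            _ = _ := by ring
      _ = C * A * 2 ^ s' * (n : ℝ) ^ (-s') * ∑ t ∈ Ioc M (n / 2), (t : ℝ) ^ (-(5 / 2 : ℝ)) := by
          rw [mul_sum]
      _ ≤ C * A * 2 ^ s' * (n : ℝ) ^ (-s') * _ := mul_le_mul_of_nonneg_left h5 (by positivity)
      _ = _ := by ring
  · have hterm : ∀ p ∈ range (M + 1), ∀ s ∈ range p, w ^ n * ∑ t ∈ Ioc (n / 2) n,
        c * (A * ((t - p : ℕ) : ℝ) ^ (-s') / w ^ (t - p)) * gaussC d lam ρ s (n - t) x ≤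
        c * A * 4 ^ s' * 2 ^ M * (n : ℝ) ^ (-s') * (∑ j ∈ range (J + 1), 2 ^ j *
          gauss d (s + 1 + j) x + A * (5 / 3 * ((J : ℝ) + 1) ^ (-(3 / 2 : ℝ)))) := by
      intro p hp s hs
      rw [mem_range] at hp hs
      refine le_trans ?_ (mul_le_mul_of_nonneg_left (sum_gaussC_le hd H.lam_nonneg H.lam_le hA.le hw
        H.w_le H.two_point s (n / 2) n J x) (by positivity))
      rw [mul_sum, mul_sum]
      refine sum_le_sum fun t ht => ?_
      rw [mem_Ioc] at ht
      have e1 : w ^ n = w ^ p * w ^ (t - p) * w ^ (n - t) := by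
        rw [← pow_add, ← pow_add]; congr 1; omega
      have e2 : ((t - p : ℕ) : ℝ) ^ (-s') ≤ 4 ^ s' * (n : ℝ) ^ (-s') := by
        have := rpow_le_scaled (c := 1 / 4) (x := (n : ℝ)) (y := ((t - p : ℕ) : ℝ)) (a := s')
          (by norm_num) hnpos (by
            have : (n : ℝ) ≤ 4 * ((t - p : ℕ) : ℝ) := by
              exact_mod_cast (show n ≤ 4 * (t - p) by omega)
            linarith) hs0
        simpa using this
      have e3 : w ^ p ≤ 2 ^ M := (pow_le_pow_left₀ hw.le H.w_le p).trans
        (pow_le_pow_right₀ (by norm_num) (by omega))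
      have hg := gaussC_nonneg (d := d) lam ρ s (n - t) x
      calc _ = c * A * (((t - p : ℕ) : ℝ) ^ (-s') * w ^ p) *
            (w ^ (n - t) * gaussC d lam ρ s (n - t) x) := by
            rw [e1]; field_simp
        _ ≤ c * A * (4 ^ s' * (n : ℝ) ^ (-s') * 2 ^ M) *
            (w ^ (n - t) * gaussC d lam ρ s (n - t) x) := by
            refine mul_le_mul_of_nonneg_right (mul_le_mul_of_nonneg_left
              (mul_le_mul e2 e3 ?_ ?_) ?_) ?_ <;> positivity
        _ = _ := by ring
    calc _ = 2 ^ (M - 1) * ∑ p ∈ range (M + 1), ∑ s ∈ range p, w ^ n * ∑ t ∈ Ioc (n / 2) n,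
          c * (A * ((t - p : ℕ) : ℝ) ^ (-s') / w ^ (t - p)) * gaussC d lam ρ s (n - t) x := by
          simp only [mul_sum]
          refine sum_congr rfl fun p _ => sum_congr rfl fun s _ =>
            sum_congr rfl fun t _ => by ring
      _ ≤ 2 ^ (M - 1) * ∑ p ∈ range (M + 1), ∑ s ∈ range p, c * A * 4 ^ s' * 2 ^ M *
          (n : ℝ) ^ (-s') * (∑ j ∈ range (J + 1), 2 ^ j *
          gauss d (s + 1 + j) x + A * (5 / 3 * ((J : ℝ) + 1) ^ (-(3 / 2 : ℝ)))) :=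
          mul_le_mul_of_nonneg_left (sum_le_sum fun p hp => sum_le_sum fun s hs =>
            hterm p hp s hs) (by positivity)
      _ = _ := by
          simp only [← mul_sum]
          ring

theorem tendsto_natcast_add_one_rpow {a : ℝ} (ha : 0 < a) :
    Tendsto (fun M : ℕ => ((M : ℝ) + 1) ^ (-a)) atTop (nhds 0) :=
  (tendsto_rpow_neg_atTop ha).comp
    (tendsto_atTop_add_const_right _ _ tendsto_natCast_atTop_atTop)

theorem truncation_far (hd : 5 ≤ d) {A C w : ℝ} (H : LaceBounds d lam ρ A C w) {η : ℝ}
    (hη : 0 < η) : ∀ᶠ M : ℕ in atTop, ∀ᶠ q in far d,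
    |(w ^ q.1 • cLF d lam ρ q.1 : LF d) q.2 - ∑ m ∈ Icc 1 M,
      ((w ^ m • pLF d lam ρ m) * (w ^ (q.1 - m) • cLF d lam ρ (q.1 - m)) : LF d) q.2| ≤
      η * (q.1 : ℝ) ^ (-((d : ℝ) / 2)) := by
  obtain ⟨c, hc, hbd⟩ := truncation_error_le hd
  have h32 := tendsto_natcast_add_one_rpow (a := 3 / 2) (by norm_num)
  have t1 : Tendsto (fun M : ℕ => C * A * 2 ^ ((d : ℝ) / 2) *
      (5 / 3 * ((M : ℝ) + 1) ^ (-(3 / 2 : ℝ)))) atTop (nhds 0) := by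
    simpa using (h32.const_mul (5 / 3)).const_mul (C * A * 2 ^ ((d : ℝ) / 2))
  filter_upwards [t1.eventually_lt_const (half_pos hη), eventually_ge_atTop 1] with M hM hM1
  have t2 : Tendsto (fun J : ℕ => 2 ^ (M - 1) * (c * A * 4 ^ ((d : ℝ) / 2) * 2 ^ M) *
      ∑ p ∈ range (M + 1), ∑ s ∈ range p, A * (5 / 3 * ((J : ℝ) + 1) ^ (-(3 / 2 : ℝ))))
      atTop (nhds 0) := by
    have := (tendsto_finsetSum (range (M + 1)) fun p _ => tendsto_finsetSum (range p) fun s _ =>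
      (h32.const_mul (5 / 3)).const_mul A).const_mul
      (2 ^ (M - 1) * (c * A * 4 ^ ((d : ℝ) / 2) * 2 ^ M))
    simpa using this
  obtain ⟨J, hJ⟩ := (t2.eventually_lt_const (show (0 : ℝ) < η / 4 by positivity)).exists
  have t3 : Tendsto (fun x : Ed d => 2 ^ (M - 1) * (c * A * 4 ^ ((d : ℝ) / 2) * 2 ^ M) *
      ∑ p ∈ range (M + 1), ∑ s ∈ range p, ∑ j ∈ range (J + 1), 2 ^ j * gauss d (s + 1 + j) x)
      (comap norm atTop) (nhds 0) := by
    have := (tendsto_finsetSum (range (M + 1)) fun p _ => tendsto_finsetSum (range p) fun s _ =>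
      tendsto_finsetSum (range (J + 1)) fun j _ => (tendsto_gauss_far (d := d)
        (show (0 : ℝ) < s + 1 + j by positivity)).const_mul (2 ^ j : ℝ)).const_mul
      (2 ^ (M - 1) * (c * A * 4 ^ ((d : ℝ) / 2) * 2 ^ M))
    simpa using this
  have e3 : ∀ᶠ q in far d, _ := tendsto_snd.eventually
    (t3.eventually_lt_const (show (0 : ℝ) < η / 4 by positivity))
  have e4 : ∀ᶠ q in far d, _ := tendsto_fst.eventually (eventually_ge_atTop (4 * M + 4))
  filter_upwards [e3, e4] with q hq hn
  refine (hbd lam ρ A C w H M q.1 J hM1 hn q.2).trans ?_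
  refine mul_le_mul_of_nonneg_right ?_ (by positivity)
  simp only [sum_add_distrib, mul_add] at hJ hq ⊢
  linarith

theorem LF.exists_tail_le (f : LF d) {ε : ℝ} (hε : 0 < ε) :
    ∃ R : ℝ, ∫ y, {y : Ed d | R < ‖y‖}.indicator (fun y => |f y|) y ≤ ε := by
  have ht : Tendsto (fun R : ℕ => ∫ y, {y : Ed d | (R : ℝ) < ‖y‖}.indicator (fun y => |f y|) y)
      atTop (nhds (∫ _ : Ed d, (0 : ℝ))) := by
    refine tendsto_integral_of_dominated_convergence (fun y => |f y|) (fun R => ?_) f.integ.abs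
      (fun R => Eventually.of_forall fun y => ?_) (Eventually.of_forall fun y => ?_)
    · exact (f.meas.abs.indicator (measurableSet_lt measurable_const measurable_norm)).aestronglyMeasurable
    · rw [Real.norm_eq_abs, Set.indicator_apply]
      split_ifs <;> simp
    · refine tendsto_const_nhds.congr' ?_
      filter_upwards [eventually_ge_atTop ⌈‖y‖⌉₊] with R hR
      rw [Set.indicator_of_notMem]
      simpa using (Nat.le_ceil ‖y‖).trans (by exact_mod_cast hR)
  rw [integral_zero] at ht
  obtain ⟨R, hR⟩ := (ht.eventually_le_const hε).exists
  exact ⟨R, hR⟩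

/-- `F n x` is at most `g * n ^ (-d / 2)` up to an error negligible for `n` and `‖x‖` large. -/
def FarLe (F : ℕ → LF d) (g : ℝ) : Prop :=
  ∀ η > 0, ∀ᶠ q in far d, |F q.1 q.2| ≤ (g + η) * (q.1 : ℝ) ^ (-((d : ℝ) / 2))

theorem FarLe.mono {F : ℕ → LF d} {g g' : ℝ} (h : FarLe F g) (hg : g ≤ g') : FarLe F g' :=
  fun η hη => (h η hη).mono fun q hq => hq.trans (by gcongr)

theorem FarLe.add {F F' : ℕ → LF d} {g g' : ℝ} (h : FarLe F g) (h' : FarLe F' g') :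
    FarLe (fun n => F n + F' n) (g + g') := fun η hη => by
  filter_upwards [h (η / 2) (half_pos hη), h' (η / 2) (half_pos hη)] with q h1 h2
  calc _ ≤ |F q.1 q.2| + |F' q.1 q.2| := abs_add_le _ _
    _ ≤ _ := add_le_add h1 h2
    _ = _ := by ring

theorem FarLe.sum {ι : Type*} (S : Finset ι) {F : ι → ℕ → LF d} {g : ι → ℝ}
    (h : ∀ i ∈ S, FarLe (F i) (g i)) : FarLe (fun n => ∑ i ∈ S, F i n) (∑ i ∈ S, g i) := by
  induction S using Finset.induction_on with
  | empty => exact fun η hη => Eventually.of_forall fun q => by simpa using by positivity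
  | insert i S hi ih =>
    simp only [sum_insert hi]
    exact (h i (mem_insert_self i S)).add (ih fun j hj => h j (mem_insert_of_mem hj))

theorem FarLe.conv {f : LF d} {F : ℕ → LF d} {B g : ℝ} (hg : 0 ≤ g)
    (hB : ∀ n, 2 ≤ n → SB (F n) (B * (n : ℝ) ^ (-((d : ℝ) / 2)))) (hF : FarLe F g) (m : ℕ) :
    FarLe (fun n => f * F (n - m)) (2 ^ ((d : ℝ) / 2) * (∫ y, |f y|) * g) := by
  intro η hη
  set s : ℝ := (d : ℝ) / 2 with hs
  set I : ℝ := ∫ y, |f y| with hI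
  have hI0 : 0 ≤ I := integral_nonneg fun y => abs_nonneg _
  have hB0 : 0 ≤ B := by
    have := (hB 2 le_rfl).nonneg
    exact nonneg_of_mul_nonneg_left this (by positivity)
  have h2s : (0 : ℝ) < 2 ^ s := by positivity
  set η' : ℝ := η / (2 * 2 ^ s * (I + 1)) with hη'
  have hη'0 : 0 < η' := by positivity
  set ε : ℝ := η / (2 * 2 ^ s * (B + 1)) with hε
  have hε0 : 0 < ε := by positivity
  obtain ⟨R, hR⟩ := f.exists_tail_le hε0
  obtain ⟨N, r, hNr⟩ := eventually_far.1 (hF η' hη'0)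
  refine eventually_far.2 ⟨max (N + m) (2 * m + 2), r + R, fun n hn x hx => ?_⟩
  have hn1 : N + m ≤ n := (le_max_left _ _).trans hn
  have hn2 : 2 * m + 2 ≤ n := (le_max_right _ _).trans hn
  set c : ℝ := ((n - m : ℕ) : ℝ) ^ (-s) with hc
  have hc0 : 0 ≤ c := by positivity
  have hcn : c ≤ 2 ^ s * (n : ℝ) ^ (-s) := by
    refine rpow_half (by exact_mod_cast (by omega : 0 < n)) (by positivity) ?_
    exact_mod_cast (by omega : n ≤ 2 * (n - m))
  have hind : Integrable fun y => {y : Ed d | R < ‖y‖}.indicator (fun y => |f y|) y :=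
    f.integ.abs.indicator (measurableSet_lt measurable_const measurable_norm)
  have hpt : ∀ y, |f y * F (n - m) (x - y)| ≤
      (g + η') * c * |f y| + B * c * {y : Ed d | R < ‖y‖}.indicator (fun y => |f y|) y := by
    intro y
    rw [abs_mul, mul_comm]
    by_cases hy : R < ‖y‖
    · rw [Set.indicator_of_mem (by exact hy)]
      refine (mul_le_mul_of_nonneg_right (hB (n - m) (by omega) (x - y)) (abs_nonneg _)).trans ?_
      exact le_add_of_nonneg_left (by positivity)
    · rw [Set.indicator_of_notMem (by exact hy), mul_zero, add_zero]
      refine mul_le_mul_of_nonneg_right (hNr (n - m) (by omega) (x - y) ?_) (abs_nonneg _)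
      have := norm_sub_norm_le x y
      linarith
  have e1 : I * η' ≤ η / (2 * 2 ^ s) := by
    rw [hη', ← div_div, mul_div_assoc', div_le_iff₀ (by positivity), mul_comm]
    exact mul_le_mul_of_nonneg_left (by linarith) (by positivity)
  have e2 : B * ε ≤ η / (2 * 2 ^ s) := by
    rw [hε, ← div_div, mul_div_assoc', div_le_iff₀ (by positivity), mul_comm]
    exact mul_le_mul_of_nonneg_left (by linarith) (by positivity)
  calc |(f * F (n - m)) x| ≤ ∫ y, |f y * F (n - m) (x - y)| := abs_integral_le_integral_abs
    _ ≤ ∫ y, ((g + η') * c * |f y| +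
          B * c * {y : Ed d | R < ‖y‖}.indicator (fun y => |f y|) y) :=
        integral_mono (f.integrable_mul_sub _ x).abs
          ((f.integ.abs.const_mul _).add (hind.const_mul _)) hpt
    _ = (g + η') * c * I +
          B * c * ∫ y, {y : Ed d | R < ‖y‖}.indicator (fun y => |f y|) y := by
        rw [integral_add (f.integ.abs.const_mul _) (hind.const_mul _), integral_const_mul,
          integral_const_mul]
    _ ≤ (g + η') * c * I + B * c * ε := by gcongr
    _ = c * (I * g + I * η' + B * ε) := by ring
    _ ≤ (2 ^ s * (n : ℝ) ^ (-s)) * (I * g + η / (2 * 2 ^ s) + η / (2 * 2 ^ s)) :=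
        mul_le_mul hcn (by linarith) (by positivity) (by positivity)
    _ = (2 ^ s * I * g + η) * (n : ℝ) ^ (-s) := by field_simp; ring

variable {p φ u E F : ℕ → LF d}

theorem Renewal.SB_defect (h : Renewal p φ u E F) {A : ℝ}
    (hu : ∀ n, 0 < n → SB (u n) (A * (n : ℝ) ^ (-((d : ℝ) / 2)))) (hφ : ∫ y, |φ 1 y| ≤ 1) :
    ∀ n, 2 ≤ n → SB (F n) ((A + A * 2 ^ ((d : ℝ) / 2)) * (n : ℝ) ^ (-((d : ℝ) / 2))) := by
  intro n hn
  obtain ⟨k, rfl⟩ : ∃ k, n = k + 1 := ⟨n - 1, by omega⟩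
  have hA : 0 ≤ A := by simpa using (hu 1 one_pos).nonneg
  rw [h.hF k (by omega)]
  refine ((hu _ (by omega)).sub (SB.mul_of_integral hφ (hu k (by omega)))).mono ?_
  rw [one_mul, add_mul, mul_assoc A (2 ^ ((d : ℝ) / 2))]
  have := rpow_half (n := ((k + 1 : ℕ) : ℝ)) (x := (k : ℝ)) (a := (d : ℝ) / 2) (by positivity)
    (by positivity) (by exact_mod_cast (by omega : k + 1 ≤ 2 * k))
  gcongr

set_option maxHeartbeats 1000000 in
theorem Renewal.defect_far (h : Renewal p φ u E F) {A κ : ℝ}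
    (hu : ∀ n, 0 < n → SB (u n) (A * (n : ℝ) ^ (-((d : ℝ) / 2)))) (hφ : ∫ y, |φ 1 y| ≤ 1)
    (hκ : 0 ≤ κ) (hE : ∀ n, 0 < n → ∫ y, |E n y| ≤ κ * (n : ℝ) ^ (-(3 / 2 : ℝ)))
    (hκ2 : 2 ^ ((d : ℝ) / 2) * (κ * zeta32) ≤ 1 / 2)
    (hfar : ∀ η > 0, ∀ᶠ M : ℕ in atTop, ∀ᶠ q in far d,
      |(u q.1 - ∑ m ∈ Icc 1 M, p m * u (q.1 - m) : LF d) q.2| ≤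
        η * (q.1 : ℝ) ^ (-((d : ℝ) / 2))) : FarLe F 0 := by
  have hB := h.SB_defect hu hφ
  set s : ℝ := (d : ℝ) / 2 with hs
  have hA : 0 ≤ A := by simpa using (hu 1 one_pos).nonneg
  set B : ℝ := A + A * 2 ^ s with hBdef
  have hB0 : 0 ≤ B := by positivity
  have hstep : ∀ g, 0 ≤ g → FarLe F g → FarLe F (g / 2) := by
    intro g hg hF η hη
    have t32 : Tendsto (fun M : ℕ => κ * (M : ℝ) ^ (-(3 / 2 : ℝ)) * (A * 2 ^ s)) atTop (nhds 0) := by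
      have := ((tendsto_rpow_neg_atTop (show (0 : ℝ) < 3 / 2 by norm_num)).comp
        tendsto_natCast_atTop_atTop).const_mul κ |>.mul_const (A * 2 ^ s)
      simpa using this
    obtain ⟨M, hM, hM1, hMk⟩ := ((hfar (η / 4) (by positivity)).and ((eventually_ge_atTop 1).and
      (t32.eventually_le_const (show (0 : ℝ) < η / 4 by positivity)))).exists
    have hsum : FarLe (fun n => ∑ m ∈ Icc 1 M, E m * F (n - m)) (g / 2) := by
      refine (FarLe.sum (Icc 1 M) fun m _ => FarLe.conv (f := E m) hg hB hF m).mono ?_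
      calc ∑ m ∈ Icc 1 M, 2 ^ s * (∫ y, |E m y|) * g
          ≤ ∑ m ∈ Icc 1 M, (2 ^ s * κ * g) * (m : ℝ) ^ (-(3 / 2 : ℝ)) := by
            refine sum_le_sum fun m hm => ?_
            have h1 : 1 ≤ m := (mem_Icc.1 hm).1
            calc 2 ^ s * (∫ y, |E m y|) * g ≤ 2 ^ s * (κ * (m : ℝ) ^ (-(3 / 2 : ℝ))) * g := by
                  gcongr
                  exact hE m h1
              _ = _ := by ring
        _ ≤ (2 ^ s * κ * g) * zeta32 := by
            rw [← mul_sum]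
            exact mul_le_mul_of_nonneg_left (sum_32_le _) (by positivity)
        _ = 2 ^ s * (κ * zeta32) * g := by ring
        _ ≤ 1 / 2 * g := by gcongr
        _ = g / 2 := by ring
    have e4 : ∀ᶠ q in far d, _ := tendsto_fst.eventually (eventually_ge_atTop (2 * M + 4))
    filter_upwards [hM, hsum (η / 4) (by positivity), e4] with q h1 h2 hn
    have hrec := h.truncated M hM1 q.1 (by omega)
    have hk : SB (φ 1 * E M * u (q.1 - M - 1) : LF d) (η / 4 * (q.1 : ℝ) ^ (-s)) := by
      rw [mul_assoc]
      refine (SB.mul_of_integral hφ (SB.mul_of_integral (hE M hM1)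
        (hu (q.1 - M - 1) (by omega)))).mono ?_
      have := rpow_half (n := (q.1 : ℝ)) (x := ((q.1 - M - 1 : ℕ) : ℝ)) (a := s)
        (by exact_mod_cast (by omega : 0 < q.1)) (by positivity)
        (by exact_mod_cast (by omega : q.1 ≤ 2 * (q.1 - M - 1)))
      calc _ ≤ 1 * (κ * (M : ℝ) ^ (-(3 / 2 : ℝ)) * (A * (2 ^ s * (q.1 : ℝ) ^ (-s)))) := by gcongr
        _ = κ * (M : ℝ) ^ (-(3 / 2 : ℝ)) * (A * 2 ^ s) * (q.1 : ℝ) ^ (-s) := by ring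
        _ ≤ _ := by gcongr
    have hFq : F q.1 = (u q.1 - ∑ m ∈ Icc 1 M, p m * u (q.1 - m)) - φ 1 * E M * u (q.1 - M - 1) -
        ∑ m ∈ Icc 1 M, E m * F (q.1 - m) := by rw [← hrec]; abel
    rw [hFq, LF.sub_apply, LF.sub_apply]
    have hk' := hk q.2
    have hp : 0 ≤ η * (q.1 : ℝ) ^ (-s) := by positivity
    calc _ ≤ η / 4 * (q.1 : ℝ) ^ (-s) + η / 4 * (q.1 : ℝ) ^ (-s) +
          (g / 2 + η / 4) * (q.1 : ℝ) ^ (-s) :=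
          (abs_sub _ _).trans (add_le_add ((abs_sub _ _).trans (add_le_add h1 hk')) h2)
      _ ≤ _ := by linarith
  have hiter : ∀ k : ℕ, FarLe F (B / 2 ^ k) := by
    intro k
    induction k with
    | zero =>
      intro η hη
      have e4 : ∀ᶠ q in far d, _ := tendsto_fst.eventually (eventually_ge_atTop 2)
      filter_upwards [e4] with q hq
      refine (hB q.1 hq q.2).trans ?_
      rw [pow_zero, div_one]
      gcongr
      linarith
    | succ k ih =>
      have := hstep _ (by positivity) ih
      rwa [div_div, ← pow_succ] at this
  intro η hη
  obtain ⟨k, hk⟩ := ((tendsto_const_nhds (x := B)).div_atTop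
    (tendsto_pow_atTop_atTop_of_one_lt (one_lt_two (α := ℝ)))
    |>.eventually_le_const (half_pos hη)).exists
  filter_upwards [hiter k (η / 2) (half_pos hη)] with q hq
  exact hq.trans (mul_le_mul_of_nonneg_right (by linarith) (by positivity))

theorem exists_G_mul_sub_le (hd : 0 < d) {f : LF d} {m : ℕ} (hm : 0 < m) {c δ : ℝ} (hc : 0 ≤ c)
    (hf : NB m f c) (hsym : Sym f) (hδ : 1 / 2 ≤ δ) : ∃ D : ℝ, ∀ n : ℕ, 4 * m ≤ n →
    SB (G d ((n - m : ℕ) * δ) * f - (∫ y, f y) • G d (n * δ) : LF d)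
      (D / n * (n : ℝ) ^ (-((d : ℝ) / 2))) := by
  obtain ⟨K, hK, H⟩ := remT_bounds hd
  set s : ℝ := (d : ℝ) / 2 with hs
  set e : ℝ := -(m * δ) * (∫ y, f y) + 1 / d * ∫ y, ‖y‖ ^ 2 * f y with he
  have hKA := KA_pos d
  refine ⟨(5 * K * c * m ^ 2 + 2 * |e| * KA d) * 2 ^ s, fun n hn => ?_⟩
  have hm1 : (1 : ℝ) ≤ m := by exact_mod_cast hm
  have hn4 : 4 * (m : ℝ) ≤ n := by exact_mod_cast hn
  have hn1 : (1 : ℝ) ≤ n := by linarith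
  have hδ0 : 0 < δ := by linarith
  have hT : 0 < n * δ := by positivity
  have hsmall : |-(m * δ)| ≤ n * δ / 4 := by
    rw [abs_neg, abs_of_nonneg (by positivity), le_div_iff₀ (by norm_num)]
    calc (m : ℝ) * δ * 4 = 4 * m * δ := by ring
      _ ≤ _ := by gcongr
  have h1 := (H (n * δ) (-(m * δ)) hT hsmall f m c hm hc hsym hf).1
  have h2 : SB (e • AT d (n * δ) : LF d) _ := (SB_AT (d := d) hT).smul e
  have heq : G d ((n - m : ℕ) * δ) * f - (∫ y, f y) • G d (n * δ) =
      remT f (n * δ) (-(m * δ)) + e • AT d (n * δ) := by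
    rw [remT, ← he, Nat.cast_sub (by omega), mul_comm (G d _) f,
      show ((n : ℝ) - m) * δ = n * δ + -(m * δ) by ring]
    abel
  rw [heq]
  refine (h1.add h2).mono ?_
  rw [show -(d : ℝ) / 2 = -s by rw [hs, neg_div]]
  have hTs : (n * δ : ℝ) ^ (-s) ≤ 2 ^ s * (n : ℝ) ^ (-s) :=
    rpow_half (by linarith) (by positivity) (by nlinarith)
  have q1 : (-(m * δ) / (n * δ)) ^ 2 ≤ m ^ 2 / n := by
    rw [neg_div, neg_sq, mul_div_mul_right _ _ hδ0.ne', div_pow]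
    gcongr
    exact le_self_pow₀ hn1 (by norm_num)
  have q2 : ((m : ℝ) / (n * δ)) ^ 2 ≤ 4 * (m ^ 2 / n) := by
    rw [div_pow, ← mul_div_assoc, div_le_div_iff₀ (by positivity) (by linarith)]
    have : 1 ≤ 4 * δ ^ 2 := by nlinarith
    have h3 : (n : ℝ) ≤ n ^ 2 * (4 * δ ^ 2) := by nlinarith
    calc (m : ℝ) ^ 2 * n ≤ m ^ 2 * (n ^ 2 * (4 * δ ^ 2)) := by gcongr
      _ = _ := by ring
  have q3 : KA d / (n * δ) ≤ 2 * KA d / n := by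
    rw [div_le_div_iff₀ hT (by linarith)]
    have : 1 ≤ 2 * δ := by linarith
    calc KA d * n ≤ KA d * n * (2 * δ) := le_mul_of_one_le_right (by positivity) this
      _ = _ := by ring
  calc _ ≤ K * (c * (m ^ 2 / n + 4 * (m ^ 2 / n))) * (2 ^ s * (n : ℝ) ^ (-s)) +
        |e| * (2 * KA d / n * (2 ^ s * (n : ℝ) ^ (-s))) := by gcongr
    _ = _ := by field_simp; ring

/-- A solution of the renewal recursion together with the decay of its defect. -/
structure RenewalBounds (δ κ : ℝ) (p φ u E F : ℕ → LF d) : Prop extends Renewal p φ u E F where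
  φ_eq : ∀ n, φ n = G d (n * δ)
  δ_ge : 1 / 2 ≤ δ
  κ_nonneg : 0 ≤ κ
  F_zero : F 0 = 0
  nb_F : ∀ m, 0 < m → NB m (F m) (κ * (m : ℝ) ^ (-(3 / 2 : ℝ)))
  sb_F : ∀ m, 0 < m → ∀ t : ℝ, 1 ≤ t → SB (G d t * F m : LF d)
    (κ * ((m : ℝ) ^ (-((d : ℝ) / 2)) * t ^ (-(3 / 2 : ℝ))))
  sym_F : ∀ m, 0 < m → Sym (F m)

variable {δ κ : ℝ}

/-- The limiting total mass. -/
def limitMass (F : ℕ → LF d) : ℝ := 1 + ∑' m, ∫ y, F m y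

theorem RenewalBounds.abs_limitMass_sub_le (h : RenewalBounds δ κ p φ u E F) (q : ℕ) :
    |limitMass F - (1 + ∑ m ∈ Ioc 0 q, ∫ y, F m y)| ≤ 4 * κ * ((q : ℝ) + 1) ^ (-(1 / 2 : ℝ)) := by
  rw [limitMass, add_sub_add_left_eq_sub]
  refine abs_tsum_sub_sum_le (g := fun m : ℕ => κ * (m : ℝ) ^ (-(3 / 2 : ℝ)))
    (summable_32.mul_left κ) (fun m => ?_) (by simp [h.F_zero]) q (fun N => ?_)
  · rcases Nat.eq_zero_or_pos m with rfl | hm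
    · rw [h.F_zero]
      simp
    · exact (h.nb_F m hm).abs_integral_le (mul_nonneg h.κ_nonneg (by positivity))
  · rw [← mul_sum, mul_comm 4 κ, mul_assoc]
    exact mul_le_mul_of_nonneg_left (sum_Ioc_three_halves q N) h.κ_nonneg

theorem RenewalBounds.δ_pos (h : RenewalBounds δ κ p φ u E F) : 0 < δ := by linarith [h.δ_ge]

theorem RenewalBounds.integral_φ (h : RenewalBounds δ κ p φ u E F) {n : ℕ} (hn : 0 < n) :
    ∫ y, φ n y = 1 := by
  have hn' : (0 : ℝ) < n := by exact_mod_cast hn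
  rw [h.φ_eq, integral_G (mul_pos hn' h.δ_pos)]

theorem RenewalBounds.integral_u (h : RenewalBounds δ κ p φ u E F) {n : ℕ} (hn : 0 < n) :
    ∫ y, u n y = 1 + ∑ m ∈ Ioc 0 n, ∫ y, F m y := by
  have e : Ioc 0 n = insert n (Ioo 0 n) := by ext; simp; omega
  rw [h.u_eq n hn, e, sum_insert (by simp)]
  simp only [LF.add_apply, LF.sum_apply]
  have hi : ∀ m ∈ Ioo 0 n, Integrable fun y => (φ (n - m) * F m) y := fun m _ => LF.integ _
  have h1 : Integrable fun y => φ n y + F n y := (φ n).integ.add (F n).integ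
  rw [integral_add h1 (integrable_finsetSum _ hi), integral_add (φ n).integ (F n).integ,
    integral_finsetSum _ hi, h.integral_φ hn, add_assoc]
  congr 2
  refine sum_congr rfl fun m hm => ?_
  rw [LF.integral_mul, h.integral_φ (by have := mem_Ioo.1 hm; omega), one_mul]

theorem RenewalBounds.φ_mul_u (h : RenewalBounds δ κ p φ u E F) {J n : ℕ} (hJ : 0 < J)
    (hn : J < n) : φ J * u (n - J) = φ n + ∑ m ∈ Ioc 0 (n - J), φ (n - m) * F m := by
  have e : Ioc 0 (n - J) = insert (n - J) (Ioo 0 (n - J)) := by ext; simp; omega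
  rw [h.u_eq (n - J) (by omega), e, sum_insert (by simp), mul_add, mul_add,
    ← h.hφ J (n - J) hJ (by omega), show J + (n - J) = n by omega, show n - (n - J) = J by omega,
    mul_sum, add_assoc]
  congr 2
  refine sum_congr rfl fun m hm => ?_
  have := mem_Ioo.1 hm
  rw [← mul_assoc, ← h.hφ J (n - J - m) hJ (by omega), show J + (n - J - m) = n - m by omega]

theorem RenewalBounds.SB_φ_mul_F (h : RenewalBounds δ κ p φ u E F) {m n : ℕ} (hm : 0 < m)
    (hn : m + 2 ≤ n) : SB (φ (n - m) * F m : LF d) (4 * 4 ^ ((d : ℝ) / 2) * κ *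
      (n : ℝ) ^ (-((d : ℝ) / 2)) * ((m : ℝ) ^ (-(3 / 2 : ℝ)) +
        ((n - m : ℕ) : ℝ) ^ (-(3 / 2 : ℝ)))) := by
  set s : ℝ := (d : ℝ) / 2 with hs
  have hδ := h.δ_ge
  have hδ0 := h.δ_pos
  have hκ := h.κ_nonneg
  have hs0 : 0 ≤ s := by positivity
  have hn0 : (0 : ℝ) < n := by exact_mod_cast (by omega : 0 < n)
  have hk2 : (2 : ℝ) ≤ ((n - m : ℕ) : ℝ) := by exact_mod_cast (by omega : 2 ≤ n - m)
  have hT : 0 < ((n - m : ℕ) : ℝ) * δ := by positivity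
  have h4 : (1 : ℝ) ≤ 4 ^ s := Real.one_le_rpow (by norm_num) hs0
  rw [h.φ_eq]
  rcases le_total (2 * m) n with hmn | hmn
  · rw [mul_comm]
    refine ((h.nb_F m hm).mul_SB (mul_nonneg hκ (by positivity)) (SB_G hT)).mono ?_
    rw [neg_div, ← hs]
    have hh : (n : ℝ) ≤ 2 * ((n - m : ℕ) : ℝ) := by exact_mod_cast (by omega : n ≤ 2 * (n - m))
    have h1 : (((n - m : ℕ) : ℝ) * δ) ^ (-s) ≤ 4 ^ s * (n : ℝ) ^ (-s) := by
      have := rpow_le_scaled (c := 1 / 4) (x := (n : ℝ)) (y := ((n - m : ℕ) : ℝ) * δ) (a := s)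
        (by norm_num) hn0 (by nlinarith) hs0
      norm_num at this
      exact this
    calc _ ≤ κ * (m : ℝ) ^ (-(3 / 2 : ℝ)) * (4 ^ s * (n : ℝ) ^ (-s)) := by gcongr
      _ = 1 * 4 ^ s * κ * (n : ℝ) ^ (-s) * ((m : ℝ) ^ (-(3 / 2 : ℝ)) + 0) := by ring
      _ ≤ _ := by gcongr <;> first | positivity | norm_num
  · refine (h.sb_F m hm _ (by nlinarith)).mono ?_
    have h1 : (m : ℝ) ^ (-s) ≤ 4 ^ s * (n : ℝ) ^ (-s) := by
      refine (rpow_half hn0 hs0 (by exact_mod_cast hmn)).trans ?_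
      gcongr
      norm_num
    have h2 : (((n - m : ℕ) : ℝ) * δ) ^ (-(3 / 2 : ℝ)) ≤
        4 * ((n - m : ℕ) : ℝ) ^ (-(3 / 2 : ℝ)) := by
      refine (rpow_half (n := ((n - m : ℕ) : ℝ)) (by linarith) (by norm_num) (by nlinarith)).trans ?_
      gcongr
      calc (2 : ℝ) ^ (3 / 2 : ℝ) ≤ 2 ^ (2 : ℝ) :=
            Real.rpow_le_rpow_of_exponent_le (by norm_num) (by norm_num)
        _ = 4 := by norm_num
    calc _ ≤ κ * (4 ^ s * (n : ℝ) ^ (-s) * (4 * ((n - m : ℕ) : ℝ) ^ (-(3 / 2 : ℝ)))) := by gcongr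
      _ = 4 * 4 ^ s * κ * (n : ℝ) ^ (-s) * (0 + ((n - m : ℕ) : ℝ) ^ (-(3 / 2 : ℝ))) := by ring
      _ ≤ _ := by gcongr; positivity

theorem sum_Ioc_reflect_three_halves_le (q n : ℕ) :
    ∑ m ∈ Ioc q (n - (q + 1)), ((n - m : ℕ) : ℝ) ^ (-(3 / 2 : ℝ)) ≤
      4 * ((q : ℝ) + 1) ^ (-(1 / 2 : ℝ)) := by
  refine le_trans ?_ (sum_Ioc_three_halves q n)
  rw [← sum_image (s := Ioc q (n - (q + 1))) (g := fun m => n - m)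
    (f := fun k : ℕ => (k : ℝ) ^ (-(3 / 2 : ℝ)))]
  · refine sum_le_sum_of_subset_of_nonneg (fun k hk => ?_) fun k _ _ => by positivity
    obtain ⟨m, hm, rfl⟩ := mem_image.1 hk
    rw [mem_Ioc] at hm ⊢
    omega
  · intro a ha b hb hab
    simp only [coe_Ioc, Set.mem_Ioc] at ha hb hab
    omega

set_option maxHeartbeats 1000000 in
theorem RenewalBounds.smoothed_le (h : RenewalBounds δ κ p φ u E F) (hd : 0 < d) {η : ℝ}
    (hη : 0 < η) : ∃ J > 0, ∀ᶠ n in atTop, SB (φ J * u (n - J) - limitMass F • φ n : LF d)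
      (η * (n : ℝ) ^ (-((d : ℝ) / 2))) := by
  set s : ℝ := (d : ℝ) / 2 with hs
  have hs0 : 0 ≤ s := by positivity
  have hκ := h.κ_nonneg
  have hδ := h.δ_ge
  set c₀ : ℝ := (32 * 4 ^ s + 4 * 2 ^ s) * κ with hc₀
  obtain ⟨q, hq, hq1⟩ := (((tendsto_natcast_add_one_rpow (a := 1 / 2) (by norm_num)).const_mul c₀
    |>.eventually_le_const (show c₀ * 0 < η / 2 by simpa using hη)).and (eventually_ge_atTop 1)).exists
  have hD : ∀ m : ℕ, ∃ D : ℝ, 0 < m → ∀ n : ℕ, 4 * m ≤ n →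
      SB (φ (n - m) * F m - (∫ y, F m y) • φ n : LF d) (D / n * (n : ℝ) ^ (-s)) := by
    intro m
    rcases Nat.eq_zero_or_pos m with rfl | hm
    · exact ⟨0, fun h0 => absurd h0 (lt_irrefl 0)⟩
    · obtain ⟨D, hD⟩ := exists_G_mul_sub_le hd hm (mul_nonneg hκ (by positivity)) (h.nb_F m hm)
        (h.sym_F m hm) hδ
      refine ⟨D, fun _ n hn => ?_⟩
      simpa only [h.φ_eq] using hD n hn
  choose D hD using hD
  have hfix : Tendsto (fun n : ℕ => (∑ m ∈ Ioc 0 q, D m) / n) atTop (nhds 0) :=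
    tendsto_const_nhds.div_atTop tendsto_natCast_atTop_atTop
  refine ⟨q + 1, by omega, ?_⟩
  filter_upwards [hfix.eventually_le_const (half_pos hη), eventually_ge_atTop (4 * q + 4)]
    with n hn1 hn2
  have hn0 : (0 : ℝ) < n := by exact_mod_cast (by omega : 0 < n)
  set x : ℝ := ((q : ℝ) + 1) ^ (-(1 / 2 : ℝ)) with hx
  have hsplit : φ (q + 1) * u (n - (q + 1)) - limitMass F • φ n =
      ∑ m ∈ Ioc 0 q, (φ (n - m) * F m - (∫ y, F m y) • φ n) +
      ∑ m ∈ Ioc q (n - (q + 1)), φ (n - m) * F m -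
      (limitMass F - (1 + ∑ m ∈ Ioc 0 q, ∫ y, F m y)) • φ n := by
    rw [h.φ_mul_u (by omega) (by omega), sum_sub_distrib, ← Finset.sum_smul, sub_smul,
      add_smul, one_smul, ← sum_Ioc_consecutive (fun m => φ (n - m) * F m)
        (Nat.zero_le q) (show q ≤ n - (q + 1) by omega)]
    abel
  rw [hsplit]
  have b1 : SB (∑ m ∈ Ioc 0 q, (φ (n - m) * F m - (∫ y, F m y) • φ n) : LF d)
      (∑ m ∈ Ioc 0 q, D m / n * (n : ℝ) ^ (-s)) :=
    SB.sum _ fun m hm => by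
      have := mem_Ioc.1 hm
      exact hD m (by omega) n (by omega)
  have b2 : SB (∑ m ∈ Ioc q (n - (q + 1)), φ (n - m) * F m : LF d) _ :=
    SB.sum _ fun m hm => by
      have := mem_Ioc.1 hm
      exact h.SB_φ_mul_F (by omega) (by omega)
  have hφn : SB (φ n) (2 ^ s * (n : ℝ) ^ (-s)) := by
    rw [h.φ_eq]
    have hT : 0 < n * δ := mul_pos hn0 h.δ_pos
    refine (SB_G hT).mono ?_
    rw [neg_div, ← hs]
    exact rpow_half hn0 hs0 (by nlinarith)
  have b3 := hφn.smul (limitMass F - (1 + ∑ m ∈ Ioc 0 q, ∫ y, F m y))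
  refine ((b1.add b2).sub b3).mono ?_
  rw [← sum_mul, ← sum_div, ← mul_sum, sum_add_distrib, ← hs]
  have t1 := h.abs_limitMass_sub_le q
  have t2 := sum_Ioc_three_halves q (n - (q + 1))
  have t3 := sum_Ioc_reflect_three_halves_le q n
  rw [← hx] at t1 t2 t3
  calc _ ≤ η / 2 * (n : ℝ) ^ (-s) + 4 * 4 ^ s * κ * (n : ℝ) ^ (-s) * (4 * x + 4 * x) +
        4 * κ * x * (2 ^ s * (n : ℝ) ^ (-s)) := by
        refine add_le_add (add_le_add ?_ ?_) ?_
        · exact mul_le_mul_of_nonneg_right hn1 (by positivity)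
        · exact mul_le_mul_of_nonneg_left (add_le_add t2 t3) (by positivity)
        · exact mul_le_mul_of_nonneg_right t1 (by positivity)
    _ = (η / 2 + c₀ * x) * (n : ℝ) ^ (-s) := by rw [hc₀]; ring
    _ ≤ _ := mul_le_mul_of_nonneg_right (by linarith) (by positivity)

theorem RenewalBounds.u_far (h : RenewalBounds δ κ p φ u E F) (hd : 0 < d) {B : ℝ}
    (hB : ∀ n, 2 ≤ n → SB (F n) (B * (n : ℝ) ^ (-((d : ℝ) / 2)))) (hF : FarLe F 0) :
    FarLe (fun n => u n - limitMass F • φ n) 0 := by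
  intro η hη
  obtain ⟨J, hJ, hJn⟩ := h.smoothed_le hd (half_pos hη)
  have hsum : FarLe (fun n => F n + ∑ j ∈ Ioo 0 J, φ j * F (n - j)) 0 := by
    refine (hF.add (FarLe.sum (Ioo 0 J) fun j _ =>
      FarLe.conv (f := φ j) le_rfl hB hF j)).mono ?_
    simp
  have e1 : ∀ᶠ q in far d, _ := tendsto_fst.eventually hJn
  have e2 : ∀ᶠ q in far d, _ := tendsto_fst.eventually (eventually_ge_atTop (J + 1))
  filter_upwards [hsum (η / 2) (half_pos hη), e1, e2] with q h1 h2 hq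
  have heq : u q.1 - limitMass F • φ q.1 = (φ J * u (q.1 - J) - limitMass F • φ q.1) +
      (F q.1 + ∑ j ∈ Ioo 0 J, φ j * F (q.1 - j)) := by
    rw [h.telescope J hJ q.1 (by omega)]; abel
  simp only [heq]
  calc _ ≤ η / 2 * (q.1 : ℝ) ^ (-((d : ℝ) / 2)) + (0 + η / 2) * (q.1 : ℝ) ^ (-((d : ℝ) / 2)) :=
        (abs_add_le _ _).trans (add_le_add (h2 q.2) h1)
    _ = _ := by ring

/-- Invariance under the orthogonal group. -/
def Isotropic (f : LF d) : Prop := ∀ (L : Ed d ≃ₗᵢ[ℝ] Ed d) (x : Ed d), f (L x) = f x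

theorem Isotropic.zero : Isotropic (0 : LF d) := fun L x => by simp

theorem Isotropic.add {f g : LF d} (hf : Isotropic f) (hg : Isotropic g) :
    Isotropic (f + g) := fun L x => by simp [hf L x, hg L x]

theorem Isotropic.sub {f g : LF d} (hf : Isotropic f) (hg : Isotropic g) :
    Isotropic (f - g) := fun L x => by simp [hf L x, hg L x]

theorem Isotropic.smul {f : LF d} (hf : Isotropic f) (a : ℝ) : Isotropic (a • f) :=
  fun L x => by simp [hf L x]

theorem Isotropic.sum {ι : Type*} (S : Finset ι) {f : ι → LF d}
    (h : ∀ i ∈ S, Isotropic (f i)) : Isotropic (∑ i ∈ S, f i) := fun L x => by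
  rw [LF.sum_apply, LF.sum_apply]
  exact sum_congr rfl fun i hi => h i hi L x

theorem Isotropic.mul {f g : LF d} (hf : Isotropic f) (hg : Isotropic g) :
    Isotropic (f * g) := fun L x => by
  rw [LF.mul_apply, LF.mul_apply,
    ← L.measurePreserving.integral_comp L.toHomeomorph.measurableEmbedding]
  simp only [← map_sub, hf L, hg L]

theorem isotropic_G (t : ℝ) : Isotropic (G d t) := fun L x => by
  by_cases ht : 0 < t
  · rw [G_apply ht, G_apply ht]; simp [gauss]
  · simp [G, ht]

theorem isotropic_Fren {w : ℝ} {P : ℕ → LF d} (hP : ∀ m, Isotropic (P m)) (n : ℕ) :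
    Isotropic (Fren w P n) := by
  have hp : ∀ m, Isotropic (pfull w P m) := fun m => by
    refine (hP m).add ?_
    split_ifs
    · exact (isotropic_G 1).smul w
    · exact Isotropic.zero
  have hu : ∀ m, Isotropic (uren w P m) := fun m => by
    induction m using Nat.strong_induction_on with
    | _ m ih =>
      rw [uren]
      exact (hp m).add (Isotropic.sum _ fun k _ => (hp _).mul (ih _ (by have := k.2; omega)))
  refine (hu n).sub ?_
  split_ifs
  · exact isotropic_G _
  · exact (isotropic_G _).mul (hu _)

/-- Dividing the far-field asymptotics by the total mass. -/
theorem abs_div_sub_le {u c a φ e : ℝ} (hu : |u - a * φ| ≤ e) (hc : 1 / 4 ≤ c) :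
    |u / c - φ| ≤ 4 * (e + |a - c| * |φ|) := by
  have hc0 : 0 < c := by linarith
  have h : u / c - φ = (u - a * φ + (a - c) * φ) / c := by field_simp; ring
  have h2 : |u - a * φ + (a - c) * φ| ≤ e + |a - c| * |φ| :=
    (abs_add_le _ _).trans (add_le_add hu (abs_mul _ _).le)
  rw [h, abs_div, abs_of_pos hc0, div_le_iff₀ hc0]
  nlinarith [abs_nonneg (u - a * φ + (a - c) * φ)]

theorem LaceData.renewalBounds {K β w : ℝ} {P : ℕ → LF d} (hL : LaceData d β w P)
    (hP : ∀ m, Isotropic (P m)) (hδ : |delta w P - 1| ≤ 1 / 8) (hκ : 0 ≤ K * β)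
    (hF : ∀ n : ℕ, 0 < n → NB n (Fren w P n) (K * β * (n : ℝ) ^ (-(3 / 2 : ℝ))))
    (hG : ∀ n : ℕ, 0 < n → ∀ t : ℝ, 1 ≤ t → SB (G d t * Fren w P n : LF d)
      (K * β * ((n : ℝ) ^ (-((d : ℝ) / 2)) * t ^ (-(3 / 2 : ℝ))))) :
    RenewalBounds (delta w P) (K * β) (pfull w P) (phiD w P) (uren w P) (errE w P)
      (Fren w P) where
  toRenewal := renewal_uren (by linarith [(abs_le.1 hδ).1])
  φ_eq := fun n => rfl
  δ_ge := by linarith [(abs_le.1 hδ).1]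
  κ_nonneg := hκ
  F_zero := by
    have hu : uren w P 0 = 0 := by rw [uren]; simp [pfull, hL.zero]
    simp [Fren, hu]
  nb_F := hF
  sb_F := hG
  sym_F := fun m hm => Sym.of_isometry hm (hF m hm) (isotropic_Fren hP m)

set_option maxHeartbeats 1000000 in
theorem exists_far_asymptotics (hd : 5 ≤ d) : ∃ lam0 > 0, lam0 ≤ 1 ∧ ∀ lam ρ : ℝ, 0 ≤ lam →
    lam ≤ lam0 → 0 < ρ → ρ ≤ 1 → ∃ w > 0, ∃ δ ≥ 1 / 2, ∃ a ≥ 1 / 2,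
    FarLe (fun n => w ^ n • cLF d lam ρ n - a • G d (n * δ)) 0 ∧
    Tendsto (fun n => w ^ n * ∫ x, cLF d lam ρ n x) atTop (nhds a) := by
  obtain ⟨K, hK, β0, hβ0, Hu⟩ := uren_bounds hd
  set s : ℝ := (d : ℝ) / 2 with hs
  have hz := zeta32_nonneg
  set β : ℝ := min β0 (1 / (K * (8 + 2 * 2 ^ s * zeta32))) with hβ
  have hβp : 0 < β := lt_min hβ0 (by positivity)
  have hκβ : K * β * (8 + 2 * 2 ^ s * zeta32) ≤ 1 := by
    have : β ≤ 1 / (K * (8 + 2 * 2 ^ s * zeta32)) := min_le_right _ _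
    rw [le_div_iff₀ (by positivity)] at this
    linarith
  have hκ0 : 0 ≤ K * β := by positivity
  have hκz : 0 ≤ K * β * (2 ^ s * zeta32) := by positivity
  obtain ⟨A, hA, C, hC, lam0, hl0, hl1, H⟩ := lace_construction hd hβp
  refine ⟨lam0, hl0, hl1, fun lam ρ h0 h1 hρ0 hρ => ?_⟩
  obtain ⟨w, hL, hT, hlace⟩ := H lam ρ h0 h1 hρ0 hρ
  have h1' : lam ≤ 1 := h1.trans hl1
  have hw0 : 0 < w := by linarith [hL.w_ge]
  set P : ℕ → LF d := fun m => w ^ m • piLF d lam ρ m with hP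
  obtain ⟨hδ, hb⟩ := Hu β w P hL hβp.le (min_le_left _ _)
  have R : RenewalBounds (delta w P) (K * β) (pfull w P) (phiD w P) (uren w P) (errE w P)
      (Fren w P) :=
    hL.renewalBounds (fun m => Isotropic.smul (piLF_isometry h0 h1' m) _) hδ hκ0
      (fun n hn => (hb n hn).2.1) (fun n hn => (hb n hn).2.2.1)
  have hu : ∀ n, uren w P n = w ^ n • cLF d lam ρ n := fun n =>
    uren_eq_cLF h0 h1' (R := n) (fun m _ => rfl) n le_rfl
  have hp : ∀ m, pfull w P m = w ^ m • pLF d lam ρ m := fun m => pfull_smul_piLF w rfl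
  have hSu : ∀ n, 0 < n → SB (uren w P n) (A * (n : ℝ) ^ (-s)) := fun n hn x => by
    rw [hu, LF.smul_apply, abs_of_nonneg (mul_nonneg (by positivity) (cLF_nonneg n x))]
    exact TwoPointBound.cLF_le hw0 hT hn x
  have hφ1 : ∫ y, |phiD w P 1 y| ≤ 1 := by
    rw [← R.integral_φ one_pos]
    exact le_of_eq (integral_congr_ae (Eventually.of_forall fun y => abs_of_nonneg (G_nonneg _ y)))
  have HB : LaceBounds d lam ρ A C w := ⟨h0, h1', hρ, hA, hC, hw0, hL.w_le, hT, hlace⟩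
  have hfar : FarLe (Fren w P) 0 := by
    refine R.defect_far hSu hφ1 hκ0
      (fun n hn => (hb n hn).1.integral_abs_le (mul_nonneg hκ0 (by positivity))) ?_ ?_
    · rw [← hs]; linarith
    · intro η hη
      filter_upwards [truncation_far hd HB hη] with M hM
      filter_upwards [hM] with q hq
      simpa only [LF.sub_apply, LF.sum_apply, hu, hp] using hq
  have h4 := R.abs_limitMass_sub_le 0
  simp only [Ioc_self, sum_empty, Nat.cast_zero, zero_add, Real.one_rpow] at h4
  refine ⟨w, hw0, delta w P, R.δ_ge, limitMass (Fren w P), ?_, ?_, ?_⟩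
  · linarith [(abs_le.1 h4).1]
  · have := R.u_far (by omega) (R.SB_defect hSu hφ1) hfar
    simpa only [hu, R.φ_eq] using this
  · have ht := (tendsto_natcast_add_one_rpow (a := 1 / 2) (by norm_num)).const_mul (4 * (K * β))
    rw [mul_zero] at ht
    rw [tendsto_iff_norm_sub_tendsto_zero]
    refine squeeze_zero' (Eventually.of_forall fun n => norm_nonneg _) ?_ ht
    filter_upwards [eventually_gt_atTop 0] with n hn
    have hi := R.integral_u hn
    simp only [hu, LF.smul_apply, integral_const_mul] at hi
    rw [Real.norm_eq_abs, abs_sub_comm, hi]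
    exact R.abs_limitMass_sub_le n

end SAW

/-- Near-local CLT for the weakly self-avoiding walk away from the origin:
`lim_{r→∞} limsup_{n→∞} sup_{|x| ≥ r} n^{d/2} |C_n(x)/c_n − φ_{nδ}(x)| = 0`. -/
theorem saw_local_clt_away_from_origin (d : ℕ) (hd : 5 ≤ d)
    (ρ : ℝ) (hρ : 0 < ρ) (hρ1 : ρ ≤ 1) :
    ∃ lam0 > (0 : ℝ), ∀ lam : ℝ, 0 < lam → lam ≤ lam0 →
      ∃ δv > (0 : ℝ), ∀ η : ℝ, 0 < η → ∃ r : ℝ, ∃ N : ℕ, ∀ n : ℕ, N ≤ n →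
        ∀ x : Ed d, r ≤ ‖x‖ →
          (n : ℝ) ^ ((d : ℝ) / 2) *
            |Csaw d lam ρ n x / csawInt d lam ρ n - gauss d ((n : ℝ) * δv) x| ≤ η := by
  obtain ⟨lam0, hl0, hl1, H⟩ := SAW.exists_far_asymptotics hd
  refine ⟨lam0, hl0, fun lam hlam hlam0 => ?_⟩
  obtain ⟨w, hw, δ, hδ, a, ha, hfar, hmass⟩ := H lam ρ hlam.le hlam0 hρ hρ1
  have hδ0 : 0 < δ := by linarith
  refine ⟨δ, hδ0, fun η hη => ?_⟩
  have hmass' : Tendsto (fun n => |a - w ^ n * ∫ x, SAW.cLF d lam ρ n x| * 2 ^ ((d : ℝ) / 2))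
      atTop (nhds 0) := by
    simpa using ((tendsto_const_nhds (x := a)).sub hmass).abs.mul_const (2 ^ ((d : ℝ) / 2))
  obtain ⟨N, r, hNr⟩ := SAW.eventually_far.1 ((hfar (η / 8) (by positivity)).and
    (tendsto_fst.eventually ((hmass'.eventually_le_const (show (0 : ℝ) < η / 8 by positivity)).and
      ((hmass.eventually_const_le (show 1 / 4 < a by linarith)).and (eventually_gt_atTop 0)))))
  refine ⟨r, N, fun n hn x hx => ?_⟩
  obtain ⟨h1, h2, h3, hn0⟩ := hNr n hn x hx
  have hn' : (0 : ℝ) < n := by exact_mod_cast hn0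
  have hT : 0 < n * δ := by positivity
  have hint : csawInt d lam ρ n = ∫ x, SAW.cLF d lam ρ n x := by
    rw [csawInt]
    exact integral_congr_ae (Eventually.of_forall fun x =>
      SAW.Csaw_eq hlam.le (hlam0.trans hl1) hn0 x)
  rw [SAW.Csaw_eq hlam.le (hlam0.trans hl1) hn0, hint,
    ← mul_div_mul_left (SAW.cLF d lam ρ n x) _ (pow_pos hw n).ne']
  simp only [SAW.LF.sub_apply, SAW.LF.smul_apply, SAW.G_apply hT, zero_add] at h1
  refine (mul_le_mul_of_nonneg_left (SAW.abs_div_sub_le h1 h3) (by positivity)).trans ?_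
  have hg : |gauss d (n * δ) x| ≤ 2 ^ ((d : ℝ) / 2) * (n : ℝ) ^ (-((d : ℝ) / 2)) := by
    rw [abs_of_nonneg (SAW.gauss_nonneg hT.le x)]
    refine (SAW.gauss_le hT x).trans ?_
    rw [neg_div]
    exact SAW.rpow_half hn' (by positivity) (by nlinarith)
  have hinv : (n : ℝ) ^ ((d : ℝ) / 2) * (n : ℝ) ^ (-((d : ℝ) / 2)) = 1 := by
    rw [← Real.rpow_add hn', add_neg_cancel, Real.rpow_zero]
  have h2' := mul_le_mul_of_nonneg_left hg
    (abs_nonneg (a - w ^ n * ∫ x, SAW.cLF d lam ρ n x))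
  calc _ ≤ (n : ℝ) ^ ((d : ℝ) / 2) * (4 * (η / 8 * (n : ℝ) ^ (-((d : ℝ) / 2)) +
        |a - w ^ n * ∫ x, SAW.cLF d lam ρ n x| *
          (2 ^ ((d : ℝ) / 2) * (n : ℝ) ^ (-((d : ℝ) / 2))))) := by
        gcongr
    _ = 4 * (η / 8 + |a - w ^ n * ∫ x, SAW.cLF d lam ρ n x| * 2 ^ ((d : ℝ) / 2)) *
        ((n : ℝ) ^ ((d : ℝ) / 2) * (n : ℝ) ^ (-((d : ℝ) / 2))) := by ring
    _ ≤ η := by rw [hinv, mul_one]; linarith
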